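/- Let M, N be finite-dimensional representations of a finite quiver Q over ℂ. Then the F-polynomial of M ⊕ N equals the product of the F-polynomials of M and N, i.e. for every dimension vector e, χ(Gr_e(M ⊕ N)) = Σ_{f+g=e} χ(Gr_f(M)) · χ(Gr_g(N)). -/

import Mathlib

/-!
STATEMENT 15: Let M, N be finite-dimensional representations of a finite quiver Q
over ℂ.  Then for every dimension vector e,
`χ(Gr_e(M ⊕ N)) = Σ_{f+g=e} χ(Gr_f(M)) · χ(Gr_g(N))`
(i.e. the F-polynomial of `M ⊕ N` is the product of those of M and N).

Quiver Grassmannians carry the classical topology; χ is the Euler characteristic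
with rational coefficients.  The sum runs over all `f ≤ e` (with `g = e − f`).
-/

noncomputable section
open Matrix

variable {V A : Type}

/-- A complex representation of the quiver `(V, A, s, t)` of dimension vector `d`. -/
abbrev QRep (s t : A → V) (d : V → ℕ) : Type :=
  ∀ a : A, Matrix (Fin (d (t a))) (Fin (d (s a))) ℂ

/-- The quiver Grassmannian `Gr_e(M)`: families of subspaces `N i ⊆ ℂ^{d i}` of
dimension `e i` with `M_a (N (s a)) ⊆ N (t a)` for every arrow. -/
def SubRep (s t : A → V) {d : V → ℕ} (M : QRep s t d) (e : V → ℕ) : Type :=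
  {N : ∀ i : V, Submodule ℂ (Fin (d i) → ℂ) //
    (∀ i, Module.finrank ℂ (N i) = e i) ∧
    ∀ a : A, (N (s a)).map (M a).mulVecLin ≤ N (t a)}

/-- The map `Φ^M_N`, whose cokernel is `Ext¹_Q(N,M)`. -/
def PhiFun (s t : A → V) {e d : V → ℕ} (N : QRep s t e) (M : QRep s t d) :
    (∀ i : V, Matrix (Fin (d i)) (Fin (e i)) ℂ) →
      (∀ a : A, Matrix (Fin (d (t a))) (Fin (e (s a))) ℂ) :=
  fun f a => M a * f (s a) - f (t a) * N a

/-- `Ext¹_Q(N, M) = 0`, expressed as surjectivity of `Φ^M_N` (whose cokernel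
computes `Ext¹` via the standard resolution over the path algebra). -/
def ExtVanish (s t : A → V) {e d : V → ℕ} (N : QRep s t e) (M : QRep s t d) : Prop :=
  Function.Surjective (PhiFun s t N M)

/-- A representation is rigid if `Ext¹_Q(M, M) = 0`. -/
def Rigid (s t : A → V) {d : V → ℕ} (M : QRep s t d) : Prop :=
  ExtVanish s t M M

/-- The Euler form `⟨x,y⟩ = Σ_i x i * y i − Σ_a x (s a) * y (t a)` of the quiver. -/
def eulerForm [Fintype V] [Fintype A] (s t : A → V) (x y : V → ℤ) : ℤ :=
  (∑ i : V, x i * y i) - ∑ a : A, x (s a) * y (t a)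

/-- The quiver is Dynkin (disjoint union of simply-laced Dynkin diagrams), i.e. its
Tits form is positive definite. -/
def IsDynkin [Fintype V] [Fintype A] (s t : A → V) : Prop :=
  ∀ x : V → ℤ, x ≠ 0 → 0 < eulerForm s t x x

/-- Morphisms of representations `X → Y`, given by matrices `φ i` with
`Y_a φ_{s a} = φ_{t a} X_a`. -/
def RHom (s t : A → V) {dX dY : V → ℕ} (X : QRep s t dX) (Y : QRep s t dY) : Type :=
  {φ : ∀ i : V, Matrix (Fin (dY i)) (Fin (dX i)) ℂ //
    ∀ a : A, Y a * φ (s a) = φ (t a) * X a}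

/-- A representation is indecomposable: nonzero, and its only idempotent
endomorphisms are 0 and 1. -/
def Indec (s t : A → V) {d : V → ℕ} (M : QRep s t d) : Prop :=
  (∃ i, 0 < d i) ∧
  ∀ φ : RHom s t M M, (∀ i, φ.1 i * φ.1 i = φ.1 i) →
    (∀ i, φ.1 i = 0) ∨ (∀ i, φ.1 i = 1)

/-- The direct sum of two representations. -/
def dsum (s t : A → V) {d e : V → ℕ} (M : QRep s t d) (N : QRep s t e) :
    QRep s t (fun i => d i + e i) :=
  fun a => Matrix.reindex finSumFinEquiv finSumFinEquiv
    (Matrix.fromBlocks (M a) 0 0 (N a))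

/-- `0 → X → Y → Z → 0` is a short exact sequence of representations. -/
def IsSES (s t : A → V) {dX dY dZ : V → ℕ}
    {X : QRep s t dX} {Y : QRep s t dY} {Z : QRep s t dZ}
    (f : RHom s t X Y) (g : RHom s t Y Z) : Prop :=
  (∀ i, Function.Injective (f.1 i).mulVecLin) ∧
  (∀ i, Function.Surjective (g.1 i).mulVecLin) ∧
  ∀ i, LinearMap.range (f.1 i).mulVecLin = LinearMap.ker (g.1 i).mulVecLin

/-- A morphism of representations is a split epimorphism. -/
def IsSplitEpi (s t : A → V) {dX dY : V → ℕ}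
    {X : QRep s t dX} {Y : QRep s t dY} (h : RHom s t X Y) : Prop :=
  ∃ r : RHom s t Y X, ∀ i, h.1 i * r.1 i = 1

/-- `0 → T → E → M → 0` is an almost split (Auslander–Reiten) sequence: it is a
non-split short exact sequence, T and M are indecomposable, and every morphism
`X → M` which is not a split epimorphism factors through `E`. -/
def IsAlmostSplit (s t : A → V) {dT dE dM : V → ℕ}
    {T : QRep s t dT} {E : QRep s t dE} {M : QRep s t dM}
    (f : RHom s t T E) (g : RHom s t E M) : Prop :=
  IsSES s t f g ∧ ¬ IsSplitEpi s t g ∧ Indec s t T ∧ Indec s t M ∧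
  ∀ (x : V → ℕ) (X : QRep s t x) (h : RHom s t X M), ¬ IsSplitEpi s t h →
    ∃ u : RHom s t X E, ∀ i, g.1 i * u.1 i = h.1 i

/-- Coordinates for a tuple of `(d i) × (e i)` matrices. -/
abbrev Coord (d e : V → ℕ) : Type := (Σ i : V, Fin (d i) × Fin (e i)) → ℂ

/-- The `i`-th matrix encoded by a coordinate vector. -/
def matOf {d e : V → ℕ} (F : Coord (V := V) d e) (i : V) :
    Matrix (Fin (d i)) (Fin (e i)) ℂ :=
  fun p q => F ⟨i, (p, q)⟩

/-- The "Stiefel-type" variety of tuples of injective linear maps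
`ℂ^{e i} → ℂ^{d i}` whose images form a subrepresentation of `M`. -/
def StQ (s t : A → V) {d : V → ℕ} (M : QRep s t d) (e : V → ℕ) : Type :=
  {F : Coord (V := V) d e //
    (∀ i, Function.Injective (matOf F i).mulVecLin) ∧
    ∀ a : A, (LinearMap.range (matOf F (s a)).mulVecLin).map (M a).mulVecLin ≤
      LinearMap.range (matOf F (t a)).mulVecLin}

/-- The canonical surjection from the Stiefel-type variety onto the quiver
Grassmannian, sending a tuple of injective maps to the tuple of their images. -/
def toSub (s t : A → V) {d : V → ℕ} (M : QRep s t d) (e : V → ℕ) :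
    StQ s t M e → SubRep s t M e := fun F =>
  ⟨fun i => LinearMap.range (matOf F.1 i).mulVecLin,
   fun i => by
     rw [LinearMap.finrank_range_of_inj (F.2.1 i)]
     exact Module.finrank_fin_fun ℂ,
   F.2.2⟩

/-- The classical (Euclidean) topology on the quiver Grassmannian, as the quotient
topology from the space of injective tuples with its Euclidean topology. -/
instance (s t : A → V) {d : V → ℕ} (M : QRep s t d) (e : V → ℕ) :
    TopologicalSpace (SubRep s t M e) :=
  TopologicalSpace.coinduced (toSub s t M e)
    (TopologicalSpace.induced Subtype.val inferInstance)

open CategoryTheory in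
/-- The singular chain complex of a topological space with rational coefficients. -/
def singComplex (X : Type) [TopologicalSpace X] : ChainComplex (ModuleCat ℚ) ℕ :=
  (AlgebraicTopology.alternatingFaceMapComplex (ModuleCat ℚ)).obj
    (((CategoryTheory.SimplicialObject.whiskering _ _).obj (ModuleCat.free ℚ)).obj
      (TopCat.toSSet.obj (TopCat.of X)))

/-- Singular homology with rational coefficients. -/
def Hsing (n : ℕ) (X : Type) [TopologicalSpace X] : ModuleCat ℚ :=
  (singComplex X).homology n

/-- Singular cohomology with rational coefficients (over a field, the dual of
singular homology by universal coefficients). -/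
abbrev Hcoh (n : ℕ) (X : Type) [TopologicalSpace X] : Type :=
  Module.Dual ℚ (Hsing n X)

/-- The topological Euler characteristic `χ(X) = Σ (−1)ⁱ dim Hⁱ(X, ℚ)`. -/
def eulerChar (X : Type) [TopologicalSpace X] : ℤ :=
  finsum fun n : ℕ => (-1 : ℤ) ^ n * (Module.finrank ℚ (Hcoh n X) : ℤ)

set_option linter.unusedSectionVars false

/-- Trace is additive over the kernel and the range of a (twisted-)equivariant map. -/
theorem trace_ker_add_range {A B : Type} [AddCommGroup A] [Module ℚ A] [AddCommGroup B]
    [Module ℚ B] [Module.Finite ℚ A] (f : A →ₗ[ℚ] B) (α : A →ₗ[ℚ] A) (β : B →ₗ[ℚ] B) (c : ℚ)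
    (h : ∀ x, f (α x) = c • β (f x))
    (hk : ∀ x ∈ LinearMap.ker f, α x ∈ LinearMap.ker f)
    (hr : ∀ x ∈ LinearMap.range f, β x ∈ LinearMap.range f) :
    LinearMap.trace ℚ A α = LinearMap.trace ℚ _ (α.restrict hk) +
      c * LinearMap.trace ℚ _ (β.restrict hr) := by
  obtain ⟨g, hg⟩ := f.rangeRestrict.exists_rightInverse_of_surjective f.range_rangeRestrict
  have hg' : ∀ y, f (g y) = y := fun y => congrArg Subtype.val (LinearMap.congr_fun hg y)
  let p : A →ₗ[ℚ] LinearMap.ker f :=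
    LinearMap.codRestrict _ (LinearMap.id - g ∘ₗ f.rangeRestrict) (fun x => by
      simp [hg'])
  have e : α = α ∘ₗ (LinearMap.ker f).subtype ∘ₗ p + α ∘ₗ g ∘ₗ f.rangeRestrict := by
    ext x; simp [p]
  have e1 : p ∘ₗ α ∘ₗ (LinearMap.ker f).subtype = α.restrict hk := by
    ext x
    have : f (α x) = 0 := hk x x.2
    have h0 : f.rangeRestrict (α x) = 0 := Subtype.ext this
    simp [p, h0]
  have e2 : f.rangeRestrict ∘ₗ α ∘ₗ g = c • β.restrict hr := by
    ext x; simp [h, hg']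
  conv_lhs => rw [e]
  rw [map_add, ← LinearMap.comp_assoc, LinearMap.trace_comp_comm' p (α ∘ₗ (LinearMap.ker f).subtype),
    e1, ← LinearMap.comp_assoc, LinearMap.trace_comp_comm' f.rangeRestrict (α ∘ₗ g), e2, map_smul,
    smul_eq_mul]

theorem trace_restrict_congr {A : Type} [AddCommGroup A] [Module ℚ A] (α : A →ₗ[ℚ] A)
    {S T : Submodule ℚ A} (e : S = T) (hS : ∀ x ∈ S, α x ∈ S) (hT : ∀ x ∈ T, α x ∈ T) :
    LinearMap.trace ℚ _ (α.restrict hS) = LinearMap.trace ℚ _ (α.restrict hT) := by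
  subst e; rfl

theorem finite_of_ker_range {A B : Type} [AddCommGroup A] [Module ℚ A] [AddCommGroup B]
    [Module ℚ B] (f : A →ₗ[ℚ] B) (h1 : Module.Finite ℚ (LinearMap.ker f))
    (h2 : Module.Finite ℚ (LinearMap.range f)) : Module.Finite ℚ A := by
  refine ⟨Submodule.fg_of_fg_map_of_fg_inf_ker f ?_ ?_⟩
  · rw [Submodule.map_top]; exact Module.Finite.iff_fg.1 h2
  · rw [top_inf_eq]; exact Module.Finite.iff_fg.1 h1

/-- Finiteness of the middle term of an exact sequence. -/
theorem finite_of_exact {A B C : Type} [AddCommGroup A] [Module ℚ A] [AddCommGroup B]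
    [Module ℚ B] [AddCommGroup C] [Module ℚ C] [Module.Finite ℚ A] [Module.Finite ℚ C]
    (i : A →ₗ[ℚ] B) (p : B →ₗ[ℚ] C) (h : LinearMap.ker p = LinearMap.range i) :
    Module.Finite ℚ B :=
  finite_of_ker_range p (h ▸ inferInstance) inferInstance

/-- Additivity of the trace in an exact triangle whose connecting map anticommutes. -/
theorem trace_exact_triangle {A B C : Type} [AddCommGroup A] [Module ℚ A] [AddCommGroup B]
    [Module ℚ B] [AddCommGroup C] [Module ℚ C] [Module.Finite ℚ A] [Module.Finite ℚ B]
    [Module.Finite ℚ C] (i : A →ₗ[ℚ] B) (p : B →ₗ[ℚ] C) (q : C →ₗ[ℚ] A)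
    (α : A →ₗ[ℚ] A) (β : B →ₗ[ℚ] B) (γ : C →ₗ[ℚ] C)
    (hi : ∀ x, i (α x) = β (i x)) (hp : ∀ x, p (β x) = γ (p x)) (hq : ∀ x, q (γ x) = - α (q x))
    (e1 : LinearMap.ker p = LinearMap.range i) (e2 : LinearMap.ker q = LinearMap.range p)
    (e3 : LinearMap.ker i = LinearMap.range q) :
    LinearMap.trace ℚ B β = LinearMap.trace ℚ A α + LinearMap.trace ℚ C γ := by
  have kA : ∀ x ∈ LinearMap.ker i, α x ∈ LinearMap.ker i := fun x hx => by
    rw [LinearMap.mem_ker] at *; rw [hi, hx, map_zero]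
  have kB : ∀ x ∈ LinearMap.ker p, β x ∈ LinearMap.ker p := fun x hx => by
    rw [LinearMap.mem_ker] at *; rw [hp, hx, map_zero]
  have kC : ∀ x ∈ LinearMap.ker q, γ x ∈ LinearMap.ker q := fun x hx => by
    rw [LinearMap.mem_ker] at *; rw [hq, hx, map_zero, neg_zero]
  have rA : ∀ x ∈ LinearMap.range q, α x ∈ LinearMap.range q := e3 ▸ kA
  have rB : ∀ x ∈ LinearMap.range i, β x ∈ LinearMap.range i := e1 ▸ kB
  have rC : ∀ x ∈ LinearMap.range p, γ x ∈ LinearMap.range p := e2 ▸ kC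
  rw [trace_ker_add_range i α β 1 (by simpa using hi) kA rB,
    trace_ker_add_range p β γ 1 (by simpa using hp) kB rC,
    trace_ker_add_range q γ α (-1) (by simpa using hq) kC rA,
    trace_restrict_congr α e3 kA rA, trace_restrict_congr β e1 kB rB,
    trace_restrict_congr γ e2 kC rC]
  ring

/-- An (ungraded) differential module with a sign operator anticommuting with the differential. -/
structure Cx where
  C : Type
  [grp : AddCommGroup C]
  [mod : Module ℚ C]
  d : C →ₗ[ℚ] C
  ε : C →ₗ[ℚ] C
  d_d : ∀ x, d (d x) = 0
  d_ε : ∀ x, d (ε x) = - ε (d x)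

attribute [instance] Cx.grp Cx.mod

namespace Cx

/-- A subcomplex. -/
structure Sub (K : Cx) where
  S : Submodule ℚ K.C
  d_mem : ∀ x ∈ S, K.d x ∈ S
  ε_mem : ∀ x ∈ S, K.ε x ∈ S

variable {K L M : Cx}

instance : SetLike (Sub K) K.C where
  coe E := E.S
  coe_injective E D h := by
    cases E; cases D; simpa using h

instance : AddSubgroupClass (Sub K) K.C where
  add_mem := fun {s} _ _ => s.S.add_mem
  zero_mem := fun s => s.S.zero_mem
  neg_mem := fun {s} _ => s.S.neg_mem

theorem Sub.smul_mem (E : Sub K) (c : ℚ) {x : K.C} (hx : x ∈ E) : c • x ∈ E := E.S.smul_mem c hx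

instance : PartialOrder (Sub K) := .ofSetLike (Sub K) K.C

instance : Top (Sub K) := ⟨⟨⊤, by simp, by simp⟩⟩
instance : Bot (Sub K) := ⟨⟨⊥, by simp, by simp⟩⟩
instance : Max (Sub K) := ⟨fun E D => ⟨E.S ⊔ D.S, fun x hx => by
    obtain ⟨a, ha, b, hb, rfl⟩ := Submodule.mem_sup.1 hx
    rw [map_add]
    exact add_mem (Submodule.mem_sup_left (E.d_mem a ha)) (Submodule.mem_sup_right (D.d_mem b hb)),
    fun x hx => by
    obtain ⟨a, ha, b, hb, rfl⟩ := Submodule.mem_sup.1 hx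
    rw [map_add]
    exact add_mem (Submodule.mem_sup_left (E.ε_mem a ha)) (Submodule.mem_sup_right (D.ε_mem b hb))⟩⟩
instance : Min (Sub K) := ⟨fun E D => ⟨E.S ⊓ D.S, fun x hx => ⟨E.d_mem x hx.1, D.d_mem x hx.2⟩,
    fun x hx => ⟨E.ε_mem x hx.1, D.ε_mem x hx.2⟩⟩⟩

@[simp] theorem mem_top (x : K.C) : x ∈ (⊤ : Sub K) := Submodule.mem_top (R := ℚ)
@[simp] theorem mem_bot {x : K.C} : x ∈ (⊥ : Sub K) ↔ x = 0 := Submodule.mem_bot ℚ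
theorem mem_sup {E D : Sub K} {x : K.C} : x ∈ E ⊔ D ↔ ∃ a ∈ E, ∃ b ∈ D, a + b = x :=
  Submodule.mem_sup (p := E.S) (p' := D.S)
theorem bot_le' (E : Sub K) : ⊥ ≤ E := fun x hx => by
  rw [mem_bot.1 hx]; exact zero_mem E
theorem le_top' (E : Sub K) : E ≤ ⊤ := fun _ _ => mem_top _
theorem le_sup_left' (E D : Sub K) : E ≤ E ⊔ D := fun x hx => mem_sup.2 ⟨x, hx, 0, zero_mem _, add_zero x⟩
theorem le_sup_right' (E D : Sub K) : D ≤ E ⊔ D := fun x hx => mem_sup.2 ⟨0, zero_mem _, x, hx, zero_add x⟩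

/-- Relative cycles. -/
def Z (E D : Sub K) : Submodule ℚ K.C := E.S ⊓ D.S.comap K.d
/-- Relative boundaries. -/
def B (E D : Sub K) : Submodule ℚ K.C := D.S ⊔ E.S.map K.d

theorem mem_Z {E D : Sub K} {x : K.C} : x ∈ Z E D ↔ x ∈ E ∧ K.d x ∈ D := Iff.rfl
theorem mem_B {E D : Sub K} {x : K.C} : x ∈ B E D ↔ ∃ y ∈ E, x - K.d y ∈ D := by
  rw [B, Submodule.mem_sup]
  constructor
  · rintro ⟨a, ha, _, ⟨y, hy, rfl⟩, rfl⟩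
    exact ⟨y, hy, by rwa [add_sub_cancel_right]⟩
  · rintro ⟨y, hy, h⟩
    exact ⟨_, h, _, ⟨y, hy, rfl⟩, by simp⟩

/-- Homology of the subquotient. -/
abbrev H (E D : Sub K) : Type := Z E D ⧸ (B E D).submoduleOf (Z E D)

/-- The class of a relative cycle. -/
def cls {E D : Sub K} (x : K.C) (hx : x ∈ E) (hd : K.d x ∈ D) : H E D :=
  Submodule.Quotient.mk ⟨x, hx, hd⟩

theorem cls_surj {E D : Sub K} (a : H E D) : ∃ x hx hd, a = cls x hx hd := by
  obtain ⟨⟨x, hx, hd⟩, rfl⟩ := Submodule.Quotient.mk_surjective _ a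
  exact ⟨x, hx, hd, rfl⟩

theorem cls_eq_zero {E D : Sub K} {x : K.C} {hx : x ∈ E} {hd : K.d x ∈ D} :
    cls x hx hd = 0 ↔ ∃ y ∈ E, x - K.d y ∈ D := by
  rw [← mem_B]
  exact Submodule.Quotient.mk_eq_zero _

theorem d_eps_mem {E D : Sub K} {x : K.C} (h : x ∈ Z E D) : K.ε x ∈ Z E D :=
  ⟨E.ε_mem _ h.1, by
    change K.d (K.ε x) ∈ D.S
    rw [K.d_ε]; exact D.S.neg_mem (D.ε_mem _ h.2)⟩

/-- The linear map on homology induced by a linear map on representatives. -/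
def mapOf {E D : Sub K} {E' D' : Sub L} (f : K.C →ₗ[ℚ] L.C)
    (hZ : ∀ x ∈ Z E D, f x ∈ Z E' D') (hB : ∀ x ∈ Z E D, x ∈ B E D → f x ∈ B E' D') :
    H E D →ₗ[ℚ] H E' D' :=
  Submodule.mapQ _ _ (f.restrict hZ) fun x hx => hB x.1 x.2 hx

theorem mapOf_cls {E D : Sub K} {E' D' : Sub L} (f : K.C →ₗ[ℚ] L.C)
    (hZ : ∀ x ∈ Z E D, f x ∈ Z E' D') (hB : ∀ x ∈ Z E D, x ∈ B E D → f x ∈ B E' D')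
    (x : K.C) (hx : x ∈ E) (hd : K.d x ∈ D) :
    mapOf f hZ hB (cls x hx hd) = cls (f x) (hZ x ⟨hx, hd⟩).1 (hZ x ⟨hx, hd⟩).2 := rfl

/-- The sign operator on homology. -/
def sgn (E D : Sub K) : H E D →ₗ[ℚ] H E D :=
  mapOf K.ε (fun _ h => d_eps_mem h) fun x _ hx => by
    obtain ⟨y, hy, h⟩ := mem_B.1 hx
    refine mem_B.2 ⟨- K.ε y, neg_mem (E.ε_mem y hy), ?_⟩
    rw [map_neg, K.d_ε, neg_neg, ← map_sub]
    exact D.ε_mem _ h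

/-- Finite-dimensional homology. -/
def FinH (E D : Sub K) : Prop := Module.Finite ℚ (H E D)

/-- The Euler characteristic. -/
def chi (E D : Sub K) : ℚ := LinearMap.trace ℚ (H E D) (sgn E D)

/-- A chain map commuting with signs. -/
@[ext]
structure Hom (K L : Cx) where
  f : K.C →ₗ[ℚ] L.C
  comm : ∀ x, f (K.d x) = L.d (f x)
  commε : ∀ x, f (K.ε x) = L.ε (f x)

/-- The identity chain map. -/
def Hom.id (K : Cx) : Hom K K := ⟨LinearMap.id, fun _ => rfl, fun _ => rfl⟩
/-- Composition of chain maps. -/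
def Hom.comp (ψ : Hom L M) (φ : Hom K L) : Hom K M :=
  ⟨ψ.f ∘ₗ φ.f, fun x => by simp [φ.comm, ψ.comm], fun x => by simp [φ.commε, ψ.commε]⟩

/-- `φ` maps the pair `(E, D)` to the pair `(E', D')`. -/
structure Hom.Pair (φ : Hom K L) (E D : Sub K) (E' D' : Sub L) : Prop where
  mapE : ∀ x ∈ E, φ.f x ∈ E'
  mapD : ∀ x ∈ D, φ.f x ∈ D'

theorem Hom.Pair.mapZ {φ : Hom K L} {E D : Sub K} {E' D' : Sub L} (h : φ.Pair E D E' D') :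
    ∀ x ∈ Z E D, φ.f x ∈ Z E' D' := fun x hx =>
  ⟨h.mapE x hx.1, by
    change L.d (φ.f x) ∈ D'; rw [← φ.comm]; exact h.mapD _ hx.2⟩

/-- The induced map on homology. -/
def Hom.Pair.map {φ : Hom K L} {E D : Sub K} {E' D' : Sub L} (h : φ.Pair E D E' D') :
    H E D →ₗ[ℚ] H E' D' :=
  mapOf φ.f h.mapZ fun x _ hx => by
    obtain ⟨y, hy, hxy⟩ := mem_B.1 hx
    exact mem_B.2 ⟨φ.f y, h.mapE y hy, by rw [← φ.comm, ← map_sub]; exact h.mapD _ hxy⟩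

theorem Hom.Pair.map_cls {φ : Hom K L} {E D : Sub K} {E' D' : Sub L} (h : φ.Pair E D E' D')
    (x : K.C) (hx : x ∈ E) (hd : K.d x ∈ D) :
    h.map (cls x hx hd) = cls (φ.f x) (h.mapE x hx) (h.mapZ x ⟨hx, hd⟩).2 := rfl

/-- Injectivity on homology, on representatives. -/
def Hom.Inj (φ : Hom K L) (E D : Sub K) (E' D' : Sub L) : Prop :=
  ∀ x ∈ E, K.d x ∈ D → (∃ y ∈ E', φ.f x - L.d y ∈ D') → ∃ y ∈ E, x - K.d y ∈ D
/-- Surjectivity on homology, on representatives. -/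
def Hom.Surj (φ : Hom K L) (E D : Sub K) (E' D' : Sub L) : Prop :=
  ∀ x' ∈ E', L.d x' ∈ D' → ∃ x ∈ E, K.d x ∈ D ∧ ∃ y ∈ E', φ.f x - x' - L.d y ∈ D'

/-- A map of pairs inducing an isomorphism on homology. -/
structure Hom.QIso (φ : Hom K L) (E D : Sub K) (E' D' : Sub L) : Prop where
  pair : φ.Pair E D E' D'
  inj : φ.Inj E D E' D'
  surj : φ.Surj E D E' D'

theorem Hom.Inj.map_injective {φ : Hom K L} {E D : Sub K} {E' D' : Sub L} (h : φ.Inj E D E' D')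
    (p : φ.Pair E D E' D') : Function.Injective p.map := by
  rw [injective_iff_map_eq_zero]
  intro a ha
  obtain ⟨x, hx, hd, rfl⟩ := cls_surj a
  rw [p.map_cls, cls_eq_zero] at ha
  exact cls_eq_zero.2 (h x hx hd ha)

theorem cls_sub {E D : Sub K} {x y : K.C} (hx : x ∈ E) (hdx : K.d x ∈ D) (hy : y ∈ E)
    (hdy : K.d y ∈ D) : cls x hx hdx - cls y hy hdy =
      cls (x - y) (sub_mem hx hy) (by rw [map_sub]; exact sub_mem hdx hdy) := rfl

theorem Hom.Surj.map_surjective {φ : Hom K L} {E D : Sub K} {E' D' : Sub L} (h : φ.Surj E D E' D')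
    (p : φ.Pair E D E' D') : Function.Surjective p.map := by
  intro a
  obtain ⟨x', hx', hd', rfl⟩ := cls_surj a
  obtain ⟨x, hx, hd, hy⟩ := h x' hx' hd'
  refine ⟨cls x hx hd, ?_⟩
  rw [p.map_cls, ← sub_eq_zero, cls_sub, cls_eq_zero]
  exact hy

/-- The isomorphism on homology. -/
def Hom.QIso.equiv {φ : Hom K L} {E D : Sub K} {E' D' : Sub L} (h : φ.QIso E D E' D') :
    H E D ≃ₗ[ℚ] H E' D' :=
  LinearEquiv.ofBijective h.pair.map ⟨h.inj.map_injective h.pair, h.surj.map_surjective h.pair⟩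

theorem Hom.QIso.finH_iff {φ : Hom K L} {E D : Sub K} {E' D' : Sub L} (h : φ.QIso E D E' D') :
    FinH E D ↔ FinH E' D' :=
  ⟨fun h1 => @Module.Finite.equiv _ _ _ _ _ _ _ _ h1 h.equiv,
    fun h1 => @Module.Finite.equiv _ _ _ _ _ _ _ _ h1 h.equiv.symm⟩

theorem Hom.QIso.chi_eq {φ : Hom K L} {E D : Sub K} {E' D' : Sub L} (h : φ.QIso E D E' D') :
    chi E D = chi E' D' := by
  rw [chi, chi, ← LinearMap.trace_conj' _ h.equiv]
  congr 1
  refine LinearMap.ext fun a => ?_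
  obtain ⟨b, rfl⟩ := h.equiv.surjective a
  simp only [LinearEquiv.conj_apply, LinearMap.comp_apply, LinearEquiv.coe_coe,
    LinearEquiv.symm_apply_apply]
  obtain ⟨x, hx, hd, rfl⟩ := cls_surj b
  exact congrArg Submodule.Quotient.mk (Subtype.ext (φ.commε x))

theorem FinH.of_inj {φ : Hom K L} {E D : Sub K} {E' D' : Sub L} (p : φ.Pair E D E' D')
    (h : φ.Inj E D E' D') (hf : FinH E' D') : FinH E D := by
  have : Module.Finite ℚ (H E' D') := hf
  exact Module.Finite.of_injective p.map (h.map_injective p)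

theorem Hom.id_pair {E D E' D' : Sub K} (hE : E ≤ E') (hD : D ≤ D') :
    (Hom.id K).Pair E D E' D' := ⟨fun _ hx => hE hx, fun _ hx => hD hx⟩

/-- The connecting map. -/
def delta (E D : Sub K) : H E D →ₗ[ℚ] H D ⊥ :=
  mapOf K.d (fun x hx => ⟨hx.2, by
      change K.d (K.d x) ∈ (⊥ : Sub K)
      rw [K.d_d]; exact zero_mem _⟩) fun x _ hx => by
    obtain ⟨y, _, h⟩ := mem_B.1 hx
    refine mem_B.2 ⟨_, h, ?_⟩
    rw [map_sub, K.d_d, sub_zero, sub_self]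
    exact zero_mem _

theorem delta_cls {E D : Sub K} (x : K.C) (hx : x ∈ E) (hd : K.d x ∈ D) :
    delta E D (cls x hx hd) = cls (K.d x) hd (by rw [K.d_d]; exact zero_mem _) := rfl

section exactness
variable {E D : Sub K} (h : D ≤ E)
include h

theorem exact_middle : LinearMap.ker (Hom.id_pair (le_refl E) (bot_le' D)).map =
    LinearMap.range (Hom.id_pair h (le_refl (⊥ : Sub K))).map := by
  ext a
  obtain ⟨x, hx, hd, rfl⟩ := cls_surj a
  rw [LinearMap.mem_ker, Hom.Pair.map_cls, cls_eq_zero, LinearMap.mem_range]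
  constructor
  · rintro ⟨y, hy, hxy⟩
    refine ⟨cls _ hxy ?_, ?_⟩
    · rw [map_sub, K.d_d, sub_zero]; exact hd
    · rw [Hom.Pair.map_cls, ← sub_eq_zero, cls_sub, cls_eq_zero]
      refine ⟨-y, neg_mem hy, ?_⟩
      simp [Hom.id]
  · rintro ⟨b, hb⟩
    obtain ⟨z, hz, hdz, rfl⟩ := cls_surj b
    rw [Hom.Pair.map_cls, ← sub_eq_zero, cls_sub, cls_eq_zero] at hb
    obtain ⟨y, hy, hb⟩ := hb
    refine ⟨-y, neg_mem hy, ?_⟩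
    rw [mem_bot, sub_eq_zero] at hb
    change x - K.d (-y) ∈ D
    rw [map_neg, ← hb, sub_neg_eq_add, add_sub_cancel]
    exact hz

theorem exact_quot : LinearMap.ker (delta E D) =
    LinearMap.range (Hom.id_pair (le_refl E) (bot_le' D)).map := by
  ext a
  obtain ⟨x, hx, hd, rfl⟩ := cls_surj a
  rw [LinearMap.mem_ker, delta_cls, cls_eq_zero, LinearMap.mem_range]
  constructor
  · rintro ⟨y, hy, hxy⟩
    refine ⟨cls (x - y) (sub_mem hx (h hy)) (by rwa [map_sub]), ?_⟩
    rw [Hom.Pair.map_cls, ← sub_eq_zero, cls_sub, cls_eq_zero]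
    refine ⟨0, zero_mem _, ?_⟩
    simp only [Hom.id, LinearMap.id_apply, map_zero, sub_zero, sub_sub_cancel_left]
    exact neg_mem hy
  · rintro ⟨b, hb⟩
    obtain ⟨z, hz, hdz, rfl⟩ := cls_surj b
    rw [Hom.Pair.map_cls, ← sub_eq_zero, cls_sub, cls_eq_zero] at hb
    obtain ⟨y, hy, hb⟩ := hb
    refine ⟨_, neg_mem hb, ?_⟩
    change K.d x - K.d (-(z - x - K.d y)) ∈ _
    rw [mem_bot] at hdz ⊢
    simp [hdz, K.d_d]

theorem exact_sub : LinearMap.ker (Hom.id_pair h (le_refl (⊥ : Sub K))).map =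
    LinearMap.range (delta E D) := by
  ext a
  obtain ⟨x, hx, hd, rfl⟩ := cls_surj a
  rw [LinearMap.mem_ker, Hom.Pair.map_cls, cls_eq_zero, LinearMap.mem_range]
  constructor
  · rintro ⟨y, hy, hxy⟩
    rw [mem_bot, sub_eq_zero] at hxy
    have hxy : x = K.d y := hxy
    subst hxy
    exact ⟨cls y hy hx, rfl⟩
  · rintro ⟨b, hb⟩
    obtain ⟨z, hz, hdz, rfl⟩ := cls_surj b
    rw [delta_cls, ← sub_eq_zero, cls_sub, cls_eq_zero] at hb
    obtain ⟨y, hy, hb⟩ := hb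
    refine ⟨z - y, sub_mem hz (h hy), ?_⟩
    change x - K.d (z - y) ∈ _
    rw [mem_bot] at hb ⊢
    rw [map_sub]
    linear_combination (norm := module) -hb

theorem FinH.quot (hE : FinH E ⊥) (hD : FinH D ⊥) : FinH E D := by
  have : Module.Finite ℚ (H E ⊥) := hE
  have : Module.Finite ℚ (H D ⊥) := hD
  exact finite_of_exact _ _ (exact_quot h)

theorem FinH.ext (hD : FinH D ⊥) (hE : FinH E D) : FinH E ⊥ := by
  have : Module.Finite ℚ (H E D) := hE
  have : Module.Finite ℚ (H D ⊥) := hD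
  exact finite_of_exact _ _ (exact_middle h)

theorem chi_add (hE : FinH E ⊥) (hD : FinH D ⊥) : chi E ⊥ = chi D ⊥ + chi E D := by
  have : Module.Finite ℚ (H E ⊥) := hE
  have : Module.Finite ℚ (H D ⊥) := hD
  have : Module.Finite ℚ (H E D) := FinH.quot h hE hD
  refine trace_exact_triangle _ _ _ _ _ _ ?_ ?_ ?_ (exact_middle h) (exact_quot h) (exact_sub h)
  · intro a; obtain ⟨x, hx, hd, rfl⟩ := cls_surj a; rfl
  · intro a; obtain ⟨x, hx, hd, rfl⟩ := cls_surj a; rfl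
  · intro a; obtain ⟨x, hx, hd, rfl⟩ := cls_surj a
    have aux : ∀ (u v : K.C) (_ : u = v) (h1 : u ∈ D) (h2 : K.d u ∈ (⊥ : Sub K)) (h3 : v ∈ D)
        (h4 : K.d v ∈ (⊥ : Sub K)), (cls u h1 h2 : H D ⊥) = cls v h3 h4 := by
      rintro u _ rfl _ _ _ _; rfl
    have hz : K.ε (K.d x) ∈ Z D ⊥ := d_eps_mem ⟨hd, by
      change _ ∈ (⊥ : Sub K); rw [K.d_d]; exact zero_mem _⟩
    exact aux _ _ (K.d_ε x) (d_eps_mem (E := E) ⟨hx, hd⟩).2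
      (by rw [K.d_d]; exact zero_mem _) (neg_mem (s := (Z D ⊥)) hz).1 (neg_mem (s := (Z D ⊥)) hz).2

end exactness

/-- The second isomorphism theorem: excision. -/
theorem excision (E D : Sub K) : (Hom.id K).QIso E (E ⊓ D) (E ⊔ D) D where
  pair := Hom.id_pair (le_sup_left' E D) fun _ hx => hx.2
  inj x hx hd := by
    rintro ⟨y, hy, hxy⟩
    obtain ⟨a, ha, b, hb, rfl⟩ := mem_sup.1 hy
    refine ⟨a, ha, sub_mem hx (E.d_mem a ha), ?_⟩
    have := add_mem hxy (D.d_mem b hb)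
    change x - _ + _ ∈ D at this
    rwa [map_add, sub_add, add_sub_cancel_right] at this
  surj x' hx' hd := by
    obtain ⟨a, ha, b, hb, rfl⟩ := mem_sup.1 hx'
    refine ⟨a, ha, ⟨E.d_mem a ha, ?_⟩, 0, zero_mem _, ?_⟩
    · have := sub_mem hd (D.d_mem b hb)
      rwa [map_add, add_sub_cancel_right] at this
    · change a - (a + b) - K.d 0 ∈ D
      rw [map_zero, sub_zero, sub_add_cancel_left]
      exact neg_mem hb

/-- Five lemma: quotient. -/
theorem Hom.QIso.quot {φ : Hom K L} {E D : Sub K} {E' D' : Sub L} (h : D ≤ E) (h' : D' ≤ E')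
    (hE : φ.QIso E ⊥ E' ⊥) (hD : φ.QIso D ⊥ D' ⊥) : φ.QIso E D E' D' where
  pair := ⟨hE.pair.mapE, hD.pair.mapE⟩
  inj x hx hd := by
    rintro ⟨y, hy, hxy⟩
    -- dx is a boundary in D
    obtain ⟨z, hz, hz'⟩ := hD.inj (K.d x) hd (by rw [K.d_d]; exact zero_mem _)
      ⟨_, hxy, by rw [map_sub, L.d_d, φ.comm, sub_zero, sub_self]; exact zero_mem _⟩
    rw [mem_bot, sub_eq_zero] at hz'
    -- φ(x - z) - dy is a cycle of D'
    obtain ⟨w, hw, hdw, v, hv, hwv⟩ := hD.surj (φ.f (x - z) - L.d y) (by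
        rw [map_sub, sub_right_comm]; exact sub_mem hxy (hD.pair.mapE z hz)) (by
        rw [mem_bot, map_sub, L.d_d, ← φ.comm, map_sub, hz', sub_self, map_zero, sub_zero])
    obtain ⟨u, hu, hxu⟩ := hE.inj (x - z - w) (sub_mem (sub_mem hx (h hz)) (h hw)) (by
        rw [mem_bot] at hdw ⊢
        rw [map_sub, map_sub, hz', hdw, sub_self, sub_zero]) ⟨y - v, sub_mem hy (h' hv), by
        rw [mem_bot] at hwv ⊢
        simp only [map_sub] at hwv ⊢
        linear_combination (norm := module) -hwv⟩
    refine ⟨u, hu, ?_⟩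
    rw [mem_bot] at hxu
    have : x - K.d u = z + w := by linear_combination (norm := module) hxu
    rw [this]; exact add_mem hz hw
  surj x' hx' hd := by
    obtain ⟨z, hz, hdz, y, hy, hzy⟩ := hD.surj (L.d x') hd (by rw [L.d_d]; exact zero_mem _)
    rw [mem_bot] at hdz hzy
    obtain ⟨w, hw, hzw⟩ := hE.inj z (h hz) (by rw [hdz]; exact zero_mem _) ⟨x' + y,
      add_mem hx' (h' hy), by rw [mem_bot, map_add]; linear_combination (norm := module) hzy⟩
    rw [mem_bot, sub_eq_zero] at hzw
    obtain ⟨v, hv, hdv, u, hu, hvu⟩ := hE.surj (x' + y - φ.f w)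
      (sub_mem (add_mem hx' (h' hy)) (hE.pair.mapE w hw)) (by
        rw [mem_bot, map_sub, ← φ.comm, ← hzw, map_add]; linear_combination (norm := module) -hzy)
    rw [mem_bot] at hdv hvu
    refine ⟨w + v, add_mem hw hv, ?_, u, hu, ?_⟩
    · rw [map_add, hdv, ← hzw, add_zero]; exact hz
    · have : φ.f (w + v) - x' - L.d u = y := by
        rw [map_add]; linear_combination (norm := module) hvu
      rw [this]; exact hy

/-- Five lemma: extension. -/
theorem Hom.QIso.ext {φ : Hom K L} {E D : Sub K} {E' D' : Sub L} (h : D ≤ E) (h' : D' ≤ E')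
    (hD : φ.QIso D ⊥ D' ⊥) (hE : φ.QIso E D E' D') : φ.QIso E ⊥ E' ⊥ where
  pair := ⟨hE.pair.mapE, fun x hx => by rw [mem_bot] at *; rw [hx, map_zero]⟩
  inj x hx hd := by
    rintro ⟨y, hy, hxy⟩
    rw [mem_bot] at hd hxy
    obtain ⟨z, hz, hxz⟩ := hE.inj x hx (by rw [hd]; exact zero_mem _)
      ⟨y, hy, by rw [hxy]; exact zero_mem _⟩
    -- w = x - dz in D, φ w = d (y - φ z)
    obtain ⟨v, hv, hdv, u, hu, hvu⟩ := hE.surj (y - φ.f z) (sub_mem hy (hE.pair.mapE z hz)) (by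
        have : L.d (y - φ.f z) = φ.f (x - K.d z) := by
          rw [map_sub, map_sub, φ.comm]; linear_combination (norm := module) -hxy
        rw [this]; exact hE.pair.mapD _ hxz)
    obtain ⟨t, ht, hxt⟩ := hD.inj (x - K.d z - K.d v) (sub_mem hxz hdv) (by
        rw [mem_bot, map_sub, map_sub, K.d_d, K.d_d, hd]; simp) ⟨_, neg_mem hvu, by
        rw [mem_bot]
        simp only [map_sub, map_neg, φ.comm, L.d_d]
        linear_combination (norm := module) hxy⟩
    rw [mem_bot] at hxt
    refine ⟨z + v + t, add_mem (add_mem hz hv) (h ht), ?_⟩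
    rw [mem_bot, map_add, map_add]
    linear_combination (norm := module) hxt
  surj x' hx' hd := by
    rw [mem_bot] at hd
    obtain ⟨x, hx, hdx, y, hy, hxy⟩ := hE.surj x' hx' (by rw [hd]; exact zero_mem _)
    obtain ⟨z, hz, hxz⟩ := hD.inj (K.d x) hdx (by rw [mem_bot, K.d_d]) ⟨_, hxy, by
      rw [mem_bot, map_sub, map_sub, L.d_d, φ.comm, hd]; simp⟩
    rw [mem_bot] at hxz
    obtain ⟨w, hw, hdw, v, hv, hwv⟩ := hD.surj (φ.f x - x' - L.d y - φ.f z)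
      (sub_mem hxy (hD.pair.mapE z hz)) (by
        rw [mem_bot, map_sub, map_sub, map_sub, L.d_d, ← φ.comm, ← φ.comm, hd, sub_zero, sub_zero,
          ← map_sub, hxz, map_zero])
    rw [mem_bot] at hdw hwv
    refine ⟨x - z - w, sub_mem (sub_mem hx (h hz)) (h hw), ?_, y - v, sub_mem hy (h' hv), ?_⟩
    · rw [mem_bot, map_sub, map_sub, hdw]; linear_combination (norm := module) hxz
    · rw [mem_bot, map_sub, map_sub, map_sub]
      linear_combination (norm := module) -hwv

theorem Hom.QIso.comp {ψ : Hom L M} {φ : Hom K L} {E D : Sub K} {E' D' : Sub L} {E'' D'' : Sub M}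
    (h : φ.QIso E D E' D') (h' : ψ.QIso E' D' E'' D'') : (ψ.comp φ).QIso E D E'' D'' where
  pair := ⟨fun x hx => h'.pair.mapE _ (h.pair.mapE x hx),
    fun x hx => h'.pair.mapD _ (h.pair.mapD x hx)⟩
  inj x hx hd hy := h.inj x hx hd (h'.inj _ (h.pair.mapE x hx) (h.pair.mapZ x ⟨hx, hd⟩).2 hy)
  surj x hx hd := by
    obtain ⟨y, hy, hdy, z, hz, hyz⟩ := h'.surj x hx hd
    obtain ⟨w, hw, hdw, v, hv, hwv⟩ := h.surj y hy hdy
    refine ⟨w, hw, hdw, ψ.f v + z, add_mem (h'.pair.mapE _ hv) hz, ?_⟩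
    have := add_mem (h'.pair.mapD _ hwv) hyz
    convert this using 1
    change ψ.f (φ.f w) - x - _ = _
    rw [map_add, map_sub, map_sub, ψ.comm]
    abel

/-- Cancel a quasi-isomorphism on the right factor. -/
theorem Hom.QIso.of_comp_left {ψ : Hom L M} {φ : Hom K L} {E D : Sub K} {E' D' : Sub L}
    {E'' D'' : Sub M} (p : φ.Pair E D E' D')
    (h : (ψ.comp φ).QIso E D E'' D'') (h' : ψ.QIso E' D' E'' D'') : φ.QIso E D E' D' where
  pair := p
  inj x hx hd := by
    rintro ⟨y, hy, hxy⟩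
    refine h.inj x hx hd ⟨ψ.f y, h'.pair.mapE y hy, ?_⟩
    have := h'.pair.mapD _ hxy
    rwa [map_sub, ψ.comm] at this
  surj x hx hd := by
    obtain ⟨w, hw, hdw, v, hv, hwv⟩ := h.surj (ψ.f x) (h'.pair.mapE x hx) (h'.pair.mapZ x ⟨hx, hd⟩).2
    refine ⟨w, hw, hdw, h'.inj _ (sub_mem (p.mapE w hw) hx) ?_ ⟨v, hv, ?_⟩⟩
    · rw [map_sub]; exact sub_mem (p.mapZ w ⟨hw, hdw⟩).2 hd
    · rwa [map_sub]

/-- Cancel a quasi-isomorphism on the inner factor. -/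
theorem Hom.QIso.of_comp_right {ψ : Hom L M} {φ : Hom K L} {E D : Sub K} {E' D' : Sub L}
    {E'' D'' : Sub M} (p : ψ.Pair E' D' E'' D'')
    (h : (ψ.comp φ).QIso E D E'' D'') (h' : φ.QIso E D E' D') : ψ.QIso E' D' E'' D'' where
  pair := p
  inj x hx hd := by
    rintro ⟨y, hy, hxy⟩
    obtain ⟨w, hw, hdw, v, hv, hwv⟩ := h'.surj x hx hd
    obtain ⟨u, hu, hwu⟩ := h.inj w hw hdw ⟨y + ψ.f v, add_mem hy (p.mapE v hv), by
      have := add_mem hxy (p.mapD _ hwv)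
      convert this using 1
      change ψ.f (φ.f w) - _ = _
      rw [map_add, map_sub, map_sub, ψ.comm]
      abel⟩
    refine ⟨φ.f u - v, sub_mem (h'.pair.mapE u hu) hv, ?_⟩
    have := sub_mem (h'.pair.mapD _ hwu) hwv
    convert this using 1
    rw [map_sub, map_sub, φ.comm]
    abel
  surj x hx hd := by
    obtain ⟨w, hw, hdw, v, hv, hwv⟩ := h.surj x hx hd
    exact ⟨φ.f w, h'.pair.mapE w hw, (h'.pair.mapZ w ⟨hw, hdw⟩).2, v, hv, hwv⟩

/-- A retract of a quasi-isomorphism is a quasi-isomorphism. -/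
theorem Hom.QIso.retract {K₁ L₁ : Cx} {φ : Hom K L} {φ₁ : Hom K₁ L₁}
    {i : Hom K₁ K} {r : Hom K K₁} {i' : Hom L₁ L} {r' : Hom L L₁}
    (hri : ∀ x, r.f (i.f x) = x) (hri' : ∀ x, r'.f (i'.f x) = x)
    (hi : ∀ x, φ.f (i.f x) = i'.f (φ₁.f x)) (hr : ∀ x, φ₁.f (r.f x) = r'.f (φ.f x))
    (h : φ.QIso ⊤ ⊥ ⊤ ⊥) : φ₁.QIso ⊤ ⊥ ⊤ ⊥ where
  pair := ⟨fun _ _ => mem_top _, fun x hx => by rw [mem_bot] at *; rw [hx, map_zero]⟩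
  inj x hx hd := by
    rintro ⟨y, -, hxy⟩
    rw [mem_bot] at hd hxy
    obtain ⟨z, -, hz⟩ := h.inj (i.f x) (mem_top _) (by rw [mem_bot, ← i.comm, hd, map_zero])
      ⟨i'.f y, mem_top _, by rw [mem_bot, hi, ← i'.comm, ← map_sub, hxy, map_zero]⟩
    rw [mem_bot] at hz
    refine ⟨r.f z, mem_top _, ?_⟩
    rw [mem_bot, ← r.comm]
    nth_rewrite 1 [← hri x]
    rw [← map_sub, hz, map_zero]
  surj x hx hd := by
    rw [mem_bot] at hd
    obtain ⟨w, hw, hdw, v, hv, hwv⟩ := h.surj (i'.f x) (mem_top _)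
      (by rw [mem_bot, ← i'.comm, hd, map_zero])
    rw [mem_bot] at hdw hwv
    refine ⟨r.f w, mem_top _, by rw [mem_bot, ← r.comm, hdw, map_zero], r'.f v, mem_top _, ?_⟩
    rw [mem_bot, hr, ← r'.comm]
    nth_rewrite 1 [← hri' x]
    rw [← map_sub, ← map_sub, hwv, map_zero]

end Cx

/-- Augmented affine chains: formal combinations of tuples of vertices. -/
abbrev LC (K : Type) : Type := (Σ n : ℕ, (Fin n → K)) →₀ ℚ

namespace LC
variable {K L : Type}

/-- The generator attached to a tuple. -/
abbrev tup {n : ℕ} (v : Fin n → K) : LC K := Finsupp.single ⟨n, v⟩ 1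

/-- Linear extension from tuples. -/
def lift {P : Type} [AddCommGroup P] [Module ℚ P] (F : ∀ n, (Fin n → K) → P) : LC K →ₗ[ℚ] P :=
  Finsupp.linearCombination ℚ fun s : Σ n : ℕ, (Fin n → K) => F s.1 s.2

@[simp] theorem lift_tup {P : Type} [AddCommGroup P] [Module ℚ P] (F : ∀ n, (Fin n → K) → P)
    {n : ℕ} (v : Fin n → K) : lift F (tup v) = F n v := by
  simp [lift, tup]

theorem hom_ext {P : Type} [AddCommGroup P] [Module ℚ P] {f g : LC K →ₗ[ℚ] P}
    (h : ∀ n (v : Fin n → K), f (tup v) = g (tup v)) : f = g :=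
  Finsupp.lhom_ext' fun ⟨n, v⟩ => LinearMap.ext_ring (h n v)

/-- The boundary of a tuple. -/
def bdS : ∀ n, (Fin n → K) → LC K
  | 0, _ => 0
  | n + 1, v => ∑ i : Fin (n + 1), (-1 : ℚ) ^ (i : ℕ) • tup (v ∘ i.succAbove)

/-- The augmented boundary. -/
def bd : LC K →ₗ[ℚ] LC K := lift bdS

theorem bd_zero (v : Fin 0 → K) : bd (tup v) = 0 := lift_tup _ _
theorem bd_succ {n : ℕ} (v : Fin (n + 1) → K) :
    bd (tup v) = ∑ i : Fin (n + 1), (-1 : ℚ) ^ (i : ℕ) • tup (v ∘ i.succAbove) := lift_tup _ _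

/-- The cone with apex `b`. -/
def cone (b : K) : LC K →ₗ[ℚ] LC K := lift fun _ v => tup (Fin.cons b v : Fin _ → K)

@[simp] theorem cone_tup (b : K) {n : ℕ} (v : Fin n → K) :
    cone b (tup v) = tup (Fin.cons b v : Fin (n + 1) → K) := lift_tup _ _

theorem cons_comp_succAbove_succ (b : K) {n : ℕ} (v : Fin (n + 1) → K) (i : Fin (n + 1)) :
    (Fin.cons b v : Fin (n + 2) → K) ∘ i.succ.succAbove =
      (Fin.cons b (v ∘ i.succAbove) : Fin (n + 1) → K) := by
  funext j
  refine Fin.cases ?_ (fun j => ?_) j <;> simp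

theorem bd_cone (b : K) (x : LC K) : bd (cone b x) = x - cone b (bd x) := by
  have : bd ∘ₗ cone b = LinearMap.id - cone b ∘ₗ bd := by
    refine hom_ext fun n v => ?_
    cases n with
    | zero =>
      simp only [LinearMap.comp_apply, cone_tup, LinearMap.sub_apply, bd_zero, map_zero, bd_succ]
      rw [LinearMap.id_apply, sub_zero, Fin.sum_univ_one, Fin.val_zero, pow_zero, one_smul]
      exact congrArg tup (Subsingleton.elim _ _)
    | succ n =>
      simp only [LinearMap.comp_apply, cone_tup, LinearMap.sub_apply, bd_succ, map_sum, map_smul]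
      rw [Fin.sum_univ_succ]
      simp only [cons_comp_succAbove_succ, Fin.val_zero, pow_zero, one_smul, Fin.val_succ, pow_succ,
        mul_neg, mul_one, neg_smul, Finset.sum_neg_distrib, LinearMap.id_apply, sub_eq_add_neg]
      congr 1
  exact LinearMap.congr_fun this x

theorem bd_bd (x : LC K) : bd (bd x) = 0 := by
  have : (bd ∘ₗ bd : LC K →ₗ[ℚ] LC K) = 0 := by
    refine hom_ext fun n => ?_
    induction n with
    | zero => intro v; simp [bd_zero]
    | succ n ih =>
      intro v
      have h : tup v = cone (v 0) (tup (Fin.tail v)) := by rw [cone_tup, Fin.cons_self_tail]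
      have := ih (Fin.tail v)
      simp only [LinearMap.comp_apply, LinearMap.zero_apply] at this ⊢
      rw [h, bd_cone, map_sub, bd_cone, this]
      simp
  exact LinearMap.congr_fun this x

/-- Functoriality. -/
def map (g : K → L) : LC K →ₗ[ℚ] LC L := lift fun _ v => tup (g ∘ v)

@[simp] theorem map_tup (g : K → L) {n : ℕ} (v : Fin n → K) : map g (tup v) = tup (g ∘ v) :=
  lift_tup _ _

theorem map_bd (g : K → L) (x : LC K) : map g (bd x) = bd (map g x) := by
  have : map g ∘ₗ bd = bd ∘ₗ map g := hom_ext fun n v => by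
    cases n with
    | zero => simp [bd_zero]
    | succ n => simp only [LinearMap.comp_apply, map_tup, bd_succ, map_sum, map_smul]; rfl
  exact LinearMap.congr_fun this x

theorem map_cone (g : K → L) (b : K) (x : LC K) : map g (cone b x) = cone (g b) (map g x) := by
  have : map g ∘ₗ cone b = cone (g b) ∘ₗ map g := hom_ext fun n v => by
    simp only [LinearMap.comp_apply, map_tup, cone_tup]
    exact congrArg tup (Fin.comp_cons g b v)
  exact LinearMap.congr_fun this x

section sd
variable (β : ∀ n, (Fin (n + 1) → K) → K)

/-- Barycentric subdivision of a tuple. -/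
def sdS : ∀ n, (Fin n → K) → LC K
  | 0, v => tup v
  | n + 1, v => cone (β n v) (∑ i : Fin (n + 1), (-1 : ℚ) ^ (i : ℕ) • sdS n (v ∘ i.succAbove))

/-- Barycentric subdivision with respect to a choice of barycentres. -/
def sd : LC K →ₗ[ℚ] LC K := lift (sdS β)

theorem sd_zero (v : Fin 0 → K) : sd β (tup v) = tup v := lift_tup _ _
theorem sd_succ {n : ℕ} (v : Fin (n + 1) → K) :
    sd β (tup v) = cone (β n v) (sd β (bd (tup v))) := by
  rw [bd_succ]; simp only [map_sum, map_smul, sd, lift_tup, sdS]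

theorem bd_sd (x : LC K) : bd (sd β x) = sd β (bd x) := by
  have : bd ∘ₗ sd β = sd β ∘ₗ bd := by
    refine hom_ext fun n => ?_
    induction n with
    | zero => intro v; simp [sd_zero, bd_zero]
    | succ n ih =>
      intro v
      have h : bd (sd β (bd (tup v))) = 0 := by
        rw [bd_succ]
        simp only [map_sum, map_smul]
        have h2 := bd_bd (tup v)
        rw [bd_succ, map_sum] at h2
        have h3 := congrArg (sd β) h2
        simp only [map_sum, map_smul, map_zero] at h3
        rw [← h3]
        exact Finset.sum_congr rfl fun i _ => by congr 1; exact ih _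
      rw [LinearMap.comp_apply, LinearMap.comp_apply, sd_succ, bd_cone, h, map_zero, sub_zero]
  exact LinearMap.congr_fun this x

/-- The homotopy from the identity to the subdivision, on tuples. -/
def htS : ∀ n, (Fin n → K) → LC K
  | 0, _ => 0
  | n + 1, v => cone (β n v)
      (tup v - ∑ i : Fin (n + 1), (-1 : ℚ) ^ (i : ℕ) • htS n (v ∘ i.succAbove))

/-- The homotopy from the identity to the subdivision. -/
def ht : LC K →ₗ[ℚ] LC K := lift (htS β)

theorem ht_zero (v : Fin 0 → K) : ht β (tup v) = 0 := lift_tup _ _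
theorem ht_succ {n : ℕ} (v : Fin (n + 1) → K) :
    ht β (tup v) = cone (β n v) (tup v - ht β (bd (tup v))) := by
  rw [bd_succ]; simp only [map_sum, map_smul, map_sub, ht, lift_tup, htS]

theorem bd_ht (x : LC K) : bd (ht β x) = x - sd β x - ht β (bd x) := by
  have : bd ∘ₗ ht β = LinearMap.id - sd β - ht β ∘ₗ bd := by
    refine hom_ext fun n => ?_
    induction n with
    | zero => intro v; simp [sd_zero, bd_zero, ht_zero]
    | succ n ih =>
      intro v
      have h : bd (ht β (bd (tup v))) = bd (tup v) - sd β (bd (tup v)) := by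
        have h2 := bd_bd (tup v)
        have h3 := congrArg (ht β) h2
        rw [map_zero] at h3
        have h4 : bd (ht β (bd (tup v))) =
            bd (tup v) - sd β (bd (tup v)) - ht β (bd (bd (tup v))) := by
          rw [bd_succ]
          simp only [map_sum, map_smul]
          rw [← Finset.sum_sub_distrib, ← Finset.sum_sub_distrib]
          refine Finset.sum_congr rfl fun i _ => ?_
          rw [← smul_sub, ← smul_sub]
          congr 1; exact ih _
        rw [h4, h3, sub_zero]
      simp only [LinearMap.comp_apply, LinearMap.sub_apply, LinearMap.id_apply]
      rw [ht_succ, bd_cone, map_sub, h, sub_sub_cancel, ← sd_succ]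
      abel
  exact LinearMap.congr_fun this x

theorem map_sd {β' : ∀ n, (Fin (n + 1) → L) → L} (g : K → L)
    (hg : ∀ n v, g (β n v) = β' n (g ∘ v)) (x : LC K) :
    map g (sd β x) = sd β' (map g x) := by
  have : map g ∘ₗ sd β = sd β' ∘ₗ map g := by
    refine hom_ext fun n => ?_
    induction n with
    | zero => intro v; simp [sd_zero]
    | succ n ih =>
      intro v
      simp only [LinearMap.comp_apply, map_tup]
      rw [sd_succ, map_cone, hg, sd_succ, ← map_tup, ← map_bd, bd_succ]
      simp only [map_sum, map_smul]
      exact Finset.sum_congr rfl fun i _ => by congr 2; exact ih _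
  exact LinearMap.congr_fun this x

theorem map_ht {β' : ∀ n, (Fin (n + 1) → L) → L} (g : K → L)
    (hg : ∀ n v, g (β n v) = β' n (g ∘ v)) (x : LC K) :
    map g (ht β x) = ht β' (map g x) := by
  have : map g ∘ₗ ht β = ht β' ∘ₗ map g := by
    refine hom_ext fun n => ?_
    induction n with
    | zero => intro v; simp [ht_zero]
    | succ n ih =>
      intro v
      simp only [LinearMap.comp_apply, map_tup]
      rw [ht_succ, map_cone, hg, ht_succ, map_sub, ← map_tup, ← map_bd, bd_succ]
      simp only [map_sum, map_smul]
      congr 2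
      exact Finset.sum_congr rfl fun i _ => by congr 1; exact ih _
  exact LinearMap.congr_fun this x

end sd

section cross

/-- The cross product of two tuples (by induction, with apex the pair of first vertices). -/
def crossS : ∀ p q : ℕ, (Fin (p + 1) → K) → (Fin (q + 1) → L) → LC (K × L)
  | p, 0, v, w => tup fun i => (v i, w 0)
  | 0, q + 1, v, w => tup fun i => (v 0, w i)
  | p + 1, q + 1, v, w => cone (v 0, w 0)
      ((∑ i : Fin (p + 2), (-1 : ℚ) ^ (i : ℕ) • crossS p (q + 1) (v ∘ i.succAbove) w) +
        (-1 : ℚ) ^ (p + 1) •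
          ∑ j : Fin (q + 2), (-1 : ℚ) ^ (j : ℕ) • crossS (p + 1) q v (w ∘ j.succAbove))
  termination_by p q => (p, q)

/-- The cross product. -/
def cross : LC K →ₗ[ℚ] LC L →ₗ[ℚ] LC (K × L) :=
  lift fun n => match n with
    | 0 => fun _ => 0
    | p + 1 => fun v => lift fun m => match m with
      | 0 => fun _ => 0
      | q + 1 => fun w => crossS p q v w

theorem cross_zero_left (v : Fin 0 → K) (y : LC L) : cross (tup v) y = 0 := by
  simp [cross]
theorem cross_zero_right (x : LC K) (w : Fin 0 → L) : cross x (tup w) = 0 := by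
  have : cross.flip (tup w) = (0 : LC K →ₗ[ℚ] LC (K × L)) := hom_ext fun n v => by
    cases n <;> simp [cross]
  exact LinearMap.congr_fun this x
theorem cross_tup {p q : ℕ} (v : Fin (p + 1) → K) (w : Fin (q + 1) → L) :
    cross (tup v) (tup w) = crossS p q v w := by
  simp [cross]
theorem cross_tup_one {p : ℕ} (v : Fin (p + 1) → K) (w : Fin 1 → L) :
    cross (tup v) (tup w) = tup fun i => (v i, w 0) := by
  rw [cross_tup, crossS]
theorem cross_one_tup {q : ℕ} (v : Fin 1 → K) (w : Fin (q + 1) → L) :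
    cross (tup v) (tup w) = tup fun i => (v 0, w i) := by
  rw [cross_tup]
  cases q with
  | zero =>
    rw [crossS]; refine congrArg tup (funext fun i => ?_); rw [Fin.fin_one_eq_zero i]
  | succ q => rw [crossS]
theorem cross_succ {p q : ℕ} (v : Fin (p + 2) → K) (w : Fin (q + 2) → L) :
    cross (tup v) (tup w) = cone (v 0, w 0)
      (cross (bd (tup v)) (tup w) + (-1 : ℚ) ^ (p + 1) • cross (tup v) (bd (tup w))) := by
  rw [cross_tup, crossS, bd_succ, bd_succ]
  simp only [map_sum, map_smul, LinearMap.sum_apply, LinearMap.smul_apply, cross_tup]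

theorem bd_cross {p q : ℕ} (hpq : p + q ≠ 0) (v : Fin (p + 1) → K) (w : Fin (q + 1) → L) :
    bd (cross (tup v) (tup w)) =
      cross (bd (tup v)) (tup w) + (-1 : ℚ) ^ p • cross (tup v) (bd (tup w)) := by
  induction p generalizing q with
  | zero =>
    cases q with
    | zero => simp at hpq
    | succ q =>
      rw [cross_one_tup, bd_succ, bd_succ, bd_succ]
      simp only [map_sum, map_smul, LinearMap.sum_apply, LinearMap.smul_apply, cross_zero_left,
        smul_zero, Finset.sum_const_zero, zero_add, pow_zero, one_smul]
      refine Finset.sum_congr rfl fun i _ => ?_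
      rw [cross_one_tup]; rfl
  | succ p ihp =>
    induction q with
    | zero =>
      rw [cross_tup_one, bd_succ, bd_succ, bd_succ]
      simp only [map_sum, map_smul, LinearMap.sum_apply, LinearMap.smul_apply, cross_zero_right,
        smul_zero, Finset.sum_const_zero, add_zero]
      refine Finset.sum_congr rfl fun i _ => ?_
      rw [cross_tup_one]; rfl
    | succ q ihq =>
      rw [cross_succ, bd_cone]
      have e1 : bd (cross (bd (tup v)) (tup w)) =
          (-1 : ℚ) ^ p • cross (bd (tup v)) (bd (tup w)) := by
        have h1 : bd (cross (bd (tup v)) (tup w)) = cross (bd (bd (tup v))) (tup w) +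
            (-1 : ℚ) ^ p • cross (bd (tup v)) (bd (tup w)) := by
          rw [bd_succ v]
          simp only [map_sum, map_smul, LinearMap.sum_apply, LinearMap.smul_apply]
          rw [Finset.smul_sum, ← Finset.sum_add_distrib]
          refine Finset.sum_congr rfl fun i _ => ?_
          rw [ihp (by omega), smul_add, smul_comm]
        rw [h1, bd_bd]; simp
      have e2 : bd (cross (tup v) (bd (tup w))) = cross (bd (tup v)) (bd (tup w)) := by
        have h1 : bd (cross (tup v) (bd (tup w))) = cross (bd (tup v)) (bd (tup w)) +
            (-1 : ℚ) ^ (p + 1) • cross (tup v) (bd (bd (tup w))) := by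
          rw [bd_succ w]
          simp only [map_sum, map_smul]
          rw [Finset.smul_sum, ← Finset.sum_add_distrib]
          refine Finset.sum_congr rfl fun i _ => ?_
          rw [ihq (by omega), smul_add, smul_comm]
        rw [h1, bd_bd]; simp
      rw [map_add, map_smul, e1, e2, ← add_smul, pow_succ]
      simp

theorem map_cross {K' L' : Type} (g : K → K') (h : L → L') (x : LC K) (y : LC L) :
    map (Prod.map g h) (cross x y) = cross (map g x) (map h y) := by
  have key : ∀ (p q : ℕ) (v : Fin (p + 1) → K) (w : Fin (q + 1) → L),
      map (Prod.map g h) (cross (tup v) (tup w)) = cross (tup (g ∘ v)) (tup (h ∘ w)) := by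
    intro p
    induction p with
    | zero => intro q v w; rw [cross_one_tup, cross_one_tup, map_tup]; rfl
    | succ p ihp =>
      intro q
      induction q with
      | zero => intro v w; rw [cross_tup_one, cross_tup_one, map_tup]; rfl
      | succ q ihq =>
        intro v w
        rw [cross_succ, cross_succ, map_cone, ← map_tup, ← map_tup, ← map_bd, ← map_bd,
          map_add, map_smul, bd_succ, bd_succ]
        simp only [map_sum, map_smul, LinearMap.sum_apply, LinearMap.smul_apply, map_tup, ihp,
          ihq, Prod.map_apply, Function.comp_apply]
  have : (cross.compr₂ (map (Prod.map g h)) : LC K →ₗ[ℚ] LC L →ₗ[ℚ] LC (K' × L')) =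
      cross.compl₁₂ (map g) (map h) := by
    refine hom_ext fun n v => hom_ext fun m w => ?_
    simp only [LinearMap.compr₂_apply, LinearMap.compl₁₂_apply, map_tup]
    cases n with
    | zero => rw [cross_zero_left, cross_zero_left, map_zero]
    | succ p =>
      cases m with
      | zero => rw [cross_zero_right, cross_zero_right, map_zero]
      | succ q => exact key p q v w
  exact LinearMap.congr_fun (LinearMap.congr_fun this x) y

end cross
end LC

/-- The standard topological simplex. -/
abbrev Spx (n : ℕ) : Type := stdSimplex ℝ (Fin (n + 1))

namespace Spx
/-- The vertices. -/
def vtx {n : ℕ} (i : Fin (n + 1)) : Spx n := stdSimplex.vertex i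

/-- Affine combinations in a simplex. -/
def scomb {m n : ℕ} (t : Spx m) (v : Fin (m + 1) → Spx n) : Spx n :=
  ⟨fun l => ∑ i, t i * v i l, fun l => Finset.sum_nonneg fun i _ =>
    mul_nonneg (stdSimplex.zero_le _ _) (stdSimplex.zero_le _ _), by
    rw [Finset.sum_comm]
    simp_rw [← Finset.mul_sum]
    simp⟩

theorem scomb_apply {m n : ℕ} (t : Spx m) (v : Fin (m + 1) → Spx n) (l : Fin (n + 1)) :
    scomb t v l = ∑ i, t i * v i l := rfl

theorem vtx_apply {n : ℕ} (i j : Fin (n + 1)) :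
    (vtx i : Spx n) j = if j = i then 1 else 0 := by
  rw [vtx, stdSimplex.vertex_coe, Pi.single_apply]

theorem scomb_vtx {n : ℕ} (t : Spx n) : scomb t vtx = t := by
  refine stdSimplex.ext (funext fun l => ?_)
  rw [scomb_apply]; simp [vtx_apply]

theorem continuous_coord {n : ℕ} (i : Fin (n + 1)) : Continuous fun t : Spx n => t i :=
  (continuous_apply i).comp continuous_subtype_val

theorem map_eq_scomb {m n : ℕ} (f : Fin (m + 1) → Fin (n + 1)) (t : Spx m) :
    stdSimplex.map f t = scomb t (vtx ∘ f) := by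
  refine stdSimplex.ext (funext fun l => ?_)
  rw [scomb_apply, stdSimplex.map_coe, FunOnFinite.linearMap_apply_apply, Finset.sum_filter]
  refine Finset.sum_congr rfl fun i _ => ?_
  rw [Function.comp_apply, vtx_apply]
  by_cases h : f i = l
  · simp [h]
  · rw [if_neg h, if_neg (Ne.symm h), mul_zero]
end Spx

open Spx

/-- Spaces with affine combinations. -/
class Aff (K : Type) [TopologicalSpace K] where
  comb : ∀ {n : ℕ}, Spx n → (Fin (n + 1) → K) → K
  cont : ∀ {n : ℕ} (v : Fin (n + 1) → K), Continuous fun t => comb t v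
  comb_vtx : ∀ {n : ℕ} (v : Fin (n + 1) → K) (i), comb (vtx i) v = v i
  comb_comb : ∀ {m n : ℕ} (t : Spx m) (w : Fin (m + 1) → Spx n) (v : Fin (n + 1) → K),
    comb (scomb t w) v = comb t fun i => comb (w i) v

instance (n : ℕ) : Aff (Spx n) where
  comb := scomb
  cont v := Continuous.subtype_mk (continuous_pi fun l =>
    continuous_finsetSum _ fun i _ => (continuous_coord i).mul continuous_const) _
  comb_vtx v i := by
    refine stdSimplex.ext (funext fun l => ?_)
    rw [scomb_apply]; simp [vtx_apply]
  comb_comb t w v := by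
    refine stdSimplex.ext (funext fun l => ?_)
    simp only [scomb_apply, Finset.sum_mul, Finset.mul_sum]
    rw [Finset.sum_comm]
    exact Finset.sum_congr rfl fun i _ => Finset.sum_congr rfl fun j _ => mul_assoc _ _ _

instance {K L : Type} [TopologicalSpace K] [TopologicalSpace L] [Aff K] [Aff L] : Aff (K × L) where
  comb t v := (Aff.comb t fun i => (v i).1, Aff.comb t fun i => (v i).2)
  cont v := (Aff.cont _).prodMk (Aff.cont _)
  comb_vtx v i := by simp only [Aff.comb_vtx]
  comb_comb t w v := by simp only [Aff.comb_comb]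

/-- Affine maps. -/
def IsAff {K L : Type} [TopologicalSpace K] [TopologicalSpace L] [Aff K] [Aff L] (g : K → L) :
    Prop := ∀ {n : ℕ} (t : Spx n) (v : Fin (n + 1) → K), g (Aff.comb t v) = Aff.comb t (g ∘ v)

/-- The affine simplex with given vertices. -/
def aff {K : Type} [TopologicalSpace K] [Aff K] {n : ℕ} (v : Fin (n + 1) → K) : C(Spx n, K) :=
  ⟨fun t => Aff.comb t v, Aff.cont v⟩

theorem aff_apply {K : Type} [TopologicalSpace K] [Aff K] {n : ℕ} (v : Fin (n + 1) → K)
    (t : Spx n) : aff v t = Aff.comb t v := rfl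

theorem isAff_aff {K : Type} [TopologicalSpace K] [Aff K] {n : ℕ} (v : Fin (n + 1) → K) :
    IsAff (aff v) := fun t w => Aff.comb_comb t w v

theorem aff_vtx (n : ℕ) : aff (vtx : Fin (n + 1) → Spx n) = ContinuousMap.id _ := by
  ext1 t; exact scomb_vtx t

theorem aff_comp_vtx {K : Type} [TopologicalSpace K] [Aff K] {n : ℕ} (v : Fin (n + 1) → K) :
    aff v ∘ vtx = v := funext fun i => Aff.comb_vtx v i

theorem IsAff.comp_aff {K L : Type} [TopologicalSpace K] [TopologicalSpace L] [Aff K] [Aff L]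
    {g : C(K, L)} (hg : IsAff g) {n : ℕ} (v : Fin (n + 1) → K) : g.comp (aff v) = aff (g ∘ v) := by
  ext1 t; exact hg t v

/-- Singular chains. -/
abbrev TC (X : Type) [TopologicalSpace X] : Type := (Σ n : ℕ, C(Spx n, X)) →₀ ℚ

namespace TC
variable {X Y Z : Type} [TopologicalSpace X] [TopologicalSpace Y] [TopologicalSpace Z]

/-- The generator attached to a singular simplex. -/
abbrev sg {n : ℕ} (σ : C(Spx n, X)) : TC X := Finsupp.single ⟨n, σ⟩ 1

/-- Linear extension from simplices. -/
def lift {P : Type} [AddCommGroup P] [Module ℚ P] (F : ∀ n, C(Spx n, X) → P) : TC X →ₗ[ℚ] P :=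
  Finsupp.linearCombination ℚ fun s : Σ n : ℕ, C(Spx n, X) => F s.1 s.2

@[simp] theorem lift_sg {P : Type} [AddCommGroup P] [Module ℚ P] (F : ∀ n, C(Spx n, X) → P)
    {n : ℕ} (σ : C(Spx n, X)) : lift F (sg σ) = F n σ := by
  simp [lift, sg]

theorem hom_ext {P : Type} [AddCommGroup P] [Module ℚ P] {f g : TC X →ₗ[ℚ] P}
    (h : ∀ n (σ : C(Spx n, X)), f (sg σ) = g (sg σ)) : f = g :=
  Finsupp.lhom_ext' fun ⟨n, σ⟩ => LinearMap.ext_ring (h n σ)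

theorem hom_congr {P : Type} [AddCommGroup P] [Module ℚ P] {f g : TC X →ₗ[ℚ] P}
    (h : ∀ n (σ : C(Spx n, X)), f (sg σ) = g (sg σ)) (x : TC X) : f x = g x :=
  LinearMap.congr_fun (hom_ext h) x

/-- Pushforward. -/
def push (g : C(X, Y)) : TC X →ₗ[ℚ] TC Y := lift fun _ σ => sg (g.comp σ)

@[simp] theorem push_sg (g : C(X, Y)) {n : ℕ} (σ : C(Spx n, X)) :
    push g (sg σ) = sg (g.comp σ) := lift_sg _ _

theorem push_push (h : C(Y, Z)) (g : C(X, Y)) (x : TC X) :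
    push h (push g x) = push (h.comp g) x :=
  hom_congr (f := push h ∘ₗ push g) (g := push (h.comp g)) (fun n σ => by
    simp only [LinearMap.comp_apply, push_sg, ContinuousMap.comp_assoc]) x

theorem push_id (x : TC X) : push (ContinuousMap.id X) x = x :=
  hom_congr (f := push (ContinuousMap.id X)) (g := LinearMap.id) (fun n σ => by simp) x

/-- The boundary of a simplex. -/
def dS : ∀ n, C(Spx n, X) → TC X
  | 0, _ => 0
  | n + 1, σ => ∑ i : Fin (n + 2), (-1 : ℚ) ^ (i : ℕ) • sg (σ.comp (aff (vtx ∘ i.succAbove)))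

/-- The singular boundary. -/
def d : TC X →ₗ[ℚ] TC X := lift dS

/-- The sign operator. -/
def ε : TC X →ₗ[ℚ] TC X := lift fun n σ => (-1 : ℚ) ^ n • sg σ

theorem ε_sg {n : ℕ} (σ : C(Spx n, X)) : ε (sg σ) = (-1 : ℚ) ^ n • sg σ := lift_sg _ _

theorem d_zero (σ : C(Spx 0, X)) : d (sg σ) = 0 := lift_sg _ _
theorem d_succ {n : ℕ} (σ : C(Spx (n + 1), X)) : d (sg σ) =
    ∑ i : Fin (n + 2), (-1 : ℚ) ^ (i : ℕ) • sg (σ.comp (aff (vtx ∘ i.succAbove))) := lift_sg _ _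

theorem push_d (g : C(X, Y)) (x : TC X) : push g (d x) = d (push g x) :=
  hom_congr (f := push g ∘ₗ d) (g := d ∘ₗ push g) (fun n σ => by
    cases n with
    | zero => simp [d_zero]
    | succ n =>
      simp only [LinearMap.comp_apply, d_succ, push_sg, map_sum, map_smul]; rfl) x

theorem push_ε (g : C(X, Y)) (x : TC X) : push g (ε x) = ε (push g x) :=
  hom_congr (f := push g ∘ₗ ε) (g := ε ∘ₗ push g) (fun n σ => by
    simp only [LinearMap.comp_apply, ε_sg, push_sg, map_smul]) x

theorem ε_ε (x : TC X) : ε (ε x) = x :=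
  hom_congr (f := ε ∘ₗ ε) (g := LinearMap.id) (fun n σ => by
    simp only [LinearMap.comp_apply, ε_sg, map_smul, smul_smul, ← pow_add, LinearMap.id_apply]
    rw [Even.neg_one_pow ⟨n, rfl⟩, one_smul]) x

section real
variable {K L : Type} [TopologicalSpace K] [Aff K] [TopologicalSpace L] [Aff L]

/-- Realization of an affine tuple. -/
def realS : ∀ n, (Fin n → K) → TC K
  | 0, _ => 0
  | _ + 1, v => sg (aff v)

/-- Realization of affine chains as singular chains. -/
def real : LC K →ₗ[ℚ] TC K := LC.lift realS

theorem real_zero (v : Fin 0 → K) : real (LC.tup v) = 0 := LC.lift_tup _ _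
theorem real_succ {n : ℕ} (v : Fin (n + 1) → K) : real (LC.tup v) = sg (aff v) := LC.lift_tup _ _

theorem real_bd (x : LC K) : real (LC.bd x) = d (real x) := by
  have : real ∘ₗ LC.bd = d ∘ₗ (real : LC K →ₗ[ℚ] TC K) := LC.hom_ext fun n v => by
    simp only [LinearMap.comp_apply]
    match n with
    | 0 => rw [LC.bd_zero, real_zero, map_zero, map_zero]
    | 1 => rw [LC.bd_succ, real_succ, d_zero]; simp [real_zero]
    | n + 2 =>
      rw [LC.bd_succ, real_succ, d_succ]
      simp only [map_sum, map_smul, real_succ]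
      refine Finset.sum_congr rfl fun i _ => ?_
      rw [IsAff.comp_aff (isAff_aff v), ← Function.comp_assoc, aff_comp_vtx]
  exact LinearMap.congr_fun this x

theorem push_real {g : C(K, L)} (hg : IsAff g) (x : LC K) :
    push g (real x) = real (LC.map g x) := by
  have : push g ∘ₗ real = real ∘ₗ LC.map g := LC.hom_ext fun n v => by
    simp only [LinearMap.comp_apply, LC.map_tup]
    cases n with
    | zero => rw [real_zero, real_zero, map_zero]
    | succ n => rw [real_succ, real_succ, push_sg, hg.comp_aff]
  exact LinearMap.congr_fun this x

/-- The fundamental affine simplex. -/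
def io (n : ℕ) : LC (Spx n) := LC.tup vtx

theorem push_io {n : ℕ} (σ : C(Spx n, X)) : push σ (real (io n)) = sg σ := by
  rw [io, real_succ, push_sg, aff_vtx]; rfl

theorem map_io {n : ℕ} (v : Fin (n + 1) → K) : LC.map (aff v) (io n) = LC.tup v := by
  rw [io, LC.map_tup, aff_comp_vtx]

theorem d_sg {n : ℕ} (σ : C(Spx n, X)) : d (sg σ) = push σ (real (LC.bd (io n))) := by
  rw [real_bd, push_d, push_io]

theorem d_d (x : TC X) : d (d x) = 0 :=
  hom_congr (f := d ∘ₗ d) (g := 0) (fun n σ => by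
    rw [LinearMap.comp_apply, d_sg, ← push_d, ← real_bd, LC.bd_bd, map_zero, map_zero]; rfl) x

theorem d_ε (x : TC X) : d (ε x) = - ε (d x) :=
  hom_congr (f := d ∘ₗ ε) (g := - (ε ∘ₗ d)) (fun n σ => by
    rw [LinearMap.comp_apply, LinearMap.neg_apply, LinearMap.comp_apply, ε_sg, map_smul]
    cases n with
    | zero => simp [d_zero]
    | succ n =>
      rw [d_succ]
      simp only [map_sum, map_smul, ε_sg, Finset.smul_sum, ← Finset.sum_neg_distrib, pow_succ]
      refine Finset.sum_congr rfl fun i _ => ?_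
      linear_combination (norm := module)) x

end real

/-- An operator on simplices induced by universal affine chains. -/
def op (a : ∀ n, LC (Spx n)) : TC X →ₗ[ℚ] TC X := lift fun n σ => push σ (real (a n))

theorem op_sg (a : ∀ n, LC (Spx n)) {n : ℕ} (σ : C(Spx n, X)) :
    op a (sg σ) = push σ (real (a n)) := lift_sg _ _

theorem op_push (a : ∀ n, LC (Spx n)) (g : C(X, Y)) (x : TC X) :
    op a (push g x) = push g (op a x) :=
  hom_congr (f := op a ∘ₗ push g) (g := push g ∘ₗ op a) (fun n σ => by
    simp only [LinearMap.comp_apply, push_sg, op_sg, push_push]) x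

/-- The choice of barycentres. -/
def bary (K : Type) [TopologicalSpace K] [Aff K] : ∀ n, (Fin (n + 1) → K) → K :=
  fun _ v => Aff.comb stdSimplex.barycenter v

/-- Barycentric subdivision of singular chains. -/
def sd : TC X →ₗ[ℚ] TC X := op fun n => LC.sd (bary _) (io n)
/-- The homotopy to barycentric subdivision. -/
def ht : TC X →ₗ[ℚ] TC X := op fun n => LC.ht (bary _) (io n)

section
variable {K : Type} [TopologicalSpace K] [Aff K]

theorem sd_real_tup {n : ℕ} (v : Fin (n + 1) → K) :
    sd (real (LC.tup v)) = real (LC.sd (bary _) (LC.tup v)) := by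
  rw [real_succ, sd, op_sg, push_real (isAff_aff v), LC.map_sd (β' := bary K), map_io]
  intro n w; exact isAff_aff v _ _

theorem ht_real (x : LC K) : ht (real x) = real (LC.ht (bary _) x) := by
  have : ht ∘ₗ real = real ∘ₗ LC.ht (bary K) := LC.hom_ext fun n v => by
    simp only [LinearMap.comp_apply]
    cases n with
    | zero => rw [real_zero, map_zero, LC.ht_zero, map_zero]
    | succ n =>
      rw [real_succ, ht, op_sg, push_real (isAff_aff v), LC.map_ht (β' := bary K), map_io]
      intro n w; exact isAff_aff v _ _
  exact LinearMap.congr_fun this x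

theorem sd_real' (x : LC K) : sd (real x) = real (LC.sd (bary _) x) := by
  have : sd ∘ₗ real = real ∘ₗ LC.sd (bary K) := LC.hom_ext fun n v => by
    simp only [LinearMap.comp_apply]
    cases n with
    | zero => rw [real_zero, map_zero, LC.sd_zero, real_zero]
    | succ n => exact sd_real_tup v
  exact LinearMap.congr_fun this x
end

theorem sd_push (g : C(X, Y)) (x : TC X) : sd (push g x) = push g (sd x) := op_push _ g x
theorem ht_push (g : C(X, Y)) (x : TC X) : ht (push g x) = push g (ht x) := op_push _ g x
theorem sd_sg {n : ℕ} (σ : C(Spx n, X)) :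
    sd (sg σ) = push σ (real (LC.sd (bary _) (io n))) := op_sg _ σ
theorem ht_sg {n : ℕ} (σ : C(Spx n, X)) :
    ht (sg σ) = push σ (real (LC.ht (bary _) (io n))) := op_sg _ σ

theorem sd_d (x : TC X) : sd (d x) = d (sd x) :=
  hom_congr (f := sd ∘ₗ d) (g := d ∘ₗ sd) (fun n σ => by
    rw [LinearMap.comp_apply, LinearMap.comp_apply, d_sg, sd_push, sd_real',
      ← LC.bd_sd, real_bd, push_d, sd_sg]) x

theorem d_ht (x : TC X) : d (ht x) = x - sd x - ht (d x) :=
  hom_congr (f := d ∘ₗ ht) (g := LinearMap.id - sd - ht ∘ₗ d) (fun n σ => by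
    simp only [LinearMap.comp_apply, LinearMap.sub_apply, LinearMap.id_apply]
    rw [d_sg, ht_push, ht_real, ht_sg, ← push_d, ← real_bd, LC.bd_ht, map_sub,
      map_sub, map_sub, map_sub, push_io, sd_sg]) x

end TC

/-- The singular complex of a space. -/
abbrev SC (X : Type) [TopologicalSpace X] : Cx := ⟨TC X, TC.d, TC.ε, TC.d_d, TC.d_ε⟩

namespace TC
open Cx
variable {X Y Z : Type} [TopologicalSpace X] [TopologicalSpace Y] [TopologicalSpace Z]

/-- The chains supported in a subset, as a submodule. -/
def supp (U : Set X) : Submodule ℚ (TC X) :=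
  Finsupp.supported ℚ ℚ {s : Σ n : ℕ, C(Spx n, X) | Set.range s.2 ⊆ U}

theorem sg_mem {U : Set X} {n : ℕ} {σ : C(Spx n, X)} (h : Set.range σ ⊆ U) : sg σ ∈ supp U :=
  Finsupp.single_mem_supported ℚ 1 h

theorem supp_induct {U : Set X} {P : Type} [AddCommGroup P] [Module ℚ P] (S : Submodule ℚ P)
    (F : TC X →ₗ[ℚ] P) (h : ∀ n (σ : C(Spx n, X)), Set.range σ ⊆ U → F (sg σ) ∈ S) {x : TC X}
    (hx : x ∈ supp U) : F x ∈ S := by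
  rw [supp, Finsupp.supported_eq_span_single] at hx
  have : Submodule.span ℚ ((fun s : Σ n : ℕ, C(Spx n, X) => Finsupp.single s (1 : ℚ)) ''
      {s | Set.range s.2 ⊆ U}) ≤ S.comap F := by
    rw [Submodule.span_le]
    rintro _ ⟨⟨n, σ⟩, hs, rfl⟩
    exact h n σ hs
  exact this hx

theorem push_mem {g : C(X, Y)} {U : Set X} {V : Set Y} (h : Set.MapsTo g U V) {x : TC X}
    (hx : x ∈ supp U) : push g x ∈ supp V :=
  supp_induct (supp V) (push g) (fun n σ hσ => by
    rw [push_sg]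
    refine sg_mem ?_
    rintro _ ⟨t, rfl⟩
    exact h (hσ ⟨t, rfl⟩)) hx

theorem supp_univ (x : TC X) : x ∈ supp (Set.univ : Set X) := by
  rw [supp]; simp

theorem op_mem (a : ∀ n, LC (Spx n)) {U : Set X} {x : TC X} (hx : x ∈ supp U) :
    op a x ∈ supp U :=
  supp_induct (supp U) (op a) (fun n σ hσ => by
    rw [op_sg]
    exact push_mem (fun t _ => hσ (Set.mem_range_self t)) (supp_univ _)) hx

/-- The subcomplex of chains supported in a subset. -/
def sub (U : Set X) : Sub (SC X) where
  S := supp U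
  d_mem x hx := supp_induct (supp U) d (fun n σ hσ => by
    rw [d_sg]
    exact push_mem (fun t _ => hσ (Set.mem_range_self t)) (supp_univ _)) hx
  ε_mem x hx := supp_induct (supp U) ε (fun n σ hσ => by
    rw [ε_sg]
    exact Submodule.smul_mem _ _ (sg_mem hσ)) hx

theorem mem_sub {U : Set X} {x : TC X} : x ∈ (sub U : Sub (SC X)) ↔ x ∈ supp U := Iff.rfl

theorem sub_mono {U V : Set X} (h : U ⊆ V) : sub U ≤ sub V := fun _ hx =>
  Finsupp.supported_mono (fun _ hs => hs.trans h) hx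

theorem sub_univ : sub (Set.univ : Set X) = ⊤ :=
  le_antisymm (le_top' _) fun x _ => supp_univ x

theorem sub_empty : sub (∅ : Set X) = ⊥ := by
  refine le_antisymm (fun x hx => ?_) (bot_le' _)
  rw [mem_bot]
  rw [mem_sub, supp, Finsupp.mem_supported] at hx
  ext s
  by_contra h
  have := hx (Finsupp.mem_support_iff.2 h)
  exact (this ⟨vtx 0, rfl⟩).elim

theorem sub_inf (U V : Set X) : sub U ⊓ sub V = sub (U ∩ V) := by
  refine le_antisymm (fun x hx => ?_) fun x hx =>
    ⟨sub_mono Set.inter_subset_left hx, sub_mono Set.inter_subset_right hx⟩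
  rw [mem_sub, supp, Finsupp.mem_supported] at *
  intro s hs
  exact Set.subset_inter (((Finsupp.mem_supported ℚ x).1 hx.1) hs)
    (((Finsupp.mem_supported ℚ x).1 hx.2) hs)

/-- Pushforward as a chain map. -/
def pushHom (g : C(X, Y)) : Hom (SC X) (SC Y) := ⟨push g, push_d g, push_ε g⟩

theorem push_pair {g : C(X, Y)} {U U' : Set X} {V V' : Set Y} (h : Set.MapsTo g U V)
    (h' : Set.MapsTo g U' V') : (pushHom g).Pair (sub U) (sub U') (sub V) (sub V') :=
  ⟨fun _ hx => push_mem h hx, fun _ hx => push_mem h' hx⟩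

section embed
variable {g : C(X, Y)} (hg : Topology.IsEmbedding g)
include hg

theorem push_mem_iff {D : Set Y} {x : TC X} : push g x ∈ supp D ↔ x ∈ supp (g ⁻¹' D) := by
  refine ⟨fun h => ?_, fun h => push_mem (fun t ht => ht) h⟩
  have e : push g x = Finsupp.mapDomain (fun s : Σ n : ℕ, C(Spx n, X) =>
      (⟨s.1, g.comp s.2⟩ : Σ n : ℕ, C(Spx n, Y))) x :=
    hom_congr (f := push g) (g := Finsupp.lmapDomain ℚ ℚ fun s : Σ n : ℕ, C(Spx n, X) =>
      (⟨s.1, g.comp s.2⟩ : Σ n : ℕ, C(Spx n, Y))) (fun n σ => by simp) x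
  have inj : Function.Injective (fun s : Σ n : ℕ, C(Spx n, X) =>
      (⟨s.1, g.comp s.2⟩ : Σ n : ℕ, C(Spx n, Y))) := by
    rintro ⟨n, σ⟩ ⟨m, τ⟩ h
    obtain ⟨h1, h2⟩ := Sigma.mk.inj h
    cases h1
    have h3 := eq_of_heq h2
    congr 1
    ext t
    exact hg.injective (DFunLike.congr_fun h3 t)
  rw [supp, Finsupp.mem_supported] at *
  intro s hs
  have : (⟨s.1, g.comp s.2⟩ : Σ n : ℕ, C(Spx n, Y)) ∈ (push g x).support := by
    rw [e, Finsupp.mem_support_iff, Finsupp.mapDomain_apply inj]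
    exact Finsupp.mem_support_iff.1 hs
  rintro _ ⟨t, rfl⟩
  exact h this ⟨t, rfl⟩

theorem exists_lift {E : Set Y} (hE : E ⊆ Set.range g) {y : TC Y} (hy : y ∈ supp E) :
    ∃ x ∈ supp (g ⁻¹' E), push g x = y := by
  have := supp_induct ((supp (g ⁻¹' E)).map (push g)) LinearMap.id (fun n σ hσ => by
    refine ⟨sg ⟨fun t => hg.toHomeomorph.symm ⟨σ t, hE (hσ ⟨t, rfl⟩)⟩, by fun_prop⟩, ?_, ?_⟩
    · refine sg_mem ?_
      rintro _ ⟨t, rfl⟩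
      change g (hg.toHomeomorph.symm ⟨σ t, _⟩) ∈ E
      have := congrArg Subtype.val (hg.toHomeomorph.apply_symm_apply ⟨σ t, hE (hσ ⟨t, rfl⟩)⟩)
      rw [show g _ = σ t from this]; exact hσ (Set.mem_range_self t)
    · rw [push_sg]
      refine congrArg sg ?_
      ext t
      exact congrArg Subtype.val
        (hg.toHomeomorph.apply_symm_apply ⟨σ t, hE (hσ ⟨t, rfl⟩)⟩)) hy
  exact this

theorem embed_qiso {E D : Set Y} (hE : E ⊆ Set.range g) :
    (pushHom g).QIso (sub (g ⁻¹' E)) (sub (g ⁻¹' D)) (sub E) (sub D) where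
  pair := push_pair (fun _ h => h) fun _ h => h
  inj x hx hdx := by
    rintro ⟨y', hy', h⟩
    obtain ⟨y, hy, rfl⟩ := exists_lift hg hE hy'
    refine ⟨y, hy, ?_⟩
    rw [mem_sub, ← push_mem_iff hg, map_sub]
    change push g x - push g (d y) ∈ _
    rw [push_d]; exact h
  surj x' hx' hd := by
    obtain ⟨x, hx, rfl⟩ := exists_lift hg hE hx'
    refine ⟨x, hx, ?_, 0, zero_mem _, ?_⟩
    · rw [mem_sub, ← push_mem_iff hg]
      change push g (d x) ∈ _
      rw [push_d]; exact hd
    · simp [pushHom]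

end embed

section mesh
variable {m : ℕ}

theorem dist_scomb_le {n : ℕ} (t : Spx n) (v : Fin (n + 1) → Spx m) (c : Spx m) {ρ : ℝ}
    (h : ∀ j, dist c (v j) ≤ ρ) : dist c (scomb t v) ≤ ρ := by
  have hρ : 0 ≤ ρ := dist_nonneg.trans (h 0)
  change dist c.1 (scomb t v).1 ≤ ρ
  rw [dist_pi_le_iff hρ]
  intro l
  have e : c l - scomb t v l = ∑ i, t i * (c l - v i l) := by
    simp_rw [mul_sub, Finset.sum_sub_distrib, ← Finset.sum_mul, stdSimplex.sum_eq_one, one_mul]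
    rfl
  change |c l - scomb t v l| ≤ ρ
  rw [e]
  calc |∑ i, t i * (c l - v i l)| ≤ ∑ i, |t i * (c l - v i l)| := Finset.abs_sum_le_sum_abs _ _
    _ ≤ ∑ i, t i * ρ := Finset.sum_le_sum fun i _ => by
        rw [abs_mul, abs_of_nonneg (stdSimplex.zero_le t i)]
        exact mul_le_mul_of_nonneg_left ((dist_le_pi_dist c.1 (v i).1 l).trans (h i))
          (stdSimplex.zero_le t i)
    _ = ρ := by rw [← Finset.sum_mul, stdSimplex.sum_eq_one, one_mul]

theorem dist_bary_le {n : ℕ} (v : Fin (n + 1) → Spx m) {ρ : ℝ} (h : ∀ i j, dist (v i) (v j) ≤ ρ)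
    (j : Fin (n + 1)) : dist (bary _ n v) (v j) ≤ (n : ℝ) / (n + 1) * ρ := by
  have hρ : 0 ≤ ρ := dist_nonneg.trans (h 0 0)
  change dist (scomb stdSimplex.barycenter v).1 (v j).1 ≤ _
  rw [dist_pi_le_iff (by positivity)]
  intro l
  change |scomb stdSimplex.barycenter v l - v j l| ≤ _
  have hn : ((n : ℝ) + 1) ≠ 0 := by positivity
  have e : scomb stdSimplex.barycenter v l - v j l =
      ((n : ℝ) + 1)⁻¹ * ∑ i, (v i l - v j l) := by
    rw [scomb_apply, Finset.sum_sub_distrib]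
    have : ∀ i, (stdSimplex.barycenter : Spx n) i = ((n : ℝ) + 1)⁻¹ := fun i => by
      change ((Fintype.card (Fin (n + 1)) : ℝ))⁻¹ = _
      simp
    simp_rw [this, ← Finset.mul_sum]
    rw [Finset.sum_const, Finset.card_univ, Fintype.card_fin, nsmul_eq_mul]
    push_cast
    field_simp
  rw [e, abs_mul, abs_of_pos (by positivity), div_eq_inv_mul, mul_assoc]
  refine mul_le_mul_of_nonneg_left ?_ (by positivity)
  rw [← Finset.add_sum_erase _ _ (Finset.mem_univ j), sub_self, zero_add]
  refine (Finset.abs_sum_le_sum_abs _ _).trans ((Finset.sum_le_card_nsmul _ _ ρ fun i _ =>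
    (dist_le_pi_dist (v i).1 (v j).1 l).trans (h i j)).trans (le_of_eq ?_))
  rw [Finset.card_erase_of_mem (Finset.mem_univ _), Finset.card_univ, Fintype.card_fin,
    nsmul_eq_mul]
  simp

/-- The span of tuples of length `k` near `v` and of diameter at most `r`. -/
def fine (k : ℕ) (P : (Fin k → Spx m) → Prop) : Submodule ℚ (LC (Spx m)) :=
  Submodule.span ℚ {x | ∃ w : Fin k → Spx m, P w ∧ x = LC.tup w}

theorem fine_induct {k : ℕ} {P : (Fin k → Spx m) → Prop} {M : Type} [AddCommGroup M] [Module ℚ M]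
    (S : Submodule ℚ M) (F : LC (Spx m) →ₗ[ℚ] M) (h : ∀ w, P w → F (LC.tup w) ∈ S)
    {x : LC (Spx m)} (hx : x ∈ fine k P) : F x ∈ S := by
  have : fine k P ≤ S.comap F := by
    rw [fine, Submodule.span_le]
    rintro _ ⟨w, hw, rfl⟩
    exact h w hw
  exact this hx

theorem tup_mem_fine {k : ℕ} {P : (Fin k → Spx m) → Prop} {w : Fin k → Spx m} (h : P w) :
    LC.tup w ∈ fine k P := Submodule.subset_span ⟨w, h, rfl⟩

theorem sd_tup_mem (k : ℕ) (v : Fin k → Spx m) {r : ℝ} (h : ∀ i j, dist (v i) (v j) ≤ r) :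
    LC.sd (bary _) (LC.tup v) ∈ fine k fun w =>
      (∀ c ρ, (∀ j, dist c (v j) ≤ ρ) → ∀ i, dist c (w i) ≤ ρ) ∧
        ∀ i j, dist (w i) (w j) ≤ (k : ℝ) / (k + 1) * r := by
  induction k with
  | zero =>
    rw [LC.sd_zero]
    exact tup_mem_fine ⟨fun _ _ _ i => i.elim0, fun i => i.elim0⟩
  | succ k ih =>
    have hr : 0 ≤ r := dist_nonneg.trans (h 0 0)
    have hk : (k : ℝ) / (k + 1) * r ≤ ((k + 1 : ℕ) : ℝ) / ((k + 1 : ℕ) + 1) * r := by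
      refine mul_le_mul_of_nonneg_right ?_ hr
      rw [div_le_div_iff₀ (by positivity) (by positivity)]
      push_cast; nlinarith
    rw [LC.sd_succ, LC.bd_succ]
    simp only [map_sum, map_smul]
    refine Submodule.sum_mem _ fun i _ => Submodule.smul_mem _ _ ?_
    refine fine_induct _ (LC.cone (bary _ k v)) (fun w hw => ?_)
      (ih (v ∘ i.succAbove) fun _ _ => h _ _)
    rw [LC.cone_tup]
    have hw1 : ∀ c ρ, (∀ j, dist c (v j) ≤ ρ) → ∀ j, dist c (w j) ≤ ρ := fun c ρ hc =>
      hw.1 c ρ fun j => hc _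
    have hb : ∀ j, dist (bary _ k v) (w j) ≤ ((k + 1 : ℕ) : ℝ) / ((k + 1 : ℕ) + 1) * r :=
      hw1 _ _ fun j => (dist_bary_le v h j).trans hk
    refine tup_mem_fine ⟨fun c ρ hc j => ?_, fun a b => ?_⟩
    · refine Fin.cases ?_ (fun j => ?_) j
      · exact dist_scomb_le _ _ _ hc
      · rw [Fin.cons_succ]; exact hw1 c ρ hc j
    · refine Fin.cases ?_ (fun a => ?_) a <;> refine Fin.cases ?_ (fun b => ?_) b
      · rw [dist_self]; positivity
      · rw [Fin.cons_succ]; exact hb b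
      · rw [Fin.cons_succ, dist_comm]; exact hb a
      · rw [Fin.cons_succ, Fin.cons_succ]; exact (hw.2 a b).trans hk

theorem sd_fine {k : ℕ} {r : ℝ} {x : LC (Spx m)}
    (hx : x ∈ fine k fun w => ∀ i j, dist (w i) (w j) ≤ r) :
    LC.sd (bary _) x ∈ fine k fun w => ∀ i j, dist (w i) (w j) ≤ (k : ℝ) / (k + 1) * r :=
  fine_induct _ _ (fun w hw => by
    have := sd_tup_mem k w hw
    exact fine_induct _ LinearMap.id (fun w hw => tup_mem_fine hw.2) this) hx

theorem sd_iterate_fine (k : ℕ) {r : ℝ} {x : LC (Spx m)}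
    (hx : x ∈ fine k fun w => ∀ i j, dist (w i) (w j) ≤ r) (N : ℕ) :
    (LC.sd (bary _))^[N] x ∈ fine k fun w =>
      ∀ i j, dist (w i) (w j) ≤ ((k : ℝ) / (k + 1)) ^ N * r := by
  induction N with
  | zero => simpa using hx
  | succ N ih =>
    rw [Function.iterate_succ_apply', pow_succ', mul_assoc]
    exact sd_fine ih

theorem exists_sd_iterate_io (n : ℕ) {δ : ℝ} (hδ : 0 < δ) : ∃ N₀, ∀ N ≥ N₀,
    (LC.sd (bary _))^[N] (io n) ∈ fine (n + 1) fun w => ∀ i j, dist (w i) (w j) < δ := by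
  obtain ⟨r, hr⟩ : ∃ r : ℝ, ∀ i j : Fin (n + 1), dist (vtx i : Spx n) (vtx j) ≤ r := by
    obtain ⟨r, hr⟩ := (Set.finite_range fun p : Fin (n + 1) × Fin (n + 1) =>
      dist (vtx p.1 : Spx n) (vtx p.2)).bddAbove
    exact ⟨r, fun i j => hr ⟨(i, j), rfl⟩⟩
  have ht : Filter.Tendsto (fun N : ℕ => (((n + 1 : ℕ) : ℝ) / ((n + 1 : ℕ) + 1)) ^ N * r)
      Filter.atTop (nhds (0 * r)) :=
    (tendsto_pow_atTop_nhds_zero_of_lt_one (by positivity)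
      ((div_lt_one (by positivity)).2 (by linarith))).mul_const r
  rw [zero_mul] at ht
  obtain ⟨N₀, hN⟩ := Filter.eventually_atTop.1 (ht.eventually_lt_const hδ)
  refine ⟨N₀, fun N h => ?_⟩
  refine fine_induct _ LinearMap.id (fun w hw => tup_mem_fine fun i j => (hw i j).trans_lt (hN N h))
    (sd_iterate_fine (n + 1) (x := io n) (tup_mem_fine hr) N)

end mesh

theorem sd_iterate_push (g : C(X, Y)) (x : TC X) (N : ℕ) : sd^[N] (push g x) = push g (sd^[N] x) := by
  induction N with
  | zero => rfl
  | succ N ih => rw [Function.iterate_succ_apply', Function.iterate_succ_apply', ih, sd_push]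

theorem sd_iterate_real {K : Type} [TopologicalSpace K] [Aff K] (x : LC K) (N : ℕ) :
    sd^[N] (real x) = real ((LC.sd (bary _))^[N] x) := by
  induction N with
  | zero => rfl
  | succ N ih => rw [Function.iterate_succ_apply', Function.iterate_succ_apply', ih, sd_real']

theorem exists_sd_iterate_sg {U V : Set X} (hU : IsOpen U) (hV : IsOpen V) {n : ℕ}
    (σ : C(Spx n, X)) (h : Set.range σ ⊆ U ∪ V) :
    ∃ N₀, ∀ N ≥ N₀, sd^[N] (sg σ) ∈ supp U ⊔ supp V := by
  obtain ⟨δ, hδ, hL⟩ := lebesgue_number_lemma_of_metric (s := (Set.univ : Set (Spx n)))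
    (c := fun b : Bool => if b then σ ⁻¹' U else σ ⁻¹' V) isCompact_univ
    (fun b => by cases b <;> simp [hU.preimage σ.continuous, hV.preimage σ.continuous])
    (fun t _ => by
      rcases h ⟨t, rfl⟩ with h | h
      · exact Set.mem_iUnion.2 ⟨true, by simpa using h⟩
      · exact Set.mem_iUnion.2 ⟨false, by simpa using h⟩)
  obtain ⟨N₀, hN₀⟩ := exists_sd_iterate_io n (half_pos hδ)
  refine ⟨N₀, fun N hN => ?_⟩
  rw [← push_io σ, sd_iterate_push, sd_iterate_real]
  refine fine_induct (supp U ⊔ supp V) (push σ ∘ₗ real) (fun w hw => ?_) (hN₀ N hN)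
  rw [LinearMap.comp_apply, real_succ, push_sg]
  have hs : ∀ t, aff w t ∈ Metric.ball (w 0) δ := fun t => by
    rw [Metric.mem_ball']
    exact (dist_scomb_le t w (w 0) fun j => (hw 0 j).le).trans_lt (half_lt_self hδ)
  obtain ⟨b, hb⟩ := hL (w 0) trivial
  cases b
  · refine Submodule.mem_sup_right (sg_mem ?_)
    rintro _ ⟨t, rfl⟩
    simpa using hb (hs t)
  · refine Submodule.mem_sup_left (sg_mem ?_)
    rintro _ ⟨t, rfl⟩
    simpa using hb (hs t)

theorem sd_sup {U V : Set X} {x : TC X} (hx : x ∈ supp U ⊔ supp V) : sd x ∈ supp U ⊔ supp V := by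
  obtain ⟨a, ha, b, hb, rfl⟩ := Submodule.mem_sup.1 hx
  rw [map_add]
  exact add_mem (Submodule.mem_sup_left (op_mem _ ha)) (Submodule.mem_sup_right (op_mem _ hb))

theorem ht_sup {U V : Set X} {x : TC X} (hx : x ∈ supp U ⊔ supp V) : ht x ∈ supp U ⊔ supp V := by
  obtain ⟨a, ha, b, hb, rfl⟩ := Submodule.mem_sup.1 hx
  rw [map_add]
  exact add_mem (Submodule.mem_sup_left (op_mem _ ha)) (Submodule.mem_sup_right (op_mem _ hb))

theorem exists_sd_iterate {U V : Set X} (hU : IsOpen U) (hV : IsOpen V) {x : TC X}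
    (hx : x ∈ supp (U ∪ V)) : ∃ N₀, ∀ N ≥ N₀, sd^[N] x ∈ supp U ⊔ supp V := by
  rw [supp, Finsupp.supported_eq_span_single] at hx
  induction hx using Submodule.span_induction with
  | mem x h =>
    obtain ⟨⟨n, σ⟩, h, rfl⟩ := h
    exact exists_sd_iterate_sg hU hV σ h
  | zero => exact ⟨0, fun N _ => by rw [← Module.End.coe_pow, map_zero]; exact zero_mem _⟩
  | add x y _ _ hx hy =>
    obtain ⟨a, ha⟩ := hx
    obtain ⟨b, hb⟩ := hy
    refine ⟨max a b, fun N hN => ?_⟩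
    have h1 := ha N (le_of_max_le_left hN)
    have h2 := hb N (le_of_max_le_right hN)
    rw [← Module.End.coe_pow] at *
    rw [map_add]; exact add_mem h1 h2
  | smul c x _ hx =>
    obtain ⟨a, ha⟩ := hx
    refine ⟨a, fun N hN => ?_⟩
    have h1 := ha N hN
    rw [← Module.End.coe_pow] at *
    rw [map_smul]; exact Submodule.smul_mem _ _ h1

/-- Iterated subdivision is homotopic to the identity by a support preserving homotopy. -/
theorem exists_iterate_homotopy (N : ℕ) : ∃ T : TC X →ₗ[ℚ] TC X,
    (∀ x, d (T x) = x - sd^[N] x - T (d x)) ∧ (∀ U x, x ∈ supp U → T x ∈ supp U) ∧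
      ∀ U V x, x ∈ supp U ⊔ supp V → T x ∈ supp U ⊔ supp V := by
  induction N with
  | zero => exact ⟨0, fun x => by simp, fun U x _ => zero_mem _, fun U V x _ => zero_mem _⟩
  | succ N ih =>
    obtain ⟨T, h1, h2, h3⟩ := ih
    refine ⟨ht + T ∘ₗ sd, fun x => ?_, fun U x hx => ?_, fun U V x hx => ?_⟩
    · simp only [LinearMap.add_apply, LinearMap.comp_apply, map_add]
      rw [h1, d_ht, sd_d, Function.iterate_succ_apply]; abel
    · exact add_mem (op_mem _ hx) (h2 _ _ (op_mem _ hx))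
    · exact add_mem (ht_sup hx) (h3 _ _ _ (sd_sup hx))

theorem sd_iterate_d (x : TC X) (N : ℕ) : sd^[N] (d x) = d (sd^[N] x) := by
  induction N with
  | zero => rfl
  | succ N ih => rw [Function.iterate_succ_apply', Function.iterate_succ_apply', ih, sd_d]

theorem small_qiso {U V : Set X} (hU : IsOpen U) (hV : IsOpen V) :
    (Hom.id (SC X)).QIso (sub U ⊔ sub V) ⊥ (sub (U ∪ V)) ⊥ where
  pair := ⟨fun x hx => by
    obtain ⟨a, ha, b, hb, rfl⟩ := mem_sup.1 hx
    exact add_mem (sub_mono Set.subset_union_left ha) (sub_mono Set.subset_union_right hb),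
    fun x hx => hx⟩
  inj x hx hdx := by
    rintro ⟨y, hy, h⟩
    obtain ⟨N, hN⟩ := exists_sd_iterate hU hV hy
    obtain ⟨T, h1, -, h3⟩ := exists_iterate_homotopy (X := X) N
    rw [mem_bot, sub_eq_zero] at h
    rw [mem_bot] at hdx
    refine ⟨sd^[N] y + T x, add_mem (hN N le_rfl) (h3 _ _ _ hx), ?_⟩
    change x - d (sd^[N] y + T x) ∈ _
    change x = d y at h
    change d x = 0 at hdx
    rw [map_add, h1, hdx, ← sd_iterate_d, ← h, mem_bot]
    simp
  surj x hx hdx := by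
    obtain ⟨N, hN⟩ := exists_sd_iterate hU hV hx
    obtain ⟨T, h1, h2, -⟩ := exists_iterate_homotopy (X := X) N
    rw [mem_bot] at hdx
    change d x = 0 at hdx
    refine ⟨sd^[N] x, hN N le_rfl, ?_, - T x, neg_mem (h2 _ _ hx), ?_⟩
    · change d (sd^[N] x) ∈ _
      rw [← sd_iterate_d, hdx, ← Module.End.coe_pow, map_zero]; exact zero_mem _
    · change sd^[N] x - x - d (- T x) ∈ _
      rw [map_neg, h1, hdx, mem_bot, map_zero]
      abel

/-- Excision for open sets. -/
theorem open_excision {U V : Set X} (hU : IsOpen U) (hV : IsOpen V) :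
    (Hom.id (SC X)).QIso (sub U) (sub (U ∩ V)) (sub (U ∪ V)) (sub V) := by
  have h1 := excision (sub U) (sub V)
  rw [sub_inf] at h1
  have h2 : (Hom.id (SC X)).QIso (sub U ⊔ sub V) (sub V) (sub (U ∪ V)) (sub V) :=
    Hom.QIso.quot (le_sup_right' _ _) (sub_mono Set.subset_union_right) (small_qiso hU hV)
      ⟨⟨fun x hx => hx, fun x hx => hx⟩, fun x hx hdx h => h, fun x hx hdx =>
        ⟨x, hx, hdx, 0, zero_mem _, by simp [Hom.id]⟩⟩
  exact h1.comp h2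

end TC

namespace LC
variable {K L : Type}

/-- The sign operator on affine chains. -/
def eps : LC K →ₗ[ℚ] LC K := lift fun n v => (-1 : ℚ) ^ n • tup v

theorem eps_tup {n : ℕ} (v : Fin n → K) : eps (tup v) = (-1 : ℚ) ^ n • tup v := lift_tup _ _

theorem eps_cone (b : K) (x : LC K) : eps (cone b x) = - cone b (eps x) := by
  have : eps ∘ₗ cone b = - (cone b ∘ₗ eps) := hom_ext fun n v => by
    simp only [LinearMap.comp_apply, LinearMap.neg_apply, cone_tup, eps_tup, map_smul, pow_succ]
    module
  exact LinearMap.congr_fun this x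

theorem eps_cross (p q : ℕ) (v : Fin (p + 1) → K) (w : Fin (q + 1) → L) :
    eps (cross (tup v) (tup w)) = (-1 : ℚ) ^ (p + q + 1) • cross (tup v) (tup w) := by
  induction p generalizing q with
  | zero => rw [cross_one_tup, eps_tup, zero_add]
  | succ p ihp =>
    induction q with
    | zero => rw [cross_tup_one, eps_tup]
    | succ q ihq =>
      rw [cross_succ, eps_cone, bd_succ, bd_succ]
      simp only [map_add, map_sum, map_smul, LinearMap.sum_apply, LinearMap.smul_apply, ihp, ihq]
      rw [show p + 1 + (q + 1) + 1 = (p + (q + 1) + 1) + 1 by ring,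
        show p + 1 + q + 1 = p + (q + 1) + 1 by ring]
      simp only [smul_comm _ ((-1 : ℚ) ^ (p + (q + 1) + 1)), ← Finset.smul_sum, pow_succ _ (p + (q + 1) + 1)]
      module

end LC

namespace TC
open Cx
variable {X Y X' Y' : Type} [TopologicalSpace X] [TopologicalSpace Y] [TopologicalSpace X']
  [TopologicalSpace Y']

theorem real_eps {K : Type} [TopologicalSpace K] [Aff K] (x : LC K) :
    real (LC.eps x) = - ε (real x) := by
  have : real ∘ₗ LC.eps = - (ε ∘ₗ (real : LC K →ₗ[ℚ] TC K)) := LC.hom_ext fun n v => by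
    simp only [LinearMap.comp_apply, LinearMap.neg_apply, LC.eps_tup, map_smul]
    cases n with
    | zero => simp [real_zero]
    | succ n => rw [real_succ, ε_sg, pow_succ]; module
  exact LinearMap.congr_fun this x

theorem hom_ext₂ {P : Type} [AddCommGroup P] [Module ℚ P] {f g : TC X →ₗ[ℚ] TC Y →ₗ[ℚ] P}
    (h : ∀ p (σ : C(Spx p, X)) q (τ : C(Spx q, Y)), f (sg σ) (sg τ) = g (sg σ) (sg τ)) : f = g :=
  hom_ext fun p σ => hom_ext fun q τ => h p σ q τ

/-- The cross product of singular chains. -/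
def crossT : TC X →ₗ[ℚ] TC Y →ₗ[ℚ] TC (X × Y) :=
  lift fun p σ => lift fun q τ => push (σ.prodMap τ) (real (LC.cross (io p) (io q)))

theorem crossT_sg {p q : ℕ} (σ : C(Spx p, X)) (τ : C(Spx q, Y)) :
    crossT (sg σ) (sg τ) = push (σ.prodMap τ) (real (LC.cross (io p) (io q))) := by
  rw [crossT, lift_sg, lift_sg]

theorem push_crossT (g : C(X, X')) (h : C(Y, Y')) (x : TC X) (y : TC Y) :
    push (g.prodMap h) (crossT x y) = crossT (push g x) (push h y) := by
  have : (crossT.compr₂ (push (g.prodMap h)) : TC X →ₗ[ℚ] TC Y →ₗ[ℚ] TC (X' × Y')) =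
      crossT.compl₁₂ (push g) (push h) := hom_ext₂ fun p σ q τ => by
    simp only [LinearMap.compr₂_apply, LinearMap.compl₁₂_apply, push_sg, crossT_sg, push_push]
    rfl
  exact LinearMap.congr_fun (LinearMap.congr_fun this x) y

theorem crossT_real {K L : Type} [TopologicalSpace K] [Aff K] [TopologicalSpace L] [Aff L]
    (x : LC K) (y : LC L) : crossT (real x) (real y) = real (LC.cross x y) := by
  have : (crossT.compl₁₂ real real : LC K →ₗ[ℚ] LC L →ₗ[ℚ] TC (K × L)) =
      LC.cross.compr₂ real := LC.hom_ext fun n v => LC.hom_ext fun m w => by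
    simp only [LinearMap.compr₂_apply, LinearMap.compl₁₂_apply]
    cases n with
    | zero => rw [LC.cross_zero_left, real_zero, map_zero, map_zero]; rfl
    | succ p =>
      cases m with
      | zero => rw [LC.cross_zero_right, real_zero, map_zero, map_zero]
      | succ q =>
        rw [real_succ, real_succ, crossT_sg]
        have ha : IsAff ((aff v).prodMap (aff w)) := fun t u =>
          Prod.ext (isAff_aff v t _) (isAff_aff w t _)
        rw [push_real ha]
        change real (LC.map (Prod.map (aff v) (aff w)) _) = _
        rw [LC.map_cross, map_io, map_io]
  exact LinearMap.congr_fun (LinearMap.congr_fun this x) y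

theorem d_crossT (x : TC X) (y : TC Y) :
    d (crossT x y) = crossT (d x) y + crossT (ε x) (d y) := by
  have : (crossT.compr₂ d : TC X →ₗ[ℚ] TC Y →ₗ[ℚ] TC (X × Y)) =
      crossT.compl₁₂ d LinearMap.id + crossT.compl₁₂ ε d := hom_ext₂ fun p σ q τ => by
    simp only [LinearMap.compr₂_apply, LinearMap.compl₁₂_apply, LinearMap.add_apply,
      LinearMap.id_apply]
    by_cases hpq : p + q = 0
    · obtain ⟨rfl, rfl⟩ : p = 0 ∧ q = 0 := by omega
      rw [d_zero, d_zero, crossT_sg, map_zero, io, LC.cross_one_tup, real_succ, push_sg, d_zero,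
        map_zero]
      simp
    · rw [crossT_sg, ← push_d, ← real_bd, io, io, LC.bd_cross hpq, map_add, map_add, map_smul,
        map_smul, ← crossT_real, ← crossT_real, push_crossT, push_crossT]
      change crossT _ (push τ (real (io q))) + _ • crossT (push σ (real (io p))) _ = _
      rw [push_io, push_io, d_sg, d_sg, ε_sg, map_smul]
      rfl
  exact LinearMap.congr_fun (LinearMap.congr_fun this x) y

theorem ε_crossT (x : TC X) (y : TC Y) : ε (crossT x y) = crossT (ε x) (ε y) := by
  have : (crossT.compr₂ ε : TC X →ₗ[ℚ] TC Y →ₗ[ℚ] TC (X × Y)) =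
      crossT.compl₁₂ ε ε := hom_ext₂ fun p σ q τ => by
    simp only [LinearMap.compr₂_apply, LinearMap.compl₁₂_apply]
    have h := real_eps (LC.cross (io p) (io q))
    rw [io, io, LC.eps_cross, ← io, ← io, map_smul] at h
    rw [crossT_sg, ← push_ε, ← neg_eq_iff_eq_neg.2 h, ε_sg, ε_sg, map_smul, map_smul, map_neg,
      map_smul, LinearMap.smul_apply, crossT_sg, pow_succ, pow_add]
    module
  exact LinearMap.congr_fun (LinearMap.congr_fun this x) y

theorem crossT_mem {U : Set X} {V : Set Y} {x : TC X} {y : TC Y} (hx : x ∈ supp U)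
    (hy : y ∈ supp V) : crossT x y ∈ supp (U ×ˢ V) := by
  refine supp_induct (supp (U ×ˢ V)) (crossT.flip y) (fun p σ hσ => ?_) hx
  refine supp_induct (supp (U ×ˢ V)) (crossT (sg σ)) (fun q τ hτ => ?_) hy
  rw [crossT_sg]
  exact push_mem (fun t _ => Set.mk_mem_prod (hσ (Set.mem_range_self t.1)) (hτ (Set.mem_range_self t.2)))
    (supp_univ _)

/-- A point as a chain. -/
def pt (y : Y) : TC Y := sg (ContinuousMap.const (Spx 0) y)

theorem d_pt (y : Y) : d (pt y) = 0 := d_zero _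
theorem crossT_pt (x : TC X) (y : Y) :
    crossT x (pt y) = push ((ContinuousMap.id X).prodMk (ContinuousMap.const X y)) x := by
  refine hom_congr (f := crossT.flip (pt y)) (fun n σ => ?_) x
  rw [LinearMap.flip_apply, pt, crossT_sg, io, io, LC.cross_tup_one, real_succ, push_sg, push_sg]
  refine congrArg sg (ContinuousMap.ext fun t => ?_)
  refine Prod.ext ?_ rfl
  change σ (scomb t vtx) = σ t
  rw [scomb_vtx]

/-- The interval as a chain. -/
def ichain : TC unitInterval :=
  sg ((stdSimplexHomeomorphUnitInterval : Spx 1 ≃ₜ unitInterval) : C(Spx 1, unitInterval))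

theorem d_ichain : d ichain = pt 1 - pt 0 := by
  have key : ∀ (j : Fin 2) (v : Fin 1 → Spx 1), v 0 = vtx j →
      (aff v : C(Spx 0, Spx 1)) = ContinuousMap.const _ (vtx j) := fun j v h => by
    ext1 t
    rw [← scomb_vtx t]
    have : t = vtx 0 := Subsingleton.elim _ _
    rw [this, scomb_vtx, aff_apply, Aff.comb_vtx, h]; rfl
  rw [ichain, d_succ, Fin.sum_univ_two, key 1 _ rfl, key 0 _ rfl]
  simp only [Fin.val_zero, pow_zero, one_smul, Fin.val_one, pow_one, neg_smul, ← sub_eq_add_neg]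
  rfl

/-- The homotopy operator. -/
def prism (H : C(X × unitInterval, Y)) : TC X →ₗ[ℚ] TC Y :=
  push H ∘ₗ crossT.flip ichain ∘ₗ ε

theorem d_prism (H : C(X × unitInterval, Y)) (x : TC X) :
    d (prism H x) = push (H.comp ((ContinuousMap.id X).prodMk (ContinuousMap.const X 1))) x -
      push (H.comp ((ContinuousMap.id X).prodMk (ContinuousMap.const X 0))) x - prism H (d x) := by
  simp only [prism, LinearMap.comp_apply, LinearMap.flip_apply]
  rw [← push_d, d_crossT, d_ε, ε_ε, d_ichain]
  simp only [map_add, map_neg, map_sub, LinearMap.neg_apply, crossT_pt, push_push]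
  abel

theorem prism_mem {H : C(X × unitInterval, Y)} {U : Set X} {V : Set Y}
    (h : ∀ x ∈ U, ∀ t, H (x, t) ∈ V) {x : TC X} (hx : x ∈ supp U) : prism H x ∈ supp V := by
  refine push_mem (U := U ×ˢ Set.univ) (fun p hp => h _ hp.1 _) (crossT_mem ?_ (supp_univ _))
  refine supp_induct (supp U) ε (fun n σ hσ => ?_) hx
  rw [ε_sg]
  exact Submodule.smul_mem _ _ (sg_mem hσ)

end TC

namespace Cx
variable {K L : Cx} {J : Type}

section power
variable (s : J → ℚ)

/-- A power of a complex, with signs twisted by `s`. -/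
def PC (K : Cx) : Cx where
  C := J → K.C
  d := LinearMap.pi fun j => K.d ∘ₗ LinearMap.proj j
  ε := LinearMap.pi fun j => s j • (K.ε ∘ₗ LinearMap.proj j)
  d_d x := funext fun j => K.d_d (x j)
  d_ε x := funext fun j => by
    change K.d (s j • K.ε (x j)) = - (s j • K.ε (K.d (x j)))
    rw [map_smul, K.d_ε, smul_neg]

/-- The power of a subcomplex. -/
def PSub (E : Sub K) : Sub (PC s K) where
  S := Submodule.pi Set.univ fun _ => E.S
  d_mem _ hx j _ := E.d_mem _ (hx j trivial)
  ε_mem _ hx j _ := E.S.smul_mem _ (E.ε_mem _ (hx j trivial))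

variable {s}
theorem mem_PSub {E : Sub K} {x : J → K.C} : (x : (PC s K).C) ∈ PSub s E ↔ ∀ j, x j ∈ E :=
  ⟨fun h j => h j trivial, fun h j _ => h j⟩

theorem PSub_mono {E D : Sub K} (h : E ≤ D) : PSub s E ≤ PSub s D := fun _ hx =>
  mem_PSub.2 fun j => h (mem_PSub.1 hx j)

theorem PSub_top : PSub s (⊤ : Sub K) = ⊤ :=
  le_antisymm (le_top' _) fun _ _ => mem_PSub.2 fun _ => mem_top _

theorem PSub_bot : PSub s (⊥ : Sub K) = ⊥ :=
  le_antisymm (fun x hx => by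
    rw [mem_bot]; exact funext fun j => mem_bot.1 (mem_PSub.1 hx j)) (bot_le' _)

variable (s) in
/-- The power of a chain map. -/
def PHom (φ : Hom K L) : Hom (PC s K) (PC s L) where
  f := LinearMap.pi fun j => φ.f ∘ₗ LinearMap.proj j
  comm x := funext fun j => φ.comm (x j)
  commε x := funext fun j => by
    change φ.f (s j • K.ε (x j)) = s j • L.ε (φ.f (x j))
    rw [map_smul, φ.commε]

theorem Hom.QIso.power {φ : Hom K L} {E D : Sub K} {E' D' : Sub L} (h : φ.QIso E D E' D') :
    (PHom s φ).QIso (PSub s E) (PSub s D) (PSub s E') (PSub s D') where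
  pair := ⟨fun x hx => mem_PSub.2 fun j => h.pair.mapE _ (mem_PSub.1 hx j),
    fun x hx => mem_PSub.2 fun j => h.pair.mapD _ (mem_PSub.1 hx j)⟩
  inj x hx hd := by
    rintro ⟨y, hy, hxy⟩
    choose z hz hzd using fun j => h.inj (x j) (mem_PSub.1 hx j) (mem_PSub.1 hd j)
      ⟨y j, mem_PSub.1 hy j, mem_PSub.1 hxy j⟩
    exact ⟨z, mem_PSub.2 hz, mem_PSub.2 hzd⟩
  surj x hx hd := by
    choose w hw hdw y hy hwy using fun j => h.surj (x j) (mem_PSub.1 hx j) (mem_PSub.1 hd j)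
    exact ⟨w, mem_PSub.2 hw, mem_PSub.2 hdw, y, mem_PSub.2 hy, mem_PSub.2 hwy⟩

/-- The homology of a power. -/
def powerMap (E D : Sub K) : H (PSub s E) (PSub s D) →ₗ[ℚ] (J → H E D) :=
  LinearMap.pi fun j => mapOf (K := PC s K) (LinearMap.proj j)
    (fun _ hx => ⟨mem_PSub.1 (mem_Z.1 hx).1 j, mem_PSub.1 (mem_Z.1 hx).2 j⟩) fun x _ hx => by
      obtain ⟨y, hy, hxy⟩ := mem_B.1 hx
      exact mem_B.2 ⟨y j, mem_PSub.1 hy j, mem_PSub.1 hxy j⟩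

theorem powerMap_bijective (E D : Sub K) :
    Function.Bijective (powerMap (s := s) E D) := by
  constructor
  · rw [injective_iff_map_eq_zero]
    intro a ha
    obtain ⟨x, hx, hd, rfl⟩ := cls_surj a
    have : ∀ j, ∃ y ∈ E, x j - K.d y ∈ D := fun j =>
      (cls_eq_zero (hx := mem_PSub.1 hx j) (hd := mem_PSub.1 hd j)).1 (congrFun ha j)
    choose y hy hxy using this
    exact cls_eq_zero.2 ⟨y, mem_PSub.2 hy, mem_PSub.2 hxy⟩
  · intro a
    choose x hx hd h using fun j => cls_surj (a j)
    exact ⟨cls x (mem_PSub.2 hx) (mem_PSub.2 hd), funext fun j => (h j).symm⟩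

theorem FinH.power [Finite J] {E D : Sub K} (h : FinH E D) : FinH (PSub s E) (PSub s D) := by
  have : Module.Finite ℚ (H E D) := h
  exact Module.Finite.of_injective _ (powerMap_bijective (s := s) E D).1

theorem chi_power [Fintype J] {E D : Sub K} (h : FinH E D) :
    chi (PSub s E) (PSub s D) = (∑ j, s j) * chi E D := by
  classical
  have : Module.Finite ℚ (H E D) := h
  let e := LinearEquiv.ofBijective _ (powerMap_bijective (s := s) E D)
  have key : e.conj (sgn (PSub s E) (PSub s D)) = ∑ j, s j • (LinearMap.single ℚ (fun _ => H E D) j ∘ₗ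
      (sgn E D ∘ₗ LinearMap.proj j)) := by
    refine LinearMap.ext fun a => ?_
    obtain ⟨b, rfl⟩ := e.surjective a
    obtain ⟨x, hx, hd, rfl⟩ := cls_surj b
    rw [LinearEquiv.conj_apply_apply, LinearEquiv.symm_apply_apply, LinearMap.sum_apply]
    funext i
    rw [Finset.sum_apply, Finset.sum_eq_single i]
    · simp only [LinearMap.smul_apply, LinearMap.comp_apply, LinearMap.proj_apply,
        LinearMap.coe_single, Pi.smul_apply, Pi.single_eq_same]
      rfl
    · intro j _ hj
      simp [Pi.single_eq_of_ne hj.symm]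
    · simp
  rw [chi, ← LinearMap.trace_conj' _ e, key, map_sum, Finset.sum_mul]
  refine Finset.sum_congr rfl fun j _ => ?_
  rw [map_smul, LinearMap.trace_comp_comm', LinearMap.comp_assoc]
  have : LinearMap.proj j ∘ₗ LinearMap.single ℚ (fun _ => H E D) j = LinearMap.id :=
    LinearMap.ext fun a => by simp
  rw [this, LinearMap.comp_id]; rfl

end power

/-- Homology with an involutive sign operator has a basis of eigencycles. -/
theorem exists_eigencycles (hε : ∀ x, K.ε (K.ε x) = x) (h : FinH (⊤ : Sub K) ⊥) :
    ∃ (J : Type) (_ : Fintype J) (s : J → ℚ) (z : J → K.C),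
      (∀ j, K.d (z j) = 0) ∧ (∀ j, K.ε (z j) = s j • z j) ∧
      (∀ w, K.d w = 0 → ∃ a : J → ℚ, ∃ b, w = ∑ j, a j • z j + K.d b) ∧
      (∀ (a : J → ℚ) b, ∑ j, a j • z j = K.d b → ∀ j, a j = 0) ∧
      chi (⊤ : Sub K) ⊥ = ∑ j, s j := by
  classical
  have hf : Module.Finite ℚ (H (⊤ : Sub K) ⊥) := h
  set σ := sgn (⊤ : Sub K) ⊥ with hσ
  have hinv : ∀ a, σ (σ a) = a := fun a => by
    obtain ⟨x, hx, hd, rfl⟩ := cls_surj a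
    simp only [hσ, sgn, mapOf_cls, hε]
  let p := LinearMap.ker (σ - LinearMap.id)
  let q := LinearMap.ker (σ + LinearMap.id)
  have hpq : IsCompl p q := by
    constructor
    · rw [Submodule.disjoint_def]
      intro x hx hy
      have h1 : σ x = x := by
        have := LinearMap.mem_ker.1 hx
        rwa [LinearMap.sub_apply, LinearMap.id_apply, sub_eq_zero] at this
      have h2 : σ x + x = 0 := LinearMap.mem_ker.1 hy
      rw [h1] at h2
      have : (2 : ℚ) • x = 0 := by rw [two_smul, h2]
      simpa using this
    · rw [codisjoint_iff_le_sup]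
      intro x _
      refine Submodule.mem_sup.2 ⟨(1 / 2 : ℚ) • (x + σ x), ?_, (1 / 2 : ℚ) • (x - σ x), ?_, by module⟩
      · rw [LinearMap.mem_ker, LinearMap.sub_apply, LinearMap.id_apply, map_smul, map_add, hinv]
        module
      · rw [LinearMap.mem_ker, LinearMap.add_apply, LinearMap.id_apply, map_smul, map_sub, hinv]
        module
  let b := ((Module.finBasis ℚ p).prod (Module.finBasis ℚ q)).map
    (Submodule.prodEquivOfIsCompl p q hpq)
  let J := Fin (Module.finrank ℚ p) ⊕ Fin (Module.finrank ℚ q)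
  let s : J → ℚ := Sum.elim (fun _ => 1) fun _ => -1
  have hs : ∀ j, s j * s j = 1 := by rintro (j | j) <;> simp [s]
  have hb : ∀ j, σ (b j) = s j • b j := by
    rintro (j | j)
    · have h1 : b (Sum.inl j) = (Module.finBasis ℚ p j : H (⊤ : Sub K) ⊥) := by simp [b]
      have h2 := LinearMap.mem_ker.1 (Module.finBasis ℚ p j).2
      rw [LinearMap.sub_apply, LinearMap.id_apply, sub_eq_zero] at h2
      rw [h1, h2]; simp [s]
    · have h1 : b (Sum.inr j) = (Module.finBasis ℚ q j : H (⊤ : Sub K) ⊥) := by simp [b]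
      have h2 := LinearMap.mem_ker.1 (Module.finBasis ℚ q j).2
      rw [LinearMap.add_apply, LinearMap.id_apply, add_eq_zero_iff_eq_neg] at h2
      rw [h1, h2]; simp [s]
  choose y hy hdy hyb using fun j => cls_surj (b j)
  have hdy' : ∀ j, K.d (y j) = 0 := fun j => mem_bot.1 (hdy j)
  let z : J → K.C := fun j => (1 / 2 : ℚ) • (y j + s j • K.ε (y j))
  have hz : ∀ j, K.d (z j) = 0 := fun j => by
    simp only [z]
    rw [map_smul, map_add, map_smul, K.d_ε, hdy', map_zero, neg_zero, smul_zero, add_zero, smul_zero]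
  have hzb : ∀ j, b j = cls (z j) (mem_top _) (mem_bot.2 (hz j)) := fun j => by
    have h1 := hb j
    rw [hyb j] at h1
    have h2 : (cls (y j) (hy j) (hdy j) : H (⊤ : Sub K) ⊥) = (1 / 2 : ℚ) • (cls (y j) (hy j) (hdy j) +
        s j • σ (cls (y j) (hy j) (hdy j))) := by
      rw [h1, smul_smul, hs]; module
    rw [hyb j, h2]; rfl
  have hsum : ∀ a : J → ℚ, ∃ hd, ∑ j, a j • b j =
      cls (∑ j, a j • z j) (mem_top _) hd := fun a => by
    have hd : K.d (∑ j, a j • z j) ∈ (⊥ : Sub K) := by simp [hz]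
    refine ⟨hd, ?_⟩
    have : (⟨∑ j, a j • z j, mem_top _, hd⟩ : Z (⊤ : Sub K) ⊥) =
        ∑ j, a j • ⟨z j, mem_top _, mem_bot.2 (hz j)⟩ := Subtype.ext (by simp)
    rw [cls, this]
    simp only [← Submodule.mkQ_apply, map_sum, map_smul, hzb]
    rfl
  refine ⟨J, inferInstance, s, z, hz, fun j => ?_, fun w hw => ?_, fun a c hac => ?_, ?_⟩
  · simp only [z, map_smul, map_add, hε]
    linear_combination (norm := module) (-(1 / 2) * hs j) • K.ε (y j)
  · let w' : H (⊤ : Sub K) ⊥ := cls w (mem_top _) (mem_bot.2 hw)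
    obtain ⟨hd, h1⟩ := hsum (b.repr w')
    rw [b.sum_repr] at h1
    have h2 := sub_eq_zero.2 h1
    rw [cls_sub, cls_eq_zero] at h2
    obtain ⟨c, -, hc⟩ := h2
    rw [mem_bot, sub_eq_zero, sub_eq_iff_eq_add] at hc
    exact ⟨b.repr w', c, by rw [hc, add_comm]⟩
  · obtain ⟨hd, h1⟩ := hsum a
    have h2 : (cls (∑ j, a j • z j) (mem_top _) hd : H (⊤ : Sub K) ⊥) = 0 :=
      cls_eq_zero.2 ⟨c, mem_top _, by rw [mem_bot, hac, sub_self]⟩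
    rw [h2] at h1
    exact Fintype.linearIndependent_iff.1 b.linearIndependent a h1
  · rw [chi, ← hσ, LinearMap.trace_eq_matrix_trace ℚ b, Matrix.trace]
    refine Finset.sum_congr rfl fun j _ => ?_
    rw [Matrix.diag_apply, LinearMap.toMatrix_apply, hb, map_smul]
    simp

end Cx

namespace TC
open Cx
variable {X Y : Type} [TopologicalSpace X] [TopologicalSpace Y]

theorem crossT_pt_left (x : X) (y : TC Y) :
    crossT (pt x) y = push ((ContinuousMap.const Y x).prodMk (ContinuousMap.id Y)) y := by
  refine hom_congr (f := crossT (pt x)) (fun n σ => ?_) y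
  rw [pt, crossT_sg, io, io, LC.cross_one_tup, real_succ, push_sg, push_sg]
  refine congrArg sg (ContinuousMap.ext fun t => ?_)
  refine Prod.ext rfl ?_
  change σ (scomb t vtx) = σ t
  rw [scomb_vtx]

/-- A constant simplex. -/
def kn (n : ℕ) (x : X) : TC X := sg (ContinuousMap.const (Spx n) x)

theorem kn_mem (n : ℕ) (x : X) : kn n x ∈ supp {x} :=
  sg_mem (by rintro _ ⟨t, rfl⟩; rfl)

theorem d_kn (n : ℕ) (x : X) : d (kn (n + 1) x) = if Even n then 0 else kn n x := by
  rw [kn, d_succ]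
  change ∑ i : Fin (n + 2), (-1 : ℚ) ^ (i : ℕ) • kn n x = _
  rw [← Finset.sum_smul, Fin.sum_neg_one_pow]
  by_cases h : Even n
  · rw [if_pos (h.add even_two), if_pos h, zero_smul]
  · rw [if_neg (by simpa [Nat.even_add] using h), if_neg h, one_smul]

/-- Constant cycles are homologous to multiples of a point. -/
theorem exists_push_const (x₀ : X) (c : TC X) (hc : d c = 0) :
    ∃ a : ℚ, ∃ b ∈ supp {x₀}, push (ContinuousMap.const X x₀) c = a • pt x₀ + d b := by
  let h : TC X →ₗ[ℚ] TC X := lift fun n _ => if Even n then 0 else kn (n + 1) x₀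
  let g : TC X →ₗ[ℚ] ℚ := lift fun n _ => if n = 0 then 1 else 0
  have key : push (ContinuousMap.const X x₀) c = g c • pt x₀ + d (h c) + h (d c) := by
    refine hom_congr (f := push (ContinuousMap.const X x₀))
      (g := LinearMap.smulRight g (pt x₀) + d ∘ₗ h + h ∘ₗ d) (fun n σ => ?_) c
    simp only [LinearMap.add_apply, LinearMap.comp_apply, LinearMap.smulRight_apply, g, h, lift_sg,
      push_sg]
    change kn n x₀ = _
    cases n with
    | zero => simp [d_zero]; rfl
    | succ n =>
      rw [d_succ]
      simp only [map_sum, map_smul, lift_sg, ← Finset.sum_smul, Fin.sum_neg_one_pow]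
      by_cases hn : Even n
      · have h1 : ¬ Even (n + 1) := by simpa [Nat.even_add_one] using hn
        rw [if_neg h1, d_kn, if_neg h1]; simp [hn]
      · have h1 : Even (n + 1) := by simpa [Nat.even_add_one] using hn
        have h2 : ¬ Even (n + 1 + 1) := by simpa [Nat.even_add_one] using hn
        rw [if_pos h1, if_neg h2, if_neg hn]; simp
  rw [hc, map_zero, add_zero] at key
  refine ⟨g c, h c, ?_, key⟩
  have := supp_induct (supp {x₀}) h (U := Set.univ) (fun n σ _ => ?_) (supp_univ c)
  · exact this
  · simp only [h, lift_sg]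
    split_ifs
    · exact zero_mem _
    · exact kn_mem _ _

section kunneth
variable {J : Type} [Fintype J] {s : J → ℚ} {z : J → TC Y}

variable (X) in
/-- The linear map underlying the cross product with fixed cycles. -/
def kunL (z : J → TC Y) : (J → TC X) →ₗ[ℚ] TC (X × Y) :=
  ∑ j, crossT.flip (z j) ∘ₗ LinearMap.proj j

theorem kunL_apply (z : J → TC Y) (c : J → TC X) : kunL X z c = ∑ j, crossT (c j) (z j) := by
  rw [kunL, LinearMap.sum_apply]; rfl

theorem kunL_d (hz : ∀ j, d (z j) = 0) (x : J → TC X) : kunL X z (fun j => d (x j)) = d (kunL X z x) := by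
  rw [kunL_apply, kunL_apply, map_sum]
  refine Eq.symm (Finset.sum_congr rfl fun j _ => (d_crossT _ _).trans ?_)
  rw [hz, map_zero, add_zero]

theorem kunL_ε (hε : ∀ j, ε (z j) = s j • z j) (x : J → TC X) : kunL X z (fun j => s j • ε (x j)) = ε (kunL X z x) := by
  rw [kunL_apply, kunL_apply, map_sum]
  refine Eq.symm (Finset.sum_congr rfl fun j _ => (ε_crossT _ _).trans ?_)
  rw [hε, map_smul, ← LinearMap.smul_apply, ← map_smul]

variable (hz : ∀ j, d (z j) = 0) (hε : ∀ j, ε (z j) = s j • z j)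

variable (X) in
/-- Cross product with fixed cycles. -/
def kun : Hom (PC s (SC X)) (SC (X × Y)) where
  f := kunL X z
  comm x := kunL_d hz x
  commε x := kunL_ε hε x

/-- A tuple of chains, as an element of the twisted power. -/
def mkPC (s : J → ℚ) (c : J → TC X) : (PC s (SC X)).C := c

theorem kun_mk (c : J → TC X) : (kun X hz hε).f (mkPC s c) = ∑ j, crossT (c j) (z j) :=
  kunL_apply z c

theorem kun_apply (c : (PC s (SC X)).C) :
    (kun X hz hε).f c = ∑ j, crossT ((c : J → TC X) j) (z j) :=
  kunL_apply z c

theorem kun_pair (U : Set X) : (kun X hz hε).Pair (PSub s (sub U)) ⊥ (sub (U ×ˢ Set.univ)) ⊥ :=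
  ⟨fun x hx => by
    rw [kun_apply hz hε x]
    exact sum_mem fun j _ => crossT_mem (mem_PSub.1 hx j) (supp_univ _),
  fun x hx => by rw [mem_bot] at *; rw [hx, map_zero]⟩

/-- The Künneth property of a subset. -/
def Kun (U : Set X) : Prop := (kun X hz hε).QIso (PSub s (sub U)) ⊥ (sub (U ×ˢ Set.univ)) ⊥

variable {hz hε}

theorem Kun.union {U V : Set X} (hU : IsOpen U) (hV : IsOpen V) (h : Kun hz hε U)
    (h' : Kun hz hε V) (hi : Kun hz hε (U ∩ V)) : Kun hz hε (U ∪ V) := by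
  have e1 : (kun X hz hε).QIso (PSub s (sub U)) (PSub s (sub (U ∩ V))) (sub (U ×ˢ Set.univ))
      (sub ((U ∩ V) ×ˢ Set.univ)) :=
    Hom.QIso.quot (PSub_mono (sub_mono Set.inter_subset_left))
      (sub_mono (Set.prod_mono_left Set.inter_subset_left)) h hi
  have e2 := (open_excision hU hV).power (s := s)
  have e3 := open_excision (hU.prod (isOpen_univ (X := Y))) (hV.prod (isOpen_univ (X := Y)))
  rw [← Set.inter_prod, ← Set.union_prod] at e3
  have e4 : (kun X hz hε).QIso (PSub s (sub (U ∪ V))) (PSub s (sub V))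
      (sub ((U ∪ V) ×ˢ Set.univ)) (sub (V ×ˢ Set.univ)) :=
    Hom.QIso.of_comp_right (φ := PHom s (Hom.id (SC X)))
      ⟨(kun_pair hz hε (U ∪ V)).mapE, (kun_pair hz hε V).mapE⟩ (e1.comp e3) e2
  exact Hom.QIso.ext (PSub_mono (sub_mono Set.subset_union_right))
    (sub_mono (Set.prod_mono_left Set.subset_union_right)) h' e4

theorem Kun.empty : Kun hz hε (∅ : Set X) := by
  rw [Kun, Set.empty_prod, sub_empty, sub_empty, PSub_bot]
  refine ⟨⟨fun x hx => by rw [mem_bot] at *; rw [hx, map_zero],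
    fun x hx => by rw [mem_bot] at *; rw [hx, map_zero]⟩, fun x hx _ _ => ⟨0, zero_mem _, ?_⟩,
    fun x hx _ => ⟨0, zero_mem _, ?_, 0, zero_mem _, ?_⟩⟩
  · rwa [map_zero, sub_zero]
  · rw [map_zero]; exact zero_mem _
  · rw [map_zero, map_zero, zero_sub, sub_zero]; exact neg_mem hx

/-- Sets contractible to one of their points satisfy the Künneth property. -/
theorem Kun.contractible {U : Set X} {u : X} (hu : u ∈ U) (C : C(X × unitInterval, X))
    (h0 : ∀ x, C (x, 0) = x) (h1 : ∀ x, C (x, 1) = u) (hC : ∀ x ∈ U, ∀ t, C (x, t) ∈ U)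
    (hspan : ∀ w, d w = 0 → ∃ a : J → ℚ, ∃ b, w = ∑ j, a j • z j + d b)
    (hind : ∀ (a : J → ℚ) b, ∑ j, a j • z j = d b → ∀ j, a j = 0) : Kun hz hε U := by
  have hC0 : C.comp ((ContinuousMap.id X).prodMk (ContinuousMap.const X 0)) =
      ContinuousMap.id X := ContinuousMap.ext h0
  have hC1 : C.comp ((ContinuousMap.id X).prodMk (ContinuousMap.const X 1)) =
      ContinuousMap.const X u := ContinuousMap.ext h1
  let i : C(Y, X × Y) := (ContinuousMap.const Y u).prodMk (ContinuousMap.id Y)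
  have hi : ∀ a : J → ℚ, (kun X hz hε).f (mkPC s fun j => a j • pt u) = push i (∑ j, a j • z j) :=
    fun a => by
      rw [kun_mk, map_sum]
      refine Finset.sum_congr rfl fun j _ => ?_
      rw [map_smul, map_smul, LinearMap.smul_apply, crossT_pt_left]
  have hpt : pt u ∈ supp U := sg_mem (by rintro _ ⟨t, rfl⟩; exact hu)
  refine ⟨kun_pair hz hε U, fun c hc hdc hy => ?_, fun w hw hdw => ?_⟩
  · obtain ⟨y, -, hy⟩ := hy
    rw [mem_bot] at hdc hy
    have hdc' : ∀ j, d (c j) = 0 := fun j => congrFun hdc j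
    choose a b hb hab using fun j => exists_push_const u (c j) (hdc' j)
    have hbU : ∀ j, b j ∈ supp U := fun j => sub_mono (Set.singleton_subset_iff.2 hu) (hb j)
    have hcj : ∀ j, c j = a j • pt u + d (b j - prism C (c j)) := fun j => by
      have := d_prism C (c j)
      rw [hC0, hC1, push_id, hdc', map_zero, hab] at this
      rw [map_sub, this]; abel
    have hbc : mkPC s (fun j => b j - prism C (c j)) ∈ PSub s (sub U) :=
      mem_PSub.2 fun j => sub_mem (hbU j) (prism_mem hC (mem_PSub.1 hc j))
    have hsum : c = mkPC s (fun j => a j • pt u) +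
        (PC s (SC X)).d (mkPC s fun j => b j - prism C (c j)) := funext hcj
    have ha : ∀ j, a j = 0 := by
      rw [hsum, map_add, (kun X hz hε).comm, hi, sub_eq_zero] at hy
      refine hind a (push ContinuousMap.snd (y - (kun X hz hε).f (mkPC s fun j => b j - prism C (c j)))) ?_
      have h2 : push i (∑ j, a j • z j) = d (y - (kun X hz hε).f (mkPC s fun j => b j - prism C (c j))) := by
        rw [map_sub]; exact eq_sub_of_add_eq hy
      have h3 := congrArg (push ContinuousMap.snd) h2
      rw [push_push, push_d] at h3
      rw [← h3]; exact (push_id _).symm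
    refine ⟨_, hbc, ?_⟩
    rw [mem_bot]
    funext j
    change c j - d (b j - prism C (c j)) = 0
    rw [sub_eq_zero]
    conv_lhs => rw [hcj j, ha j, zero_smul, zero_add]
  · rw [mem_bot] at hdw
    change d w = 0 at hdw
    let C' : C((X × Y) × unitInterval, X × Y) := ⟨fun p => (C (p.1.1, p.2), p.1.2), by fun_prop⟩
    have e0 : C'.comp ((ContinuousMap.id _).prodMk (ContinuousMap.const _ 0)) =
        ContinuousMap.id (X × Y) := ContinuousMap.ext fun p => Prod.ext (h0 p.1) rfl
    have e1 : C'.comp ((ContinuousMap.id _).prodMk (ContinuousMap.const _ 1)) =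
        i.comp ContinuousMap.snd := ContinuousMap.ext fun p => Prod.ext (h1 p.1) rfl
    have hp := d_prism C' w
    rw [e0, e1, push_id, hdw, map_zero, ← push_push] at hp
    obtain ⟨a, b, hab⟩ := hspan (push ContinuousMap.snd w) (by rw [← push_d, hdw, map_zero])
    have hib : push i b ∈ supp (U ×ˢ Set.univ) :=
      push_mem (U := Set.univ) (fun y _ => Set.mk_mem_prod hu (Set.mem_univ _)) (supp_univ b)
    refine ⟨mkPC s fun j => a j • pt u, mem_PSub.2 fun j => Submodule.smul_mem _ _ hpt, ?_,
      prism C' w - push i b, sub_mem (prism_mem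
        (fun p hp t => Set.mk_mem_prod (hC _ hp.1 t) (Set.mem_univ _)) hw) hib, ?_⟩
    · rw [mem_bot]
      funext j
      change d (a j • pt u) = 0
      rw [map_smul, d_pt, smul_zero]
    · rw [mem_bot, hi]
      change _ - w - d _ = 0
      rw [hab, map_add, push_d] at hp
      rw [map_sub, hp]; abel

end kunneth
end TC

namespace TC
open Cx
variable {X Y Z : Type} [TopologicalSpace X] [TopologicalSpace Y] [TopologicalSpace Z]

variable (X) in
/-- The homology of `X` is finite-dimensional. -/
def FinT : Prop := FinH (⊤ : Sub (SC X)) ⊥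
variable (X) in
/-- The homological Euler characteristic of `X`. -/
def chiT : ℚ := chi (⊤ : Sub (SC X)) ⊥

/-- A property of open sets stable under Mayer-Vietoris unions holds for finite unions of convex
open sets. -/
theorem finite_union_induct {E : Type} [AddCommGroup E] [Module ℝ E] [TopologicalSpace E]
    (P : Set E → Prop) (h0 : P ∅) (hc : ∀ C, IsOpen C → Convex ℝ C → C.Nonempty → P C)
    (hu : ∀ U V, IsOpen U → IsOpen V → P U → P V → P (U ∩ V) → P (U ∪ V)) {α : Type}
    (t : Finset α) : ∀ C : α → Set E, (∀ i, IsOpen (C i) ∧ Convex ℝ (C i)) → P (⋃ i ∈ t, C i) := by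
  classical
  induction t using Finset.induction_on with
  | empty => intro C _; simpa using h0
  | insert a t _ ih =>
    intro C hC
    rw [Finset.set_biUnion_insert]
    refine hu _ _ (hC a).1 (isOpen_biUnion fun i _ => (hC i).1) ?_ (ih C hC) ?_
    · rcases (C a).eq_empty_or_nonempty with h | h
      · rw [h]; exact h0
      · exact hc _ (hC a).1 (hC a).2 h
    · rw [Set.inter_iUnion₂]
      exact ih _ fun i => ⟨(hC a).1.inter (hC i).1, (hC a).2.inter (hC i).2⟩

/-- Contractible sets have the homology of a point. -/
theorem point_qiso {U : Set X} {u : X} (hu : u ∈ U) (C : C(X × unitInterval, X))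
    (h0 : ∀ x, C (x, 0) = x) (h1 : ∀ x, C (x, 1) = u) (hC : ∀ x ∈ U, ∀ t, C (x, t) ∈ U) :
    (pushHom (ContinuousMap.const Unit u)).QIso ⊤ ⊥ (sub U) ⊥ where
  pair := by
    rw [← sub_univ, ← sub_empty, ← sub_empty]
    exact push_pair (fun _ _ => hu) fun _ h => h.elim
  inj x _ hd := by
    rintro ⟨y, -, hy⟩
    rw [mem_bot] at hy
    refine ⟨push (ContinuousMap.const X ()) y, mem_top _, ?_⟩
    rw [mem_bot]
    have := congrArg (push (ContinuousMap.const X ())) hy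
    change push _ (push _ x - d y) = _ at this
    rw [map_zero, map_sub, push_push, push_d] at this
    rw [← this]
    congr 1
    exact (push_id x).symm
  surj w hw hd := by
    rw [mem_bot] at hd
    change d w = 0 at hd
    have hC0 : C.comp ((ContinuousMap.id X).prodMk (ContinuousMap.const X 0)) =
        ContinuousMap.id X := ContinuousMap.ext h0
    have hC1 : C.comp ((ContinuousMap.id X).prodMk (ContinuousMap.const X 1)) =
        (ContinuousMap.const Unit u).comp (ContinuousMap.const X ()) := ContinuousMap.ext h1
    have hp := d_prism C w
    rw [hC0, hC1, push_id, hd, map_zero, sub_zero, ← push_push] at hp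
    refine ⟨push (ContinuousMap.const X ()) w, mem_top _, ?_, prism C w,
      prism_mem (fun x hx t => hC x hx t) hw, ?_⟩
    · rw [mem_bot]
      change d (push _ w) = 0
      rw [← push_d, hd, map_zero]
    · rw [mem_bot]
      change push _ (push _ w) - w - d _ = 0
      rw [hp, sub_self]

theorem finT_unit : FinT Unit := by
  have hp : (pt () : (SC Unit).C) ∈ (⊤ : Sub (SC Unit)) := mem_top _
  have hpd : (SC Unit).d (pt ()) ∈ (⊥ : Sub (SC Unit)) := by
    rw [mem_bot]; exact d_pt ()
  let v : H (⊤ : Sub (SC Unit)) ⊥ := cls (pt ()) hp hpd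
  refine Module.Finite.of_surjective (LinearMap.toSpanSingleton ℚ _ v) fun a => ?_
  obtain ⟨x, hx, hd, rfl⟩ := cls_surj a
  rw [mem_bot] at hd
  obtain ⟨a, b, -, hab⟩ := exists_push_const () x hd
  refine ⟨a, ?_⟩
  rw [LinearMap.toSpanSingleton_apply]
  have : a • v = cls (a • pt () : TC Unit) (Sub.smul_mem _ _ hp)
    (by rw [map_smul]; exact Sub.smul_mem _ _ hpd) := rfl
  rw [this, ← sub_eq_zero, cls_sub, cls_eq_zero]
  refine ⟨(-b : TC Unit), mem_top _, ?_⟩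
  have e : push (ContinuousMap.const Unit ()) x = x := push_id x
  rw [mem_bot]
  change a • pt () - x - d (-b) = 0
  rw [map_neg, ← e, hab]; abel

theorem finH_union {U V : Set X} (hU : IsOpen U) (hV : IsOpen V)
    (h : FinH (sub U) ⊥) (h' : FinH (sub V) ⊥) (hi : FinH (sub (U ∩ V)) ⊥) :
    FinH (sub (U ∪ V)) ⊥ :=
  FinH.ext (sub_mono Set.subset_union_right) h'
    ((open_excision hU hV).finH_iff.1 (FinH.quot (sub_mono Set.inter_subset_left) h hi))

/-- Inclusion-exclusion. -/
theorem chi_union {U V : Set X} (hU : IsOpen U) (hV : IsOpen V)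
    (h : FinH (sub U) ⊥) (h' : FinH (sub V) ⊥) (hi : FinH (sub (U ∩ V)) ⊥) :
    chi (sub (U ∪ V)) ⊥ = chi (sub U) ⊥ + chi (sub V) ⊥ - chi (sub (U ∩ V)) ⊥ := by
  rw [chi_add (sub_mono Set.subset_union_right) (finH_union hU hV h h' hi) h',
    ← (open_excision hU hV).chi_eq, chi_add (sub_mono (Set.inter_subset_left (t := V))) h hi]
  ring

section convex
variable {E : Type} [AddCommGroup E] [Module ℝ E] [TopologicalSpace E] [ContinuousAdd E]
  [ContinuousSMul ℝ E]

/-- The straight-line contraction. -/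
def lineC (u : E) : C(E × unitInterval, E) where
  toFun p := (1 - (p.2 : ℝ)) • p.1 + (p.2 : ℝ) • u

theorem lineC_zero (u x : E) : lineC u (x, 0) = x := by simp [lineC]

theorem lineC_one (u x : E) : lineC u (x, 1) = u := by simp [lineC]

theorem lineC_mem {U : Set E} (h : Convex ℝ U) {u x : E} (hu : u ∈ U) (hx : x ∈ U)
    (t : unitInterval) : lineC u (x, t) ∈ U :=
  h hx hu (sub_nonneg.2 t.2.2) t.2.1 (by ring)

theorem convex_qiso {U : Set E} (h : Convex ℝ U) {u : E} (hu : u ∈ U) :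
    (pushHom (ContinuousMap.const Unit u)).QIso ⊤ ⊥ (sub U) ⊥ :=
  point_qiso hu (lineC u) (lineC_zero u) (lineC_one u) fun _ hx t => lineC_mem h hu hx t

theorem finH_iUnion_convex {α : Type} (t : Finset α) (C : α → Set E)
    (hC : ∀ i, IsOpen (C i) ∧ Convex ℝ (C i)) : FinH (sub (⋃ i ∈ t, C i)) ⊥ := by
  refine finite_union_induct (fun U => FinH (sub U) ⊥) ?_ (fun C _ hC hn => ?_)
    (fun U V hU hV => finH_union hU hV) t C hC
  · rw [sub_empty]
    refine Module.Finite.of_surjective (0 : ℚ →ₗ[ℚ] _) fun a => ?_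
    obtain ⟨x, hx, hd, rfl⟩ := cls_surj a
    exact ⟨0, ((cls_eq_zero).2 ⟨0, zero_mem _, by rwa [map_zero, sub_zero]⟩).symm⟩
  · obtain ⟨u, hu⟩ := hn
    exact (convex_qiso hC hu).finH_iff.1 finT_unit

theorem Kun.iUnion_convex {J : Type} [Fintype J] {s : J → ℚ} {z : J → TC Y}
    (hz : ∀ j, d (z j) = 0) (hε : ∀ j, ε (z j) = s j • z j)
    (hspan : ∀ w, d w = 0 → ∃ a : J → ℚ, ∃ b, w = ∑ j, a j • z j + d b)
    (hind : ∀ (a : J → ℚ) b, ∑ j, a j • z j = d b → ∀ j, a j = 0)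
    {α : Type} (t : Finset α) (C : α → Set E)
    (hC : ∀ i, IsOpen (C i) ∧ Convex ℝ (C i)) : Kun hz hε (⋃ i ∈ t, C i) := by
  refine finite_union_induct (fun U => Kun hz hε U) Kun.empty (fun C _ hC hn => ?_)
    (fun U V hU hV => Kun.union hU hV) t C hC
  obtain ⟨u, hu⟩ := hn
  exact Kun.contractible hu (lineC u) (lineC_zero u) (lineC_one u)
    (fun _ hx t => lineC_mem hC hu hx t) hspan hind

end convex

theorem push_kunL {J : Type} [Fintype J] (g : C(X, Z)) (z : J → TC Y) (c : J → TC X) :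
    push (g.prodMap (ContinuousMap.id Y)) (kunL X z c) = kunL Z z fun j => push g (c j) := by
  rw [kunL_apply, kunL_apply, map_sum]
  refine Finset.sum_congr rfl fun j _ => ?_
  rw [push_crossT, push_id]

theorem kun_push {J : Type} [Fintype J] {s : J → ℚ} {z : J → TC Y}
    (hz : ∀ j, d (z j) = 0) (hε : ∀ j, ε (z j) = s j • z j) (g : C(X, Z)) (c : (PC s (SC X)).C) :
    (kun Z hz hε).f ((PHom s (pushHom g)).f c) =
      (pushHom (g.prodMap (ContinuousMap.id Y))).f ((kun X hz hε).f c) :=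
  (push_kunL g z c).symm

/-- Finiteness passes to retracts. -/
theorem FinT.retract {i : C(X, Z)} {r : C(Z, X)} (h : ∀ x, r (i x) = x) (hZ : FinT Z) : FinT X := by
  refine FinH.of_inj (φ := pushHom i) (E' := ⊤) (D' := ⊥) ⟨fun _ _ => mem_top _, fun x hx => by
    rw [mem_bot] at *; rw [hx, map_zero]⟩ (fun x _ _ => ?_) hZ
  rintro ⟨y, -, hy⟩
  refine ⟨push r y, mem_top _, ?_⟩
  rw [mem_bot] at *
  have := congrArg (push r) hy
  change push r (push i x - d y) = _ at this
  have e : r.comp i = ContinuousMap.id X := ContinuousMap.ext h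
  rw [map_zero, map_sub, push_push, push_d, e, push_id] at this
  exact this

variable (X) in
/-- Euclidean neighbourhood retracts. -/
def ENR : Prop := ∃ (ι : Type) (_ : Fintype ι) (i : C(X, ι → ℝ)) (O : Set (ι → ℝ)) (r : C(O, X)),
  IsOpen O ∧ ∃ h : ∀ x, i x ∈ O, ∀ x, r ⟨i x, h x⟩ = x

theorem ENR.exists_cover [CompactSpace X] (h : ENR X) :
    ∃ (ι : Type) (_ : Fintype ι) (t : Finset (ι → ℝ)) (ρ : (ι → ℝ) → ℝ) (W : Set (ι → ℝ)),
      W = ⋃ p ∈ t, Metric.ball p (ρ p) ∧ ∃ (i : C(X, W)) (r : C(W, X)), ∀ x, r (i x) = x := by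
  obtain ⟨ι, _, i, O, r, hO, hi, hr⟩ := h
  have hb : ∀ p ∈ O, ∃ δ > 0, Metric.ball p δ ⊆ O := fun p hp => Metric.isOpen_iff.1 hO p hp
  choose! ρ hρ hρO using hb
  obtain ⟨t, ht, hcov⟩ := (isCompact_range i.continuous).elim_nhds_subcover
    (fun p => Metric.ball p (ρ p)) fun p hp => by
      obtain ⟨x, rfl⟩ := hp
      exact Metric.ball_mem_nhds _ (hρ _ (hi x))
  have hW : (⋃ p ∈ t, Metric.ball p (ρ p)) ⊆ O := Set.iUnion₂_subset fun p hp => by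
    obtain ⟨x, rfl⟩ := ht p hp
    exact hρO _ (hi x)
  exact ⟨ι, inferInstance, t, ρ, _, rfl, ⟨fun x => ⟨i x, hcov (Set.mem_range_self x)⟩, by fun_prop⟩,
    r.comp ⟨Set.inclusion hW, continuous_inclusion hW⟩, hr⟩

/-- The inclusion of a subspace. -/
def incl (U : Set X) : C(U, X) := ⟨Subtype.val, continuous_subtype_val⟩

theorem incl_qiso (U : Set X) : (pushHom (incl U)).QIso ⊤ ⊥ (sub U) ⊥ := by
  have := embed_qiso (g := incl U) Topology.IsEmbedding.subtypeVal (E := U) (D := ∅)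
    (by rw [incl]; exact Subtype.range_val.ge)
  rwa [Set.preimage_empty, sub_empty, sub_empty,
    show incl U ⁻¹' U = Set.univ from Set.eq_univ_of_forall fun x => x.2, sub_univ] at this

theorem ENR.finT [CompactSpace X] (h : ENR X) : FinT X := by
  obtain ⟨ι, _, t, ρ, W, rfl, i, r, hr⟩ := h.exists_cover
  exact FinT.retract hr ((incl_qiso _).finH_iff.2
    (finH_iUnion_convex t _ fun p => ⟨Metric.isOpen_ball, convex_ball _ _⟩))

/-- The Künneth formula for compact ENRs. -/
theorem ENR.kunneth [CompactSpace X] (h : ENR X) (hY : FinT Y) :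
    FinT (X × Y) ∧ chiT (X × Y) = chiT X * chiT Y := by
  obtain ⟨J, _, s, z, hz, hε, hspan, hind, hchi⟩ := exists_eigencycles (K := SC Y) ε_ε hY
  have hX := h.finT
  have key : (kun X hz hε).QIso ⊤ ⊥ ⊤ ⊥ := by
    obtain ⟨ι, _, t, ρ, W, hW, i, r, hr⟩ := h.exists_cover
    have h1 : Kun hz hε W := hW ▸ Kun.iUnion_convex hz hε hspan hind t _ fun p =>
      ⟨Metric.isOpen_ball, convex_ball _ _⟩
    have h2 := (incl_qiso W).power (s := s)
    rw [PSub_top, PSub_bot, PSub_bot] at h2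
    have h3 : (pushHom ((incl W).prodMap (ContinuousMap.id Y))).QIso ⊤ ⊥
        (sub (W ×ˢ (Set.univ : Set Y))) ⊥ := by
      have := embed_qiso (g := (incl W).prodMap (ContinuousMap.id Y))
        (Topology.IsEmbedding.subtypeVal.prodMap Topology.IsEmbedding.id)
        (E := W ×ˢ Set.univ) (D := ∅) (by
          rintro ⟨a, b⟩ hab
          exact ⟨(⟨a, hab.1⟩, b), rfl⟩)
      rwa [Set.preimage_empty, sub_empty, sub_empty,
        show (incl W).prodMap (ContinuousMap.id Y) ⁻¹' (W ×ˢ Set.univ) = Set.univ from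
        Set.eq_univ_of_forall fun x => Set.mk_mem_prod x.1.2 (Set.mem_univ _), sub_univ] at this
    rw [Kun] at h1
    have h4 := h2.comp h1
    have e : (kun (ι → ℝ) hz hε).comp (PHom s (pushHom (incl W))) =
        (pushHom ((incl W).prodMap (ContinuousMap.id Y))).comp (kun W hz hε) := by
      exact Hom.ext (LinearMap.ext fun c => kun_push hz hε (incl W) c)
    rw [e] at h4
    have h5 : (kun W hz hε).QIso ⊤ ⊥ ⊤ ⊥ := Hom.QIso.of_comp_left
      ⟨fun _ _ => mem_top _, fun x hx => by rw [mem_bot] at *; rw [hx, map_zero]⟩ h4 h3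
    have hri : r.comp i = ContinuousMap.id X := ContinuousMap.ext hr
    refine Hom.QIso.retract (i := PHom s (pushHom i)) (r := PHom s (pushHom r))
      (i' := pushHom (i.prodMap (ContinuousMap.id Y)))
      (r' := pushHom (r.prodMap (ContinuousMap.id Y))) (fun c => ?_) (fun c => ?_)
      (kun_push hz hε i) (kun_push hz hε r) h5
    · refine funext fun j => ?_
      refine (push_push r i _).trans ?_
      rw [hri, push_id]
      rfl
    · change push (r.prodMap (ContinuousMap.id Y)) (push (i.prodMap (ContinuousMap.id Y)) c) = _
      have e2 : (r.prodMap (ContinuousMap.id Y)).comp (i.prodMap (ContinuousMap.id Y)) =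
        ContinuousMap.id (X × Y) := ContinuousMap.ext fun p => Prod.ext (hr p.1) rfl
      rw [push_push, e2, push_id]
  have hp : FinH (⊤ : Sub (PC s (SC X))) ⊥ := by
    rw [← PSub_top, ← PSub_bot]; exact FinH.power hX
  refine ⟨key.finH_iff.1 hp, key.chi_eq.symm.trans ?_⟩
  rw [← PSub_top, ← PSub_bot, chi_power hX, mul_comm, ← hchi]; rfl

end TC

namespace TC
open Cx
variable {X Y Z : Type} [TopologicalSpace X] [TopologicalSpace Y] [TopologicalSpace Z]

/-- Strong deformation retracts have the same homology. -/
theorem deform_qiso {i : C(X, Z)} {r : C(Z, X)} (h : ∀ x, r (i x) = x) (C : C(Z × unitInterval, Z))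
    (h0 : ∀ z, C (z, 0) = z) (h1 : ∀ z, C (z, 1) = i (r z)) :
    (pushHom i).QIso ⊤ ⊥ ⊤ ⊥ where
  pair := ⟨fun _ _ => mem_top _, fun x hx => by rw [mem_bot] at *; rw [hx, map_zero]⟩
  inj x _ _ := by
    rintro ⟨y, -, hy⟩
    refine ⟨push r y, mem_top _, ?_⟩
    rw [mem_bot] at *
    have := congrArg (push r) hy
    change push r (push i x - d y) = _ at this
    have e : r.comp i = ContinuousMap.id X := ContinuousMap.ext h
    rw [map_zero, map_sub, push_push, push_d, e, push_id] at this
    exact this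
  surj w _ hd := by
    rw [mem_bot] at hd
    change d w = 0 at hd
    have hC0 : C.comp ((ContinuousMap.id Z).prodMk (ContinuousMap.const Z 0)) =
        ContinuousMap.id Z := ContinuousMap.ext h0
    have hC1 : C.comp ((ContinuousMap.id Z).prodMk (ContinuousMap.const Z 1)) =
        i.comp r := ContinuousMap.ext h1
    have hp := d_prism C w
    rw [hC0, hC1, push_id, hd, map_zero, sub_zero, ← push_push] at hp
    refine ⟨push r w, mem_top _, ?_, prism C w, mem_top _, ?_⟩
    · rw [mem_bot]
      change d (push _ w) = 0
      rw [← push_d, hd, map_zero]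
    · rw [mem_bot]
      change push _ (push _ w) - w - d _ = 0
      rw [hp, sub_self]

/-- Open sets with finite homology and prescribed Euler characteristic. -/
def OpenChi (U : Set X) (q : ℚ) : Prop :=
  IsOpen U ∧ FinH (sub U) ⊥ ∧ chi (sub U) ⊥ = q * chiT Unit

theorem OpenChi.union {U V : Set X} {a b k : ℚ} (h : OpenChi U a) (h' : OpenChi V b)
    (hi : OpenChi (U ∩ V) k) : OpenChi (U ∪ V) (a + b - k) :=
  ⟨h.1.union h'.1, finH_union h.1 h'.1 h.2.1 h'.2.1 hi.2.1, by
    rw [chi_union h.1 h'.1 h.2.1 h'.2.1 hi.2.1, h.2.2, h'.2.2, hi.2.2]; ring⟩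

theorem OpenChi.empty : OpenChi (∅ : Set X) 0 := by
  have : Subsingleton (H (sub (∅ : Set X)) ⊥) := ⟨fun a b => by
    have key : ∀ a : H (sub (∅ : Set X)) ⊥, a = 0 := fun a => by
      obtain ⟨x, hx, hd, rfl⟩ := cls_surj a
      rw [cls_eq_zero]
      refine ⟨0, zero_mem _, ?_⟩
      rw [sub_empty] at hx
      rwa [map_zero, sub_zero]
    rw [key a, key b]⟩
  refine ⟨isOpen_empty, Module.Finite.of_finite, ?_⟩
  rw [zero_mul, chi, Subsingleton.elim (sgn _ _) 0, map_zero]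

theorem OpenChi.disjoint {U V : Set X} {a b : ℚ} (h : OpenChi U a) (h' : OpenChi V b)
    (hi : U ∩ V = ∅) : OpenChi (U ∪ V) (a + b) := by
  have := h.union h' (k := 0) (hi ▸ OpenChi.empty)
  rwa [sub_zero] at this

theorem OpenChi.convex {E : Type} [AddCommGroup E] [Module ℝ E] [TopologicalSpace E]
    [ContinuousAdd E] [ContinuousSMul ℝ E] {U : Set E} (hU : IsOpen U) (h : Convex ℝ U)
    (hn : U.Nonempty) : OpenChi U 1 := by
  obtain ⟨u, hu⟩ := hn
  exact ⟨hU, (convex_qiso h hu).finH_iff.1 finT_unit, by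
    rw [one_mul]; exact (convex_qiso h hu).chi_eq.symm⟩

theorem openChi_punctured : OpenChi ({0}ᶜ : Set ℂ) 0 := by
  let A : Set ℂ := {z | 0 < z.re}
  let B : Set ℂ := {z | z.re < 0}
  let C : Set ℂ := {z | 0 < z.im}
  let D : Set ℂ := {z | z.im < 0}
  have oA : IsOpen A := isOpen_lt continuous_const Complex.continuous_re
  have oB : IsOpen B := isOpen_lt Complex.continuous_re continuous_const
  have oC : IsOpen C := isOpen_lt continuous_const Complex.continuous_im
  have oD : IsOpen D := isOpen_lt Complex.continuous_im continuous_const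
  have cA : Convex ℝ A := convex_halfSpace_re_gt 0
  have cB : Convex ℝ B := convex_halfSpace_re_lt 0
  have cC : Convex ℝ C := convex_halfSpace_im_gt 0
  have cD : Convex ℝ D := convex_halfSpace_im_lt 0
  have AB : OpenChi (A ∪ B) (1 + 1) := (OpenChi.convex oA cA ⟨⟨1, 0⟩, by simp [A]⟩).disjoint
    (OpenChi.convex oB cB ⟨⟨-1, 0⟩, by simp [B]⟩) (by ext z; simp [A, B]; intro h; exact h.le)
  have q : ∀ (C : Set ℂ), IsOpen C → Convex ℝ C → (A ∩ C).Nonempty → (B ∩ C).Nonempty →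
      OpenChi ((A ∪ B) ∩ C) (1 + 1) := fun C oC cC h h' => by
    rw [Set.union_inter_distrib_right]
    exact (OpenChi.convex (oA.inter oC) (cA.inter cC) h).disjoint
      (OpenChi.convex (oB.inter oC) (cB.inter cC) h') (by
        ext z; simp only [A, B, Set.mem_inter_iff, Set.mem_ofPred_eq, Set.mem_empty_iff_false]
        exact ⟨fun h => by linarith [h.1.1, h.2.1], False.elim⟩)
  have h1 := AB.union (OpenChi.convex oC cC ⟨⟨0, 1⟩, by simp [C]⟩)
    (q C oC cC ⟨⟨1, 1⟩, by simp [A, C]⟩ ⟨⟨-1, 1⟩, by simp [B, C]⟩)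
  have h2 := h1.union (OpenChi.convex oD cD ⟨⟨0, -1⟩, by simp [D]⟩) (k := 1 + 1) (by
    rw [Set.union_inter_distrib_right _ C, show C ∩ D = ∅ by ext z; simp [C, D]; intro h; exact h.le,
      Set.union_empty]
    exact q D oD cD ⟨⟨1, -1⟩, by simp [A, D]⟩ ⟨⟨-1, -1⟩, by simp [B, D]⟩)
  convert h2 using 1
  · ext z
    simp only [Set.mem_compl_iff, Set.mem_singleton_iff, Complex.ext_iff, A, B, C, D, Set.mem_union,
      Set.mem_ofPred_eq, Complex.zero_re, Complex.zero_im]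
    rw [or_assoc, not_and_or, ← Ne, ← Ne, ne_comm, ne_iff_lt_or_gt, ne_comm, ne_iff_lt_or_gt]
  · norm_num

theorem mem_sphere_unit {z : ℂ} : z ∈ Submonoid.unitSphere ℂ ↔ ‖z‖ = 1 :=
  mem_sphere_zero_iff_norm

theorem chiT_circle : chiT Circle = 0 := by
  let W : Set ℂ := {0}ᶜ
  let i : C(Circle, W) := ⟨fun z => ⟨z, by simp [W]⟩, by fun_prop⟩
  have hn : ∀ z : W, ‖(z : ℂ)‖ ≠ 0 := fun z => norm_ne_zero_iff.2 z.2
  have hr : ∀ z : W, (‖(z : ℂ)‖⁻¹ : ℝ) • (z : ℂ) ∈ Submonoid.unitSphere ℂ := fun z => by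
    rw [mem_sphere_unit, norm_smul, norm_inv, norm_norm, inv_mul_cancel₀ (hn z)]
  let r : C(W, Circle) := ⟨fun z => ⟨(‖(z : ℂ)‖⁻¹ : ℝ) • (z : ℂ), hr z⟩, by
    refine Continuous.subtype_mk ?_ _
    exact (continuous_subtype_val.norm.inv₀ hn).smul continuous_subtype_val⟩
  have hpos : ∀ p : W × unitInterval, 0 < 1 - (p.2 : ℝ) + p.2 * ‖(p.1 : ℂ)‖⁻¹ := fun p => by
    have h1 : 0 < ‖(p.1 : ℂ)‖⁻¹ := inv_pos.2 (norm_pos_iff.2 p.1.2)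
    rcases eq_or_lt_of_le p.2.2.2 with h | h
    · rw [h]; linarith
    · have := mul_nonneg p.2.2.1 h1.le
      linarith
  let C : C(W × unitInterval, W) :=
    ⟨fun p => ⟨(1 - (p.2 : ℝ) + p.2 * ‖(p.1 : ℂ)‖⁻¹ : ℝ) • (p.1 : ℂ),
      smul_ne_zero (hpos p).ne' p.1.2⟩, by
      refine Continuous.subtype_mk ?_ _
      have h1 : Continuous fun p : W × unitInterval => ‖(p.1 : ℂ)‖⁻¹ :=
        (continuous_subtype_val.comp continuous_fst).norm.inv₀ fun p => hn p.1
      fun_prop⟩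
  have key := deform_qiso (i := i) (r := r) (fun z => Subtype.ext (by
      change (‖(z : ℂ)‖⁻¹ : ℝ) • (z : ℂ) = z
      rw [Circle.norm_coe, inv_one, one_smul])) C
    (fun z => Subtype.ext (by
      change (1 - (0 : ℝ) + 0 * _) • (z : ℂ) = z
      simp)) (fun z => Subtype.ext (by
      change (1 - (1 : ℝ) + 1 * _) • (z : ℂ) = (‖(z : ℂ)‖⁻¹ : ℝ) • (z : ℂ)
      rw [sub_self, zero_add, one_mul]))
  rw [chiT, key.chi_eq, (incl_qiso W).chi_eq, openChi_punctured.2.2, zero_mul]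

theorem enr_circle : ENR Circle := by
  let toC : (Fin 2 → ℝ) → ℂ := fun v => ⟨v 0, v 1⟩
  have hc : Continuous toC := by
    have : toC = fun v => (v 0 : ℂ) + v 1 * Complex.I := by
      ext v
      exact Complex.mk_eq_add_mul_I _ _
    rw [this]; fun_prop
  have hO : IsOpen {v | toC v ≠ 0} := isOpen_ne_fun hc continuous_const
  have hn : ∀ v : {v | toC v ≠ 0}, ‖toC v‖ ≠ 0 := fun v => norm_ne_zero_iff.2 v.2
  refine ⟨Fin 2, inferInstance, ⟨fun z => ![(z : ℂ).re, (z : ℂ).im], ?_⟩, {v | toC v ≠ 0},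
    ⟨fun v => ⟨(‖toC v‖⁻¹ : ℝ) • toC v, ?_⟩, ?_⟩, hO, fun z => ?_, fun z => ?_⟩
  · refine continuous_pi fun j => ?_
    fin_cases j
    · exact Complex.continuous_re.comp continuous_subtype_val
    · exact Complex.continuous_im.comp continuous_subtype_val
  · rw [mem_sphere_unit, norm_smul, norm_inv, norm_norm, inv_mul_cancel₀ (hn v)]
  · refine Continuous.subtype_mk ?_ _
    exact ((hc.comp continuous_subtype_val).norm.inv₀ hn).smul (hc.comp continuous_subtype_val)
  · exact z.coe_ne_zero
  · refine Subtype.ext ?_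
    change (‖(z : ℂ)‖⁻¹ : ℝ) • (z : ℂ) = z
    rw [Circle.norm_coe, inv_one, one_smul]

end TC

namespace TC
open Cx CategoryTheory

/-- A grading of a complex. -/
structure Grading (K : Cx) (A : ℕ → Type) [∀ n, AddCommGroup (A n)] [∀ n, Module ℚ (A n)] where
  bd : ∀ n, A (n + 1) →ₗ[ℚ] A n
  io : ∀ n, A n →ₗ[ℚ] K.C
  pr : ∀ n, K.C →ₗ[ℚ] A n
  pr_io : ∀ n a, pr n (io n a) = a
  pr_ne : ∀ n m a, m ≠ n → pr n (io m a) = 0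
  span : ∀ p : Submodule ℚ K.C, (∀ n a, io n a ∈ p) → p = ⊤
  eps : ∀ n a, K.ε (io n a) = (-1 : ℚ) ^ n • io n a
  d_zero : ∀ a, K.d (io 0 a) = 0
  d_succ : ∀ n a, K.d (io (n + 1) a) = io n (bd n a)

namespace Grading
variable {K : Cx} {A : ℕ → Type} [∀ n, AddCommGroup (A n)] [∀ n, Module ℚ (A n)]
  (G : Grading K A)

theorem induct {P : Type} [AddCommGroup P] [Module ℚ P] {f g : K.C →ₗ[ℚ] P}
    (h : ∀ n a, f (G.io n a) = g (G.io n a)) (x : K.C) : f x = g x := by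
  have := G.span (LinearMap.eqLocus f g) h
  exact (this ▸ Submodule.mem_top : x ∈ LinearMap.eqLocus f g)

theorem pr_d (n : ℕ) (x : K.C) : G.pr n (K.d x) = G.bd n (G.pr (n + 1) x) :=
  G.induct (f := G.pr n ∘ₗ K.d) (g := G.bd n ∘ₗ G.pr (n + 1)) (fun m a => by
    simp only [LinearMap.comp_apply]
    cases m with
    | zero => rw [G.d_zero, map_zero, G.pr_ne _ _ _ (Nat.succ_ne_zero n).symm, map_zero]
    | succ m =>
      rw [G.d_succ]
      by_cases h : m = n
      · subst h; rw [G.pr_io, G.pr_io]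
      · rw [G.pr_ne _ _ _ h, G.pr_ne _ _ _ (by omega), map_zero]) x

theorem d_comp (n : ℕ) (x : K.C) : K.d (G.io (n + 1) (G.pr (n + 1) x)) = G.io n (G.pr n (K.d x)) := by
  rw [G.d_succ, G.pr_d]

theorem d_pr_zero (n : ℕ) {x : K.C} (hx : K.d x = 0) : K.d (G.io n (G.pr n x)) = 0 := by
  cases n with
  | zero => exact G.d_zero _
  | succ n => rw [G.d_comp, hx, map_zero, map_zero]

/-- The projection on homology. -/
def proj (n : ℕ) : H (⊤ : Sub K) ⊥ →ₗ[ℚ] H (⊤ : Sub K) ⊥ :=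
  mapOf (G.io n ∘ₗ G.pr n) (fun x hx => mem_Z.2 ⟨mem_top _, mem_bot.2 (by
      exact G.d_pr_zero n (mem_bot.1 (mem_Z.1 hx).2))⟩) fun x _ hx => by
    obtain ⟨y, _, hy⟩ := mem_B.1 hx
    refine mem_B.2 ⟨G.io (n + 1) (G.pr (n + 1) y), mem_top _, mem_bot.2 ?_⟩
    rw [G.d_comp, ← sub_eq_zero.1 (mem_bot.1 hy)]; exact sub_self _

theorem cycle_mem {n : ℕ} {a : A n} (h : K.d (G.io n a) = 0) : K.d (G.io n a) ∈ (⊥ : Sub K) :=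
  mem_bot.2 h

theorem proj_cls (n : ℕ) (x : K.C) (hx : x ∈ (⊤ : Sub K)) (hd : K.d x ∈ (⊥ : Sub K)) :
    G.proj n (cls x hx hd) = cls (G.io n (G.pr n x)) (mem_top _)
      (G.cycle_mem (G.d_pr_zero n (mem_bot.1 hd))) := rfl

theorem cls_congr {E D : Sub K} {x y : K.C} (h : x = y) (hx : x ∈ E) (hd : K.d x ∈ D) :
    cls x hx hd = cls y (h ▸ hx) (h ▸ hd) := by subst h; rfl

theorem proj_proj (n : ℕ) (a : H (⊤ : Sub K) ⊥) : G.proj n (G.proj n a) = G.proj n a := by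
  obtain ⟨x, hx, hd, rfl⟩ := cls_surj a
  rw [proj_cls, proj_cls]
  exact cls_congr (by rw [G.pr_io]) _ _

theorem sgn_proj (n : ℕ) (a : H (⊤ : Sub K) ⊥) :
    sgn ⊤ ⊥ (G.proj n a) = (-1 : ℚ) ^ n • G.proj n a := by
  obtain ⟨x, hx, hd, rfl⟩ := cls_surj a
  rw [proj_cls, sgn, mapOf_cls]
  exact cls_congr (G.eps _ _) _ _

theorem exists_sum (x : K.C) : ∃ k, ∀ m ≥ k, ∑ n ∈ Finset.range m, G.io n (G.pr n x) = x := by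
  let p : Submodule ℚ K.C :=
    { carrier := {x | ∃ k, ∀ m ≥ k, ∑ n ∈ Finset.range m, G.io n (G.pr n x) = x}
      zero_mem' := ⟨0, fun m _ => by simp⟩
      add_mem' := by
        rintro a b ⟨k, hk⟩ ⟨l, hl⟩
        refine ⟨max k l, fun m hm => ?_⟩
        simp only [map_add, Finset.sum_add_distrib]
        rw [hk m (le_trans (le_max_left _ _) hm), hl m (le_trans (le_max_right _ _) hm)]
      smul_mem' := by
        rintro c a ⟨k, hk⟩
        refine ⟨k, fun m hm => ?_⟩
        simp only [map_smul, ← Finset.smul_sum]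
        rw [hk m hm] }
  have : p = ⊤ := G.span p fun n a => ⟨n + 1, fun m hm => by
    rw [Finset.sum_eq_single n, G.pr_io]
    · intro b _ hb; rw [G.pr_ne _ _ _ hb.symm, map_zero]
    · intro h; exact absurd (Finset.mem_range.2 hm) h⟩
  exact (this ▸ Submodule.mem_top : x ∈ p)

theorem proj_sum_cls (m : ℕ) (x : K.C) (hx : x ∈ (⊤ : Sub K)) (hd : K.d x ∈ (⊥ : Sub K))
    (h : ∑ n ∈ Finset.range m, G.io n (G.pr n x) = x) :
    ∑ n ∈ Finset.range m, G.proj n (cls x hx hd) = cls x hx hd := by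
  have h1 := map_sum (Submodule.mkQ ((B (⊤ : Sub K) ⊥).submoduleOf (Z ⊤ ⊥)))
    (fun n => (⟨G.io n (G.pr n x), mem_top _, G.cycle_mem (G.d_pr_zero n (mem_bot.1 hd))⟩ :
      Z (⊤ : Sub K) ⊥)) (Finset.range m)
  refine h1.symm.trans (congrArg (Submodule.mkQ ((B (⊤ : Sub K) ⊥).submoduleOf (Z ⊤ ⊥)))
    (a₂ := ⟨x, hx, hd⟩) (Subtype.ext ?_))
  rw [AddSubmonoidClass.coe_finsetSum]
  exact h

theorem exists_proj_sum (h : FinH (⊤ : Sub K) ⊥) :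
    ∃ k, ∀ m ≥ k, ∑ n ∈ Finset.range m, G.proj n = LinearMap.id := by
  have : Module.Finite ℚ (H (⊤ : Sub K) ⊥) := h
  let b := Module.finBasis ℚ (H (⊤ : Sub K) ⊥)
  have : ∀ i, ∃ k, ∀ m ≥ k, ∑ n ∈ Finset.range m, G.proj n (b i) = b i := fun i => by
    obtain ⟨x, hx, hd, e⟩ := cls_surj (b i)
    obtain ⟨k, hk⟩ := G.exists_sum x
    exact ⟨k, fun m hm => by rw [e]; exact G.proj_sum_cls m x hx hd (hk m hm)⟩
  choose k hk using this
  refine ⟨Finset.univ.sup k, fun m hm => b.ext fun i => ?_⟩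
  rw [LinearMap.sum_apply]
  exact hk i m (le_trans (Finset.le_sup (Finset.mem_univ i)) hm)

/-- The map from homogeneous cycles to homology. -/
def ofCycles (n : ℕ) : LinearMap.ker (K.d ∘ₗ G.io n) →ₗ[ℚ] H (⊤ : Sub K) ⊥ :=
  Submodule.mkQ _ ∘ₗ (G.io n ∘ₗ Submodule.subtype _).codRestrict (Z ⊤ ⊥) fun a =>
    mem_Z.2 ⟨mem_top _, mem_bot.2 a.2⟩

theorem ofCycles_apply (n : ℕ) (a : LinearMap.ker (K.d ∘ₗ G.io n)) :
    G.ofCycles n a = cls (G.io n a) (mem_top _) (mem_bot.2 a.2) := rfl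

theorem range_ofCycles (n : ℕ) : LinearMap.range (G.ofCycles n) = LinearMap.range (G.proj n) := by
  ext y
  constructor
  · rintro ⟨a, rfl⟩
    refine ⟨G.ofCycles n a, ?_⟩
    rw [ofCycles_apply, proj_cls]
    exact cls_congr (by rw [G.pr_io]) _ _
  · rintro ⟨a, rfl⟩
    obtain ⟨x, hx, hd, rfl⟩ := cls_surj a
    exact ⟨⟨G.pr n x, G.d_pr_zero n (mem_bot.1 hd)⟩, rfl⟩

theorem mem_ker_ofCycles (n : ℕ) (a : LinearMap.ker (K.d ∘ₗ G.io n)) :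
    G.ofCycles n a = 0 ↔ ∃ b, G.bd n b = a := by
  rw [ofCycles_apply, cls_eq_zero]
  constructor
  · rintro ⟨y, _, hy⟩
    refine ⟨G.pr (n + 1) y, ?_⟩
    rw [← G.pr_d, ← sub_eq_zero.1 (mem_bot.1 hy), G.pr_io]
  · rintro ⟨b, hb⟩
    exact ⟨G.io (n + 1) b, mem_top _, mem_bot.2 (by rw [G.d_succ, hb, sub_self])⟩

theorem chi_eq_sum (h : FinH (⊤ : Sub K) ⊥) : ∃ k, (∀ n ≥ k, G.proj n = 0) ∧
    chi (⊤ : Sub K) ⊥ = ∑ n ∈ Finset.range k,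
      (-1 : ℚ) ^ n * (Module.finrank ℚ (LinearMap.range (G.proj n)) : ℚ) := by
  have : Module.Finite ℚ (H (⊤ : Sub K) ⊥) := h
  obtain ⟨k, hk⟩ := G.exists_proj_sum h
  refine ⟨k, fun n hn => ?_, ?_⟩
  · have h1 := hk (n + 1) (by omega)
    rw [Finset.sum_range_succ, hk n hn] at h1
    simpa using h1
  have : sgn (⊤ : Sub K) ⊥ = ∑ n ∈ Finset.range k, (-1 : ℚ) ^ n • G.proj n := by
    refine LinearMap.ext fun a => ?_
    have h1 := LinearMap.congr_fun (hk k le_rfl) a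
    rw [LinearMap.sum_apply, LinearMap.id_apply] at h1
    conv_lhs => rw [← h1]
    rw [map_sum, LinearMap.sum_apply]
    exact Finset.sum_congr rfl fun n _ => by rw [sgn_proj, LinearMap.smul_apply]
  rw [chi, this, map_sum]
  refine Finset.sum_congr rfl fun n _ => ?_
  rw [map_smul, smul_eq_mul]
  congr 1
  exact LinearMap.IsProj.trace ⟨fun x => ⟨x, rfl⟩, by
    rintro _ ⟨x, rfl⟩; exact G.proj_proj n x⟩

end Grading

theorem shortComplex_finrank (S : ShortComplex (ModuleCat.{0} ℚ)) {P : Type} [AddCommGroup P]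
    [Module ℚ P] (q : LinearMap.ker S.g.hom →ₗ[ℚ] P)
    (hq : ∀ a, q a = 0 ↔ ∃ b, S.f.hom b = a.1) :
    Module.finrank ℚ S.homology = Module.finrank ℚ (LinearMap.range q) := by
  have e : LinearMap.range S.moduleCatToCycles = LinearMap.ker q := by
    ext a
    rw [LinearMap.mem_ker, hq]
    exact ⟨fun ⟨b, hb⟩ => ⟨b, congrArg Subtype.val hb⟩, fun ⟨b, hb⟩ => ⟨b, Subtype.ext hb⟩⟩
  refine (S.moduleCatHomologyIso.toLinearEquiv).finrank_eq.trans ?_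
  exact ((Submodule.quotEquivOfEq _ _ e).trans q.quotKerEquivRange).finrank_eq

theorem finrank_homology {K : Cx} (S : ChainComplex (ModuleCat.{0} ℚ) ℕ)
    (G : Grading K fun n => S.X n) (hG : ∀ n, G.bd n = (S.d (n + 1) n).hom) (n : ℕ) :
    Module.finrank ℚ (S.homology n) = Module.finrank ℚ (LinearMap.range (G.proj n)) := by
  rw [← G.range_ofCycles]
  have hg : ∀ a : S.X n, (S.sc n).g.hom a = 0 ↔ K.d (G.io n a) = 0 := by
    intro a
    change (S.d n ((ComplexShape.down ℕ).next n)).hom a = 0 ↔ _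
    cases n with
    | zero =>
      rw [ChainComplex.next_nat_zero, S.shape _ _ (by simp)]
      exact ⟨fun _ => G.d_zero a, fun _ => rfl⟩
    | succ n =>
      rw [ChainComplex.next_nat_succ, G.d_succ, hG]
      exact ⟨fun h => by rw [h, map_zero], fun h => by
        have := congrArg (G.pr n) h; rwa [G.pr_io, map_zero] at this⟩
  have hf : ∀ a : S.X n, (∃ b, (S.sc n).f.hom b = a) ↔ ∃ b, G.bd n b = a := by
    intro a
    change (∃ b, (S.d ((ComplexShape.down ℕ).prev n) n).hom b = a) ↔ _
    rw [ChainComplex.prev, hG]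
  let j : LinearMap.ker (S.sc n).g.hom →ₗ[ℚ] LinearMap.ker (K.d ∘ₗ G.io n) :=
    { toFun := fun a => ⟨a.1, (hg a.1).1 a.2⟩
      map_add' := fun _ _ => rfl
      map_smul' := fun _ _ => rfl }
  have hj : LinearMap.range (G.ofCycles n ∘ₗ j) = LinearMap.range (G.ofCycles n) := by
    apply LinearMap.range_comp_of_range_eq_top
    exact LinearMap.range_eq_top.2 fun a => ⟨⟨a.1, (hg a.1).2 a.2⟩, rfl⟩
  rw [← hj]
  exact shortComplex_finrank (S.sc n) (G.ofCycles n ∘ₗ j) fun a =>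
    (G.mem_ker_ofCycles n (j a)).trans (hf a.1).symm

variable {X : Type} [TopologicalSpace X]

/-- Simplices of the singular simplicial set as maps from the standard simplex. -/
def smp (n : ℕ) : ((TopCat.toSSet.obj (TopCat.of X)).obj (Opposite.op (SimplexCategory.mk n))) ≃
    C(Spx n, X) := TopCat.toSSetObjEquiv (TopCat.of X) (Opposite.op (SimplexCategory.mk n))

theorem smp_delta {n : ℕ} (i : Fin (n + 2))
    (σ : (TopCat.toSSet.obj (TopCat.of X)).obj (Opposite.op (SimplexCategory.mk (n + 1)))) :
    smp n (((TopCat.toSSet.obj (TopCat.of X)).map (SimplexCategory.δ i).op) σ) =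
      (smp (n + 1) σ).comp (aff (vtx ∘ i.succAbove)) := by
  ext t
  change smp (n + 1) σ (stdSimplex.map _ t) = smp (n + 1) σ (scomb t (vtx ∘ i.succAbove))
  rw [Spx.map_eq_scomb]
  rfl

/-- The type of simplices. -/
abbrev SS (X : Type) [TopologicalSpace X] (n : ℕ) : Type :=
  (TopCat.toSSet.obj (TopCat.of X)).obj (Opposite.op (SimplexCategory.mk n))

/-- The inclusion of graded pieces. -/
def gio (X : Type) [TopologicalSpace X] (n : ℕ) : (SS X n →₀ ℚ) →ₗ[ℚ] TC X :=
  Finsupp.lmapDomain ℚ ℚ fun σ => (⟨n, smp n σ⟩ : Σ n, C(Spx n, X))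

/-- The projection to graded pieces. -/
def gpr (X : Type) [TopologicalSpace X] (n : ℕ) : TC X →ₗ[ℚ] (SS X n →₀ ℚ) :=
  lift fun m σ => if h : m = n then Finsupp.single ((smp n).symm (h ▸ σ)) 1 else 0

/-- The boundary on graded pieces. -/
def gbd (X : Type) [TopologicalSpace X] (n : ℕ) : (SS X (n + 1) →₀ ℚ) →ₗ[ℚ] (SS X n →₀ ℚ) :=
  ∑ i : Fin (n + 2), (-1 : ℤ) ^ (i : ℕ) • Finsupp.lmapDomain ℚ ℚ
    ((TopCat.toSSet.obj (TopCat.of X)).map (SimplexCategory.δ i).op)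

theorem gio_single (n : ℕ) (σ : SS X n) : gio X n (Finsupp.single σ 1) = sg (smp n σ) :=
  Finsupp.mapDomain_single

theorem gpr_sg (n : ℕ) (σ : C(Spx n, X)) :
    gpr X n (sg σ) = Finsupp.single ((smp n).symm σ) 1 := by
  rw [gpr, lift_sg, dif_pos rfl]

theorem gpr_sg_ne {n m : ℕ} (h : m ≠ n) (σ : C(Spx m, X)) : gpr X n (sg σ) = 0 := by
  rw [gpr, lift_sg, dif_neg h]

theorem gbd_eq (n : ℕ) : gbd X n = ((singComplex X).d (n + 1) n).hom := by
  unfold singComplex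
  rw [AlgebraicTopology.alternatingFaceMapComplex_obj_d,
    AlgebraicTopology.AlternatingFaceMapComplex.objD, ModuleCat.hom_sum, gbd]
  refine Finset.sum_congr rfl fun i _ => ?_
  rw [ModuleCat.hom_zsmul]
  rfl

theorem g_hom_congr {n : ℕ} {P : Type} [AddCommGroup P] [Module ℚ P]
    {f g : (SS X n →₀ ℚ) →ₗ[ℚ] P}
    (h : ∀ σ : SS X n, f (Finsupp.single σ 1) = g (Finsupp.single σ 1)) (x) : f x = g x :=
  LinearMap.congr_fun (Finsupp.lhom_ext' fun σ => LinearMap.ext_ring (h σ)) x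

/-- The grading of the singular complex. -/
def singGrading (X : Type) [TopologicalSpace X] : Grading (SC X) fun n => (singComplex X).X n where
  bd n := ((singComplex X).d (n + 1) n).hom
  io := gio X
  pr := gpr X
  pr_io n a := g_hom_congr (f := gpr X n ∘ₗ gio X n) (g := LinearMap.id) (fun σ => by
    rw [LinearMap.comp_apply, gio_single, gpr_sg, Equiv.symm_apply_apply]; rfl) a
  pr_ne n m a h := g_hom_congr (f := gpr X n ∘ₗ gio X m) (g := 0) (fun σ => by
    rw [LinearMap.comp_apply, gio_single, gpr_sg_ne h]; rfl) a
  span p h := by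
    refine Submodule.eq_top_iff'.2 fun x => ?_
    have := hom_congr (f := p.mkQ) (g := 0) (fun n σ => by
      rw [LinearMap.zero_apply, Submodule.mkQ_apply, Submodule.Quotient.mk_eq_zero]
      have := h n (Finsupp.single ((smp n).symm σ) 1 : SS X n →₀ ℚ)
      have e : gio X n (Finsupp.single ((smp n).symm σ) 1) = sg σ := by
        rw [gio_single, Equiv.apply_symm_apply]
      exact e ▸ this) x
    rwa [LinearMap.zero_apply, Submodule.mkQ_apply, Submodule.Quotient.mk_eq_zero] at this
  eps n a := g_hom_congr (f := ε ∘ₗ gio X n) (g := (-1 : ℚ) ^ n • gio X n) (fun σ => by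
    rw [LinearMap.comp_apply, LinearMap.smul_apply, gio_single, ε_sg]) a
  d_zero a := g_hom_congr (f := d ∘ₗ gio X 0) (g := 0) (fun σ => by
    rw [LinearMap.comp_apply, gio_single, d_zero]; rfl) a
  d_succ n a := by
    rw [← gbd_eq]
    exact g_hom_congr (f := d ∘ₗ gio X (n + 1)) (g := gio X n ∘ₗ gbd X n) (fun σ => by
      rw [LinearMap.comp_apply, LinearMap.comp_apply, gio_single, d_succ, gbd, LinearMap.sum_apply,
        map_sum]
      refine Finset.sum_congr rfl fun i _ => ?_
      rw [LinearMap.smul_apply, map_zsmul, Finsupp.lmapDomain_apply, Finsupp.mapDomain_single,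
        gio_single, smp_delta, ← Int.cast_smul_eq_zsmul ℚ]
      push_cast
      rfl) a

theorem eulerChar_eq (h : FinT X) : (eulerChar X : ℚ) = chiT X := by
  obtain ⟨k, h0, h1⟩ := (singGrading X).chi_eq_sum h
  have hr : ∀ n, Module.finrank ℚ (Hcoh n X) =
      Module.finrank ℚ (LinearMap.range ((singGrading X).proj n)) := fun n => by
    rw [← finrank_homology (singComplex X) (singGrading X) fun _ => rfl]
    exact Subspace.dual_finrank_eq
  rw [eulerChar, finsum_eq_sum_of_support_subset (s := Finset.range k), chiT, h1]
  · push_cast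
    exact Finset.sum_congr rfl fun n _ => by rw [hr]
  · intro n hn
    by_contra hk
    apply hn
    change (-1 : ℤ) ^ n * (Module.finrank ℚ (Hcoh n X) : ℤ) = 0
    rw [hr, h0 n (by simpa using hk), LinearMap.range_zero, finrank_bot, Nat.cast_zero, mul_zero]

end TC

namespace TC
open Cx
variable {X Y Z : Type} [TopologicalSpace X] [TopologicalSpace Y] [TopologicalSpace Z]

/-- The end map of a homotopy. -/
def endMap (K : C(X × unitInterval, Y)) : C(X, Y) :=
  K.comp ((ContinuousMap.id X).prodMk (ContinuousMap.const X 1))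

/-- A homotopy of the identity preserving `B` and pushing the neighbourhood `V` into `B`. -/
structure NDR (B V : Set X) (K : C(X × unitInterval, X)) : Prop where
  zero : ∀ x, K (x, 0) = x
  mem : ∀ x ∈ B, ∀ t, K (x, t) ∈ B
  isOpen : IsOpen V
  sub : B ⊆ V
  one : ∀ x ∈ V, K (x, 1) ∈ B

namespace NDR
variable {B V : Set X} {K : C(X × unitInterval, X)} (h : NDR B V K)
include h

theorem d_prism (x : TC X) : d (prism K x) = push (endMap K) x - x - prism K (d x) := by
  have e : K.comp ((ContinuousMap.id X).prodMk (ContinuousMap.const X 0)) =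
      ContinuousMap.id X := ContinuousMap.ext h.zero
  rw [TC.d_prism, e, push_id]; rfl

theorem prism_mem {x : TC X} (hx : x ∈ supp B) : prism K x ∈ supp B := TC.prism_mem h.mem hx

theorem push_mem {x : TC X} (hx : x ∈ supp V) : push (endMap K) x ∈ supp B :=
  TC.push_mem (fun x hx => h.one x hx) hx

theorem exists_nhds {W : Set X} (hW : IsOpen W) (hBW : B ⊆ W) :
    ∃ V₀, IsOpen V₀ ∧ B ⊆ V₀ ∧ V₀ ⊆ W ∩ V ∧ ∀ x ∈ V₀, ∀ t, K (x, t) ∈ W := by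
  refine ⟨(Prod.fst '' (K ⁻¹' W)ᶜ)ᶜ ∩ V, ((isClosedMap_fst_of_compactSpace _
    (hW.preimage K.continuous).isClosed_compl).isOpen_compl).inter h.isOpen, fun b hb =>
      ⟨?_, h.sub hb⟩, ?_, ?_⟩
  · rintro ⟨p, hp, rfl⟩
    exact hp (hBW (h.mem _ hb p.2))
  · rintro x ⟨hx, hV⟩
    refine ⟨?_, hV⟩
    by_contra hn
    exact hx ⟨(x, 0), fun h' => hn (by rw [← h.zero x]; exact h'), rfl⟩
  · rintro x ⟨hx, -⟩ t
    by_contra hn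
    exact hx ⟨(x, t), hn, rfl⟩

end NDR

section rel
variable [CompactSpace X] [T2Space Y] (π : C(X, Y)) {B : Set Y}

theorem exists_saturated {V : Set X} (hV : IsOpen V) (h : π ⁻¹' B ⊆ V) :
    ∃ V', IsOpen V' ∧ B ⊆ V' ∧ π ⁻¹' V' ⊆ V := by
  refine ⟨(π '' Vᶜ)ᶜ, (π.continuous.isClosedMap _ hV.isClosed_compl).isOpen_compl, ?_, ?_⟩
  · rintro y hy ⟨x, hx, rfl⟩
    exact hx (h hy)
  · intro x hx
    by_contra hn
    exact hx ⟨x, hn, rfl⟩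

variable {π} (hB : IsClosed B) (hinj : ∀ x x', π x ∉ B → π x = π x' → x = x')
  (hsurj : ∀ y ∉ B, ∃ x, π x = y)
include hB hinj hsurj

theorem rel_open_qiso {V : Set Y} (hV : IsOpen V) (hBV : B ⊆ V) :
    (pushHom π).QIso ⊤ (sub (π ⁻¹' V)) ⊤ (sub V) := by
  have hemb : Topology.IsEmbedding (π.comp (incl (π ⁻¹' Bᶜ))) := by
    have h1 : IsClosedMap (Set.restrictPreimage Bᶜ π) :=
      π.continuous.isClosedMap.restrictPreimage Bᶜ
    have h2 : Topology.IsClosedEmbedding (Set.restrictPreimage Bᶜ π) := by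
      refine .of_continuous_injective_isClosedMap
        (π.continuous.restrictPreimage) (fun a b hab => ?_) h1
      exact Subtype.ext (hinj _ _ a.2 (congrArg Subtype.val hab))
    exact Topology.IsEmbedding.subtypeVal.comp h2.isEmbedding
  have hV' := hV.preimage π.continuous
  have hB' := hB.preimage π.continuous
  have q1 : (pushHom (incl (π ⁻¹' Bᶜ))).QIso _ _ _ _ :=
    embed_qiso (g := incl (π ⁻¹' Bᶜ)) Topology.IsEmbedding.subtypeVal
    (E := π ⁻¹' Bᶜ) (D := π ⁻¹' Bᶜ ∩ π ⁻¹' V) (by rw [incl]; exact Subtype.range_val.ge)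
  have q2 : (pushHom (π.comp (incl (π ⁻¹' Bᶜ)))).QIso _ _ _ _ :=
    embed_qiso (g := π.comp (incl (π ⁻¹' Bᶜ))) hemb (E := Bᶜ) (D := Bᶜ ∩ V)
    (by
      intro y hy
      obtain ⟨x, rfl⟩ := hsurj y hy
      exact ⟨⟨x, hy⟩, rfl⟩)
  have e1 := open_excision hB'.isOpen_compl hV'
  have e2 := open_excision hB.isOpen_compl hV
  have u1 : (π ⁻¹' B)ᶜ ∪ π ⁻¹' V = Set.univ := by
    ext x; simp only [Set.mem_union, Set.mem_compl_iff, Set.mem_preimage, Set.mem_univ, iff_true]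
    by_cases h : π x ∈ B
    · exact Or.inr (hBV h)
    · exact Or.inl h
  have u2 : Bᶜ ∪ V = Set.univ := by
    ext x; simp only [Set.mem_union, Set.mem_compl_iff, Set.mem_univ, iff_true]
    by_cases h : x ∈ B
    · exact Or.inr (hBV h)
    · exact Or.inl h
  rw [u1, sub_univ] at e1
  rw [u2, sub_univ] at e2
  have q1' := q1.comp e1
  have q2' := q2.comp e2
  refine Hom.QIso.of_comp_right ⟨fun _ _ => mem_top _, fun x hx => push_mem (fun _ h => h) hx⟩
    (φ := (Hom.id _).comp (pushHom (incl (π ⁻¹' Bᶜ)))) ?_ q1'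
  have e : (pushHom π).comp ((Hom.id _).comp (pushHom (incl (π ⁻¹' Bᶜ)))) =
      (Hom.id _).comp (pushHom (π.comp (incl (π ⁻¹' Bᶜ)))) :=
    Hom.ext (LinearMap.ext fun c => push_push _ _ _)
  rw [e]
  exact q2'

theorem rel_qiso {V : Set X} {K : C(X × unitInterval, X)} (h : NDR (π ⁻¹' B) V K)
    {V' : Set Y} {K' : C(Y × unitInterval, Y)} (h' : NDR B V' K') :
    (pushHom π).QIso ⊤ (sub (π ⁻¹' B)) ⊤ (sub B) where
  pair := ⟨fun _ _ => mem_top _, fun x hx => push_mem (fun _ h => h) hx⟩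
  inj x _ hd := by
    rintro ⟨y, -, hy⟩
    obtain ⟨V₀, ho, hBV, hVV⟩ := exists_saturated π h.isOpen h.sub
    obtain ⟨z, -, hz⟩ := (rel_open_qiso hB hinj hsurj ho hBV).inj x (mem_top _)
      (sub_mono (Set.preimage_mono hBV) hd) ⟨y, mem_top _, sub_mono hBV hy⟩
    refine ⟨push (endMap K) z - prism K x, mem_top _, ?_⟩
    have h1 := h.push_mem (sub_mono hVV hz)
    have h2 := h.prism_mem hd
    have h3 := h.d_prism x
    change push (endMap K) (x - d z) ∈ _ at h1
    rw [map_sub, push_d] at h1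
    change x - d (push (endMap K) z - prism K x) ∈ supp _
    rw [map_sub, h3]
    change prism K (d x) ∈ supp _ at h2
    have := sub_mem h1 h2
    convert this using 1
    abel
  surj x hx hd := by
    have hW : IsOpen (π ⁻¹' V') := h'.isOpen.preimage π.continuous
    obtain ⟨V₁, ho₁, hBV₁, hV₁, hK₁⟩ := h.exists_nhds hW (Set.preimage_mono h'.sub)
    obtain ⟨V₀, ho, hBV, hVV⟩ := exists_saturated π ho₁ hBV₁
    have ho' := ho.inter h'.isOpen
    obtain ⟨c, -, hdc, y, -, hy⟩ := (rel_open_qiso hB hinj hsurj ho'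
      (Set.subset_inter hBV h'.sub)).surj x (mem_top _) (sub_mono (Set.subset_inter hBV h'.sub) hd)
    change d c ∈ supp _ at hdc
    change push π c - x - d y ∈ supp _ at hy
    change d x ∈ supp _ at hd
    have hdc₁ : d c ∈ supp V₁ :=
      sub_mono (fun t ht => hVV ht.1) hdc
    have hK := h.d_prism c
    have hdk : d (push (endMap K) c) ∈ supp (π ⁻¹' B) := by
      rw [← push_d]
      exact h.push_mem (sub_mono (fun t ht => (hV₁ ht).2) hdc₁)
    let w : TC Y := push π (push (endMap K) c) - x - d (y + push π (prism K c))
    have hw : w ∈ supp V' := by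
      have h1 : push π (prism K (d c)) ∈ supp V' :=
        push_mem (fun _ h => h) (TC.prism_mem (V := π ⁻¹' V') hK₁ hdc₁)
      have h2 : push π c - x - d y ∈ supp V' :=
        sub_mono Set.inter_subset_right hy
      have := add_mem h1 h2
      convert this using 1
      change push π (push (endMap K) c) - x - d (y + push π (prism K c)) = _
      rw [map_add, ← push_d π, hK, map_sub, map_sub]
      abel
    have hdw : d w ∈ supp B := by
      change d (push π (push (endMap K) c) - x - d (y + push π (prism K c))) ∈ _
      rw [map_sub, map_sub, d_d, sub_zero, ← push_d]
      exact sub_mem (push_mem (fun _ h => h) hdk) hd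
    refine ⟨push (endMap K) c, mem_top _, hdk, y + push π (prism K c) - prism K' w, mem_top _, ?_⟩
    change push π (push (endMap K) c) - x - d (y + push π (prism K c) - prism K' w) ∈ supp B
    have h3 := sub_mem (h'.push_mem hw) (h'.prism_mem hdw)
    convert h3 using 1
    rw [map_sub, h'.d_prism]
    simp only [w]
    abel

end rel

/-- A closed ENR in a compact ENR is a neighbourhood deformation retract. -/
theorem exists_ndr [CompactSpace X] [T2Space X] (h : ENR X) {B : Set X} (hB : IsClosed B)
    (hE : ENR B) : ∃ V K, NDR B V K := by
  obtain ⟨ι, _, i, O, r, hO, hi, hr⟩ := h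
  obtain ⟨κ, _, j, O', r', hO', hj, hr'⟩ := hE
  obtain ⟨J, hJ⟩ := j.exists_restrict_eq hB
  have hJ' : ∀ b : B, J b = j b := fun b => DFunLike.congr_fun hJ b
  have hW : IsOpen (J ⁻¹' O') := hO'.preimage J.continuous
  obtain ⟨V₀, ho₀, hBV₀, hcl₀⟩ := normal_exists_closure_subset hB hW
    (fun b hb => by rw [Set.mem_preimage, hJ' ⟨b, hb⟩]; exact hj _)
  obtain ⟨G, hG⟩ := ContinuousMap.exists_restrict_eq (Y := ι → ℝ) (isClosed_closure (s := V₀))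
    ⟨fun x => i (r' ⟨J x, hcl₀ x.2⟩), by fun_prop⟩
  have hG' : ∀ x (hx : x ∈ closure V₀), G x = i (r' ⟨J x, hcl₀ hx⟩) := fun x hx =>
    DFunLike.congr_fun hG ⟨x, hx⟩
  have hGB : ∀ b ∈ B, G b = i b := fun b hb => by
    rw [hG' b (subset_closure (hBV₀ hb))]
    congr 1
    have : (⟨J b, hcl₀ (subset_closure (hBV₀ hb))⟩ : O') = ⟨j ⟨b, hb⟩, hj _⟩ :=
      Subtype.ext (hJ' ⟨b, hb⟩)
    rw [this, hr']
  let F : C(X × unitInterval, ι → ℝ) :=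
    ⟨fun p => (1 - (p.2 : ℝ)) • i p.1 + (p.2 : ℝ) • G p.1, by fun_prop⟩
  let N : Set X := (Prod.fst '' (F ⁻¹' O)ᶜ)ᶜ ∩ V₀
  have hN : IsOpen N := ((isClosedMap_fst_of_compactSpace _
    (hO.preimage F.continuous).isClosed_compl).isOpen_compl).inter ho₀
  have hBN : B ⊆ N := fun b hb => ⟨by
    rintro ⟨p, hp, rfl⟩
    apply hp
    change (1 - (p.2 : ℝ)) • i p.1 + (p.2 : ℝ) • G p.1 ∈ O
    rw [hGB _ hb, ← add_smul, sub_add_cancel, one_smul]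
    exact hi _, hBV₀ hb⟩
  have hNF : ∀ x ∈ N, ∀ t, F (x, t) ∈ O := fun x hx t => by
    by_contra hn
    exact hx.1 ⟨(x, t), hn, rfl⟩
  obtain ⟨V, ho, hBV, hcl⟩ := normal_exists_closure_subset hB hN hBN
  obtain ⟨l, hl0, hl1, hl⟩ := exists_continuous_zero_one_of_isClosed hN.isClosed_compl
    (isClosed_closure (s := V)) (Set.disjoint_left.2 fun x hx hx' => hx (hcl hx'))
  let lam : X × unitInterval → unitInterval := fun p => ⟨p.2 * l p.1, mul_nonneg p.2.2.1 (hl _).1,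
    mul_le_one₀ p.2.2.2 (hl _).1 (hl _).2⟩
  have hlam : Continuous lam := by
    refine Continuous.subtype_mk ?_ _
    fun_prop
  have hmem : ∀ p : X × unitInterval, F (p.1, lam p) ∈ O := fun p => by
    by_cases hp : p.1 ∈ N
    · exact hNF _ hp _
    · have : lam p = 0 := Subtype.ext (by
        change (p.2 : ℝ) * l p.1 = 0
        rw [hl0 hp]; exact mul_zero _)
      rw [this]
      change (1 - (0 : ℝ)) • i p.1 + (0 : ℝ) • G p.1 ∈ O
      rw [sub_zero, one_smul, zero_smul, add_zero]
      exact hi _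
  refine ⟨V, ⟨fun p => r ⟨F (p.1, lam p), hmem p⟩, by fun_prop⟩, ?_, ?_, ho, hBV, ?_⟩
  · intro x
    have : F (x, lam (x, 0)) = i x := by
      have : lam (x, 0) = 0 := Subtype.ext (zero_mul _)
      rw [this]
      change (1 - (0 : ℝ)) • i x + (0 : ℝ) • G x = _
      rw [sub_zero, one_smul, zero_smul, add_zero]
    change r ⟨F (x, lam (x, 0)), _⟩ = x
    simp only [this, hr]
  · intro x hx t
    have : F (x, lam (x, t)) = i x := by
      change (1 - (lam (x, t) : ℝ)) • i x + (lam (x, t) : ℝ) • G x = _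
      rw [hGB x hx, ← add_smul, sub_add_cancel, one_smul]
    change r ⟨F (x, lam (x, t)), _⟩ ∈ B
    simp only [this, hr]
    exact hx
  · intro x hx
    have hx0 : x ∈ closure V₀ := subset_closure (hcl (subset_closure hx)).2
    have : F (x, lam (x, 1)) = i (r' ⟨J x, hcl₀ hx0⟩) := by
      have : lam (x, 1) = 1 := Subtype.ext (by
        change (1 : ℝ) * l x = 1
        rw [hl1 (subset_closure hx)]; exact mul_one _)
      rw [this]
      change (1 - (1 : ℝ)) • i x + (1 : ℝ) • G x = _
      rw [sub_self, one_smul, zero_smul, zero_add, hG' x hx0]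
    change r ⟨F (x, lam (x, 1)), _⟩ ∈ B
    simp only [this, hr]
    exact Subtype.coe_prop _

theorem chi_sub_eq [CompactSpace X] (h : ENR X) {B : Set X} (hE : FinT B) :
    chi ⊤ (sub B) = chiT X - chiT B := by
  have := chi_add (le_top' (sub B)) h.finT ((incl_qiso B).finH_iff.1 hE)
  rw [chiT, chiT, this, (incl_qiso B).chi_eq]; ring

/-- Relative homeomorphisms preserve relative Euler characteristics. -/
theorem rel_chi [CompactSpace X] [T2Space X] [CompactSpace Y] [T2Space Y] {π : C(X, Y)} {B : Set Y}
    (hB : IsClosed B) (hinj : ∀ x x', π x ∉ B → π x = π x' → x = x')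
    (hsurj : ∀ y ∉ B, ∃ x, π x = y) (hX : ENR X) (hY : ENR Y) (hB1 : ENR (π ⁻¹' B))
    (hB2 : ENR B) : chiT X - chiT (π ⁻¹' B) = chiT Y - chiT B := by
  have hB' := hB.preimage π.continuous
  obtain ⟨V, K, h⟩ := exists_ndr hX hB' hB1
  obtain ⟨V', K', h'⟩ := exists_ndr hY hB hB2
  have : CompactSpace B := isCompact_iff_compactSpace.1 hB.isCompact
  have : CompactSpace (π ⁻¹' B) := isCompact_iff_compactSpace.1 hB'.isCompact
  rw [← chi_sub_eq hX hB1.finT, ← chi_sub_eq hY hB2.finT]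
  exact (rel_qiso hB hinj hsurj h h').chi_eq

end TC

namespace TC
open Polynomial

section bump
variable {a u w b : ℝ}

theorem exists_bump_le (hau : a < u) (huw : u ≤ w) (hwb : w < b) :
    ∃ σ : ℝ ≃o ℝ, σ u = w ∧ ∀ t ∉ Set.Ioo a b, σ t = t := by
  let F : ℝ → ℝ := fun t => max t (min (a + (w - a) / (u - a) * (t - a))
    (b - (b - w) / (b - u) * (b - t)))
  have h1 : 0 < (w - a) / (u - a) := div_pos (by linarith) (by linarith)
  have h2 : 0 < (b - w) / (b - u) := div_pos (by linarith) (by linarith)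
  have h1' : 1 ≤ (w - a) / (u - a) := (one_le_div (by linarith)).2 (by linarith)
  have h2' : (b - w) / (b - u) ≤ 1 := (div_le_one (by linarith)).2 (by linarith)
  have hm : StrictMono F := by
    intro s t h
    refine max_lt_max h (min_lt_min ?_ ?_)
    · have := mul_lt_mul_of_pos_left h h1
      linarith
    · have := mul_lt_mul_of_pos_left h h2
      linarith
  have hout : ∀ t ∉ Set.Ioo a b, F t = t := fun t ht => by
    refine max_eq_left ?_
    by_cases h : a < t
    · have hb : b ≤ t := not_lt.1 fun h' => ht ⟨h, h'⟩
      refine (min_le_right _ _).trans ?_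
      nlinarith
    · refine (min_le_left _ _).trans ?_
      nlinarith [not_lt.1 h]
  have hs : Function.Surjective F := by
    intro y
    by_cases hy : y ∈ Set.Ioo a b
    · have := intermediate_value_Icc (f := F) (by linarith : a ≤ b) (by fun_prop)
      rw [hout a (fun h => lt_irrefl _ h.1), hout b (fun h => lt_irrefl _ h.2)] at this
      obtain ⟨x, -, hx⟩ := this ⟨hy.1.le, hy.2.le⟩
      exact ⟨x, hx⟩
    · exact ⟨y, hout y hy⟩
  refine ⟨hm.orderIsoOfSurjective F hs, ?_, hout⟩
  change F u = w
  have e1 : a + (w - a) / (u - a) * (u - a) = w := by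
    rw [div_mul_cancel₀ _ (by linarith)]; ring
  have e2 : b - (b - w) / (b - u) * (b - u) = w := by
    rw [div_mul_cancel₀ _ (by linarith)]; ring
  simp only [F]
  rw [e1, e2, min_self, max_eq_right huw]

theorem exists_bump (hau : a < u) (hub : u < b) (haw : a < w) (hwb : w < b) :
    ∃ σ : ℝ ≃o ℝ, σ u = w ∧ (∀ t ∉ Set.Ioo a b, σ t = t) ∧ ∀ t ∈ Set.Ioo a b, σ t ∈ Set.Ioo a b := by
  have key : ∃ σ : ℝ ≃o ℝ, σ u = w ∧ ∀ t ∉ Set.Ioo a b, σ t = t := by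
    rcases le_total u w with h | h
    · exact exists_bump_le hau h hwb
    · obtain ⟨σ, h1, h2⟩ := exists_bump_le haw h hub
      exact ⟨σ.symm, by rw [← h1, σ.symm_apply_apply], fun t ht => by
        conv_lhs => rw [← h2 t ht]
        exact σ.symm_apply_apply t⟩
  obtain ⟨σ, h1, h2⟩ := key
  refine ⟨σ, h1, h2, fun t ht => ⟨?_, ?_⟩⟩
  · rw [← h2 a fun h => lt_irrefl _ h.1]; exact σ.strictMono ht.1
  · rw [← h2 b fun h => lt_irrefl _ h.2]; exact σ.strictMono ht.2

end bump

/-- Every point off a closed set which is unbounded in both directions lies in a gap. -/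
theorem exists_gap {G : Set ℝ} (hG : IsClosed G) (hlo : ∀ t, ∃ a ∈ G, a ≤ t)
    (hhi : ∀ t, ∃ a ∈ G, t ≤ a) {t : ℝ} (ht : t ∉ G) :
    ∃ a ∈ G, ∃ b ∈ G, a < t ∧ t < b ∧ ∀ s ∈ Set.Ioo a b, s ∉ G := by
  obtain ⟨a₀, ha₀, hat⟩ := hlo t
  obtain ⟨b₀, hb₀, hbt⟩ := hhi t
  have h1 := IsClosed.csSup_mem (hG.inter isClosed_Iic) ⟨a₀, ha₀, hat⟩ ⟨t, fun x hx => hx.2⟩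
  have h2 := IsClosed.csInf_mem (hG.inter isClosed_Ici) ⟨b₀, hb₀, hbt⟩ ⟨t, fun x hx => hx.2⟩
  have h3 : sSup (G ∩ Set.Iic t) < t := lt_of_le_of_ne h1.2 fun h => ht (h ▸ h1.1)
  have h4 : t < sInf (G ∩ Set.Ici t) := lt_of_le_of_ne h2.2 fun h => ht (h ▸ h2.1)
  refine ⟨_, h1.1, _, h2.1, h3, h4, fun s hs hsG => ?_⟩
  rcases le_total s t with h | h
  · exact absurd (le_csSup ⟨t, fun x hx => hx.2⟩ (⟨hsG, h⟩ : s ∈ G ∩ Set.Iic t)) (not_le.2 hs.1)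
  · exact absurd (csInf_le ⟨t, fun x hx => hx.2⟩ (⟨hsG, h⟩ : s ∈ G ∩ Set.Ici t)) (not_le.2 hs.2)

/-- The sign of the value of a polynomial. -/
abbrev sg' (p : ℝ[X]) (t : ℝ) : SignType := SignType.sign (p.eval t)

section extend
variable {p q : ℝ[X]} {G : Set ℝ}

theorem sign_neg_eval (p : ℝ[X]) (t : ℝ) : sg' (-p) t = - sg' p t := by
  rw [sg', eval_neg, Left.sign_neg]

theorem strictMonoOn_of_sign {a b : ℝ} (h : ∀ s ∈ Set.Ioo a b, sg' (derivative p) s = 1) :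
    StrictMonoOn (fun t => p.eval t) (Set.Icc a b) :=
  strictMonoOn_of_deriv_pos (convex_Icc a b) p.continuous.continuousOn fun s hs => by
    rw [interior_Icc] at hs
    rw [Polynomial.deriv]
    exact sign_eq_one_iff.1 (h s hs)

theorem sign_const {a b : ℝ} (h : ∀ s ∈ Set.Ioo a b, p.eval s ≠ 0) {s t : ℝ}
    (hs : s ∈ Set.Ioo a b) (ht : t ∈ Set.Ioo a b) : sg' p s = sg' p t := by
  by_contra hne
  have key : (0 : ℝ) ∈ (fun t => p.eval t) '' Set.uIcc s t := by
    refine intermediate_value_uIcc p.continuous.continuousOn ?_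
    have hs0 := h s hs
    have ht0 := h t ht
    rcases lt_or_gt_of_ne hs0 with h1 | h1 <;> rcases lt_or_gt_of_ne ht0 with h2 | h2
    · exact absurd (by rw [sg', sg', sign_neg h1, sign_neg h2]) hne
    · exact Set.mem_uIcc.2 (Or.inl ⟨h1.le, h2.le⟩)
    · exact Set.mem_uIcc.2 (Or.inr ⟨h2.le, h1.le⟩)
    · exact absurd (by rw [sg', sg', sign_pos h1, sign_pos h2]) hne
  obtain ⟨c, hc, hc0⟩ := key
  exact h c (Set.ordConnected_Ioo.uIcc_subset hs ht hc) hc0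

/-- Signs in a gap are determined by the signs at the ends and the matching of roots. -/
theorem sign_match_incr {φ : ℝ ≃o ℝ} {a b t : ℝ} (hat : a < t) (htb : t < b)
    (hp : ∀ s ∈ Set.Ioo a b, sg' (derivative p) s = 1)
    (hd : ∀ s, sg' (derivative p) s = sg' (derivative q) (φ s))
    (ha : sg' p a = sg' q (φ a)) (hb : sg' p b = sg' q (φ b))
    (hr : ∀ u, p.eval u = 0 → q.eval (φ u) = 0) : sg' p t = sg' q (φ t) := by
  have m1 := strictMonoOn_of_sign hp
  have m2 : StrictMonoOn (fun t => q.eval t) (Set.Icc (φ a) (φ b)) :=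
    strictMonoOn_of_sign fun s hs => by
      have := hd (φ.symm s)
      rw [φ.apply_symm_apply] at this
      rw [← this]
      exact hp _ ⟨φ.lt_symm_apply.2 hs.1, φ.symm_apply_lt.2 hs.2⟩
  have it : t ∈ Set.Icc a b := ⟨hat.le, htb.le⟩
  have ia : a ∈ Set.Icc a b := ⟨le_rfl, (hat.trans htb).le⟩
  have ib : b ∈ Set.Icc a b := ⟨(hat.trans htb).le, le_rfl⟩
  have hφ : ∀ {s}, s ∈ Set.Icc a b → φ s ∈ Set.Icc (φ a) (φ b) := fun h =>
    ⟨φ.monotone h.1, φ.monotone h.2⟩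
  rcases lt_trichotomy (p.eval t) 0 with h | h | h
  · rw [sg', sign_neg h, eq_comm, sg', sign_eq_neg_one_iff]
    by_contra hn
    have hqb : 0 < q.eval (φ b) := lt_of_le_of_lt (not_lt.1 hn) (m2 (hφ it) (hφ ib) (φ.strictMono htb))
    have hpb : 0 < p.eval b := by
      rw [sg', sg', sign_pos hqb] at hb; exact sign_eq_one_iff.1 hb
    obtain ⟨u, hu, hu0⟩ := intermediate_value_Ioo htb.le p.continuous.continuousOn
      (⟨h, hpb⟩ : (0 : ℝ) ∈ Set.Ioo _ _)
    have := m2 (hφ it) (hφ ⟨hat.le.trans hu.1.le, hu.2.le⟩) (φ.strictMono hu.1)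
    simp only [hr u hu0] at this
    exact hn this
  · rw [sg', sg', h, hr t h]
  · rw [sg', sign_pos h, eq_comm, sg', sign_eq_one_iff]
    by_contra hn
    have hqa : q.eval (φ a) < 0 := lt_of_lt_of_le (m2 (hφ ia) (hφ it) (φ.strictMono hat)) (not_lt.1 hn)
    have hpa : p.eval a < 0 := by
      rw [sg', sg', sign_neg hqa] at ha; exact sign_eq_neg_one_iff.1 ha
    obtain ⟨u, hu, hu0⟩ := intermediate_value_Ioo hat.le p.continuous.continuousOn
      (⟨hpa, h⟩ : (0 : ℝ) ∈ Set.Ioo _ _)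
    have := m2 (hφ ⟨hu.1.le, hu.2.le.trans htb.le⟩) (hφ it) (φ.strictMono hu.2)
    simp only [hr u hu0] at this
    exact hn this

theorem sign_match {φ : ℝ ≃o ℝ} {a b t : ℝ} (hat : a < t) (htb : t < b)
    (hp : ∀ s ∈ Set.Ioo a b, (derivative p).eval s ≠ 0)
    (hd : ∀ s, sg' (derivative p) s = sg' (derivative q) (φ s))
    (ha : sg' p a = sg' q (φ a)) (hb : sg' p b = sg' q (φ b))
    (hr : ∀ u, p.eval u = 0 → q.eval (φ u) = 0) : sg' p t = sg' q (φ t) := by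
  have ht : t ∈ Set.Ioo a b := ⟨hat, htb⟩
  rcases lt_or_gt_of_ne (hp t ht) with h | h
  · have := sign_match_incr (p := -p) (q := -q) (φ := φ) hat htb
      (fun s hs => by
        rw [derivative_neg, sign_neg_eval, sign_const hp hs ht, sg', sign_neg h]; rfl)
      (fun s => by rw [derivative_neg, derivative_neg, sign_neg_eval, sign_neg_eval, hd])
      (by rw [sign_neg_eval, sign_neg_eval, ha]) (by rw [sign_neg_eval, sign_neg_eval, hb])
      (fun u hu => by
        rw [eval_neg, neg_eq_zero] at *; exact hr u hu)
    rw [sign_neg_eval, sign_neg_eval] at this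
    exact neg_injective this
  · exact sign_match_incr hat htb
      (fun s hs => by rw [sign_const hp hs ht, sg', sign_pos h]) hd ha hb hr

/-- Roots of a polynomial in a gap. -/
theorem injOn_gap {a b : ℝ} (hp : ∀ s ∈ Set.Ioo a b, (derivative p).eval s ≠ 0) :
    Set.InjOn (fun t => p.eval t) (Set.Icc a b) := by
  by_cases hab : a < b
  · obtain ⟨t, ht⟩ := exists_between hab
    rcases lt_or_gt_of_ne (hp t ht) with h | h
    · have := strictMonoOn_of_sign (p := -p) (a := a) (b := b) fun s hs => by
        rw [derivative_neg, sign_neg_eval, sign_const hp hs ht, sg', sign_neg h]; rfl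
      intro x hx y hy hxy
      exact this.injOn hx hy (by simpa using hxy)
    · exact (strictMonoOn_of_sign fun s hs => by
        rw [sign_const hp hs ht, sg', sign_pos h]).injOn
  · intro x hx y hy _
    have h1 := hx.1; have h2 := hx.2; have h3 := hy.1; have h4 := hy.2
    linarith [not_lt.1 hab]

theorem sign_change {a b u : ℝ} (hau : a < u) (hub : u < b) (hu : p.eval u = 0)
    (hp : ∀ s ∈ Set.Ioo a b, (derivative p).eval s ≠ 0)
    {x y : ℝ} (hxy : x < y) (ha : sg' p a = sg' q x) (hb : sg' p b = sg' q y) :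
    ∃ v ∈ Set.Ioo x y, q.eval v = 0 := by
  have ht : u ∈ Set.Ioo a b := ⟨hau, hub⟩
  have iu : u ∈ Set.Icc a b := ⟨hau.le, hub.le⟩
  have ia : a ∈ Set.Icc a b := ⟨le_rfl, (hau.trans hub).le⟩
  have ib : b ∈ Set.Icc a b := ⟨(hau.trans hub).le, le_rfl⟩
  rcases lt_or_gt_of_ne (hp u ht) with h | h
  · have m := strictMonoOn_of_sign (p := -p) (a := a) (b := b) fun s hs => by
      rw [derivative_neg, sign_neg_eval, sign_const hp hs ht, sg', sign_neg h]; rfl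
    have h1 := m ia iu hau
    have h2 := m iu ib hub
    simp only [eval_neg, hu, neg_zero, neg_lt_zero, Left.neg_pos_iff] at h1 h2
    rw [sg', sign_pos h1] at ha
    rw [sg', sign_neg h2] at hb
    exact intermediate_value_Ioo' hxy.le q.continuous.continuousOn
      ⟨sign_eq_neg_one_iff.1 hb.symm, sign_eq_one_iff.1 ha.symm⟩
  · have m := strictMonoOn_of_sign (p := p) (a := a) (b := b) fun s hs => by
      rw [sign_const hp hs ht, sg', sign_pos h]
    have h1 := m ia iu hau
    have h2 := m iu ib hub
    simp only [hu] at h1 h2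
    rw [sg', sign_neg h1] at ha
    rw [sg', sign_pos h2] at hb
    exact intermediate_value_Ioo hxy.le q.continuous.continuousOn
      ⟨sign_eq_neg_one_iff.1 ha.symm, sign_eq_one_iff.1 hb.symm⟩

/-- Extend a sign matching to one more polynomial. -/
theorem sign_extend {I : Type} (f f' : I → ℝ[X]) (hG : IsClosed G) (hlo : ∀ t, ∃ a ∈ G, a ≤ t)
    (hhi : ∀ t, ∃ a ∈ G, t ≤ a) (hf : ∀ i, f i ≠ 0 → ∀ t, (f i).eval t = 0 → t ∈ G)
    (hp0 : derivative p ≠ 0) (hp : ∀ t, (derivative p).eval t = 0 → t ∈ G) (φ : ℝ ≃o ℝ)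
    (hφ : ∀ i t, sg' (f i) t = sg' (f' i) (φ t))
    (hd : ∀ s, sg' (derivative p) s = sg' (derivative q) (φ s))
    (hpG : ∀ t ∈ G, sg' p t = sg' q (φ t)) :
    ∃ ψ : ℝ ≃o ℝ, (∀ i t, sg' (f i) t = sg' (f' i) (ψ t)) ∧ ∀ t, sg' p t = sg' q (ψ t) := by
  have hpne : p ≠ 0 := fun h => hp0 (by rw [h, derivative_zero])
  have hfin : ∀ φ : ℝ ≃o ℝ, {u | p.eval u = 0 ∧ q.eval (φ u) ≠ 0}.Finite := fun φ =>
    (p.roots.toFinset.finite_toSet).subset fun u hu => by simpa [hpne] using hu.1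
  induction hn : {u | p.eval u = 0 ∧ q.eval (φ u) ≠ 0}.ncard using Nat.strong_induction_on
    generalizing φ with
  | _ n ih =>
    subst hn
    by_cases hU : {u | p.eval u = 0 ∧ q.eval (φ u) ≠ 0} = ∅
    · refine ⟨φ, hφ, fun t => ?_⟩
      by_cases ht : t ∈ G
      · exact hpG t ht
      · obtain ⟨a, ha, b, hb, hat, htb, hgap⟩ := exists_gap hG hlo hhi ht
        refine sign_match hat htb (fun s hs h => hgap s hs (hp s h)) hd (hpG a ha) (hpG b hb)
          fun u hu => ?_
        by_contra hn
        exact Set.eq_empty_iff_forall_notMem.1 hU u ⟨hu, hn⟩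
    · obtain ⟨u, hu, huq⟩ := Set.nonempty_iff_ne_empty.2 hU
      have huG : u ∉ G := fun h => huq (by
        have := hpG u h
        rw [sg', hu, sign_zero, eq_comm, sg', sign_eq_zero_iff] at this
        exact this)
      obtain ⟨a, ha, b, hb, hau, hub, hgap⟩ := exists_gap hG hlo hhi huG
      have hp' : ∀ s ∈ Set.Ioo a b, (derivative p).eval s ≠ 0 := fun s hs h => hgap s hs (hp s h)
      obtain ⟨v, hv, hv0⟩ := sign_change hau hub hu hp' (φ.strictMono (hau.trans hub))
        (hpG a ha) (hpG b hb)
      obtain ⟨σ, hσu, hσ1, hσ2⟩ := exists_bump hau hub (w := φ.symm v)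
        (φ.lt_symm_apply.2 hv.1) (φ.symm_apply_lt.2 hv.2)
      have hσf : ∀ r : ℝ[X], (r ≠ 0 → ∀ t, r.eval t = 0 → t ∈ G) → ∀ t, sg' r t = sg' r (σ t) := by
        intro r hr t
        by_cases ht : t ∈ Set.Ioo a b
        · by_cases hr0 : r = 0
          · rw [hr0, sg', sg', eval_zero, eval_zero]
          · exact sign_const (fun s hs h => hgap s hs (hr hr0 s h)) ht (hσ2 t ht)
        · rw [hσ1 t ht]
      refine ih _ ?_ (σ.trans φ) (fun i t => ?_) (fun s => ?_) (fun t ht => ?_) rfl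
      · refine Set.ncard_lt_ncard ⟨?_, ?_⟩ (hfin φ)
        · rintro t ⟨ht, htq⟩
          refine ⟨ht, ?_⟩
          have : t ∉ Set.Ioo a b := fun h => htq (by
            have : t = u := injOn_gap hp' ⟨h.1.le, h.2.le⟩ ⟨hau.le, hub.le⟩ (by
              change p.eval t = p.eval u
              rw [ht, hu])
            change q.eval (φ (σ t)) = 0
            rw [this, hσu, φ.apply_symm_apply, hv0])
          change q.eval (φ (σ t)) ≠ 0 at htq
          rwa [hσ1 t this] at htq
        · intro h
          exact (h ⟨hu, huq⟩).2 (by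
            change q.eval (φ (σ u)) = 0
            rw [hσu, φ.apply_symm_apply, hv0])
      · rw [hσf (f i) (hf i) t, hφ]; rfl
      · rw [hσf _ (fun _ => hp) s, hd]; rfl
      · change _ = sg' q (φ (σ t))
        rw [hσ1 t fun h => hgap t h ht, hpG t ht]

end extend

section elim

theorem exists_prem {R : Type} [CommRing R] (q : R[X]) (k : ℕ) (hq : q.natDegree ≤ k + 1)
    (N : ℕ) : ∀ p : R[X], p.natDegree ≤ k + N → ∃ (m : ℕ) (s r : R[X]),
      C (q.coeff (k + 1)) ^ m * p = q * s + r ∧ r.natDegree ≤ k := by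
  induction N with
  | zero => exact fun p hp => ⟨0, 0, p, by simp, hp⟩
  | succ N ih =>
    intro p hp
    obtain ⟨m, s, r, h, hr⟩ := ih
      (C (q.coeff (k + 1)) * p - C (p.coeff (k + N + 1)) * (X ^ N * q)) (by
        rw [natDegree_le_iff_coeff_eq_zero]
        intro j hj
        rw [coeff_sub, coeff_C_mul, coeff_C_mul, coeff_X_pow_mul', if_pos (by omega)]
        rcases Nat.lt_or_ge (k + N + 1) j with h | h
        · rw [coeff_eq_zero_of_natDegree_lt (by omega : p.natDegree < j),
            coeff_eq_zero_of_natDegree_lt (by omega : q.natDegree < j - N)]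
          simp
        · obtain rfl : j = k + N + 1 := by omega
          rw [show k + N + 1 - N = k + 1 by omega]
          ring)
    refine ⟨m + 1, s + C (q.coeff (k + 1)) ^ m * (C (p.coeff (k + N + 1)) * X ^ N), r, ?_, hr⟩
    linear_combination h

variable {R Y : Type} [CommRing R]

/-- The pseudo-remainder of `p` by a polynomial `q` of degree at most `k + 1`. -/
theorem exists_prem' (p q : R[X]) (k : ℕ) : ∃ r : R[X], r.natDegree ≤ k ∧
    (q.natDegree ≤ k + 1 → ∃ (m : ℕ) (s : R[X]), C (q.coeff (k + 1)) ^ m * p = q * s + r) := by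
  by_cases hq : q.natDegree ≤ k + 1
  · obtain ⟨m, s, r, h, hr⟩ := exists_prem q k hq p.natDegree p (by omega)
    exact ⟨r, hr, fun _ => ⟨m, s, h⟩⟩
  · exact ⟨0, by simp, fun h => absurd h hq⟩

def prem (p q : R[X]) (k : ℕ) : R[X] := (exists_prem' p q k).choose

theorem natDegree_prem (p q : R[X]) (k : ℕ) : (prem p q k).natDegree ≤ k :=
  (exists_prem' p q k).choose_spec.1

theorem prem_spec (p q : R[X]) (k : ℕ) (hq : q.natDegree ≤ k + 1) :
    ∃ (m : ℕ) (s : R[X]), C (q.coeff (k + 1)) ^ m * p = q * s + prem p q k :=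
  (exists_prem' p q k).choose_spec.2 hq

/-- Truncation to degree at most `k`. -/
def ptrunc (q : R[X]) (k : ℕ) : R[X] := ∑ i ∈ Finset.range (k + 1), monomial i (q.coeff i)

theorem coeff_ptrunc (q : R[X]) (k j : ℕ) :
    (ptrunc q k).coeff j = if j ≤ k then q.coeff j else 0 := by
  simp [ptrunc, coeff_monomial]

theorem natDegree_ptrunc (q : R[X]) (k : ℕ) : (ptrunc q k).natDegree ≤ k := by
  rw [natDegree_le_iff_coeff_eq_zero]
  intro j hj
  rw [coeff_ptrunc, if_neg (by omega)]

theorem map_ptrunc (q : R[X]) (k : ℕ) (g : R →+* ℝ) (h : ∀ j, k < j → g (q.coeff j) = 0) :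
    (ptrunc q k).map g = q.map g := by
  ext j
  rw [coeff_map, coeff_map, coeff_ptrunc]
  split_ifs with hj
  · rfl
  · rw [map_zero, h j (by omega)]

theorem sign_eventually (p : ℝ[X]) : ∀ᶠ t in Filter.atTop, sg' p t = SignType.sign p.leadingCoeff := by
  by_cases h0 : p.degree ≤ 0
  · rw [eq_C_of_degree_le_zero h0]
    exact Filter.Eventually.of_forall fun t => by rw [sg', eval_C, leadingCoeff_C]
  · rw [not_le] at h0
    have hne : p.leadingCoeff ≠ 0 := fun h => by
      rw [leadingCoeff_eq_zero] at h; simp [h] at h0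
    rcases lt_or_gt_of_ne hne with h | h
    · filter_upwards [(p.tendsto_atBot_of_leadingCoeff_nonpos h0 h.le).eventually_lt_atBot 0]
        with t ht
      rw [sg', sign_neg ht, sign_neg h]
    · filter_upwards [(p.tendsto_atTop_of_leadingCoeff_nonneg h0 h.le).eventually_gt_atTop 0]
        with t ht
      rw [sg', sign_pos ht, sign_pos h]

theorem sign_atTop {p q : ℝ[X]} (φ : ℝ ≃o ℝ)
    (h : SignType.sign p.leadingCoeff = SignType.sign q.leadingCoeff) :
    ∃ T, ∀ t, T ≤ t → sg' p t = sg' q (φ t) := by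
  obtain ⟨T, hT⟩ := Filter.eventually_atTop.1
    ((sign_eventually p).and (φ.tendsto_atTop.eventually (sign_eventually q)))
  exact ⟨T, fun t ht => by rw [(hT t ht).1, (hT t ht).2, h]⟩

/-- The reflection `t ↦ - φ (- t)`. -/
def reflIso (φ : ℝ ≃o ℝ) : ℝ ≃o ℝ where
  toFun t := - φ (- t)
  invFun t := - φ.symm (- t)
  left_inv t := by simp
  right_inv t := by simp
  map_rel_iff' {a b} := by simp

theorem sign_atBot {p q : ℝ[X]} (φ : ℝ ≃o ℝ) (hd : p.natDegree = q.natDegree)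
    (h : SignType.sign p.leadingCoeff = SignType.sign q.leadingCoeff) :
    ∃ T, ∀ t, t ≤ T → sg' p t = sg' q (φ t) := by
  obtain ⟨T, hT⟩ := sign_atTop (p := p.comp (-X)) (q := q.comp (-X)) (reflIso φ) (by
    rw [leadingCoeff_comp (by simp), leadingCoeff_comp (by simp), hd, sign_mul, sign_mul, h])
  refine ⟨-T, fun t ht => ?_⟩
  have := hT (-t) (by linarith)
  simpa [sg', reflIso] using this

variable (ev : Y → R →+* ℝ)

/-- Elimination of one variable holds for a finite set of polynomials. -/
def Good (L : Set R[X]) : Prop := ∃ Q : Set R, Q.Finite ∧ ∀ x x', (∀ q ∈ Q,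
  SignType.sign (ev x q) = SignType.sign (ev x' q)) → ∃ φ : ℝ ≃o ℝ, ∀ p ∈ L, ∀ t,
    sg' (p.map (ev x)) t = sg' (p.map (ev x')) (φ t)

theorem good_const {L : Set R[X]} (hL : L.Finite) (h : ∀ p ∈ L, p.natDegree ≤ 0) : Good ev L := by
  refine ⟨(fun p : R[X] => p.coeff 0) '' L, hL.image _, fun x x' hx => ⟨OrderIso.refl ℝ, fun p hp t => ?_⟩⟩
  rw [eq_C_of_natDegree_le_zero (h p hp), sg', sg']
  simpa using hx _ ⟨p, hp, rfl⟩

theorem good_insert {d : ℕ} {p : R[X]} {L : Set R[X]} (hL : L.Finite) (hp : p.natDegree ≤ d + 1)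
    (hd : ∀ q ∈ L, q.natDegree ≤ d + 1)
    (ih : ∀ P : Set R[X], P.Finite → (∀ q ∈ P, q.natDegree ≤ d) → Good ev (P ∪ L)) :
    Good ev (insert p L) := by
  let L1 : Set R[X] := insert (derivative p) L
  let cs : Set R[X] := (fun z : R[X] × ℕ => C (z.1.coeff z.2)) ''
    ((insert p L1) ×ˢ Set.Iic (d + 1))
  let rs : Set R[X] := (fun z : R[X] × ℕ => prem p (ptrunc z.1 (z.2 + 1)) z.2) '' (L1 ×ˢ Set.Iic d)
  let P : Set R[X] := insert (derivative p) (insert p.eraseLead (cs ∪ rs))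
  have hL1 : L1.Finite := hL.insert _
  have hdp : (derivative p).natDegree ≤ d := (natDegree_derivative_le p).trans (by omega)
  have hL1d : ∀ q ∈ L1, q.natDegree ≤ d + 1 := by
    rintro q (rfl | hq)
    · omega
    · exact hd q hq
  obtain ⟨Q, hQf, hQ⟩ := ih P
    (((((hL1.insert _).prod (Set.finite_Iic _)).image _ |>.union
      ((hL1.prod (Set.finite_Iic _)).image _)).insert _).insert _) (by
    rintro q (rfl | rfl | ⟨z, -, rfl⟩ | ⟨z, hz, rfl⟩)
    · exact hdp
    · exact (eraseLead_natDegree_le p).trans (by omega)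
    · simp
    · exact (natDegree_prem _ _ _).trans hz.2)
  refine ⟨Q, hQf, fun x x' hx => ?_⟩
  obtain ⟨φ, hφ⟩ := hQ x x' hx
  have hc : ∀ q ∈ insert p L1, ∀ j, SignType.sign (ev x (q.coeff j)) =
      SignType.sign (ev x' (q.coeff j)) := by
    intro q hq j
    by_cases hj : j ≤ d + 1
    · simpa [sg'] using hφ (C (q.coeff j)) (Or.inl (Or.inr (Or.inr (Or.inl ⟨(q, j), ⟨hq, hj⟩, rfl⟩)))) 0
    · have : q.natDegree ≤ d + 1 := by
        rcases hq with rfl | hq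
        · exact hp
        · exact hL1d q hq
      rw [coeff_eq_zero_of_natDegree_lt (by omega), RingHom.map_zero, RingHom.map_zero]
  have hL1φ : ∀ q ∈ L1, ∀ t, sg' (q.map (ev x)) t = sg' (q.map (ev x')) (φ t) := by
    rintro q (rfl | hq)
    · exact hφ _ (Or.inl (Or.inl rfl))
    · exact hφ _ (Or.inr hq)
  suffices h : ∃ ψ : ℝ ≃o ℝ, (∀ q ∈ L1, ∀ t, sg' (q.map (ev x)) t = sg' (q.map (ev x')) (ψ t)) ∧
      ∀ t, sg' (p.map (ev x)) t = sg' (p.map (ev x')) (ψ t) by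
    obtain ⟨ψ, h1, h2⟩ := h
    refine ⟨ψ, ?_⟩
    rintro q (rfl | hq)
    · exact h2
    · exact h1 q (Or.inr hq)
  have hcp := hc p (Or.inl rfl)
  by_cases hlc : ev x p.leadingCoeff = 0
  · have hlc' : ev x' p.leadingCoeff = 0 := by
      have := hcp p.natDegree
      rw [coeff_natDegree, hlc, sign_zero, eq_comm, sign_eq_zero_iff] at this
      exact this
    have e : ∀ y, ev y p.leadingCoeff = 0 → p.map (ev y) = p.eraseLead.map (ev y) := fun y hy => by
      have := congrArg (Polynomial.map (ev y)) p.eraseLead_add_C_mul_X_pow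
      rw [Polynomial.map_add, Polynomial.map_mul, map_C, hy, C_0, zero_mul, add_zero] at this
      exact this.symm
    refine ⟨φ, hL1φ, fun t => ?_⟩
    rw [e x hlc, e x' hlc']
    exact hφ _ (Or.inl (Or.inr (Or.inl rfl))) t
  have hlc' : ev x' p.leadingCoeff ≠ 0 := fun h => hlc (by
    have := hcp p.natDegree
    rw [coeff_natDegree, h, sign_zero, sign_eq_zero_iff] at this
    exact this)
  by_cases hp0 : p.natDegree = 0
  · refine ⟨φ, hL1φ, fun t => ?_⟩
    have := hcp 0
    rw [eq_C_of_natDegree_eq_zero hp0]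
    simpa [sg'] using this
  have hdeg : (p.map (ev x)).natDegree = p.natDegree := natDegree_map_of_leadingCoeff_ne_zero _ hlc
  have hdeg' : (p.map (ev x')).natDegree = p.natDegree :=
    natDegree_map_of_leadingCoeff_ne_zero _ hlc'
  have hlcs : SignType.sign (p.map (ev x)).leadingCoeff =
      SignType.sign (p.map (ev x')).leadingCoeff := by
    rw [leadingCoeff, leadingCoeff, hdeg, hdeg', coeff_map, coeff_map, hcp]
  obtain ⟨T1, hT1⟩ := sign_atTop φ hlcs
  obtain ⟨T2, hT2⟩ := sign_atBot φ (hdeg.trans hdeg'.symm) hlcs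
  let Z : Set ℝ := ⋃ q ∈ L1, {t | q.map (ev x) ≠ 0 ∧ (q.map (ev x)).eval t = 0}
  have hZ : Z.Finite := hL1.biUnion fun q _ =>
    ((q.map (ev x)).roots.toFinset.finite_toSet).subset fun t ht => by
      simpa [ht.1] using ht.2
  have hder : derivative (p.map (ev x)) ≠ 0 := fun h => hp0 (by
    rw [← hdeg]; exact derivative_eq_zero.1 h)
  obtain ⟨ψ, h1, h2⟩ := sign_extend (p := p.map (ev x)) (q := p.map (ev x'))
    (G := Z ∪ (Set.Iic T2 ∪ Set.Ici T1))
    (fun i : L1 => i.1.map (ev x)) (fun i : L1 => i.1.map (ev x'))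
    (hZ.isClosed.union (isClosed_Iic.union isClosed_Ici))
    (fun t => ⟨min t T2, Or.inr (Or.inl (Set.mem_Iic.2 (min_le_right _ _))), min_le_left _ _⟩)
    (fun t => ⟨max t T1, Or.inr (Or.inr (Set.mem_Ici.2 (le_max_right _ _))), le_max_left _ _⟩)
    (fun i hi t ht => Or.inl (Set.mem_biUnion i.2 ⟨hi, ht⟩)) hder
    (fun t ht => Or.inl (Set.mem_biUnion (x := derivative p) (Or.inl rfl)
      (by rw [derivative_map] at hder ht; exact ⟨hder, ht⟩))) φ
    (fun i => hL1φ i.1 i.2) (by rw [derivative_map, derivative_map]; exact hL1φ _ (Or.inl rfl)) (by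
      rintro t (ht | ht | ht)
      · obtain ⟨q, hq, hq0, hqt⟩ := Set.mem_iUnion₂.1 ht
        have hcq := hc q (Or.inr hq)
        obtain ⟨k, hk⟩ : ∃ k, (q.map (ev x)).natDegree = k + 1 := Nat.exists_eq_succ_of_ne_zero
          fun h => by
            rw [eq_C_of_natDegree_eq_zero h, eval_C] at hqt
            apply hq0
            rw [eq_C_of_natDegree_eq_zero h, hqt, C_0]
        have hx1 : ∀ j, k + 1 < j → ev x (q.coeff j) = 0 := fun j hj => by
          rw [← coeff_map]; exact coeff_eq_zero_of_natDegree_lt (by omega)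
        have hx2 : ∀ j, k + 1 < j → ev x' (q.coeff j) = 0 := fun j hj => by
          have := hcq j
          rw [hx1 j hj, sign_zero, eq_comm, sign_eq_zero_iff] at this
          exact this
        have hck : ev x (q.coeff (k + 1)) ≠ 0 := by
          rw [← coeff_map, ← hk, coeff_natDegree]
          exact leadingCoeff_ne_zero.2 hq0
        have hqt' : (q.map (ev x')).eval (φ t) = 0 := by
          have := hL1φ q hq t
          rw [sg', hqt, sign_zero, eq_comm, sg', sign_eq_zero_iff] at this
          exact this
        have hkd : k ≤ d := by
          have := (natDegree_map_le (f := ev x) (p := q)).trans (hL1d q hq)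
          omega
        obtain ⟨m, s, hms⟩ := prem_spec p (ptrunc q (k + 1)) k (natDegree_ptrunc _ _)
        rw [coeff_ptrunc, if_pos le_rfl] at hms
        have key : ∀ y u, (∀ j, k + 1 < j → ev y (q.coeff j) = 0) → (q.map (ev y)).eval u = 0 →
            SignType.sign (ev y (q.coeff (k + 1))) ^ m * sg' (p.map (ev y)) u =
              sg' ((prem p (ptrunc q (k + 1)) k).map (ev y)) u := fun y u hy hu => by
          have := congrArg (fun r : R[X] => (r.map (ev y)).eval u) hms
          simp only [Polynomial.map_mul, Polynomial.map_add, Polynomial.map_pow, map_C, eval_mul,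
            eval_add, eval_pow, eval_C, map_ptrunc q _ _ hy, hu, zero_mul, zero_add] at this
          rw [sg', sg', ← this, sign_mul, sign_pow]
        have e1 := key x t hx1 hqt
        have e2 := key x' (φ t) hx2 hqt'
        rw [hφ _ (Or.inl (Or.inr (Or.inr (Or.inr ⟨(q, k), ⟨hq, hkd⟩, rfl⟩)))) t, ← e2,
          ← hcq] at e1
        refine mul_left_cancel₀ (pow_ne_zero m ?_) e1
        rwa [Ne, sign_eq_zero_iff]
      · exact hT2 t ht
      · exact hT1 t ht)
  exact ⟨ψ, fun q hq => h1 ⟨q, hq⟩, h2⟩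

theorem good_all (d : ℕ) : ∀ L : Set R[X], L.Finite → (∀ q ∈ L, q.natDegree ≤ d) → Good ev L := by
  induction d with
  | zero => exact fun L hL h => good_const ev hL h
  | succ d ih =>
    intro L hL
    have key : ∀ L : Set R[X], L.Finite → (∀ q ∈ L, q.natDegree ≤ d + 1) →
        ∀ P : Set R[X], P.Finite → (∀ q ∈ P, q.natDegree ≤ d) → Good ev (P ∪ L) := by
      intro L hL
      induction L, hL using Set.Finite.induction_on with
      | empty => intro _ P hP h; rw [Set.union_empty]; exact ih P hP h
      | @insert p L _ hL ih2 =>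
        intro h P hP hPd
        rw [Set.union_insert]
        refine good_insert ev (hP.union hL) (h p (Or.inl rfl)) ?_ fun P' hP' hPd' => ?_
        · rintro q (hq | hq)
          · exact (hPd q hq).trans (by omega)
          · exact h q (Or.inr hq)
        · rw [← Set.union_assoc]
          refine ih2 (fun q hq => h q (Or.inr hq)) _ (hP'.union hP) ?_
          rintro q (hq | hq)
          · exact hPd' q hq
          · exact hPd q hq
    intro h
    have := key L hL h ∅ Set.finite_empty (by simp)
    rwa [Set.empty_union] at this

theorem good_finite {L : Set R[X]} (hL : L.Finite) : Good ev L := by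
  obtain ⟨d, hd⟩ := (hL.image natDegree).bddAbove
  exact good_all ev d L hL fun q hq => hd ⟨q, hq, rfl⟩

end elim
end TC

namespace TC

/-- Semialgebraic sets: membership depends only on the signs of finitely many polynomials. -/
def SA {σ : Type} (S : Set (σ → ℝ)) : Prop := ∃ P : Set (MvPolynomial σ ℝ), P.Finite ∧
  ∀ x y, (∀ p ∈ P, SignType.sign (p.eval x) = SignType.sign (p.eval y)) → (x ∈ S → y ∈ S)

namespace SA
open MvPolynomial
variable {σ τ : Type} {S T : Set (σ → ℝ)}

theorem compl (h : SA S) : SA {x | x ∉ S} := by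
  obtain ⟨P, hP, h⟩ := h
  exact ⟨P, hP, fun x y hxy hx hy => hx (h y x (fun p hp => (hxy p hp).symm) hy)⟩

theorem inter (h : SA S) (h' : SA T) : SA {x | x ∈ S ∧ x ∈ T} := by
  obtain ⟨P, hP, h⟩ := h
  obtain ⟨P', hP', h'⟩ := h'
  exact ⟨P ∪ P', hP.union hP', fun x y hxy hx =>
    ⟨h x y (fun p hp => hxy p (Or.inl hp)) hx.1, h' x y (fun p hp => hxy p (Or.inr hp)) hx.2⟩⟩

theorem imp (h : SA S) (h' : SA T) : SA {x | x ∈ S → x ∈ T} := by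
  have := (h.inter h'.compl).compl
  simpa using this

theorem pos (p : MvPolynomial σ ℝ) : SA {x | 0 < p.eval x} :=
  ⟨{p}, Set.finite_singleton p, fun x y h hx => by
    have := h p rfl
    rw [sign_pos hx] at this
    exact sign_eq_one_iff.1 this.symm⟩

theorem lt (p q : MvPolynomial σ ℝ) : SA {x | p.eval x < q.eval x} := by
  simpa using pos (q - p)

theorem le (p q : MvPolynomial σ ℝ) : SA {x | p.eval x ≤ q.eval x} := by
  simpa using (lt q p).compl

theorem eq (p q : MvPolynomial σ ℝ) : SA {x | p.eval x = q.eval x} := by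
  simpa [← le_antisymm_iff] using (le p q).inter (le q p)

theorem eval_bind₁' (g : σ → MvPolynomial τ ℝ) (x : τ → ℝ) (p : MvPolynomial σ ℝ) :
    (bind₁ g p).eval x = p.eval fun i => (g i).eval x := by
  induction p using MvPolynomial.induction_on with
  | C a => rw [bind₁_C_right, eval_C, eval_C]
  | add p q hp hq => simp only [map_add, hp, hq]
  | mul_X p i hp => simp only [map_mul, hp, bind₁_X_right, eval_X]

theorem comap (h : SA S) (g : σ → MvPolynomial τ ℝ) :
    SA {x : τ → ℝ | (fun i => (g i).eval x) ∈ S} := by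
  obtain ⟨P, hP, h⟩ := h
  refine ⟨bind₁ g '' P, hP.image _, fun x y hxy => h _ _ fun p hp => ?_⟩
  have := hxy _ ⟨p, hp, rfl⟩
  rwa [eval_bind₁', eval_bind₁'] at this

theorem rename (h : SA S) (g : σ → τ) : SA {x : τ → ℝ | (fun i => x (g i)) ∈ S} := by
  simpa using h.comap fun i => X (g i)

theorem eval_lift [DecidableEq σ] (k : σ) (p : MvPolynomial σ ℝ) (x : σ → ℝ) (t : ℝ) :
    ((aeval (fun j => if j = k then Polynomial.X else Polynomial.C (X j)) p :
      Polynomial (MvPolynomial σ ℝ)).map (eval x)).eval t = p.eval (Function.update x k t) := by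
  induction p using MvPolynomial.induction_on with
  | C a => simp [Polynomial.algebraMap_apply, algebraMap_eq]
  | add p q hp hq => simp [hp, hq]
  | mul_X p i hp =>
    rw [map_mul, Polynomial.map_mul, Polynomial.eval_mul, hp, aeval_X, map_mul, eval_X]
    by_cases h : i = k
    · subst h; simp
    · simp [h]

theorem exv [DecidableEq σ] (h : SA S) (k : σ) : SA {x | ∃ t, Function.update x k t ∈ S} := by
  obtain ⟨P, hP, h⟩ := h
  obtain ⟨Q, hQ, hg⟩ := good_finite (fun x : σ → ℝ => eval x) (hP.image fun p =>
    (aeval (fun j => if j = k then Polynomial.X else Polynomial.C (X j)) p :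
      Polynomial (MvPolynomial σ ℝ)))
  refine ⟨Q, hQ, fun x y hxy => ?_⟩
  rintro ⟨t, ht⟩
  obtain ⟨φ, hφ⟩ := hg x y hxy
  refine ⟨φ t, h _ _ (fun p hp => ?_) ht⟩
  have := hφ _ ⟨p, hp, rfl⟩ t
  rwa [sg', sg', eval_lift, eval_lift] at this

theorem allv [DecidableEq σ] (h : SA S) (k : σ) : SA {x | ∀ t, Function.update x k t ∈ S} := by
  have := (h.compl.exv k).compl
  simpa using this

theorem ex_finset [DecidableEq σ] (h : SA S) (F : Finset σ) :
    SA {x | ∃ y ∈ S, ∀ i ∉ F, y i = x i} := by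
  induction F using Finset.induction_on with
  | empty =>
    convert h using 1
    ext x
    refine ⟨?_, fun hx => ⟨x, hx, fun _ _ => rfl⟩⟩
    rintro ⟨y, hy, hyx⟩
    have : y = x := funext fun i => hyx i (Finset.notMem_empty i)
    rwa [← this]
  | insert k F hk ih =>
    convert ih.exv k using 1
    ext x
    constructor
    · rintro ⟨y, hy, hyx⟩
      refine ⟨y k, y, hy, fun i hi => ?_⟩
      by_cases h : i = k
      · subst h; simp
      · rw [Function.update_of_ne h]
        exact hyx i (by simp [h, hi])
    · rintro ⟨t, y, hy, hyx⟩
      refine ⟨y, hy, fun i hi => ?_⟩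
      rw [Finset.mem_insert, not_or] at hi
      rw [hyx i hi.2, Function.update_of_ne hi.1]

theorem ex [Fintype τ] {S : Set (σ ⊕ τ → ℝ)} (h : SA S) :
    SA {x : σ → ℝ | ∃ y : τ → ℝ, Sum.elim x y ∈ S} := by
  classical
  have := (h.ex_finset (Finset.univ.map ⟨Sum.inr, Sum.inr_injective⟩)).comap (τ := σ)
    (Sum.elim X fun _ => 0)
  convert this using 1
  ext x
  constructor
  · rintro ⟨y, hy⟩
    refine ⟨_, hy, ?_⟩
    rintro (i | i) hi
    · simp
    · exact absurd (by simp) hi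
  · rintro ⟨y, hy, hyx⟩
    refine ⟨fun i => y (Sum.inr i), ?_⟩
    have : Sum.elim x (fun i => y (Sum.inr i)) = y := by
      ext (i | i)
      · have := hyx (Sum.inl i) (by simp)
        simpa using this.symm
      · rfl
    rwa [this]

end SA
end TC

namespace TC
open Filter Topology

theorem sign_right (p : Polynomial ℝ) (a : ℝ) : ∃ s, ∀ᶠ t in 𝓝[>] a, sg' p t = s := by
  by_cases hp : p = 0
  · exact ⟨0, Eventually.of_forall fun t => by rw [sg', hp, Polynomial.eval_zero, sign_zero]⟩
  · have hf : {t | p.eval t = 0 ∧ a < t}.Finite :=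
      (p.roots.toFinset.finite_toSet).subset fun u hu => by simpa [hp] using hu.1
    have : ∀ᶠ t in 𝓝[>] a, t ∉ {t | p.eval t = 0 ∧ a < t} :=
      mem_nhdsWithin_of_mem_nhds (hf.isClosed.isOpen_compl.mem_nhds fun h => lt_irrefl _ h.2)
    obtain ⟨b, hab, hb⟩ := mem_nhdsGT_iff_exists_Ioo_subset.1 this
    obtain ⟨c, hc⟩ := exists_between (Set.mem_Ioi.1 hab)
    refine ⟨sg' p c, ?_⟩
    filter_upwards [Ioo_mem_nhdsGT hab] with t ht
    exact sign_const (fun s hs h => hb hs ⟨h, hs.1⟩) ht hc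

namespace SA
variable {σ : Type} {S : Set (σ → ℝ)}

/-- A semialgebraic set is eventually constant along a polynomial curve. -/
theorem eventually_right (h : SA S) (γ : σ → Polynomial ℝ) (a : ℝ) :
    (∀ᶠ t in 𝓝[>] a, (fun i => (γ i).eval t) ∈ S) ∨
      ∀ᶠ t in 𝓝[>] a, (fun i => (γ i).eval t) ∉ S := by
  obtain ⟨P, hP, h⟩ := h
  have ev : ∀ (p : MvPolynomial σ ℝ) t, (MvPolynomial.aeval γ p).eval t =
      p.eval fun i => (γ i).eval t := fun p t => by
    induction p using MvPolynomial.induction_on with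
    | C a => simp
    | add p q hp hq => simp [hp, hq]
    | mul_X p i hp => simp [hp]
  have : ∀ᶠ t in 𝓝[>] a, ∀ p ∈ P, sg' (MvPolynomial.aeval γ p) t =
      (sign_right (MvPolynomial.aeval γ p) a).choose :=
    (eventually_all_finite hP).2 fun p _ => (sign_right (MvPolynomial.aeval γ p) a).choose_spec
  have key : ∀ t s, (∀ p ∈ P, sg' (MvPolynomial.aeval γ p) t =
      (sign_right (MvPolynomial.aeval γ p) a).choose) → (∀ p ∈ P, sg' (MvPolynomial.aeval γ p) s =
      (sign_right (MvPolynomial.aeval γ p) a).choose) → (fun i => (γ i).eval t) ∈ S →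
      (fun i => (γ i).eval s) ∈ S := fun t s ht hs => h _ _ fun p hp => by
    have := (ht p hp).trans (hs p hp).symm
    rwa [sg', sg', ev, ev] at this
  by_cases hS : ∃ t, (∀ p ∈ P, sg' (MvPolynomial.aeval γ p) t =
      (sign_right (MvPolynomial.aeval γ p) a).choose) ∧ (fun i => (γ i).eval t) ∈ S
  · obtain ⟨t, ht, htS⟩ := hS
    exact Or.inl (this.mono fun s hs => key t s ht hs htS)
  · exact Or.inr (this.mono fun s hs hsS => hS ⟨s, hs, hsS⟩)

theorem eventually_left (h : SA S) (γ : σ → Polynomial ℝ) (a : ℝ) :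
    (∀ᶠ t in 𝓝[<] a, (fun i => (γ i).eval t) ∈ S) ∨
      ∀ᶠ t in 𝓝[<] a, (fun i => (γ i).eval t) ∉ S := by
  have hn : Tendsto (fun t : ℝ => -t) (𝓝[<] a) (𝓝[>] (-a)) := tendsto_neg_nhdsLT
  refine (h.eventually_right (fun i => (γ i).comp (-Polynomial.X)) (-a)).imp ?_ ?_
  · intro h
    simpa using hn.eventually h
  · intro h
    simpa using hn.eventually h

theorem right_class {R : ℝ → ℝ → Prop} (h : SA {x : ℕ → ℝ | R (x 0) (x 1)}) :
    SA {x : ℕ → ℝ | ∀ᶠ s in 𝓝[>] (x 0), R (x 0) s} := by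
  have h1 := h.rename (τ := ℕ) fun i => if i = 0 then 0 else 2
  have h2 := (((lt (MvPolynomial.X 0) (MvPolynomial.X 2)).imp
    ((lt (MvPolynomial.X 2) (MvPolynomial.X 1)).imp h1)).allv 2)
  have h3 := ((lt (MvPolynomial.X 0) (MvPolynomial.X 1)).inter h2).exv 1
  convert h3 using 1
  ext x
  simp only [Set.mem_ofPred_eq, MvPolynomial.eval_X, Function.update_apply]
  constructor
  · intro h
    obtain ⟨b, hab, hb⟩ := mem_nhdsGT_iff_exists_Ioo_subset.1 h
    exact ⟨b, by simpa using hab, fun s => by simpa using fun h1 h2 => hb ⟨h1, h2⟩⟩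
  · rintro ⟨b, hab, hb⟩
    refine mem_nhdsGT_iff_exists_Ioo_subset.2 ⟨b, by simpa using hab, fun s hs => ?_⟩
    simpa using hb s (by simpa using hs.1) (by simpa using hs.2)

theorem left_class {R : ℝ → ℝ → Prop} (h : SA {x : ℕ → ℝ | R (x 0) (x 1)}) :
    SA {x : ℕ → ℝ | ∀ᶠ s in 𝓝[<] (x 0), R (x 0) s} := by
  have h1 : SA {x : ℕ → ℝ | R (- x 0) (- x 1)} := by
    simpa using h.comap fun i => - MvPolynomial.X i
  have h2 := (right_class (R := fun t s => R (-t) (-s)) h1).comap (τ := ℕ) fun i => - MvPolynomial.X i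
  convert h2 using 1
  ext x
  simp only [Set.mem_ofPred_eq, map_neg, MvPolynomial.eval_X, neg_neg]
  have hn : map (fun t : ℝ => -t) (𝓝[>] (-(x 0))) = 𝓝[<] (x 0) := by
    simp
  rw [← hn]; rfl

end SA

theorem monotoneOn_of_local {u : ℝ → ℝ} {a b : ℝ} (h1 : ∀ t ∈ Set.Ioo a b, ∀ᶠ s in 𝓝[>] t, u t ≤ u s)
    (h2 : ∀ t ∈ Set.Ioo a b, ∀ᶠ s in 𝓝[<] t, u s ≤ u t) : MonotoneOn u (Set.Ioo a b) := by
  intro x hx y hy hxy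
  let A : Set ℝ := {t | t ∈ Set.Icc x y ∧ ∀ s ∈ Set.Icc x t, u x ≤ u s}
  have hxA : x ∈ A := ⟨⟨le_rfl, hxy⟩, fun s hs => by rw [le_antisymm hs.2 hs.1]⟩
  have hbd : BddAbove A := ⟨y, fun t ht => ht.1.2⟩
  set τ := sSup A with hτ
  have hxτ : x ≤ τ := le_csSup hbd hxA
  have hτy : τ ≤ y := csSup_le ⟨x, hxA⟩ fun t ht => ht.1.2
  have hτI : τ ∈ Set.Ioo a b := ⟨hx.1.trans_le hxτ, hτy.trans_lt hy.2⟩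
  have hlt : ∀ s, x ≤ s → s < τ → u x ≤ u s := fun s hs hsτ => by
    obtain ⟨t, ht, hst⟩ := exists_lt_of_lt_csSup ⟨x, hxA⟩ hsτ
    exact ht.2 s ⟨hs, hst.le⟩
  have hτu : u x ≤ u τ := by
    rcases hxτ.eq_or_lt with h | h
    · rw [← h]
    · obtain ⟨s, hs, hs'⟩ := ((h2 τ hτI).and (Ioo_mem_nhdsLT h)).exists
      exact (hlt s hs'.1.le hs'.2).trans hs
  have hτA : ∀ s ∈ Set.Icc x τ, u x ≤ u s := fun s hs => by
    rcases hs.2.eq_or_lt with h | h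
    · rwa [h]
    · exact hlt s hs.1 h
  rcases hτy.eq_or_lt with h | h
  · rwa [← h]
  · exfalso
    obtain ⟨c, hc, hcs⟩ := mem_nhdsGT_iff_exists_Ioo_subset.1 (h1 τ hτI)
    obtain ⟨d, hd⟩ := exists_between (lt_min (Set.mem_Ioi.1 hc) h)
    have : d ∈ A := ⟨⟨hxτ.trans hd.1.le, (hd.2.trans_le (min_le_right _ _)).le⟩, fun s hs => by
      rcases le_or_gt s τ with h' | h'
      · exact hτA s ⟨hs.1, h'⟩
      · exact hτu.trans (hcs ⟨h', hs.2.trans_lt (hd.2.trans_le (min_le_left _ _))⟩)⟩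
    exact not_le.2 hd.1 (le_csSup hbd this)

/-- Not every point of an interval is a strict local minimum. -/
theorem not_strict_min {u : ℝ → ℝ} {a b : ℝ} (hab : a < b)
    (h1 : ∀ t ∈ Set.Ioo a b, ∀ᶠ s in 𝓝[>] t, u t < u s)
    (h2 : ∀ t ∈ Set.Ioo a b, ∀ᶠ s in 𝓝[<] t, u t < u s) : False := by
  have key : ∀ t : Set.Ioo a b, ∃ z : ℚ × ℚ, (z.1 : ℝ) < t ∧ (t : ℝ) < z.2 ∧
      ∀ s, (z.1 : ℝ) < s → s < z.2 → s ≠ t → u t < u s := fun t => by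
    obtain ⟨c, hc, hcs⟩ := mem_nhdsGT_iff_exists_Ioo_subset.1 (h1 t t.2)
    obtain ⟨d, hd, hds⟩ := mem_nhdsLT_iff_exists_Ioo_subset.1 (h2 t t.2)
    obtain ⟨p, hp1, hp2⟩ := exists_rat_btwn (Set.mem_Iio.1 hd)
    obtain ⟨q, hq1, hq2⟩ := exists_rat_btwn (Set.mem_Ioi.1 hc)
    refine ⟨(p, q), hp2, hq1, fun s hs1 hs2 hne => ?_⟩
    rcases lt_or_gt_of_ne hne with h | h
    · exact hds ⟨hp1.trans hs1, h⟩
    · exact hcs ⟨h, hs2.trans hq2⟩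
  choose z hz1 hz2 hz3 using key
  have hinj : Function.Injective z := fun t t' h => by
    by_contra hne
    have hne' : (t : ℝ) ≠ t' := fun h => hne (Subtype.ext h)
    have h3 := hz3 t t' (h ▸ hz1 t') (h ▸ hz2 t') hne'.symm
    have h4 := hz3 t' t (h ▸ hz1 t) (h ▸ hz2 t) hne'
    exact lt_asymm h3 h4
  have hc : (Set.Ioo a b).Countable := by
    rw [← Set.countable_coe_iff]
    exact hinj.countable
  obtain ⟨x, hx, hx'⟩ := (hc.dense_compl ℝ).exists_mem_open isOpen_Ioo (Set.nonempty_Ioo.2 hab)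
  exact hx hx'

/-- Semialgebraic functions of one variable are eventually monotone or antitone. -/
theorem SA.mono {u : ℝ → ℝ} {ε : ℝ} (hε : 0 < ε)
    (h : SA {x : ℕ → ℝ | x 0 ∈ Set.Ioo 0 ε ∧ x 1 ∈ Set.Ioo 0 ε ∧ u (x 0) ≤ u (x 1)}) :
    ∃ δ, 0 < δ ∧ δ ≤ ε ∧ (MonotoneOn u (Set.Ioo 0 δ) ∨ AntitoneOn u (Set.Ioo 0 δ)) := by
  let R : ℝ → ℝ → Prop := fun t s => t ∈ Set.Ioo 0 ε ∧ s ∈ Set.Ioo 0 ε ∧ u t ≤ u s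
  have h0 : SA {x : ℕ → ℝ | R (x 0) (x 1)} := h
  have h' : SA {x : ℕ → ℝ | R (x 1) (x 0)} := by
    exact h.rename (τ := ℕ) fun i => if i = 0 then 1 else 0
  have unary : ∀ {A : ℝ → Prop}, SA {x : ℕ → ℝ | A (x 0)} →
      (∀ᶠ t in 𝓝[>] 0, A t) ∨ ∀ᶠ t in 𝓝[>] 0, ¬ A t := fun hA => by
    simpa using hA.eventually_right (fun _ => Polynomial.X) 0
  have hI : ∀ᶠ t in 𝓝[>] (0 : ℝ), t ∈ Set.Ioo 0 ε := Ioo_mem_nhdsGT hε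
  have dich : ∀ {P : ℝ → Prop}, (∀ᶠ t in 𝓝[>] (0 : ℝ), P t) →
      ∃ δ, 0 < δ ∧ δ ≤ ε ∧ ∀ t ∈ Set.Ioo 0 δ, P t := fun {P} hP => by
    obtain ⟨b, hb, hbs⟩ := mem_nhdsGT_iff_exists_Ioo_subset.1 hP
    exact ⟨min b ε, lt_min hb hε, min_le_right _ _, fun t ht =>
      hbs ⟨ht.1, ht.2.trans_le (min_le_left _ _)⟩⟩
  have rI : ∀ {t}, t ∈ Set.Ioo 0 ε → ∀ᶠ s in 𝓝[>] t, s ∈ Set.Ioo 0 ε := fun ht =>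
    mem_nhdsWithin_of_mem_nhds (isOpen_Ioo.mem_nhds ht)
  have lI : ∀ {t}, t ∈ Set.Ioo 0 ε → ∀ᶠ s in 𝓝[<] t, s ∈ Set.Ioo 0 ε := fun ht =>
    mem_nhdsWithin_of_mem_nhds (isOpen_Ioo.mem_nhds ht)
  have hR : ∀ t, (∀ᶠ s in 𝓝[>] t, R t s) ∨ ∀ᶠ s in 𝓝[>] t, ¬ R t s := fun t => by
    simpa using h0.eventually_right (fun i => if i = 0 then Polynomial.C t else Polynomial.X) t
  have hR' : ∀ t, (∀ᶠ s in 𝓝[>] t, R s t) ∨ ∀ᶠ s in 𝓝[>] t, ¬ R s t := fun t => by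
    simpa using h'.eventually_right (fun i => if i = 0 then Polynomial.C t else Polynomial.X) t
  have hL : ∀ t, (∀ᶠ s in 𝓝[<] t, R t s) ∨ ∀ᶠ s in 𝓝[<] t, ¬ R t s := fun t => by
    simpa using h0.eventually_left (fun i => if i = 0 then Polynomial.C t else Polynomial.X) t
  have hL' : ∀ t, (∀ᶠ s in 𝓝[<] t, R s t) ∨ ∀ᶠ s in 𝓝[<] t, ¬ R s t := fun t => by
    simpa using h'.eventually_left (fun i => if i = 0 then Polynomial.C t else Polynomial.X) t
  have A1 := unary (A := fun t => ∀ᶠ s in 𝓝[>] t, R t s) (SA.right_class (R := R) h0)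
  have A2 := unary (A := fun t => ∀ᶠ s in 𝓝[>] t, R s t) (SA.right_class (R := fun t s => R s t) h')
  have B1 := unary (A := fun t => ∀ᶠ s in 𝓝[<] t, R s t) (SA.left_class (R := fun t s => R s t) h')
  have B2 := unary (A := fun t => ∀ᶠ s in 𝓝[<] t, R t s) (SA.left_class (R := R) h0)
  have cA : (∀ᶠ t in 𝓝[>] 0, ∀ᶠ s in 𝓝[>] t, R t s) ∨
      ∀ᶠ t in 𝓝[>] 0, ∀ᶠ s in 𝓝[>] t, u s < u t := A1.imp_right fun hA => by
    filter_upwards [hA, hI] with t ht htI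
    filter_upwards [(hR t).resolve_left ht, rI htI] with s hs hsI
    exact not_le.1 fun h => hs ⟨htI, hsI, h⟩
  have cA' : (∀ᶠ t in 𝓝[>] 0, ∀ᶠ s in 𝓝[>] t, R s t) ∨
      ∀ᶠ t in 𝓝[>] 0, ∀ᶠ s in 𝓝[>] t, u t < u s := A2.imp_right fun hA => by
    filter_upwards [hA, hI] with t ht htI
    filter_upwards [(hR' t).resolve_left ht, rI htI] with s hs hsI
    exact not_le.1 fun h => hs ⟨hsI, htI, h⟩
  have cB : (∀ᶠ t in 𝓝[>] 0, ∀ᶠ s in 𝓝[<] t, R s t) ∨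
      ∀ᶠ t in 𝓝[>] 0, ∀ᶠ s in 𝓝[<] t, u t < u s := B1.imp_right fun hA => by
    filter_upwards [hA, hI] with t ht htI
    filter_upwards [(hL' t).resolve_left ht, lI htI] with s hs hsI
    exact not_le.1 fun h => hs ⟨hsI, htI, h⟩
  have cB' : (∀ᶠ t in 𝓝[>] 0, ∀ᶠ s in 𝓝[<] t, R t s) ∨
      ∀ᶠ t in 𝓝[>] 0, ∀ᶠ s in 𝓝[<] t, u s < u t := B2.imp_right fun hA => by
    filter_upwards [hA, hI] with t ht htI
    filter_upwards [(hL t).resolve_left ht, lI htI] with s hs hsI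
    exact not_le.1 fun h => hs ⟨htI, hsI, h⟩
  have up : (∀ᶠ t in 𝓝[>] 0, ∀ᶠ s in 𝓝[>] t, u t ≤ u s) →
      (∀ᶠ t in 𝓝[>] 0, ∀ᶠ s in 𝓝[<] t, u s ≤ u t) →
      ∃ δ, 0 < δ ∧ δ ≤ ε ∧ (MonotoneOn u (Set.Ioo 0 δ) ∨ AntitoneOn u (Set.Ioo 0 δ)) := by
    intro h1 h2
    obtain ⟨δ, hδ, hδε, hs⟩ := dich (h1.and h2)
    exact ⟨δ, hδ, hδε, Or.inl (monotoneOn_of_local (fun t ht => (hs t ht).1) fun t ht => (hs t ht).2)⟩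
  have dn : (∀ᶠ t in 𝓝[>] 0, ∀ᶠ s in 𝓝[>] t, u s ≤ u t) →
      (∀ᶠ t in 𝓝[>] 0, ∀ᶠ s in 𝓝[<] t, u t ≤ u s) →
      ∃ δ, 0 < δ ∧ δ ≤ ε ∧ (MonotoneOn u (Set.Ioo 0 δ) ∨ AntitoneOn u (Set.Ioo 0 δ)) := by
    intro h1 h2
    obtain ⟨δ, hδ, hδε, hs⟩ := dich (h1.and h2)
    have := monotoneOn_of_local (u := fun t => - u t)
      (fun t ht => (hs t ht).1.mono fun s => neg_le_neg)
      fun t ht => (hs t ht).2.mono fun s => neg_le_neg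
    exact ⟨δ, hδ, hδε, Or.inr fun x hx y hy hxy => neg_le_neg_iff.1 (this hx hy hxy)⟩
  rcases cA with a | a <;> rcases cB with b | b
  · exact up (a.mono fun t ht => ht.mono fun s hs => hs.2.2) (b.mono fun t ht => ht.mono fun s hs => hs.2.2)
  · rcases cA' with a' | a'
    · exact dn (a'.mono fun t ht => ht.mono fun s hs => hs.2.2) (b.mono fun t ht => ht.mono fun s => le_of_lt)
    · obtain ⟨δ, hδ, hδε, hs⟩ := dich (a'.and b)
      exact (not_strict_min hδ (fun t ht => (hs t ht).1) fun t ht => (hs t ht).2).elim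
  · rcases cB' with b' | b'
    · exact dn (a.mono fun t ht => ht.mono fun s => le_of_lt) (b'.mono fun t ht => ht.mono fun s hs => hs.2.2)
    · obtain ⟨δ, hδ, hδε, hs⟩ := dich (a.and b')
      exact (not_strict_min (u := fun t => - u t) hδ
        (fun t ht => (hs t ht).1.mono fun s => neg_lt_neg) fun t ht =>
          (hs t ht).2.mono fun s => neg_lt_neg).elim
  · exact dn (a.mono fun t ht => ht.mono fun s => le_of_lt) (b.mono fun t ht => ht.mono fun s => le_of_lt)

end TC

namespace TC
open Filter Topology MvPolynomial

variable {ι : Type} [Fintype ι]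

/-- Taylor estimates for polynomials on balls. -/
theorem taylor (f : MvPolynomial ι ℝ) (r : ℝ) (hr : 0 ≤ r) : ∃ C, 0 ≤ C ∧ ∀ x y : ι → ℝ,
    ‖x‖ ≤ r → ‖y‖ ≤ r → |f.eval x| ≤ C ∧ |f.eval y - f.eval x| ≤ C * ‖y - x‖ ∧
      |f.eval y - f.eval x - ∑ i, (pderiv i f).eval x * (y i - x i)| ≤ C * ‖y - x‖ ^ 2 := by
  classical
  induction f using MvPolynomial.induction_on with
  | C a =>
    refine ⟨|a|, abs_nonneg _, fun x y _ _ => ⟨by simp, ?_, ?_⟩⟩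
    · simp only [eval_C, sub_self, abs_zero]; positivity
    · simp only [eval_C, sub_self, pderiv_C, map_zero, zero_mul, Finset.sum_const_zero, abs_zero]
      positivity
  | add p q hp hq =>
    obtain ⟨C1, h1, hC1⟩ := hp
    obtain ⟨C2, h2, hC2⟩ := hq
    refine ⟨C1 + C2, add_nonneg h1 h2, fun x y hx hy => ?_⟩
    obtain ⟨a1, a2, a3⟩ := hC1 x y hx hy
    obtain ⟨b1, b2, b3⟩ := hC2 x y hx hy
    simp only [map_add, add_mul, Finset.sum_add_distrib]
    refine ⟨(abs_add_le _ _).trans (add_le_add a1 b1), ?_, ?_⟩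
    · refine le_trans (le_of_eq_of_le ?_ (abs_add_le _ _)) (add_le_add a2 b2)
      congr 1; ring
    · refine le_trans (le_of_eq_of_le ?_ (abs_add_le _ _)) (add_le_add a3 b3)
      congr 1; ring
  | mul_X p j hp =>
    obtain ⟨C, h, hC⟩ := hp
    refine ⟨C * (r + 1), by positivity, fun x y hx hy => ?_⟩
    obtain ⟨a1, a2, a3⟩ := hC x y hx hy
    have hxj : |x j| ≤ r := (norm_le_pi_norm x j).trans hx
    have hyj : |y j| ≤ r := (norm_le_pi_norm y j).trans hy
    have hd : |y j - x j| ≤ ‖y - x‖ := norm_le_pi_norm (y - x) j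
    have hn := norm_nonneg (y - x)
    simp only [map_mul, eval_X, Derivation.leibniz, smul_eq_mul, pderiv_X, map_add]
    refine ⟨?_, ?_, ?_⟩
    · rw [abs_mul]
      exact (mul_le_mul a1 hxj (abs_nonneg _) h).trans (by nlinarith)
    · rw [show p.eval y * y j - p.eval x * x j = (p.eval y - p.eval x) * y j +
        p.eval x * (y j - x j) by ring]
      refine (abs_add_le _ _).trans ?_
      rw [abs_mul, abs_mul]
      have e1 := mul_le_mul a2 hyj (abs_nonneg _) (by positivity)
      have e2 := mul_le_mul a1 hd (abs_nonneg _) h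
      linarith
    · have hs : ∑ i, (p.eval x * (eval x) (Pi.single (M := fun _ => MvPolynomial ι ℝ) i 1 j) +
          x j * (pderiv i p).eval x) * (y i - x i) =
          p.eval x * (y j - x j) + x j * ∑ i, (pderiv i p).eval x * (y i - x i) := by
        simp only [add_mul, Finset.sum_add_distrib, Finset.mul_sum, mul_assoc]
        congr 1
        rw [Finset.sum_eq_single j]
        · simp
        · intro b _ hb; simp [hb.symm]
        · simp
      rw [hs, show p.eval y * y j - p.eval x * x j - (p.eval x * (y j - x j) +
        x j * ∑ i, (pderiv i p).eval x * (y i - x i)) = x j * (p.eval y - p.eval x -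
          ∑ i, (pderiv i p).eval x * (y i - x i)) + (p.eval y - p.eval x) * (y j - x j) by ring]
      refine (abs_add_le _ _).trans ?_
      rw [abs_mul, abs_mul]
      have e1 := mul_le_mul hxj a3 (abs_nonneg _) hr
      have e2 := mul_le_mul a2 hd (abs_nonneg _) (by positivity)
      nlinarith

/-- Semialgebraic families of sets over the line. -/
def SAF (K : ℝ → Set (ι → ℝ)) : Prop :=
  SA {x : Unit ⊕ ι → ℝ | (fun i => x (Sum.inr i)) ∈ K (x (Sum.inl ()))}

/-- Fiberwise minimizers. -/
def argmin (K : ℝ → Set (ι → ℝ)) (g : MvPolynomial ι ℝ) (t : ℝ) : Set (ι → ℝ) :=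
  {y | y ∈ K t ∧ ∀ z ∈ K t, g.eval y ≤ g.eval z}

theorem SAF.argmin {K : ℝ → Set (ι → ℝ)} (h : SAF K) (g : MvPolynomial ι ℝ) :
    SAF (argmin K g) := by
  have h1 := SA.rename (τ := (Unit ⊕ ι) ⊕ ι) h (Sum.elim (Sum.inl ∘ Sum.inl) Sum.inr)
  have h2 := h1.inter (SA.lt (MvPolynomial.rename Sum.inr g)
    (MvPolynomial.rename (Sum.inl ∘ Sum.inr) g))
  have h3 := SA.inter h h2.ex.compl
  unfold SAF
  convert h3 using 1
  ext x
  simp only [TC.argmin, Set.mem_ofPred_eq, Sum.elim_inl, Sum.elim_inr, Function.comp,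
    eval_rename, not_exists, not_and, not_lt]
  exact Iff.rfl

def argmins (K : ℝ → Set (ι → ℝ)) (l : List (MvPolynomial ι ℝ)) : ℝ → Set (ι → ℝ) :=
  l.foldl argmin K

theorem SAF.argmins {K : ℝ → Set (ι → ℝ)} (l : List (MvPolynomial ι ℝ)) (h : SAF K) :
    SAF (argmins K l) := by
  induction l generalizing K with
  | nil => exact h
  | cons g l ih => exact ih (h.argmin g)

theorem argmins_subset {K : ℝ → Set (ι → ℝ)} (l : List (MvPolynomial ι ℝ)) (t : ℝ) :
    argmins K l t ⊆ K t := by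
  induction l generalizing K with
  | nil => exact subset_rfl
  | cons g l ih => exact ih.trans fun x hx => hx.1

theorem argmins_nonempty {K : ℝ → Set (ι → ℝ)} (l : List (MvPolynomial ι ℝ)) {t : ℝ}
    (hc : IsCompact (K t)) (hn : (K t).Nonempty) : (argmins K l t).Nonempty := by
  induction l generalizing K with
  | nil => exact hn
  | cons g l ih =>
    obtain ⟨x, hx, hmin⟩ := hc.exists_isMinOn hn (MvPolynomial.continuous_eval g).continuousOn
    refine ih ?_ ⟨x, hx, hmin⟩
    refine hc.of_isClosed_subset ?_ fun x hx => hx.1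
    have : argmin K g t = K t ∩ {y | g.eval y ≤ g.eval x} := by
      ext y
      exact ⟨fun h => ⟨h.1, h.2 x hx⟩, fun h => ⟨h.1, fun z hz => h.2.trans (hmin hz)⟩⟩
    rw [this]
    exact hc.isClosed.inter (isClosed_le (MvPolynomial.continuous_eval g) continuous_const)

theorem argmins_le {K : ℝ → Set (ι → ℝ)} (l : List (MvPolynomial ι ℝ)) {t : ℝ} {y z : ι → ℝ}
    {g : MvPolynomial ι ℝ} (hg : g ∈ l) (hy : y ∈ argmins K l t) (hz : z ∈ argmins K l t) :
    g.eval y ≤ g.eval z := by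
  induction l generalizing K with
  | nil => simp at hg
  | cons g' l ih =>
    rcases List.mem_cons.1 hg with rfl | hg
    · exact (argmins_subset l t hy).2 z (argmins_subset l t hz).1
    · exact ih hg hy hz

/-- Monotonicity for polynomial functions of a semialgebraic curve. -/
theorem SAF.mono {K : ℝ → Set (ι → ℝ)} (h : SAF K) {ε : ℝ} (hε : 0 < ε) {x : ℝ → ι → ℝ}
    (hx : ∀ t ∈ Set.Ioo 0 ε, ∀ y, y ∈ K t ↔ y = x t) (g : MvPolynomial ι ℝ) :
    ∃ δ, 0 < δ ∧ δ ≤ ε ∧ (MonotoneOn (fun t => g.eval (x t)) (Set.Ioo 0 δ) ∨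
      AntitoneOn (fun t => g.eval (x t)) (Set.Ioo 0 δ)) := by
  refine SA.mono hε ?_
  have h1 := SA.rename (τ := ℕ ⊕ (ι ⊕ ι)) h (Sum.elim (fun _ => Sum.inl 0) (Sum.inr ∘ Sum.inl))
  have h2 := SA.rename (τ := ℕ ⊕ (ι ⊕ ι)) h (Sum.elim (fun _ => Sum.inl 1) (Sum.inr ∘ Sum.inr))
  have h3 := ((h1.inter h2).inter (SA.le (MvPolynomial.rename (Sum.inr ∘ Sum.inl) g)
    (MvPolynomial.rename (Sum.inr ∘ Sum.inr) g))).ex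
  have I : ∀ k : ℕ, SA {x : ℕ → ℝ | x k ∈ Set.Ioo 0 ε} := fun k => by
    simpa using (SA.lt (MvPolynomial.C 0) (MvPolynomial.X k)).inter
      (SA.lt (MvPolynomial.X k) (MvPolynomial.C ε))
  convert (I 0).inter ((I 1).inter h3) using 1
  ext v
  simp only [Set.mem_ofPred_eq, Sum.elim_inl, Sum.elim_inr, Function.comp, eval_rename]
  refine and_congr_right fun h0 => and_congr_right fun h1 => ?_
  simp only [hx _ h0, hx _ h1]
  constructor
  · exact fun h => ⟨Sum.elim (x (v 0)) (x (v 1)), ⟨rfl, rfl⟩, h⟩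
  · rintro ⟨y, ⟨e1, e2⟩, h⟩
    rw [← e1, ← e2]
    exact h

theorem growth {V : ℝ → ℝ} {s' s c : ℝ} (hs : s' ≤ s) (hV : MonotoneOn V (Set.Icc s' s))
    (h : ∀ τ ∈ Set.Ico s' s, ∀ᶠ t in 𝓝[>] τ, c * (t - τ) ≤ V t - V τ) :
    c * (s - s') ≤ V s - V s' := by
  let A : Set ℝ := {t | t ∈ Set.Icc s' s ∧ c * (t - s') ≤ V t - V s'}
  have hA : s' ∈ A := ⟨⟨le_rfl, hs⟩, by simp⟩
  have hbd : BddAbove A := ⟨s, fun t ht => ht.1.2⟩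
  set τ := sSup A with hτ
  have h1 : s' ≤ τ := le_csSup hbd hA
  have h2 : τ ≤ s := csSup_le ⟨s', hA⟩ fun t ht => ht.1.2
  have hτA : c * (τ - s') ≤ V τ - V s' := by
    have : IsLUB A τ := isLUB_csSup ⟨s', hA⟩ hbd
    have hcl : τ ∈ closure A := this.mem_closure ⟨s', hA⟩
    have hsub : A ⊆ {t | c * (t - s') ≤ V τ - V s'} := fun t ht =>
      ht.2.trans (sub_le_sub_right (hV ht.1 ⟨h1, h2⟩ (le_csSup hbd ht)) _)
    exact closure_minimal hsub (isClosed_le (by fun_prop) continuous_const) hcl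
  rcases h2.eq_or_lt with h' | h'
  · rwa [h'] at hτA
  · exfalso
    obtain ⟨t, ht, htI⟩ := ((h τ ⟨h1, h'⟩).and (Ioo_mem_nhdsGT h')).exists
    have : t ∈ A := ⟨⟨h1.trans htI.1.le, htI.2.le⟩, by linarith⟩
    exact not_le.2 htI.1 (le_csSup hbd this)

/-- The squared length of the gradient. -/
def grad2 (f : MvPolynomial ι ℝ) : MvPolynomial ι ℝ := ∑ i, pderiv i f ^ 2

theorem eval_grad2 (f : MvPolynomial ι ℝ) (x : ι → ℝ) :
    (grad2 f).eval x = ∑ i, (pderiv i f).eval x ^ 2 := by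
  simp [grad2]

theorem grad2_nonneg (f : MvPolynomial ι ℝ) (x : ι → ℝ) : 0 ≤ (grad2 f).eval x := by
  rw [eval_grad2]; exact Finset.sum_nonneg fun i _ => sq_nonneg _

theorem abs_pderiv_le (f : MvPolynomial ι ℝ) (x : ι → ℝ) (i : ι) :
    |(pderiv i f).eval x| ≤ √((grad2 f).eval x) := by
  rw [← Real.sqrt_sq_eq_abs, eval_grad2]
  exact Real.sqrt_le_sqrt (Finset.single_le_sum (f := fun i => (pderiv i f).eval x ^ 2)
    (fun i _ => sq_nonneg _) (Finset.mem_univ i))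

theorem kl_curve (f b : MvPolynomial ι ℝ) (hb : IsCompact {y | b.eval y ≤ 0}) {ε : ℝ} (hε : 0 < ε)
    {x : ℝ → ι → ℝ} (hxf : ∀ t ∈ Set.Ioo 0 ε, f.eval (x t) = t)
    (hxb : ∀ t ∈ Set.Ioo 0 ε, b.eval (x t) ≤ 0)
    (hm : ∀ i, MonotoneOn (fun t => x t i) (Set.Ioo 0 ε) ∨ AntitoneOn (fun t => x t i) (Set.Ioo 0 ε))
    (hG : MonotoneOn (fun t => (grad2 f).eval (x t)) (Set.Ioo 0 ε) ∨
      AntitoneOn (fun t => (grad2 f).eval (x t)) (Set.Ioo 0 ε)) :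
    ∃ p, 0 < p ∧ p ≤ ε ∧ ∃ W : ℝ → ℝ, MonotoneOn W (Set.Ioo 0 p) ∧ BddBelow (W '' Set.Ioo 0 p) ∧
      ∀ s ∈ Set.Ioo 0 p, ∀ s' ∈ Set.Ioo 0 s, s - s' ≤ √((grad2 f).eval (x s)) * (W s - W s') := by
  obtain ⟨r, hr0, hr⟩ := hb.isBounded.exists_pos_norm_le
  have hxr : ∀ t ∈ Set.Ioo 0 ε, ‖x t‖ ≤ r := fun t ht => hr _ (hxb t ht)
  obtain ⟨C, hC0, hC⟩ := taylor f r hr0.le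
  have hcs : ∃ c : ι → ℝ, (∀ i, |c i| = 1) ∧ ∀ i, MonotoneOn (fun t => c i * x t i) (Set.Ioo 0 ε) := by
    have : ∀ i, ∃ c : ℝ, |c| = 1 ∧ MonotoneOn (fun t => c * x t i) (Set.Ioo 0 ε) := fun i => by
      rcases hm i with h | h
      · exact ⟨1, by simp, by simpa using h⟩
      · exact ⟨-1, by simp, by simpa using h.neg⟩
    choose c h1 h2 using this
    exact ⟨c, h1, h2⟩
  obtain ⟨c, hc1, hcm⟩ := hcs
  set V : ℝ → ℝ := fun t => ∑ i, c i * x t i with hVdef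
  have hVd : ∀ τ ∈ Set.Ioo 0 ε, ∀ t ∈ Set.Ioo 0 ε, τ ≤ t → V t - V τ = ∑ i, |x t i - x τ i| := by
    intro τ hτ t ht h
    simp only [hVdef]
    rw [← Finset.sum_sub_distrib]
    refine Finset.sum_congr rfl fun i _ => ?_
    have := hcm i hτ ht h
    simp only at this
    rw [← abs_of_nonneg (sub_nonneg.2 this), ← mul_sub, abs_mul, hc1, one_mul]
  have hVm : MonotoneOn V (Set.Ioo 0 ε) := fun τ hτ t ht h => by
    rw [← sub_nonneg, hVd τ hτ t ht h]
    exact Finset.sum_nonneg fun i _ => abs_nonneg _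
  have hVb : ∀ t ∈ Set.Ioo 0 ε, -∑ _i : ι, r ≤ V t := fun t ht => by
    rw [← Finset.sum_neg_distrib]
    refine Finset.sum_le_sum fun i _ => (abs_le.1 ?_).1
    rw [abs_mul, hc1, one_mul]
    exact (norm_le_pi_norm (x t) i).trans (hxr t ht)
  have loc : ∀ τ ∈ Set.Ioo 0 ε, ∀ t ∈ Set.Ioo 0 ε, τ ≤ t →
      t - τ ≤ (√((grad2 f).eval (x τ)) + C * (V t - V τ)) * (V t - V τ) := by
    intro τ hτ t ht h
    have h1 := (hC (x τ) (x t) (hxr τ hτ) (hxr t ht)).2.2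
    rw [hxf τ hτ, hxf t ht] at h1
    have hd := hVd τ hτ t ht h
    have hn : ‖x t - x τ‖ ≤ V t - V τ := by
      rw [hd]
      refine (pi_norm_le_iff_of_nonneg (Finset.sum_nonneg fun i _ => abs_nonneg _)).2 fun i => ?_
      exact Finset.single_le_sum (f := fun i => |x t i - x τ i|) (fun i _ => abs_nonneg _)
        (Finset.mem_univ i)
    have h2 : ∑ i, (pderiv i f).eval (x τ) * (x t i - x τ i) ≤
        √((grad2 f).eval (x τ)) * (V t - V τ) := by
      rw [hd, Finset.mul_sum]
      refine Finset.sum_le_sum fun i _ => (le_abs_self _).trans ?_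
      rw [abs_mul]
      exact mul_le_mul_of_nonneg_right (abs_pderiv_le f _ i) (abs_nonneg _)
    have h3 : ‖x t - x τ‖ ^ 2 ≤ (V t - V τ) ^ 2 := pow_le_pow_left₀ (norm_nonneg _) hn 2
    have h4 := (abs_le.1 h1).2
    nlinarith [mul_le_mul_of_nonneg_left h3 hC0]
  have loc' : ∀ τ ∈ Set.Ioo 0 ε, ∀ k : ℝ, 0 ≤ k → k * √((grad2 f).eval (x τ)) < 1 →
      ∀ᶠ t in 𝓝[>] τ, k * (t - τ) ≤ V t - V τ := by
    intro τ hτ k hk hk1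
    have hη : ∃ η > 0, k * (√((grad2 f).eval (x τ)) + C * η) ≤ 1 := by
      refine ⟨(1 - k * √((grad2 f).eval (x τ))) / (k * C + 1), div_pos (by linarith) (by positivity), ?_⟩
      have h1 : k * C * ((1 - k * √((grad2 f).eval (x τ))) / (k * C + 1)) ≤
          1 - k * √((grad2 f).eval (x τ)) := by
        rw [mul_div_assoc', div_le_iff₀ (by positivity)]
        nlinarith
      linarith
    obtain ⟨η, hη0, hη⟩ := hη
    have e1 : ∀ᶠ t in 𝓝[>] τ, k * (t - τ) < η := by
      have : ContinuousAt (fun t => k * (t - τ)) τ := by fun_prop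
      exact mem_nhdsWithin_of_mem_nhds (this.eventually_lt continuousAt_const (by simpa))
    filter_upwards [e1, Ioo_mem_nhdsGT hτ.2] with t h1 h2
    have ht : t ∈ Set.Ioo 0 ε := ⟨hτ.1.trans h2.1, h2.2⟩
    rcases le_or_gt (V t - V τ) η with h | h
    · have h3 := loc τ hτ t ht h2.1.le
      have h4 := sub_nonneg.2 (hVm hτ ht h2.1.le)
      have h5 : k * (√((grad2 f).eval (x τ)) + C * (V t - V τ)) ≤ 1 := by
        refine le_trans (mul_le_mul_of_nonneg_left ?_ hk) hη
        exact add_le_add le_rfl (mul_le_mul_of_nonneg_left h hC0)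
      nlinarith [mul_le_mul_of_nonneg_left h3 hk, mul_le_mul_of_nonneg_right h5 h4]
    · exact (h1.trans h).le
  have glob : ∀ s ∈ Set.Ioo 0 ε, ∀ s' ∈ Set.Ioo 0 s, ∀ m : ℝ, 0 ≤ m →
      (∀ τ ∈ Set.Ico s' s, √((grad2 f).eval (x τ)) ≤ m) → s - s' ≤ m * (V s - V s') := by
    intro s hs s' hs' m hm0 hm
    by_contra hlt
    rw [not_le] at hlt
    have hD : 0 ≤ V s - V s' := sub_nonneg.2 (hVm ⟨hs'.1, hs'.2.trans hs.2⟩ hs hs'.2.le)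
    have hss : 0 < s - s' := sub_pos.2 hs'.2
    obtain ⟨κ, hκ0, hκ⟩ : ∃ κ > 0, m * (V s - V s') + m * κ < s - s' := by
      refine ⟨(s - s' - m * (V s - V s')) / (m + 1), div_pos (by linarith) (by positivity), ?_⟩
      have : m * ((s - s' - m * (V s - V s')) / (m + 1)) < s - s' - m * (V s - V s') := by
        rw [mul_div_assoc', div_lt_iff₀ (by positivity)]
        nlinarith
      linarith
    have hk0 : 0 ≤ (V s - V s' + κ) / (s - s') := by positivity
    have := growth (V := V) hs'.2.le
      (hVm.mono fun t ht => ⟨hs'.1.trans_le ht.1, ht.2.trans_lt hs.2⟩) (c := (V s - V s' + κ) / (s - s'))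
      fun τ hτ => loc' τ ⟨hs'.1.trans_le hτ.1, hτ.2.trans hs.2⟩ _ hk0
        (lt_of_le_of_lt (mul_le_mul_of_nonneg_left (hm τ hτ) hk0) (by
          rw [div_mul_eq_mul_div, div_lt_one hss]; linarith))
    rw [div_mul_cancel₀ _ hss.ne'] at this
    linarith
  have hsub : ∀ {s s' : ℝ}, s ∈ Set.Ioo 0 ε → s' ∈ Set.Ioo 0 s → ∀ τ ∈ Set.Ico s' s,
      τ ∈ Set.Ioo 0 ε := fun hs hs' τ hτ => ⟨hs'.1.trans_le hτ.1, hτ.2.trans hs.2⟩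
  rcases hG with hG | hG
  · refine ⟨ε, hε, le_rfl, V, hVm, ⟨-∑ _i : ι, r, ?_⟩, fun s hs s' hs' => ?_⟩
    · rintro _ ⟨t, ht, rfl⟩
      exact hVb t ht
    · exact glob s hs s' hs' _ (Real.sqrt_nonneg _) fun τ hτ =>
        Real.sqrt_le_sqrt (hG (hsub hs hs' τ hτ) hs hτ.2.le)
  · have hp : ε / 2 ∈ Set.Ioo 0 ε := ⟨by linarith, by linarith⟩
    set m := √((grad2 f).eval (x (ε / 2))) with hmdef
    have hm0 : 0 < m := by
      refine (Real.sqrt_nonneg _).lt_of_ne' fun h0 => ?_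
      have hs : 3 * ε / 4 ∈ Set.Ioo 0 ε := ⟨by linarith, by linarith⟩
      have := glob (3 * ε / 4) hs (ε / 2) ⟨by linarith, by linarith⟩ 0 le_rfl fun τ hτ => by
        rw [← h0]
        exact Real.sqrt_le_sqrt (hG hp ⟨hp.1.trans_le hτ.1, hτ.2.trans hs.2⟩ hτ.1)
      linarith
    refine ⟨ε / 2, hp.1, hp.2.le, fun s => s / m, fun s _ t _ h => div_le_div_of_nonneg_right h hm0.le,
      ⟨0, ?_⟩, fun s hs s' hs' => ?_⟩
    · rintro _ ⟨t, ht, rfl⟩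
      exact div_nonneg ht.1.le hm0.le
    · have h1 : m ≤ √((grad2 f).eval (x s)) :=
        Real.sqrt_le_sqrt (hG ⟨hs.1, hs.2.trans hp.2⟩ hp hs.2.le)
      rw [← sub_div, mul_div_assoc', le_div_iff₀ hm0, mul_comm]
      exact mul_le_mul_of_nonneg_right h1 (sub_nonneg.2 hs'.2.le)

theorem SAF.mono_finite {K : ℝ → Set (ι → ℝ)} (h : SAF K) {ε : ℝ} (hε : 0 < ε) {x : ℝ → ι → ℝ}
    (hx : ∀ t ∈ Set.Ioo 0 ε, ∀ y, y ∈ K t ↔ y = x t) {κ : Type} [Finite κ]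
    (g : κ → MvPolynomial ι ℝ) :
    ∃ δ, 0 < δ ∧ δ ≤ ε ∧ ∀ k, MonotoneOn (fun t => (g k).eval (x t)) (Set.Ioo 0 δ) ∨
      AntitoneOn (fun t => (g k).eval (x t)) (Set.Ioo 0 δ) := by
  choose d hd0 hdε hd using fun k => h.mono hε hx (g k)
  have h1 : ∀ᶠ δ in 𝓝[>] (0 : ℝ), ∀ k, δ < d k :=
    eventually_all.2 fun k => mem_nhdsWithin_of_mem_nhds (isOpen_Iio.mem_nhds (hd0 k))
  obtain ⟨δ, hδ, hδ'⟩ := (h1.and (Ioo_mem_nhdsGT hε)).exists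
  refine ⟨δ, hδ'.1, hδ'.2.le, fun k => ?_⟩
  have hs : Set.Ioo 0 δ ⊆ Set.Ioo 0 (d k) := Set.Ioo_subset_Ioo_right (hδ k).le
  exact (hd k).imp (fun h => h.mono hs) fun h => h.mono hs

theorem kl_pre (f b : MvPolynomial ι ℝ) (hb : IsCompact {y | b.eval y ≤ 0}) :
    ∃ p, 0 < p ∧ ∃ W : ℝ → ℝ, MonotoneOn W (Set.Ioo 0 p) ∧ BddBelow (W '' Set.Ioo 0 p) ∧
      ∀ y, b.eval y ≤ 0 → f.eval y ∈ Set.Ioo 0 p → ∀ s' ∈ Set.Ioo 0 (f.eval y),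
        f.eval y - s' ≤ √((grad2 f).eval y) * (W (f.eval y) - W s') := by
  let K : ℝ → Set (ι → ℝ) := fun t => {y | b.eval y ≤ 0 ∧ f.eval y = t}
  have hK : SAF K := by
    have := (SA.le (MvPolynomial.rename (Sum.inr : ι → Unit ⊕ ι) b) (MvPolynomial.C 0)).inter
      (SA.eq (MvPolynomial.rename (Sum.inr : ι → Unit ⊕ ι) f) (MvPolynomial.X (Sum.inl ())))
    simp only [eval_rename, MvPolynomial.eval_C, MvPolynomial.eval_X] at this
    exact this
  have hKc : ∀ t, IsCompact (K t) := fun t =>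
    hb.inter_right (isClosed_eq (MvPolynomial.continuous_eval f) continuous_const)
  have hne := (SA.ex hK).eventually_right (fun _ => Polynomial.X) 0
  simp only [Polynomial.eval_X, Set.mem_ofPred_eq, Sum.elim_inl, Sum.elim_inr] at hne
  rcases hne with hne | hne
  · obtain ⟨ε, hε, hne⟩ := mem_nhdsGT_iff_exists_Ioo_subset.1 hne
    let l : List (MvPolynomial ι ℝ) := grad2 f :: Finset.univ.toList.map MvPolynomial.X
    have hn : ∀ t : ℝ, ∃ x : ι → ℝ, t ∈ Set.Ioo 0 ε → x ∈ argmins K l t := fun t => by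
      by_cases ht : t ∈ Set.Ioo 0 ε
      · obtain ⟨x, hx⟩ := argmins_nonempty l (hKc t) (hne ht)
        exact ⟨x, fun _ => hx⟩
      · exact ⟨0, fun h => absurd h ht⟩
    choose x hx using hn
    have hx' : ∀ t ∈ Set.Ioo 0 ε, ∀ y, y ∈ argmins K l t ↔ y = x t := fun t ht y => by
      refine ⟨fun hy => funext fun i => ?_, fun h => h ▸ hx t ht⟩
      have hi : (MvPolynomial.X i : MvPolynomial ι ℝ) ∈ l := List.mem_cons_of_mem _
        (List.mem_map.2 ⟨i, Finset.mem_toList.2 (Finset.mem_univ i), rfl⟩)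
      have h1 := argmins_le l hi hy (hx t ht)
      have h2 := argmins_le l hi (hx t ht) hy
      rw [eval_X, eval_X] at h1 h2
      exact le_antisymm h1 h2
    obtain ⟨δ, hδ0, hδε, hδ⟩ := SAF.mono_finite (hK.argmins l) hε hx'
      (Option.elim · (grad2 f) (MvPolynomial.X : ι → MvPolynomial ι ℝ))
    have hsub : Set.Ioo 0 δ ⊆ Set.Ioo 0 ε := Set.Ioo_subset_Ioo_right hδε
    obtain ⟨p, hp0, hpδ, W, hW1, hW2, hW3⟩ := kl_curve f b hb hδ0
      (fun t ht => (argmins_subset l t (hx t (hsub ht))).2)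
      (fun t ht => (argmins_subset l t (hx t (hsub ht))).1)
      (fun i => by simpa using hδ (some i)) (hδ none)
    refine ⟨p, hp0, W, hW1, hW2, fun y hy hfy s' hs' => ?_⟩
    refine (hW3 _ hfy s' hs').trans (mul_le_mul_of_nonneg_right (Real.sqrt_le_sqrt ?_)
      (sub_nonneg.2 (hW1 ⟨hs'.1, hs'.2.trans hfy.2⟩ hfy hs'.2.le)))
    have h1 := hx _ (hsub (Set.Ioo_subset_Ioo_right hpδ hfy))
    exact (argmins_subset (K := argmin K (grad2 f)) _ _ h1).2 y ⟨hy, rfl⟩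
  · obtain ⟨ε, hε, hne⟩ := mem_nhdsGT_iff_exists_Ioo_subset.1 hne
    refine ⟨ε, hε, fun _ => 0, fun _ _ _ _ _ => le_rfl, ⟨0, ?_⟩, fun y hy hfy => ?_⟩
    · rintro _ ⟨t, -, rfl⟩; exact le_rfl
    · exact absurd ⟨y, hy, rfl⟩ (hne hfy)

/-- A Kurdyka-Łojasiewicz inequality in integrated form. -/
theorem kl (f b : MvPolynomial ι ℝ) (hb : IsCompact {y | b.eval y ≤ 0}) :
    ∃ p, 0 < p ∧ ∃ W : ℝ → ℝ, W 0 = 0 ∧ MonotoneOn W (Set.Ico 0 p) ∧ Tendsto W (𝓝[>] 0) (𝓝 0) ∧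
      ∀ y, b.eval y ≤ 0 → f.eval y ∈ Set.Ioo 0 p → ∀ s' ∈ Set.Ico 0 (f.eval y),
        f.eval y - s' ≤ √((grad2 f).eval y) * (W (f.eval y) - W s') := by
  obtain ⟨p, hp, W, hW1, hW2, hW3⟩ := kl_pre f b hb
  set w := sInf (W '' Set.Ioo 0 p) with hw
  have hlim : Tendsto W (𝓝[>] 0) (𝓝 w) :=
    hW1.tendsto_nhdsWithin_Ioo_right (Set.nonempty_Ioo.2 hp) hW2
  let V : ℝ → ℝ := fun s => if s = 0 then 0 else W s - w
  have V0 : V 0 = 0 := if_pos rfl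
  have Vp : ∀ {s}, 0 < s → V s = W s - w := fun h => if_neg h.ne'
  have hVw : ∀ s ∈ Set.Ioo 0 p, 0 ≤ V s := fun s hs => by
    rw [Vp hs.1, sub_nonneg]
    exact csInf_le hW2 ⟨s, hs, rfl⟩
  refine ⟨p, hp, V, V0, fun s hs t ht hst => ?_, ?_, fun y hy hfy s' hs' => ?_⟩
  · rcases hs.1.eq_or_lt with h | h
    · rw [← h, V0]
      rcases ht.1.eq_or_lt with h' | h'
      · rw [← h', V0]
      · exact hVw t ⟨h', ht.2⟩
    · rw [Vp h, Vp (h.trans_le hst)]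
      exact sub_le_sub_right (hW1 ⟨h, hs.2⟩ ⟨h.trans_le hst, ht.2⟩ hst) _
  · have : Tendsto (fun s => W s - w) (𝓝[>] 0) (𝓝 (w - w)) := hlim.sub_const w
    rw [sub_self] at this
    exact this.congr' (eventually_mem_nhdsWithin.mono fun s hs => (Vp hs).symm)
  · rcases hs'.1.eq_or_lt with h | h
    · rw [← h, V0, Vp hfy.1, sub_zero, sub_zero]
      have h1 : Tendsto (fun s' => f.eval y - s') (𝓝[>] 0) (𝓝 (f.eval y - 0)) :=
        (Continuous.tendsto (by fun_prop) 0).mono_left nhdsWithin_le_nhds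
      have h2 : Tendsto (fun s' => √((grad2 f).eval y) * (W (f.eval y) - W s')) (𝓝[>] 0)
          (𝓝 (√((grad2 f).eval y) * (W (f.eval y) - w))) := (hlim.const_sub _).const_mul _
      rw [sub_zero] at h1
      exact le_of_tendsto_of_tendsto h1 h2 (by
        filter_upwards [Ioo_mem_nhdsGT hfy.1] with s' hs'
        exact hW3 y hy hfy s' hs')
    · rw [Vp hfy.1, Vp h, sub_sub_sub_cancel_right]
      exact hW3 y hy hfy s' ⟨h, hs'.2⟩

end TC

namespace TC
open Filter Topology MvPolynomial

section Retract
variable {E : Type} [NormedAddCommGroup E] [CompleteSpace E]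

/-- A continuous descent map whose step length is controlled by the decrease of a desingularizing
function retracts a neighbourhood of the zero set onto it. -/
theorem descent_retract (F : C(E, E)) (f : C(E, ℝ)) {R' R p : ℝ} (hR : R' < R) (hp : 0 < p)
    (W : ℝ → ℝ) (W0 : W 0 = 0) (hW : MonotoneOn W (Set.Ico 0 p)) (hWt : Tendsto W (𝓝[>] 0) (𝓝 0))
    (hf : ∀ x, 0 ≤ f x)
    (h1 : ∀ x, ‖x‖ ≤ R → f x < p → f (F x) ≤ f x ∧ ‖F x - x‖ ≤ W (f x) - W (f (F x)))
    (h2 : ∀ x, ‖x‖ ≤ R → f x < p → f (F x) = f x → f x = 0) :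
    ∃ ε > 0, ∃ r : E → E, ContinuousOn r {x | ‖x‖ < R' ∧ f x < ε} ∧
      (∀ x, ‖x‖ < R' → f x < ε → f (r x) = 0) ∧ ∀ x, ‖x‖ < R' → f x = 0 → r x = x := by
  have Wnn : ∀ s ∈ Set.Ico 0 p, 0 ≤ W s := fun s hs => by
    have := hW ⟨le_rfl, hp⟩ hs hs.1
    rwa [W0] at this
  have Wsm : ∀ η > 0, ∃ δ > 0, δ ≤ p ∧ ∀ s, 0 ≤ s → s < δ → W s < η := fun η hη => by
    obtain ⟨δ, hδ, h⟩ := mem_nhdsGT_iff_exists_Ioo_subset.1 (hWt.eventually (gt_mem_nhds hη))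
    refine ⟨min δ p, lt_min hδ hp, min_le_right _ _, fun s hs hs' => ?_⟩
    rcases hs.eq_or_lt with rfl | hs
    · rwa [W0]
    · exact h ⟨hs, hs'.trans_le (min_le_left _ _)⟩
  let G : Set E := {x | ‖x‖ + W (f x) ≤ R ∧ f x < p}
  have GR : ∀ x ∈ G, ‖x‖ ≤ R := fun x hx => by
    have := Wnn _ ⟨hf x, hx.2⟩
    linarith [hx.1]
  have step : ∀ x ∈ G, F x ∈ G ∧ f (F x) ≤ f x ∧ ‖F x - x‖ ≤ W (f x) - W (f (F x)) :=
    fun x hx => by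
      obtain ⟨a, b⟩ := h1 x (GR x hx) hx.2
      refine ⟨⟨?_, a.trans_lt hx.2⟩, a, b⟩
      have := norm_le_norm_add_norm_sub' (F x) x
      linarith [hx.1]
  have mem : ∀ x ∈ G, ∀ k, F^[k] x ∈ G := fun x hx k => by
    induction k with
    | zero => exact hx
    | succ k ih => rw [Function.iterate_succ_apply']; exact (step _ ih).1
  have nonneg : ∀ x ∈ G, 0 ≤ W (f x) := fun x hx => Wnn _ ⟨hf x, hx.2⟩
  have dist_le : ∀ x ∈ G, ∀ k, ‖F^[k] x - x‖ ≤ W (f x) - W (f (F^[k] x)) := fun x hx k => by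
    induction k with
    | zero => simp
    | succ k ih =>
      rw [Function.iterate_succ_apply']
      have := (step _ (mem x hx k)).2.2
      have := norm_sub_le_norm_sub_add_norm_sub (F (F^[k] x)) (F^[k] x) x
      linarith
  have conv : ∀ x ∈ G, ∃ y, Tendsto (fun k => F^[k] x) atTop (𝓝 y) := fun x hx => by
    refine cauchySeq_tendsto_of_complete (cauchySeq_of_dist_le_of_summable
      (fun k => W (f (F^[k] x)) - W (f (F^[k + 1] x))) (fun k => ?_) ?_)
    · rw [dist_comm, dist_eq_norm, Function.iterate_succ_apply']
      exact (step _ (mem x hx k)).2.2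
    · refine summable_of_sum_range_le (c := W (f x)) (fun k => ?_) fun n => ?_
      · rw [Function.iterate_succ_apply']
        exact (norm_nonneg _).trans (step _ (mem x hx k)).2.2
      · rw [Finset.sum_range_sub']
        have := nonneg _ (mem x hx n)
        rw [Function.iterate_zero_apply]
        linarith
  have conv' : ∀ x, ∃ y, x ∈ G → Tendsto (fun k => F^[k] x) atTop (𝓝 y) := fun x => by
    by_cases hx : x ∈ G
    · obtain ⟨y, hy⟩ := conv x hx
      exact ⟨y, fun _ => hy⟩
    · exact ⟨x, fun h => absurd h hx⟩
  choose r hr using conv'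
  have rle : ∀ x ∈ G, ‖r x - x‖ ≤ W (f x) := fun x hx => by
    refine le_of_tendsto ((hr x hx).sub_const x).norm (Eventually.of_forall fun k => ?_)
    linarith [dist_le x hx k, nonneg _ (mem x hx k)]
  have anti : ∀ x ∈ G, ∀ k, f (F^[k] x) ≤ f x := fun x hx k => by
    induction k with
    | zero => exact le_rfl
    | succ k ih => rw [Function.iterate_succ_apply']; exact (step _ (mem x hx k)).2.1.trans ih
  have fr : ∀ x ∈ G, f (r x) = 0 := fun x hx => by
    have hfix : F (r x) = r x := by
      refine tendsto_nhds_unique ((F.continuous.tendsto _).comp (hr x hx)) ?_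
      have := (hr x hx).comp (tendsto_add_atTop_nat 1)
      refine this.congr fun k => ?_
      simp only [Function.comp, Function.iterate_succ_apply']
    refine h2 _ ?_ ?_ (by rw [hfix])
    · have := rle x hx
      have := norm_le_norm_add_norm_sub' (r x) x
      linarith [hx.1]
    · exact (le_of_tendsto ((f.continuous.tendsto _).comp (hr x hx))
        (Eventually.of_forall fun k => anti x hx k)).trans_lt hx.2
  have rit : ∀ x ∈ G, ∀ k, r (F^[k] x) = r x := fun x hx k => by
    refine tendsto_nhds_unique (hr _ (mem x hx k)) ?_
    refine ((hr x hx).comp (tendsto_add_atTop_nat k)).congr fun n => ?_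
    simp only [Function.comp, Function.iterate_add_apply]
  obtain ⟨ε, hε, hεp, hWε⟩ := Wsm (R - R') (sub_pos.2 hR)
  have OG : ∀ x, ‖x‖ < R' → f x < ε → x ∈ G := fun x hx hx' =>
    ⟨by linarith [hWε _ (hf x) hx'], hx'.trans_le hεp⟩
  refine ⟨ε, hε, r, fun x hx => ContinuousAt.continuousWithinAt ?_,
    fun x h h' => fr x (OG x h h'), fun x h h' => ?_⟩
  · have hO : {x | ‖x‖ < R' ∧ f x < ε} ∈ 𝓝 x :=
      ((isOpen_lt continuous_norm continuous_const).inter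
        (isOpen_lt f.continuous continuous_const)).mem_nhds hx
    have hxG := OG x hx.1 hx.2
    rw [Metric.continuousAt_iff']
    intro η hη
    obtain ⟨δ, hδ, -, hWδ⟩ := Wsm (η / 3) (by positivity)
    have h0 : Tendsto (fun k => f (F^[k] x)) atTop (𝓝 0) := by
      rw [← fr x hxG]
      exact (f.continuous.tendsto _).comp (hr x hxG)
    obtain ⟨k, hk⟩ := (h0.eventually (gt_mem_nhds hδ)).exists
    have hc : Continuous fun y => F^[k] y := F.continuous.iterate k
    filter_upwards [hO, (f.continuous.comp hc).continuousAt.eventually (gt_mem_nhds hk),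
      Metric.continuousAt_iff'.1 hc.continuousAt (η / 3) (by positivity)] with y hy hy1 hy2
    have hyG := OG y hy.1 hy.2
    have e1 := rle _ (mem x hxG k)
    have e2 := rle _ (mem y hyG k)
    rw [rit x hxG, ← dist_eq_norm] at e1
    rw [rit y hyG, ← dist_eq_norm] at e2
    have e3 := hWδ _ (hf _) hk
    have e4 := hWδ _ (hf _) hy1
    have e5 := dist_triangle4 (r y) (F^[k] y) (F^[k] x) (r x)
    rw [dist_comm (r x)] at e1
    simp only at e4
    linarith
  · have := rle x (OG x h (h'.trans_lt hε))
    rw [h', W0] at this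
    exact sub_eq_zero.1 (norm_le_zero_iff.1 this)

end Retract

variable {ι : Type} [Fintype ι]

/-- A compact real algebraic hypersurface is a Euclidean neighbourhood retract. -/
theorem enr_zero (f : MvPolynomial ι ℝ) (hf : ∀ x, 0 ≤ f.eval x)
    (hc : IsCompact {x | f.eval x = 0}) : ENR {x // f.eval x = 0} := by
  obtain ⟨R₀, hR₀, hZ⟩ := hc.isBounded.exists_pos_norm_lt
  set R := R₀ + 1 with hRdef
  let b : MvPolynomial ι ℝ := ∑ i, X i ^ 2 - C (Fintype.card ι * R ^ 2)
  have hbe : ∀ x, b.eval x = ∑ i, x i ^ 2 - Fintype.card ι * R ^ 2 := fun x => by simp [b]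
  have hb : IsCompact {y | b.eval y ≤ 0} := by
    refine Metric.isCompact_of_isClosed_isBounded
      (isClosed_le (MvPolynomial.continuous_eval b) continuous_const) ?_
    refine Metric.isBounded_closedBall.subset (t := Metric.closedBall (0 : ι → ℝ)
      √(Fintype.card ι * R ^ 2)) fun x hx => ?_
    rw [mem_closedBall_zero_iff, pi_norm_le_iff_of_nonneg (Real.sqrt_nonneg _)]
    intro i
    rw [Real.norm_eq_abs]
    refine Real.abs_le_sqrt ?_
    have : b.eval x ≤ 0 := hx
    rw [hbe] at this
    linarith [Finset.single_le_sum (f := fun i => x i ^ 2) (fun i _ => sq_nonneg _)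
      (Finset.mem_univ i)]
  have hb' : ∀ x, ‖x‖ ≤ R → b.eval x ≤ 0 := fun x hx => by
    rw [hbe, sub_nonpos]
    calc ∑ i, x i ^ 2 ≤ ∑ i : ι, R ^ 2 := Finset.sum_le_sum fun i _ =>
          sq_le_sq' (neg_le_of_abs_le ((norm_le_pi_norm x i).trans hx))
            (le_of_abs_le ((norm_le_pi_norm x i).trans hx))
      _ = _ := by simp
  obtain ⟨p, hp, W, W0, hW, hWt, hkl⟩ := kl f b hb
  obtain ⟨K, hK0, hK⟩ := taylor f (R + 1) (by positivity)
  obtain ⟨K', hK'0, hK'⟩ := taylor (grad2 f) (R + 1) (by positivity)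
  set τ := (1 + 2 * K + K')⁻¹ with hτ
  have hD : 0 < 1 + 2 * K + K' := by positivity
  have hτ0 : 0 < τ := by positivity
  have hτD : τ * (1 + 2 * K + K') = 1 := inv_mul_cancel₀ hD.ne'
  have hτ1 : τ * K ≤ 1 / 2 := by nlinarith
  have hτ2 : τ * K' ≤ 1 := by nlinarith [mul_nonneg hτ0.le hK0]
  have hτ3 : τ ≤ 1 := by nlinarith [mul_nonneg hτ0.le hK0, mul_nonneg hτ0.le hK'0]
  let F : C(ι → ℝ, ι → ℝ) := ⟨fun x i => x i - τ * (pderiv i f).eval x,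
    continuous_pi fun i => (continuous_apply i).sub
      (continuous_const.mul (MvPolynomial.continuous_eval _))⟩
  let fc : C(ι → ℝ, ℝ) := ⟨fun x => f.eval x, MvPolynomial.continuous_eval f⟩
  have gn := grad2_nonneg f
  have hF1 : ∀ x, ‖F x - x‖ ≤ τ * √((grad2 f).eval x) := fun x => by
    rw [pi_norm_le_iff_of_nonneg (by positivity)]
    intro i
    rw [show (F x - x) i = -(τ * (pderiv i f).eval x) by simp [F], norm_neg, norm_mul,
      Real.norm_of_nonneg hτ0.le]
    exact mul_le_mul_of_nonneg_left (abs_pderiv_le f x i) hτ0.le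
  have hF2 : ∀ x, ‖x‖ ≤ R → fc (F x) ≤ fc x - τ / 2 * (grad2 f).eval x := fun x hx => by
    have hx' : ‖x‖ ≤ R + 1 := by linarith
    have hg : (grad2 f).eval x ≤ K' := (le_abs_self _).trans (hK' x x hx' hx').1
    have hn := hF1 x
    have hsq := Real.sq_sqrt (gn x)
    have hs0 := Real.sqrt_nonneg ((grad2 f).eval x)
    have hFx : ‖F x‖ ≤ R + 1 := by
      have h1 : ‖F x - x‖ ≤ 1 := by
        refine hn.trans (abs_le_one_iff_mul_self_le_one.2 ?_ |> le_of_abs_le)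
        nlinarith [mul_le_mul_of_nonneg_left hg (mul_pos hτ0 hτ0).le]
      have := norm_le_norm_add_norm_sub' (F x) x
      linarith
    have h3 := (hK x (F x) hx' hFx).2.2
    have h4 : ∑ i, (pderiv i f).eval x * ((F x) i - x i) = -(τ * (grad2 f).eval x) := by
      rw [eval_grad2, Finset.mul_sum, ← Finset.sum_neg_distrib]
      refine Finset.sum_congr rfl fun i _ => ?_
      simp only [F, ContinuousMap.coe_mk]; ring
    rw [h4] at h3
    have h5 : ‖F x - x‖ ^ 2 ≤ τ ^ 2 * (grad2 f).eval x := by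
      rw [← hsq, ← mul_pow]
      exact pow_le_pow_left₀ (norm_nonneg _) hn 2
    have h6 := mul_le_mul_of_nonneg_left h5 hK0
    have h7 := mul_le_mul_of_nonneg_right hτ1 (mul_nonneg hτ0.le (gn x))
    have h8 := le_of_abs_le h3
    simp only [fc, ContinuousMap.coe_mk]
    linarith
  have hpos : ∀ x, ‖x‖ ≤ R → fc x < p → 0 < fc x → 0 < (grad2 f).eval x := fun x hx hxp h => by
    refine (gn x).lt_of_ne fun h0 => ?_
    have := hkl x (hb' x hx) ⟨h, hxp⟩ 0 ⟨le_rfl, h⟩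
    rw [← h0, Real.sqrt_zero, zero_mul, sub_zero] at this
    exact absurd this (not_le.2 h)
  have key1 : ∀ x, ‖x‖ ≤ R → fc x < p →
      fc (F x) ≤ fc x ∧ ‖F x - x‖ ≤ 2 * W (fc x) - 2 * W (fc (F x)) := fun x hx hxp => by
    have hd := hF2 x hx
    have hn := hF1 x
    refine ⟨hd.trans (by nlinarith [gn x]), ?_⟩
    rcases (hf x).eq_or_lt with h | h
    · have h0 : (grad2 f).eval x = 0 := by
        have : 0 ≤ fc (F x) := hf _
        have hx0 : fc x = 0 := h.symm
        exact le_antisymm (by nlinarith) (gn x)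
      rw [h0, Real.sqrt_zero, mul_zero] at hn
      rw [sub_eq_zero.1 (norm_le_zero_iff.1 hn)]
      simp
    · have hg := hpos x hx hxp h
      have hlt : fc (F x) < fc x := hd.trans_lt (by nlinarith)
      have hk := hkl x (hb' x hx) ⟨h, hxp⟩ (fc (F x)) ⟨hf _, hlt⟩
      have hs := Real.sqrt_pos.2 hg
      have hsq := Real.sq_sqrt (gn x)
      have : τ / 2 * √((grad2 f).eval x) ≤ W (fc x) - W (fc (F x)) := by
        refine le_of_mul_le_mul_left ?_ hs
        refine le_trans ?_ hk
        have : fc x = f.eval x := rfl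
        nlinarith
      linarith
  have key2 : ∀ x, ‖x‖ ≤ R → fc x < p → fc (F x) = fc x → fc x = 0 := fun x hx hxp h => by
    by_contra h0
    have hg := hpos x hx hxp ((hf x).lt_of_ne (Ne.symm h0))
    have := hF2 x hx
    nlinarith
  obtain ⟨ε, hε, r, hr1, hr2, hr3⟩ := descent_retract F fc (R' := R₀) (R := R)
    (by linarith) hp (fun s => 2 * W s) (by simp [W0])
    (fun s hs t ht h => mul_le_mul_of_nonneg_left (hW hs ht h) zero_le_two)
    (by simpa using hWt.const_mul 2) hf key1 key2
  refine ⟨ι, inferInstance, ⟨Subtype.val, continuous_subtype_val⟩, {x | ‖x‖ < R₀ ∧ fc x < ε},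
    ⟨fun x => ⟨r x, hr2 x x.2.1 x.2.2⟩, ?_⟩, ?_, fun x => ⟨hZ _ x.2, ?_⟩, fun x => ?_⟩
  · exact (continuousOn_iff_continuous_domRestrict.1 hr1).subtype_mk _
  · exact (isOpen_lt continuous_norm continuous_const).inter
      (isOpen_lt fc.continuous continuous_const)
  · exact x.2.trans_lt hε
  · exact Subtype.ext (hr3 x (hZ _ x.2) x.2)

end TC

namespace TC
open Cx
variable {X Y Z : Type} [TopologicalSpace X] [TopologicalSpace Y] [TopologicalSpace Z]

theorem ENR.retract {i : C(X, Z)} {r : C(Z, X)} (h : ∀ x, r (i x) = x) (hZ : ENR Z) : ENR X := by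
  obtain ⟨ι, hι, j, O, q, hO, hj, hq⟩ := hZ
  exact ⟨ι, hι, j.comp i, O, r.comp q, hO, fun x => hj (i x), fun x =>
    (congrArg r (hq (i x))).trans (h x)⟩

theorem ENR.homeo (e : X ≃ₜ Y) (h : ENR Y) : ENR X :=
  ENR.retract (i := (e : C(X, Y))) (r := (e.symm : C(Y, X))) e.symm_apply_apply h

theorem FinT.homeo (e : X ≃ₜ Y) (h : FinT Y) : FinT X :=
  FinT.retract (i := (e : C(X, Y))) (r := (e.symm : C(Y, X))) e.symm_apply_apply h

theorem chiT_homeo (e : X ≃ₜ Y) : chiT X = chiT Y := by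
  have := embed_qiso (g := (e : C(X, Y))) e.isEmbedding (E := Set.univ) (D := ∅)
    (fun y _ => e.surjective y)
  rw [Set.preimage_empty, Set.preimage_univ, sub_empty, sub_empty, sub_univ, sub_univ] at this
  exact this.chi_eq

theorem ENR.prod (hX : ENR X) (hY : ENR Y) : ENR (X × Y) := by
  obtain ⟨ι, _, i, O, r, hO, hi, hr⟩ := hX
  obtain ⟨κ, _, j, P, q, hP, hj, hq⟩ := hY
  have cl : Continuous fun v : ι ⊕ κ → ℝ => (v ∘ Sum.inl : ι → ℝ) := by fun_prop
  have cr : Continuous fun v : ι ⊕ κ → ℝ => (v ∘ Sum.inr : κ → ℝ) := by fun_prop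
  refine ⟨ι ⊕ κ, inferInstance, ⟨fun p => Sum.elim (i p.1) (j p.2), ?_⟩,
    {v | v ∘ Sum.inl ∈ O ∧ v ∘ Sum.inr ∈ P},
    ⟨fun v => (r ⟨_, v.2.1⟩, q ⟨_, v.2.2⟩), ?_⟩, (hO.preimage cl).inter (hP.preimage cr),
    fun p => ⟨hi p.1, hj p.2⟩, fun p => Prod.ext (hr p.1) (hq p.2)⟩
  · refine continuous_pi fun k => ?_
    cases k with
    | inl k => exact ((continuous_apply k).comp (i.continuous.comp continuous_fst))
    | inr k => exact ((continuous_apply k).comp (j.continuous.comp continuous_snd))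
  · exact (r.continuous.comp ((cl.comp continuous_subtype_val).subtype_mk _)).prodMk
      (q.continuous.comp ((cr.comp continuous_subtype_val).subtype_mk _))

/-- The Euler characteristic is additive over finite clopen partitions. -/
theorem chiT_fibers {K : Type} [Fintype K] [DecidableEq K] (φ : X → K)
    (hφ : ∀ k, IsOpen (φ ⁻¹' {k})) (h : ∀ k, FinT (φ ⁻¹' {k})) :
    FinT X ∧ chiT X = ∑ k, chiT (φ ⁻¹' {k}) := by
  have hs : ∀ s : Finset K, IsOpen (φ ⁻¹' s) := fun s => by
    have : φ ⁻¹' s = ⋃ k ∈ s, φ ⁻¹' {k} := by ext x; simp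
    rw [this]
    exact isOpen_biUnion fun k _ => hφ k
  have e0 := OpenChi.empty (X := X)
  have key : ∀ s : Finset K, FinH (sub (φ ⁻¹' s)) ⊥ ∧
      chi (sub (φ ⁻¹' (s : Set K))) ⊥ = ∑ k ∈ s, chiT (φ ⁻¹' {k}) := fun s => by
    induction s using Finset.induction_on with
    | empty =>
      rw [Finset.coe_empty, Set.preimage_empty, Finset.sum_empty]
      exact ⟨e0.2.1, by rw [e0.2.2, zero_mul]⟩
    | insert k s hk ih =>
      have hi : φ ⁻¹' {k} ∩ φ ⁻¹' (s : Set K) = ∅ := by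
        rw [← Set.preimage_inter, Set.singleton_inter_eq_empty.2 (by simpa using hk),
          Set.preimage_empty]
      have h1 := (incl_qiso (φ ⁻¹' {k})).finH_iff.1 (h k)
      have h3 : FinH (sub (φ ⁻¹' {k} ∩ φ ⁻¹' (s : Set K))) ⊥ := hi ▸ e0.2.1
      rw [Finset.coe_insert, Set.insert_eq, Set.preimage_union, Finset.sum_insert hk]
      refine ⟨finH_union (hφ k) (hs s) h1 ih.1 h3, ?_⟩
      rw [chi_union (hφ k) (hs s) h1 ih.1 h3, ih.2, ← (incl_qiso (φ ⁻¹' {k})).chi_eq, hi, e0.2.2,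
        zero_mul, sub_zero]
      rfl
  have := key Finset.univ
  rw [Finset.coe_univ, Set.preimage_univ, sub_univ] at this
  exact this

section alg
variable {T : Type}

/-- Real polynomial functions on a complex coordinate space. -/
inductive PolyC : ((T → ℂ) → ℂ) → Prop
  | const (c : ℂ) : PolyC fun _ => c
  | coord (t : T) : PolyC fun x => x t
  | add {f g} : PolyC f → PolyC g → PolyC fun x => f x + g x
  | mul {f g} : PolyC f → PolyC g → PolyC fun x => f x * g x
  | conj {f} : PolyC f → PolyC fun x => star (f x)

theorem PolyC.sum {κ : Type} {f : κ → (T → ℂ) → ℂ} (s : Finset κ) (h : ∀ k, PolyC (f k)) :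
    PolyC fun x => ∑ k ∈ s, f k x := by
  classical
  induction s using Finset.induction_on with
  | empty => simpa using PolyC.const 0
  | insert k s hk ih =>
    simp only [Finset.sum_insert hk]
    exact (h k).add ih

theorem PolyC.sub {f g : (T → ℂ) → ℂ} (hf : PolyC f) (hg : PolyC g) :
    PolyC fun x => f x - g x := by
  simpa [sub_eq_add_neg] using hf.add ((PolyC.const (-1)).mul hg)

theorem PolyC.comap {T' : Type} (ρ : T → T') {f : (T → ℂ) → ℂ} (hf : PolyC f) :
    PolyC fun x : T' → ℂ => f (x ∘ ρ) := by
  induction hf with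
  | const c => exact .const c
  | coord t => exact .coord (ρ t)
  | add _ _ h h' => exact h.add h'
  | mul _ _ h h' => exact h.mul h'
  | conj _ h => exact h.conj

theorem PolyC.continuous {f : (T → ℂ) → ℂ} (hf : PolyC f) : Continuous f := by
  induction hf with
  | const c => exact continuous_const
  | coord t => exact continuous_apply t
  | add _ _ h h' => exact h.add h'
  | mul _ _ h h' => exact h.mul h'
  | conj _ h => exact h.star

/-- Complex coordinates from real ones. -/
def toC (v : T ⊕ T → ℝ) (t : T) : ℂ := ⟨v (Sum.inl t), v (Sum.inr t)⟩

variable (T) in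
/-- Real and imaginary parts. -/
def realify : (T → ℂ) ≃ₜ (T ⊕ T → ℝ) where
  toFun x := Sum.elim (fun t => (x t).re) fun t => (x t).im
  invFun := toC
  left_inv x := rfl
  right_inv v := by ext t; cases t <;> rfl
  continuous_toFun := continuous_pi fun k => by
    cases k with
    | inl k => exact Complex.continuous_re.comp (continuous_apply k)
    | inr k => exact Complex.continuous_im.comp (continuous_apply k)
  continuous_invFun := continuous_pi fun t => by
    have : (fun v : T ⊕ T → ℝ => toC v t) =
        fun v => (v (Sum.inl t) : ℂ) + v (Sum.inr t) * Complex.I := by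
      ext v
      exact Complex.mk_eq_add_mul_I _ _
    rw [this]
    fun_prop

theorem PolyC.exists_eval {f : (T → ℂ) → ℂ} (hf : PolyC f) :
    ∃ p q : MvPolynomial (T ⊕ T) ℝ, ∀ v, f (toC v) = ⟨p.eval v, q.eval v⟩ := by
  induction hf with
  | const c => exact ⟨.C c.re, .C c.im, fun v => by simp⟩
  | coord t => exact ⟨.X (Sum.inl t), .X (Sum.inr t), fun v => by simp [toC]⟩
  | add _ _ h h' =>
    obtain ⟨p, q, h⟩ := h
    obtain ⟨p', q', h'⟩ := h'
    exact ⟨p + p', q + q', fun v => by beta_reduce; rw [h, h']; apply Complex.ext <;> simp⟩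
  | mul _ _ h h' =>
    obtain ⟨p, q, h⟩ := h
    obtain ⟨p', q', h'⟩ := h'
    exact ⟨p * p' - q * q', p * q' + q * p', fun v => by beta_reduce; rw [h, h']; apply Complex.ext <;> simp⟩
  | conj _ h =>
    obtain ⟨p, q, h⟩ := h
    exact ⟨p, -q, fun v => by beta_reduce; rw [h]; apply Complex.ext <;> simp⟩

/-- Real algebraic subsets of a complex coordinate space. -/
def CAlg (S : Set (T → ℂ)) : Prop :=
  ∃ (κ : Type) (_ : Fintype κ) (g : κ → (T → ℂ) → ℂ), (∀ k, PolyC (g k)) ∧ S = {x | ∀ k, g k x = 0}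

theorem PolyC.cAlg {f : (T → ℂ) → ℂ} (hf : PolyC f) : CAlg {x | f x = 0} :=
  ⟨Unit, inferInstance, fun _ => f, fun _ => hf, by ext x; simp⟩

theorem CAlg.iInter {κ : Type} [Fintype κ] {S : κ → Set (T → ℂ)} (h : ∀ k, CAlg (S k)) :
    CAlg (⋂ k, S k) := by
  choose α hα g hg hS using h
  refine ⟨Σ k, α k, inferInstance, fun k => g k.1 k.2, fun k => hg k.1 k.2, ?_⟩
  ext x
  simp only [hS, Set.mem_iInter, Set.mem_ofPred_eq, Sigma.forall]

theorem CAlg.inter {S S' : Set (T → ℂ)} (h : CAlg S) (h' : CAlg S') : CAlg (S ∩ S') := by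
  rw [Set.inter_eq_iInter]
  exact CAlg.iInter fun b => by cases b <;> assumption

theorem CAlg.comap {T' : Type} (ρ : T → T') {S : Set (T → ℂ)} (h : CAlg S) :
    CAlg {x : T' → ℂ | x ∘ ρ ∈ S} := by
  obtain ⟨κ, hκ, g, hg, rfl⟩ := h
  exact ⟨κ, hκ, fun k x => g k (x ∘ ρ), fun k => (hg k).comap ρ, rfl⟩

theorem CAlg.isClosed {S : Set (T → ℂ)} (h : CAlg S) : IsClosed S := by
  obtain ⟨κ, _, g, hg, rfl⟩ := h
  rw [Set.ofPred_forall]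
  exact isClosed_iInter fun k => isClosed_eq (hg k).continuous continuous_const

theorem CAlg.enr [Fintype T] {S : Set (T → ℂ)} (h : CAlg S) (hS : IsCompact S) : ENR S := by
  obtain ⟨κ, _, g, hg, rfl⟩ := h
  choose p q hpq using fun k => (hg k).exists_eval
  let F : MvPolynomial (T ⊕ T) ℝ := ∑ k, (p k ^ 2 + q k ^ 2)
  have hF : ∀ v, F.eval v = ∑ k, ((p k).eval v ^ 2 + (q k).eval v ^ 2) := fun v => by simp [F]
  have hF0 : ∀ v, F.eval v = 0 ↔ ∀ k, g k (toC v) = 0 := fun v => by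
    rw [hF, Finset.sum_eq_zero_iff_of_nonneg fun k _ => by positivity]
    simp only [Finset.mem_univ, true_implies, hpq, Complex.ext_iff, Complex.zero_re,
      Complex.zero_im]
    refine forall_congr' fun k => ⟨fun h => ?_, fun h => by rw [h.1, h.2]; simp⟩
    constructor <;> nlinarith [sq_nonneg ((p k).eval v), sq_nonneg ((q k).eval v)]
  have he : ∀ x : T → ℂ, x ∈ {x | ∀ k, g k x = 0} ↔ realify T x ∈ {v | F.eval v = 0} := fun x =>
    (hF0 (realify T x)).symm
  refine ENR.homeo ((realify T).subtype he) (enr_zero F (fun v => ?_) ?_)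
  · rw [hF]; positivity
  · have := hS.image (realify T).continuous
    convert this
    ext v
    rw [(realify T).image_eq_preimage_symm]
    exact hF0 v

end alg
end TC

namespace TC
variable {T : Type}

/-- The circle action with given weights. -/
def act (w : T → ℤ) (z : Circle) (x : T → ℂ) (t : T) : ℂ := ((z ^ w t : Circle) : ℂ) * x t

theorem continuous_act (w : T → ℤ) : Continuous fun p : (T → ℂ) × Circle => act w p.2 p.1 :=
  continuous_pi fun t => ((continuous_subtype_val (p := (· ∈ Submonoid.unitSphere ℂ))).comp
      (show Continuous fun p : (T → ℂ) × Circle => p.2 ^ w t from continuous_snd.zpow (w t))).mul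
    ((continuous_apply t).comp continuous_fst)

theorem act_inv_act (w : T → ℤ) (z : Circle) (x : T → ℂ) : act w z⁻¹ (act w z x) = x := by
  ext t
  rw [act, act, ← mul_assoc, ← Circle.coe_mul, _root_.inv_zpow, inv_mul_cancel, Circle.coe_one, one_mul]

theorem act_act_inv (w : T → ℤ) (z : Circle) (x : T → ℂ) : act w z (act w z⁻¹ x) = x := by
  have := act_inv_act w z⁻¹ x
  rwa [inv_inv] at this

theorem act_eq_zero {w : T → ℤ} {z : Circle} {x : T → ℂ} {t : T} :
    act w z x t = 0 ↔ x t = 0 :=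
  mul_eq_zero.trans (or_iff_right (Circle.coe_ne_zero _))

/-- Nonnegative values of a coordinate. -/
def slice (S : Set (T → ℂ)) (t : T) : Set (T → ℂ) := S ∩ {x | 0 ≤ (x t).re ∧ (x t).im = 0}

theorem slice_isCompact {S : Set (T → ℂ)} (hS : IsCompact S) (t : T) : IsCompact (slice S t) :=
  hS.inter_right ((isClosed_le continuous_const
    (Complex.continuous_re.comp (continuous_apply t))).inter
    (isClosed_eq (Complex.continuous_im.comp (continuous_apply t)) continuous_const))

theorem slice_eq {S : Set (T → ℂ)} {t : T} {x : T → ℂ} (hx : x ∈ slice S t) :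
    x t = (‖x t‖ : ℝ) := by
  have h1 : x t = ((x t).re : ℝ) := Complex.ext rfl hx.2.2
  have h2 := hx.2.1
  rw [h1, Complex.norm_real, Real.norm_of_nonneg h2]

theorem slice_enr [Fintype T] {S : Set (T → ℂ)} (hS : IsCompact S) (hA : CAlg S) (t : T) :
    ENR (slice S t) := by
  let S' : Set (Option T → ℂ) := {x | x ∘ some ∈ S} ∩
    ({x | x (some t) - x none * x none = 0} ∩ {x | x none - star (x none) = 0})
  have hA' : CAlg S' := (hA.comap some).inter
    ((((PolyC.coord _).sub ((PolyC.coord _).mul (.coord _))).cAlg).inter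
      ((PolyC.coord _).sub (PolyC.coord _).conj).cAlg)
  obtain ⟨K, hK, hSK⟩ := hS.isBounded.exists_pos_norm_le
  have hS' : IsCompact S' := by
    refine Metric.isCompact_of_isClosed_isBounded hA'.isClosed
      (isBounded_iff_forall_norm_le.2 ⟨K + 1, fun x hx => ?_⟩)
    rw [pi_norm_le_iff_of_nonneg (by positivity)]
    have h1 : ∀ u, ‖x (some u)‖ ≤ K := fun u => (norm_le_pi_norm (x ∘ some) u).trans (hSK _ hx.1)
    intro u
    cases u with
    | some u => exact (h1 u).trans (by linarith)
    | none =>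
      have h2 := h1 t
      rw [sub_eq_zero.1 hx.2.1, norm_mul] at h2
      nlinarith [norm_nonneg (x none)]
  have key : ∀ x : S', x.1 (some t) = (((x.1 none).re ^ 2 : ℝ) : ℂ) := fun x => by
    have h2 : (x.1 none).im = 0 := by
      have := congrArg Complex.im (sub_eq_zero.1 x.2.2.2)
      simp only [RCLike.star_def, Complex.conj_im] at this
      linarith
    have h3 : x.1 none = ((x.1 none).re : ℝ) := Complex.ext rfl h2
    rw [sub_eq_zero.1 x.2.2.1, Complex.ofReal_pow, ← h3, sq]
  refine ENR.retract (Z := S')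
    (i := ⟨fun x => ⟨fun u => u.elim (((√‖x.1 t‖ : ℝ) : ℂ)) x.1, x.2.1, ?_, ?_⟩, ?_⟩)
    (r := ⟨fun x => ⟨x.1 ∘ some, x.2.1, ?_⟩, ?_⟩) (fun x => rfl) (hA'.enr hS')
  · change x.1 t - ((√‖x.1 t‖ : ℝ) : ℂ) * ((√‖x.1 t‖ : ℝ) : ℂ) = 0
    rw [← Complex.ofReal_mul, Real.mul_self_sqrt (norm_nonneg _), sub_eq_zero]
    exact slice_eq x.2
  · change ((√‖x.1 t‖ : ℝ) : ℂ) - star ((√‖x.1 t‖ : ℝ) : ℂ) = 0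
    rw [RCLike.star_def, Complex.conj_ofReal, sub_self]
  · refine Continuous.subtype_mk (continuous_pi fun u => ?_) _
    cases u with
    | some u => exact (continuous_apply u).comp continuous_subtype_val
    | none =>
      exact Complex.continuous_ofReal.comp
        (((continuous_apply t).comp continuous_subtype_val).norm.sqrt)
  · change 0 ≤ (x.1 (some t)).re ∧ (x.1 (some t)).im = 0
    rw [key, Complex.ofReal_re, Complex.ofReal_im]
    exact ⟨sq_nonneg _, rfl⟩
  · refine Continuous.subtype_mk ?_ _
    exact continuous_pi fun u => (continuous_apply (some u)).comp continuous_subtype_val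

theorem chi_weight_one [Fintype T] {S : Set (T → ℂ)} (hS : IsCompact S) (hA : CAlg S)
    (w : T → ℤ) (inv : ∀ z, ∀ x ∈ S, act w z x ∈ S) (t : T) (ht : w t = 1) :
    chiT S = chiT ↥(S ∩ {x | x t = 0}) := by
  have hZA := hA.inter (PolyC.coord t).cAlg
  have hZ : IsCompact (S ∩ {x | x t = 0}) := hS.of_isClosed_subset hZA.isClosed fun x h => h.1
  have hP := slice_isCompact hS t
  have eP := slice_enr hS hA t
  have : CompactSpace S := isCompact_iff_compactSpace.1 hS
  have : CompactSpace ↥(S ∩ {x | x t = 0}) := isCompact_iff_compactSpace.1 hZ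
  have : CompactSpace (slice S t) := isCompact_iff_compactSpace.1 hP
  let π : C(slice S t × Circle, S) := ⟨fun p => ⟨act w p.2 p.1, inv _ _ p.1.2.1⟩,
    ((continuous_act w).comp ((continuous_subtype_val.comp continuous_fst).prodMk
      continuous_snd)).subtype_mk _⟩
  let B : Set S := {x | x.1 t = 0}
  have hB : IsClosed B := isClosed_eq ((continuous_apply t).comp continuous_subtype_val)
    continuous_const
  let eB : B ≃ₜ ↥(S ∩ {x | x t = 0}) :=
    { toFun := fun x => ⟨x.1.1, x.1.2, x.2⟩
      invFun := fun x => ⟨⟨x.1, x.2.1⟩, x.2.2⟩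
      left_inv := fun x => rfl
      right_inv := fun x => rfl
      continuous_toFun := (continuous_subtype_val.comp continuous_subtype_val).subtype_mk _
      continuous_invFun := (continuous_subtype_val.subtype_mk _).subtype_mk _ }
  let eB' : π ⁻¹' B ≃ₜ ↥(S ∩ {x | x t = 0}) × Circle :=
    { toFun := fun p => (⟨p.1.1.1, p.1.1.2.1, act_eq_zero.1 p.2⟩, p.1.2)
      invFun := fun p => ⟨(⟨p.1.1, p.1.2.1, by
        have h : p.1.1 t = 0 := p.1.2.2
        rw [Set.mem_ofPred_eq, h]; exact ⟨le_rfl, rfl⟩⟩, p.2),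
        act_eq_zero.2 p.1.2.2⟩
      left_inv := fun x => rfl
      right_inv := fun x => rfl
      continuous_toFun := ((continuous_subtype_val.comp
        (continuous_fst.comp continuous_subtype_val)).subtype_mk _).prodMk
          (continuous_snd.comp continuous_subtype_val)
      continuous_invFun := (((continuous_subtype_val.comp continuous_fst).subtype_mk _).prodMk
        continuous_snd).subtype_mk _ }
  have fc := enr_circle.finT
  have hcoord : ∀ p : slice S t × Circle, act w p.2 p.1 t = p.2 * (‖p.1.1 t‖ : ℝ) := fun p => by
    rw [act, ht, zpow_one, ← slice_eq p.1.2]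
  have key := rel_chi (π := π) (B := B) hB (fun p q hp hpq => ?_) (fun y hy => ?_)
    (eP.prod enr_circle) (hA.enr hS) (ENR.homeo eB' ((hZA.enr hZ).prod enr_circle))
    (ENR.homeo eB (hZA.enr hZ))
  · rw [chiT_homeo eB, chiT_homeo eB', (eP.kunneth fc).2, ((hZA.enr hZ).kunneth fc).2, chiT_circle,
      mul_zero, mul_zero, sub_zero] at key
    exact (sub_eq_zero.1 key.symm)
  · have h1 : act w p.2 p.1 = act w q.2 q.1 := congrArg Subtype.val hpq
    have h2 := congrFun h1 t
    rw [hcoord, hcoord] at h2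
    have h3 := congrArg norm h2
    simp only [norm_mul, Circle.norm_coe, one_mul, Complex.norm_real, norm_norm] at h3
    have h4 : ((‖p.1.1 t‖ : ℝ) : ℂ) ≠ 0 := by
      rw [Complex.ofReal_ne_zero, norm_ne_zero_iff]
      exact fun h => hp (act_eq_zero.2 h)
    rw [← h3] at h2
    have h5 : p.2 = q.2 := Circle.ext (mul_right_cancel₀ h4 h2)
    refine Prod.ext (Subtype.ext ?_) h5
    rw [← act_inv_act w p.2 p.1, h1, h5, act_inv_act]
  · have hn : ‖y.1 t‖ ≠ 0 := norm_ne_zero_iff.2 hy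
    have hn' : ((‖y.1 t‖ : ℝ) : ℂ) ≠ 0 := Complex.ofReal_ne_zero.2 hn
    let z : Circle := ⟨y.1 t / (‖y.1 t‖ : ℝ), by
      rw [mem_sphere_unit, norm_div, Complex.norm_real, norm_norm, div_self hn]⟩
    have hz : (z : ℂ) * (‖y.1 t‖ : ℝ) = y.1 t := div_mul_cancel₀ _ hn'
    have hx : act w z⁻¹ y.1 t = (‖y.1 t‖ : ℝ) := by
      rw [act, ht, zpow_one]
      conv_lhs => rw [← hz]
      rw [← mul_assoc, ← Circle.coe_mul, inv_mul_cancel, Circle.coe_one, one_mul]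
    refine ⟨(⟨act w z⁻¹ y.1, inv _ _ y.2, ?_⟩, z), Subtype.ext (act_act_inv w z y.1)⟩
    change 0 ≤ (act w z⁻¹ y.1 t).re ∧ (act w z⁻¹ y.1 t).im = 0
    rw [hx, Complex.ofReal_re, Complex.ofReal_im]
    exact ⟨norm_nonneg _, rfl⟩

/-- Localization of the Euler characteristic to the fixed points of a circle action with weights
`0` and `±1`. -/
theorem chi_weights [Fintype T] {S : Set (T → ℂ)} (hS : IsCompact S) (hA : CAlg S)
    (w : T → ℤ) (hw : ∀ t, w t ≠ 0 → w t * w t = 1) (inv : ∀ z, ∀ x ∈ S, act w z x ∈ S) :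
    chiT S = chiT ↥(S ∩ {x | ∀ t, w t ≠ 0 → x t = 0}) := by
  classical
  have key : ∀ s : Finset T, (∀ t ∈ s, w t ≠ 0) → CAlg (S ∩ {x | ∀ t ∈ s, x t = 0}) ∧
      chiT S = chiT ↥(S ∩ {x | ∀ t ∈ s, x t = 0}) := fun s => by
    induction s using Finset.induction_on with
    | empty =>
      intro _
      have : S ∩ {x | ∀ t ∈ (∅ : Finset T), x t = 0} = S := by simp
      rw [this]
      exact ⟨hA, rfl⟩
    | insert t s _ ih =>
      intro h
      obtain ⟨h1, h2⟩ := ih fun t ht => h t (Finset.mem_insert_of_mem ht)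
      have ht := h t (Finset.mem_insert_self t s)
      have e : S ∩ {x | ∀ u ∈ insert t s, x u = 0} =
          (S ∩ {x | ∀ u ∈ s, x u = 0}) ∩ {x | x t = 0} := by
        ext x
        simp only [Set.mem_inter_iff, Set.mem_ofPred_eq, Finset.forall_mem_insert]
        tauto
      rw [e]
      refine ⟨h1.inter (PolyC.coord t).cAlg, h2.trans ?_⟩
      refine chi_weight_one (hS.of_isClosed_subset h1.isClosed fun x h => h.1) h1
        (fun u => w t * w u) (fun z x hx => ⟨?_, fun u hu => act_eq_zero.2 (hx.2 u hu)⟩) t (hw t ht)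
      have := inv (z ^ w t) x hx.1
      convert this using 1
      ext u
      rw [act, act, _root_.zpow_mul]
  have := (key (Finset.univ.filter fun t => w t ≠ 0) fun t ht => (Finset.mem_filter.1 ht).2).2
  have e : {x : T → ℂ | ∀ t ∈ Finset.univ.filter (w · ≠ 0), x t = 0} =
      {x | ∀ t, w t ≠ 0 → x t = 0} := by
    ext x
    simp only [Finset.mem_filter, Finset.mem_univ, true_and, Set.mem_ofPred_eq]
  rwa [e] at this

end TC

namespace TC
variable {T : Type}

/-- A matrix of polynomial functions. -/
def PolyM {m n : Type} (f : (T → ℂ) → Matrix m n ℂ) : Prop := ∀ p q, PolyC fun x => f x p q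

section PolyM
variable {m n k : Type}

theorem PolyM.const (C : Matrix m n ℂ) : PolyM fun _ : T → ℂ => C := fun p q => PolyC.const (C p q)

theorem PolyM.mul [Fintype n] {f : (T → ℂ) → Matrix m n ℂ} {g : (T → ℂ) → Matrix n k ℂ}
    (hf : PolyM f) (hg : PolyM g) : PolyM fun x => f x * g x := by
  intro p q
  simp only [Matrix.mul_apply]
  exact PolyC.sum _ fun j => (hf p j).mul (hg j q)

theorem PolyM.sub {f g : (T → ℂ) → Matrix m n ℂ} (hf : PolyM f) (hg : PolyM g) :
    PolyM fun x => f x - g x := fun p q => (hf p q).sub (hg p q)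

theorem PolyM.conjTranspose {f : (T → ℂ) → Matrix m n ℂ} (hf : PolyM f) :
    PolyM fun x => (f x)ᴴ := fun p q => (hf q p).conj

theorem PolyM.cAlg_eq [Fintype m] [Fintype n] {f g : (T → ℂ) → Matrix m n ℂ} (hf : PolyM f)
    (hg : PolyM g) : CAlg {x | f x = g x} := by
  have : {x | f x = g x} = ⋂ p : m × n, {x | f x p.1 p.2 - g x p.1 p.2 = 0} := by
    ext x
    simp only [Set.mem_iInter, Set.mem_ofPred_eq, sub_eq_zero, Prod.forall]
    exact ⟨fun h p q => by rw [h], fun h => Matrix.ext h⟩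
  rw [this]
  exact CAlg.iInter fun p => ((hf p.1 p.2).sub (hg p.1 p.2)).cAlg

theorem PolyM.trace [Fintype n] {f : (T → ℂ) → Matrix n n ℂ} (hf : PolyM f) :
    PolyC fun x => (f x).trace := PolyC.sum _ fun j => hf j j

end PolyM

section Proj
variable {J K : Type} [Fintype J] [DecidableEq J] [Fintype K] [DecidableEq K]

theorem trace_idem {R : Matrix J J ℂ} (h : R * R = R) :
    R.trace = (Module.finrank ℂ (LinearMap.range R.mulVecLin) : ℂ) := by
  have hp : LinearMap.IsProj (LinearMap.range R.mulVecLin) R.mulVecLin := by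
    refine ⟨fun x => ⟨x, rfl⟩, ?_⟩
    rintro _ ⟨y, rfl⟩
    rw [← LinearMap.comp_apply, ← Matrix.mulVecLin_mul, h]
  rw [← hp.trace, ← Matrix.toLin'_apply', Matrix.trace_toLin'_eq]

theorem range_le_iff {P : Matrix J J ℂ} (h : P * P = P) (B : Matrix J K ℂ) :
    LinearMap.range B.mulVecLin ≤ LinearMap.range P.mulVecLin ↔ P * B = B := by
  constructor
  · intro hB
    have : (P * B).mulVecLin = B.mulVecLin := by
      refine LinearMap.ext fun v => ?_
      obtain ⟨w, hw⟩ := hB ⟨v, rfl⟩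
      rw [Matrix.mulVecLin_mul, LinearMap.comp_apply, ← hw, ← LinearMap.comp_apply,
        ← Matrix.mulVecLin_mul, h]
    rw [← Matrix.toLin'_apply', ← Matrix.toLin'_apply'] at this
    exact Matrix.toLin'.injective this
  · intro hB
    rw [← hB, Matrix.mulVecLin_mul]
    exact LinearMap.range_comp_le_range _ _

theorem proj_unique {R R' : Matrix J J ℂ} (h : R * R = R) (hh : Rᴴ = R) (h' : R' * R' = R')
    (hh' : R'ᴴ = R') (e : LinearMap.range R.mulVecLin = LinearMap.range R'.mulVecLin) :
    R = R' := by
  have e1 := (range_le_iff h' R).1 e.le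
  have e2 := (range_le_iff h R').1 e.ge
  have e3 := congrArg Matrix.conjTranspose e2
  rw [Matrix.conjTranspose_mul, hh, hh'] at e3
  rw [← e1, e3]

theorem norm_proj_le {R : Matrix J J ℂ} (h : R * R = R) (hh : Rᴴ = R) (p q : J) :
    ‖R p q‖ ≤ 1 := by
  have e : R p p = ((∑ q, ‖R p q‖ ^ 2 : ℝ) : ℂ) := by
    conv_lhs => rw [← h]
    rw [Matrix.mul_apply]
    push_cast
    refine Finset.sum_congr rfl fun q _ => ?_
    have : R q p = star (R p q) := by conv_lhs => rw [← hh, Matrix.conjTranspose_apply]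
    rw [this]
    exact Complex.mul_conj' _
  have hS : 0 ≤ ∑ q, ‖R p q‖ ^ 2 := Finset.sum_nonneg fun _ _ => sq_nonneg _
  have hq : ∀ q, ‖R p q‖ ^ 2 ≤ ∑ q, ‖R p q‖ ^ 2 := fun q =>
    Finset.single_le_sum (f := fun q => ‖R p q‖ ^ 2) (fun _ _ => sq_nonneg _) (Finset.mem_univ q)
  have hp := hq p
  have e' : ‖R p p‖ = ∑ q, ‖R p q‖ ^ 2 := by
    conv_lhs => rw [e]
    rw [Complex.norm_real, Real.norm_of_nonneg hS]
  rw [e'] at hp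
  have := hq q
  have h0 := norm_nonneg (R p q)
  have h1 : ∑ q, ‖R p q‖ ^ 2 ≤ 1 := by nlinarith
  nlinarith

/-- The orthogonal projection onto the image of an injective matrix. -/
def frameProj (F : Matrix J K ℂ) : Matrix J J ℂ := F * (Fᴴ * F)⁻¹ * Fᴴ

open scoped ComplexOrder in
theorem det_gram {F : Matrix J K ℂ} (hF : Function.Injective F.mulVecLin) :
    IsUnit (Fᴴ * F).det := by
  rw [← Matrix.isUnit_iff_isUnit_det, ← Matrix.mulVec_injective_iff_isUnit]
  have : LinearMap.ker (Fᴴ * F).mulVecLin = ⊥ := by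
    rw [Matrix.ker_mulVecLin_conjTranspose_mul_self, LinearMap.ker_eq_bot.2 hF]
  exact LinearMap.ker_eq_bot.1 this

theorem frameProj_mul {F : Matrix J K ℂ} (hF : Function.Injective F.mulVecLin) :
    frameProj F * F = F := by
  rw [frameProj, Matrix.mul_assoc, Matrix.mul_assoc, Matrix.nonsing_inv_mul _ (det_gram hF),
    Matrix.mul_one]

theorem frameProj_idem {F : Matrix J K ℂ} (hF : Function.Injective F.mulVecLin) :
    frameProj F * frameProj F = frameProj F := by
  conv_lhs => arg 2; rw [frameProj, Matrix.mul_assoc]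
  rw [← Matrix.mul_assoc, frameProj_mul hF, ← Matrix.mul_assoc, frameProj]

theorem frameProj_conj (F : Matrix J K ℂ) : (frameProj F)ᴴ = frameProj F := by
  rw [frameProj, Matrix.conjTranspose_mul, Matrix.conjTranspose_mul, Matrix.conjTranspose_nonsing_inv,
    Matrix.conjTranspose_mul, Matrix.conjTranspose_conjTranspose, Matrix.mul_assoc]

theorem range_frameProj {F : Matrix J K ℂ} (hF : Function.Injective F.mulVecLin) :
    LinearMap.range (frameProj F).mulVecLin = LinearMap.range F.mulVecLin := by
  refine le_antisymm ?_ ((range_le_iff (frameProj_idem hF) F).2 (frameProj_mul hF))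
  rw [frameProj, Matrix.mul_assoc, Matrix.mulVecLin_mul]
  exact LinearMap.range_comp_le_range _ _

theorem exists_frame {n m : ℕ} (N : Submodule ℂ (Fin n → ℂ)) (h : Module.finrank ℂ N = m) :
    ∃ F : Matrix (Fin n) (Fin m) ℂ, Function.Injective F.mulVecLin ∧
      LinearMap.range F.mulVecLin = N := by
  let b := Module.finBasisOfFinrankEq ℂ N h
  refine ⟨Matrix.of fun p q => (b q : Fin n → ℂ) p, ?_, ?_⟩
  · have := b.linearIndependent.map' N.subtype N.ker_subtype
    exact Matrix.mulVec_injective_iff.2 this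
  · rw [Matrix.range_mulVecLin]
    have : Set.range (Matrix.of fun p q => (b q : Fin n → ℂ) p).col =
        N.subtype '' Set.range b := by
      rw [← Set.range_comp]; rfl
    rw [this, Submodule.span_image, b.span_eq, Submodule.map_top, Submodule.range_subtype]

theorem map_range_mulVecLin {L : Type} [Fintype L] (B : Matrix L J ℂ) (C : Matrix J K ℂ) :
    (LinearMap.range C.mulVecLin).map B.mulVecLin = LinearMap.range (B * C).mulVecLin := by
  rw [Matrix.mulVecLin_mul, LinearMap.range_comp]

end Proj

section Gr
variable {V A : Type} {J : V → Type} [∀ i, Fintype (J i)] [∀ i, DecidableEq (J i)]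

/-- The `i`-th square matrix encoded by a coordinate vector. -/
def matG (x : (Σ i, J i × J i) → ℂ) (i : V) : Matrix (J i) (J i) ℂ :=
  Matrix.of fun p q => x ⟨i, (p, q)⟩

/-- The coordinate vector of a family of square matrices. -/
def coordG (R : ∀ i, Matrix (J i) (J i) ℂ) : (Σ i, J i × J i) → ℂ := fun t => R t.1 t.2.1 t.2.2

theorem matG_coordG (R : ∀ i, Matrix (J i) (J i) ℂ) (i : V) : matG (coordG R) i = R i := rfl

theorem polyM_matG (i : V) : PolyM fun x : (Σ i, J i × J i) → ℂ => matG x i :=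
  fun _ _ => PolyC.coord _

/-- Families of orthogonal projections onto the members of a subrepresentation. -/
def PCond (s t : A → V) (M : ∀ a, Matrix (J (t a)) (J (s a)) ℂ)
    (R : ∀ i, Matrix (J i) (J i) ℂ) : Prop :=
  (∀ i, R i * R i = R i) ∧ (∀ i, (R i)ᴴ = R i) ∧
    ∀ a, R (t a) * (M a * R (s a)) = M a * R (s a)

/-- The quiver Grassmannian as an algebraic set of orthogonal projections. -/
def Pr (s t : A → V) (M : ∀ a, Matrix (J (t a)) (J (s a)) ℂ) (e : V → ℕ) :
    Set ((Σ i, J i × J i) → ℂ) :=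
  {x | PCond s t M (matG x) ∧ ∀ i, (matG x i).trace = e i}

variable [Fintype V] [Fintype A] (s t : A → V) (M : ∀ a, Matrix (J (t a)) (J (s a)) ℂ) (e : V → ℕ)

theorem Pr_cAlg : CAlg (Pr s t M e) := by
  have h1 := CAlg.iInter fun i : V => ((polyM_matG (J := J) i).mul (polyM_matG i)).cAlg_eq
    (polyM_matG i)
  have h2 := CAlg.iInter fun i : V => (polyM_matG (J := J) i).conjTranspose.cAlg_eq (polyM_matG i)
  have h3 := CAlg.iInter fun a : A => ((polyM_matG (J := J) (t a)).mul
    ((PolyM.const (M a)).mul (polyM_matG (s a)))).cAlg_eq ((PolyM.const (M a)).mul (polyM_matG (s a)))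
  have h4 := CAlg.iInter fun i : V => ((polyM_matG (J := J) i).trace.sub (PolyC.const (e i))).cAlg
  convert ((h1.inter h2).inter h3).inter h4 using 1
  ext x
  simp only [Pr, PCond, Set.mem_inter_iff, Set.mem_iInter, Set.mem_ofPred_eq, sub_eq_zero, and_assoc]

theorem Pr_isCompact : IsCompact (Pr s t M e) := by
  refine (isCompact_univ_pi fun _ => isCompact_closedBall (0 : ℂ) 1).of_isClosed_subset
    (Pr_cAlg s t M e).isClosed fun x hx k _ => ?_
  rw [mem_closedBall_zero_iff]
  exact norm_proj_le (hx.1.1 k.1) (hx.1.2.1 k.1) k.2.1 k.2.2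

theorem Pr_enr : ENR (Pr s t M e) := (Pr_cAlg s t M e).enr (Pr_isCompact s t M e)

end Gr

section Homeo
variable {V A : Type}

instance (s t : A → V) {d : V → ℕ} (M : QRep s t d) (e : V → ℕ) : TopologicalSpace (StQ s t M e) :=
  TopologicalSpace.induced Subtype.val inferInstance

theorem finrank_range_Pr {J : V → Type} [∀ i, Fintype (J i)] [∀ i, DecidableEq (J i)]
    {s t : A → V} {M : ∀ a, Matrix (J (t a)) (J (s a)) ℂ} {e : V → ℕ}
    {x : (Σ i, J i × J i) → ℂ} (hx : x ∈ Pr s t M e) (i : V) :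
    Module.finrank ℂ (LinearMap.range (matG x i).mulVecLin) = e i := by
  have := hx.2 i
  rw [trace_idem (hx.1.1 i)] at this
  exact_mod_cast this

variable (s t : A → V) {d : V → ℕ} (M : QRep s t d) (e : V → ℕ)

/-- The subrepresentation cut out by a family of projections. -/
def prSub (x : Pr (J := fun i => Fin (d i)) s t M e) : SubRep s t M e :=
  ⟨fun i => LinearMap.range (matG x.1 i).mulVecLin, fun i => finrank_range_Pr x.2 i, fun a => by
    rw [map_range_mulVecLin, range_le_iff (x.2.1.1 _)]
    exact x.2.1.2.2 a⟩

/-- The family of projections onto the images of a family of injective maps. -/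
def stPr (F : StQ s t M e) : Pr (J := fun i => Fin (d i)) s t M e :=
  ⟨coordG fun i => frameProj (matOf F.1 i), by
    have hid := fun i => frameProj_idem (F.2.1 i)
    refine ⟨⟨hid, fun i => frameProj_conj (matOf F.1 i), fun a => ?_⟩, fun i => ?_⟩
    · have := F.2.2 a
      rw [← range_frameProj (F.2.1 (t a)), ← range_frameProj (F.2.1 (s a)), map_range_mulVecLin,
        range_le_iff (hid _)] at this
      exact this
    · rw [matG_coordG, trace_idem (hid i), range_frameProj (F.2.1 i),
        LinearMap.finrank_range_of_inj (F.2.1 i), Module.finrank_fin_fun]⟩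

theorem prSub_stPr (F : StQ s t M e) : prSub s t M e (stPr s t M e F) = toSub s t M e F := by
  refine Subtype.ext (funext fun i => ?_)
  have h : (prSub s t M e (stPr s t M e F)).1 i =
    LinearMap.range (frameProj (matOf F.1 i)).mulVecLin := rfl
  rw [h, range_frameProj (F.2.1 i)]
  rfl

theorem toSub_surjective : Function.Surjective (toSub s t M e) := by
  intro N
  choose F hF hN using fun i => exists_frame (N.1 i) (N.2.1 i)
  refine ⟨⟨fun k => F k.1 k.2.1 k.2.2, hF, fun a => ?_⟩, Subtype.ext (funext hN)⟩
  have := N.2.2 a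
  rw [← hN, ← hN] at this
  exact this

theorem prSub_bijective : Function.Bijective (prSub s t M e) := by
  constructor
  · intro x y h
    have h' := fun i => congrFun (congrArg Subtype.val h) i
    refine Subtype.ext (funext fun k => ?_)
    have := proj_unique (x.2.1.1 k.1) (x.2.1.2.1 k.1) (y.2.1.1 k.1) (y.2.1.2.1 k.1) (h' k.1)
    exact congrFun (congrFun this k.2.1) k.2.2
  · intro N
    obtain ⟨F, rfl⟩ := toSub_surjective s t M e N
    exact ⟨_, prSub_stPr s t M e F⟩

theorem continuous_matOf (i : V) : Continuous fun F : StQ s t M e => matOf F.1 i :=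
  continuous_matrix fun _ _ => (continuous_apply _).comp continuous_induced_dom

theorem continuous_stPr : Continuous (stPr s t M e) := by
  refine Continuous.subtype_mk (continuous_pi fun k => ?_) _
  have hm := continuous_matOf s t M e k.1
  have hg : Continuous fun F : StQ s t M e => (matOf F.1 k.1)ᴴ * matOf F.1 k.1 :=
    hm.matrix_conjTranspose.matrix_mul hm
  have hi : Continuous fun F : StQ s t M e => ((matOf F.1 k.1)ᴴ * matOf F.1 k.1)⁻¹ := by
    simp only [Matrix.inv_def, Ring.inverse_eq_inv']
    exact (hg.matrix_det.inv₀ fun F => (det_gram (F.2.1 k.1)).ne_zero).smul hg.matrix_adjugate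
  exact ((hm.matrix_mul hi).matrix_mul hm.matrix_conjTranspose).matrix_elem k.2.1 k.2.2

variable [Fintype V]

theorem continuous_prSub : Continuous (prSub s t M e) := by
  refine continuous_iff_continuousAt.2 fun x₀ => ?_
  obtain ⟨F, hF⟩ := toSub_surjective s t M e (prSub s t M e x₀)
  have hr : ∀ i, LinearMap.range (matOf F.1 i).mulVecLin =
      LinearMap.range (matG x₀.1 i).mulVecLin :=
    fun i => congrFun (congrArg Subtype.val hF) i
  have hm : ∀ i, Continuous fun x : Pr (J := fun i => Fin (d i)) s t M e =>
      matG x.1 i * matOf F.1 i := fun i => Continuous.matrix_mul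
    (continuous_matrix fun p q => (continuous_apply (⟨i, (p, q)⟩ : Σ i, Fin (d i) × Fin (d i))).comp
      continuous_subtype_val) continuous_const
  let U : Set (Pr (J := fun i => Fin (d i)) s t M e) :=
    ⋂ i, {x | ((matOf F.1 i)ᴴ * (matG x.1 i * matOf F.1 i)).det ≠ 0}
  have hU : IsOpen U := isOpen_iInter_of_finite fun i =>
    isOpen_ne_fun (continuous_const.matrix_mul (hm i)).matrix_det continuous_const
  have h0 : x₀ ∈ U := Set.mem_iInter.2 fun i => by
    have := (range_le_iff (x₀.2.1.1 i) _).1 (hr i).le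
    rw [Set.mem_ofPred_eq, this]
    exact (det_gram (F.2.1 i)).ne_zero
  refine ContinuousOn.continuousAt (s := U) ?_ (hU.mem_nhds h0)
  rw [continuousOn_iff_continuous_domRestrict]
  have hinj : ∀ x ∈ U, ∀ i, Function.Injective (matG x.1 i * matOf F.1 i).mulVecLin := by
    intro x hx i
    have h1 := (Matrix.isUnit_iff_isUnit_det _).2 (isUnit_iff_ne_zero.2 (Set.mem_iInter.1 hx i))
    have h2 := Matrix.mulVec_injective_iff_isUnit.2 h1
    intro v w h
    apply h2
    have h' : (matG x.1 i * matOf F.1 i) *ᵥ v = (matG x.1 i * matOf F.1 i) *ᵥ w := h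
    rw [← Matrix.mulVec_mulVec, h', Matrix.mulVec_mulVec]
  have hran : ∀ x ∈ U, ∀ i, LinearMap.range (matG x.1 i * matOf F.1 i).mulVecLin =
      LinearMap.range (matG x.1 i).mulVecLin := by
    intro x hx i
    refine Submodule.eq_of_le_of_finrank_eq ?_ ?_
    · rw [Matrix.mulVecLin_mul]
      exact LinearMap.range_comp_le_range _ _
    · rw [LinearMap.finrank_range_of_inj (hinj x hx i), Module.finrank_fin_fun,
        finrank_range_Pr x.2 i]
  let g : U → StQ s t M e := fun x =>
    ⟨fun k => (matG x.1.1 k.1 * matOf F.1 k.1) k.2.1 k.2.2, hinj x.1 x.2, fun a => by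
      have := (prSub s t M e x.1).2.2 a
      change Submodule.map _ (LinearMap.range (matG x.1.1 (s a)).mulVecLin) ≤
        LinearMap.range (matG x.1.1 (t a)).mulVecLin at this
      rw [← hran x.1 x.2, ← hran x.1 x.2] at this
      exact this⟩
  have hg : Continuous g := continuous_induced_rng.2 (continuous_pi fun k =>
    ((hm k.1).comp continuous_subtype_val).matrix_elem k.2.1 k.2.2)
  have : U.domRestrict (prSub s t M e) = toSub s t M e ∘ g := by
    ext x
    exact Subtype.ext (funext fun i => (hran x.1 x.2 i).symm)
  rw [this]
  exact (continuous_coinduced_rng (f := toSub s t M e)).comp hg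

/-- The quiver Grassmannian is homeomorphic to the algebraic set of projections. -/
def prHomeo : Pr (J := fun i => Fin (d i)) s t M e ≃ₜ SubRep s t M e where
  toEquiv := Equiv.ofBijective _ (prSub_bijective s t M e)
  continuous_toFun := continuous_prSub s t M e
  continuous_invFun := by
    refine continuous_coinduced_dom.2 ?_
    have : (Equiv.ofBijective _ (prSub_bijective s t M e)).invFun ∘ toSub s t M e =
        stPr s t M e := by
      ext1 F
      rw [Function.comp_apply, Equiv.invFun_as_coe, Equiv.symm_apply_eq]
      exact (prSub_stPr s t M e F).symm
    rw [this]
    exact continuous_stPr s t M e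

end Homeo

end TC

namespace TC
variable {V A : Type}

section Reindex
variable {J J' : V → Type} [∀ i, Fintype (J i)] [∀ i, DecidableEq (J i)] [∀ i, Fintype (J' i)]
  [∀ i, DecidableEq (J' i)]

theorem mem_Pr_reindex (s t : A → V) (M : ∀ a, Matrix (J (t a)) (J (s a)) ℂ) (e : V → ℕ)
    (σ : ∀ i, J i ≃ J' i) (x : (Σ i, J' i × J' i) → ℂ) :
    x ∈ Pr s t (fun a => Matrix.reindex (σ (t a)) (σ (s a)) (M a)) e ↔
      x ∘ (Equiv.sigmaCongrRight fun i => (σ i).prodCongr (σ i)) ∈ Pr s t M e := by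
  have h : ∀ i, matG x i = Matrix.reindex (σ i) (σ i)
      (matG (x ∘ (Equiv.sigmaCongrRight fun i => (σ i).prodCongr (σ i))) i) := by
    intro i
    ext p q
    simp [matG]
  generalize x ∘ (Equiv.sigmaCongrRight fun i => (σ i).prodCongr (σ i)) = y at h
  have ht : ∀ i, (matG x i).trace = (matG y i).trace := by
    intro i
    rw [h]
    exact Fintype.sum_equiv (σ i).symm _ _ fun _ => rfl
  have inj : ∀ i j, ∀ B C : Matrix (J i) (J j) ℂ,
      B.submatrix (σ i).symm (σ j).symm = C.submatrix (σ i).symm (σ j).symm ↔ B = C :=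
    fun i j B C => (Matrix.reindex (σ i) (σ j)).injective.eq_iff
  simp only [Pr, PCond, Set.mem_ofPred_eq, ht]
  simp only [h, Matrix.reindex_apply, Matrix.submatrix_mul_equiv, Matrix.conjTranspose_submatrix, inj]

/-- Relabelling bases does not change the set of projections. -/
def reindexPr (s t : A → V) (M : ∀ a, Matrix (J (t a)) (J (s a)) ℂ) (e : V → ℕ)
    (σ : ∀ i, J i ≃ J' i) :
    Pr s t (fun a => Matrix.reindex (σ (t a)) (σ (s a)) (M a)) e ≃ₜ Pr s t M e :=
  (Homeomorph.piCongrLeft (Y := fun _ => ℂ)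
    (Equiv.sigmaCongrRight fun i => (σ i).prodCongr (σ i))).symm.subtype
      (mem_Pr_reindex s t M e σ)

end Reindex

section Blocks
variable {I J : V → Type} [∀ i, Fintype (I i)] [∀ i, DecidableEq (I i)] [∀ i, Fintype (J i)]
  [∀ i, DecidableEq (J i)]
variable (s t : A → V) (M : ∀ a, Matrix (I (t a)) (I (s a)) ℂ)
  (N : ∀ a, Matrix (J (t a)) (J (s a)) ℂ) (e : V → ℕ)

/-- The weight of a basis vector: `1` on the second summand. -/
def wt {P Q : Type} : P ⊕ Q → ℤ := Sum.elim 0 1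

/-- The weights of matrix entries under conjugation. -/
def wtG (k : Σ i, (I i ⊕ J i) × (I i ⊕ J i)) : ℤ := wt k.2.1 - wt k.2.2

theorem wtG_sq (k : Σ i, (I i ⊕ J i) × (I i ⊕ J i)) (_ : wtG k ≠ 0) : wtG k * wtG k = 1 := by
  obtain ⟨i, p | p, q | q⟩ := k <;> simp_all [wtG, wt]

/-- The diagonal unitary scaling the second summand. -/
def scal (z : Circle) (P Q : Type) [DecidableEq P] [DecidableEq Q] : Matrix (P ⊕ Q) (P ⊕ Q) ℂ :=
  Matrix.fromBlocks 1 0 0 ((z : ℂ) • 1)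

theorem scal_conj_mul (z : Circle) (P Q : Type) [DecidableEq P] [DecidableEq Q] [Fintype P]
    [Fintype Q] : (scal z P Q)ᴴ * scal z P Q = 1 := by
  have : (z : ℂ) * (starRingEnd ℂ) z = 1 := by
    rw [← Circle.coe_inv_eq_conj, ← Circle.coe_mul, mul_inv_cancel, Circle.coe_one]
  simp [scal, Matrix.fromBlocks_conjTranspose, Matrix.fromBlocks_multiply, smul_smul, this]

theorem matG_act (z : Circle) (x : (Σ i, (I i ⊕ J i) × (I i ⊕ J i)) → ℂ) (i : V) :
    matG (act wtG z x) i = scal z (I i) (J i) * matG x i * (scal z (I i) (J i))ᴴ := by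
  rw [← Matrix.fromBlocks_toBlocks (matG x i), scal, Matrix.fromBlocks_conjTranspose,
    Matrix.fromBlocks_multiply, Matrix.fromBlocks_multiply]
  have hz : (starRingEnd ℂ) (z : ℂ) = (z : ℂ)⁻¹ := by
    rw [← Circle.coe_inv_eq_conj, Circle.coe_inv]
  have h0 := Circle.coe_ne_zero z
  ext (p | p) (q | q) <;>
    simp [matG, act, wtG, wt, Matrix.toBlocks₁₁, Matrix.toBlocks₁₂, Matrix.toBlocks₂₁,
      Matrix.toBlocks₂₂, hz, mul_comm, h0]

theorem act_mem_Pr (z : Circle) (x : (Σ i, (I i ⊕ J i) × (I i ⊕ J i)) → ℂ)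
    (hx : x ∈ Pr s t (fun a => Matrix.fromBlocks (M a) 0 0 (N a)) e) :
    act wtG z x ∈ Pr s t (fun a => Matrix.fromBlocks (M a) 0 0 (N a)) e := by
  have hu := fun i => scal_conj_mul z (I i) (J i)
  have hc : ∀ a, Matrix.fromBlocks (M a) 0 0 (N a) * scal z (I (s a)) (J (s a)) =
      scal z (I (t a)) (J (t a)) * Matrix.fromBlocks (M a) 0 0 (N a) := by
    intro a
    simp [scal, Matrix.fromBlocks_multiply]
  have hcan : ∀ i (K : Type) (B : Matrix (I i ⊕ J i) K ℂ),
      (scal z (I i) (J i))ᴴ * (scal z (I i) (J i) * B) = B := by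
    intro i K B
    rw [← Matrix.mul_assoc, hu, Matrix.one_mul]
  obtain ⟨⟨h1, h2, h3⟩, h4⟩ := hx
  refine ⟨⟨fun i => ?_, fun i => ?_, fun a => ?_⟩, fun i => ?_⟩
  · rw [matG_act]
    conv_rhs => rw [← h1]
    simp only [Matrix.mul_assoc, hcan]
  · rw [matG_act, Matrix.conjTranspose_mul, Matrix.conjTranspose_mul,
      Matrix.conjTranspose_conjTranspose, h2, Matrix.mul_assoc]
  · have := h3 a
    have e1 : Matrix.fromBlocks (M a) 0 0 (N a) * matG (act wtG z x) (s a) =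
        scal z (I (t a)) (J (t a)) * (Matrix.fromBlocks (M a) 0 0 (N a) * matG x (s a)) *
          (scal z (I (s a)) (J (s a)))ᴴ := by
      rw [matG_act, ← Matrix.mul_assoc, ← Matrix.mul_assoc, hc, Matrix.mul_assoc (scal z _ _)]
    rw [e1, matG_act]
    conv_rhs => rw [← this]
    simp only [Matrix.mul_assoc, hcan]
  · rw [matG_act, Matrix.trace_mul_comm, hcan, h4]

theorem trace_blocks {P Q : Type} [Fintype P] [Fintype Q] (B : Matrix P P ℂ) (C : Matrix Q Q ℂ) :
    (Matrix.fromBlocks B 0 0 C).trace = B.trace + C.trace := by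
  simp [Matrix.trace]

theorem pCond_fromBlocks (a : ∀ i, Matrix (I i) (I i) ℂ) (b : ∀ i, Matrix (J i) (J i) ℂ) :
    PCond s t (fun a => Matrix.fromBlocks (M a) 0 0 (N a)) (fun i => Matrix.fromBlocks (a i) 0 0 (b i))
      ↔ PCond s t M a ∧ PCond s t N b := by
  simp only [PCond, Matrix.fromBlocks_multiply, Matrix.fromBlocks_conjTranspose,
    Matrix.fromBlocks_inj, Matrix.mul_zero, Matrix.zero_mul, add_zero, zero_add,
    Matrix.conjTranspose_zero, true_and, forall_and]
  tauto

/-- The fixed locus of the circle action. -/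
def fixG : Set ((Σ i, (I i ⊕ J i) × (I i ⊕ J i)) → ℂ) :=
  Pr s t (fun a => Matrix.fromBlocks (M a) 0 0 (N a)) e ∩ {x | ∀ k, wtG k ≠ 0 → x k = 0}

/-- Coordinates of the first diagonal block. -/
def fstG (x : (Σ i, (I i ⊕ J i) × (I i ⊕ J i)) → ℂ) : (Σ i, I i × I i) → ℂ :=
  fun k => x ⟨k.1, (Sum.inl k.2.1, Sum.inl k.2.2)⟩

/-- Coordinates of the second diagonal block. -/
def sndG (x : (Σ i, (I i ⊕ J i) × (I i ⊕ J i)) → ℂ) : (Σ i, J i × J i) → ℂ :=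
  fun k => x ⟨k.1, (Sum.inr k.2.1, Sum.inr k.2.2)⟩

/-- Coordinates of a block diagonal family. -/
def diagG (y : (Σ i, I i × I i) → ℂ) (z : (Σ i, J i × J i) → ℂ) :
    (Σ i, (I i ⊕ J i) × (I i ⊕ J i)) → ℂ :=
  coordG fun i => Matrix.fromBlocks (matG y i) 0 0 (matG z i)

theorem diagG_fst_snd {x : (Σ i, (I i ⊕ J i) × (I i ⊕ J i)) → ℂ}
    (hx : ∀ k, wtG k ≠ 0 → x k = 0) : diagG (fstG x) (sndG x) = x := by
  ext ⟨i, p | p, q | q⟩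
  · rfl
  · exact (hx _ (by simp [wtG, wt])).symm
  · exact (hx _ (by simp [wtG, wt])).symm
  · rfl

theorem wtG_diagG (y : (Σ i, I i × I i) → ℂ) (z : (Σ i, J i × J i) → ℂ)
    (k : Σ i, (I i ⊕ J i) × (I i ⊕ J i)) (hk : wtG k ≠ 0) : diagG y z k = 0 := by
  obtain ⟨i, p | p, q | q⟩ := k
  · simp [wtG, wt] at hk
  · rfl
  · rfl
  · simp [wtG, wt] at hk

theorem diagG_mem_Pr (y : (Σ i, I i × I i) → ℂ) (z : (Σ i, J i × J i) → ℂ) :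
    diagG y z ∈ Pr s t (fun a => Matrix.fromBlocks (M a) 0 0 (N a)) e ↔
      (PCond s t M (matG y) ∧ PCond s t N (matG z)) ∧
        ∀ i, (matG y i).trace + (matG z i).trace = e i := by
  rw [← pCond_fromBlocks]
  refine and_congr Iff.rfl (forall_congr' fun i => ?_)
  rw [diagG, matG_coordG, trace_blocks]

variable {s t M N e}

theorem fixG_cond {x : (Σ i, (I i ⊕ J i) × (I i ⊕ J i)) → ℂ} (hx : x ∈ fixG s t M N e) :
    (PCond s t M (matG (fstG x)) ∧ PCond s t N (matG (sndG x))) ∧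
        ∀ i, (matG (fstG x) i).trace + (matG (sndG x) i).trace = e i := by
  rw [← diagG_mem_Pr, diagG_fst_snd hx.2]
  exact hx.1

theorem finrank_fstG_le {x : (Σ i, (I i ⊕ J i) × (I i ⊕ J i)) → ℂ} (hx : x ∈ fixG s t M N e)
    (i : V) : Module.finrank ℂ (LinearMap.range (matG (fstG x) i).mulVecLin) ≤ e i := by
  have h := fixG_cond hx
  have h2 := h.2 i
  rw [trace_idem (h.1.1.1 i), trace_idem (h.1.2.1 i)] at h2
  exact (Nat.le_add_right _ _).trans_eq (Nat.cast_injective (R := ℂ) ((Nat.cast_add _ _).trans h2))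

/-- The dimension vector of the first component of a fixed point. -/
def fixDim (x : fixG s t M N e) (i : V) : Fin (e i + 1) :=
  ⟨_, Nat.lt_succ_of_le (finrank_fstG_le x.2 i)⟩

theorem fixDim_eq_iff (x : fixG s t M N e) (f : ∀ i : V, Fin (e i + 1)) :
    fixDim x = f ↔ ∀ i, (matG (fstG x.1) i).trace = ((f i : ℕ) : ℂ) := by
  rw [funext_iff]
  refine forall_congr' fun i => ?_
  rw [trace_idem ((fixG_cond x.2).1.1.1 i), Nat.cast_inj, Fin.ext_iff]
  rfl

theorem fixDim_eq_iff' (x : fixG s t M N e) (f : ∀ i : V, Fin (e i + 1)) :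
    fixDim x = f ↔ fstG x.1 ∈ Pr s t M (fun i => (f i : ℕ)) ∧
      sndG x.1 ∈ Pr s t N (fun i => e i - (f i : ℕ)) := by
  rw [fixDim_eq_iff]
  have h := fixG_cond x.2
  constructor
  · intro h'
    refine ⟨⟨h.1.1, h'⟩, h.1.2, fun i => ?_⟩
    rw [Nat.cast_sub (Nat.lt_succ_iff.1 (f i).2), ← h' i, ← h.2 i, add_sub_cancel_left]
  · exact fun h' => h'.1.2

/-- A component of the fixed locus is a product of smaller sets of projections. -/
def fixHomeo (f : ∀ i : V, Fin (e i + 1)) :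
    (fixDim (s := s) (t := t) (M := M) (N := N) ⁻¹' {f}) ≃ₜ
      Pr s t M (fun i => (f i : ℕ)) × Pr s t N (fun i => e i - (f i : ℕ)) where
  toFun x := (⟨_, ((fixDim_eq_iff' x.1 f).1 x.2).1⟩, ⟨_, ((fixDim_eq_iff' x.1 f).1 x.2).2⟩)
  invFun y := ⟨⟨diagG y.1.1 y.2.1, by
    refine ⟨(diagG_mem_Pr s t M N e _ _).2 ⟨⟨y.1.2.1, y.2.2.1⟩, fun i => ?_⟩, wtG_diagG _ _⟩
    rw [y.1.2.2, y.2.2.2, Nat.cast_sub (Nat.lt_succ_iff.1 (f i).2), add_sub_cancel]⟩,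
    (fixDim_eq_iff' _ f).2 ⟨y.1.2, y.2.2⟩⟩
  left_inv x := Subtype.ext (Subtype.ext (diagG_fst_snd x.1.2.2))
  right_inv _ := rfl
  continuous_toFun := by
    refine Continuous.prodMk (Continuous.subtype_mk ?_ _) (Continuous.subtype_mk ?_ _) <;>
    exact continuous_pi fun k => (continuous_apply _).comp
      (continuous_subtype_val.comp continuous_subtype_val)
  continuous_invFun := by
    refine Continuous.subtype_mk (Continuous.subtype_mk (continuous_pi ?_) _) _
    rintro ⟨i, p | p, q | q⟩
    · exact (continuous_apply (⟨i, (p, q)⟩ : Σ i, I i × I i)).comp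
        (continuous_subtype_val.comp continuous_fst)
    · exact continuous_const
    · exact continuous_const
    · exact (continuous_apply (⟨i, (p, q)⟩ : Σ i, J i × J i)).comp
        (continuous_subtype_val.comp continuous_snd)

theorem isOpen_fixDim [Fintype V] [DecidableEq V] (f : ∀ i : V, Fin (e i + 1)) :
    IsOpen (fixDim (s := s) (t := t) (M := M) (N := N) ⁻¹' {f}) := by
  have hc : ∀ g : ∀ i : V, Fin (e i + 1),
      IsClosed (fixDim (s := s) (t := t) (M := M) (N := N) ⁻¹' {g}) := by
    intro g
    have : fixDim (s := s) (t := t) (M := M) (N := N) ⁻¹' {g} =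
        ⋂ i, {x | (matG (fstG x.1) i).trace = ((g i : ℕ) : ℂ)} := by
      ext x
      rw [Set.mem_iInter]
      exact fixDim_eq_iff x g
    rw [this]
    refine isClosed_iInter fun i => isClosed_eq (continuous_finsetSum _ fun p _ => ?_)
      continuous_const
    exact (continuous_apply (⟨i, (Sum.inl p, Sum.inl p)⟩ : Σ i, (I i ⊕ J i) × (I i ⊕ J i))).comp
      continuous_subtype_val
  have : fixDim (s := s) (t := t) (M := M) (N := N) ⁻¹' {f} =
      (⋃ g ∈ {g | g ≠ f}, fixDim (s := s) (t := t) (M := M) (N := N) ⁻¹' {g})ᶜ := by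
    ext x
    simp only [Set.mem_preimage, Set.mem_singleton_iff, Set.mem_compl_iff, Set.mem_iUnion,
      Set.mem_ofPred_eq, exists_prop, not_exists, not_and]
    exact ⟨fun h g hg h' => hg (h'.symm.trans h), fun h => by_contra fun hn => h _ hn rfl⟩
  rw [this, isOpen_compl_iff]
  exact (Set.toFinite _).isClosed_biUnion fun g _ => hc g

variable (s t M N e)

theorem chiT_Pr_blocks [Fintype V] [DecidableEq V] [Fintype A] :
    chiT (Pr (J := fun i => I i ⊕ J i) s t (fun a => Matrix.fromBlocks (M a) 0 0 (N a)) e) =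
      ∑ f : ∀ i : V, Fin (e i + 1), chiT (Pr s t M (fun i => (f i : ℕ))) *
        chiT (Pr s t N (fun i => e i - (f i : ℕ))) := by
  rw [chi_weights (Pr_isCompact s t _ e) (Pr_cAlg s t _ e) wtG wtG_sq
    fun z x hx => act_mem_Pr s t M N e z x hx]
  have hk : ∀ f : ∀ i : V, Fin (e i + 1), _ := fun f =>
    have : CompactSpace (Pr s t M (fun i => (f i : ℕ))) :=
      isCompact_iff_compactSpace.1 (Pr_isCompact s t M _)
    have : CompactSpace (Pr s t N (fun i => e i - (f i : ℕ))) :=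
      isCompact_iff_compactSpace.1 (Pr_isCompact s t N _)
    ENR.kunneth (Pr_enr s t M (fun i => (f i : ℕ)))
      (ENR.finT (Pr_enr s t N (fun i => e i - (f i : ℕ))))
  refine (chiT_fibers (fixDim (s := s) (t := t) (M := M) (N := N)) isOpen_fixDim
    fun f => (hk f).1.homeo (fixHomeo f)).2.trans ?_
  exact Finset.sum_congr rfl fun f _ => (chiT_homeo (fixHomeo f)).trans (hk f).2

end Blocks

theorem eulerChar_subRep [Fintype V] [Fintype A] (s t : A → V) {d : V → ℕ} (M : QRep s t d)
    (e : V → ℕ) : (eulerChar (SubRep s t M e) : ℚ) =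
      chiT (Pr (J := fun i => Fin (d i)) s t M e) := by
  have : CompactSpace (Pr (J := fun i => Fin (d i)) s t M e) :=
    isCompact_iff_compactSpace.1 (Pr_isCompact (J := fun i => Fin (d i)) s t M e)
  have h := ENR.finT (Pr_enr (J := fun i => Fin (d i)) s t M e)
  rw [eulerChar_eq (h.homeo (prHomeo s t M e).symm), chiT_homeo (prHomeo s t M e)]

end TC

/-- `χ(Gr_e(M ⊕ N)) = Σ_{f+g=e} χ(Gr_f(M)) χ(Gr_g(N))`. -/
theorem eulerChar_dsum [Fintype V] [Fintype A] [DecidableEq V] (s t : A → V)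
    (dM dN : V → ℕ) (M : QRep s t dM) (N : QRep s t dN) (e : V → ℕ) :
    eulerChar (SubRep s t (dsum s t M N) e) =
      ∑ f : ∀ i : V, Fin (e i + 1),
        eulerChar (SubRep s t M (fun i => (f i : ℕ))) *
          eulerChar (SubRep s t N (fun i => e i - (f i : ℕ))) := by
  rw [← Int.cast_inj (α := ℚ)]
  push_cast
  simp only [TC.eulerChar_subRep]
  rw [← TC.chiT_Pr_blocks (I := fun i => Fin (dM i)) (J := fun i => Fin (dN i))]
  exact TC.chiT_homeo (TC.reindexPr (J := fun i => Fin (dM i) ⊕ Fin (dN i))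
    (J' := fun i => Fin (dM i + dN i)) s t (fun a => Matrix.fromBlocks (M a) 0 0 (N a)) e
    fun i => finSumFinEquiv)

end
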